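/- (Littlewood restriction rule for Sp_{2n} ⊆ GL_{2n}.) Let λ and μ be non-negative integer partitions with ℓ(λ) ≤ n and ℓ(μ) ≤ n. Then the multiplicity of the irreducible Sp_{2n}(ℂ)-representation V^μ_(2n) in the restriction of the irreducible GL_{2n}(ℂ)-representation F^λ_(2n) equals Σ_{2δ} c^λ_{μ, (2δ)'}, where the sum runs over all partitions (2δ)' that are transposes of even partitions (i.e. partitions with all columns of even length). -/

import Mathlib

open scoped BigOperators TensorProduct
open Matrix

noncomputable section

def IsPartition (f : ℕ → ℕ) : Prop :=
  (∀ ⦃i j : ℕ⦄, i ≤ j → f j ≤ f i) ∧ ∃ N, f N = 0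

def Ptn : Type := {f : ℕ → ℕ // IsPartition f}

def plen (f : ℕ → ℕ) : ℕ := sInf {k | f k = 0}

def conj (f : ℕ → ℕ) : ℕ → ℕ := fun i => Set.ncard {j | i < f j}

def double (f : ℕ → ℕ) : ℕ → ℕ := fun i => 2 * f i

def InSkew (l m : ℕ → ℕ) (i j : ℕ) : Prop := m i ≤ j ∧ j < l i

def IsLRTableau (l m nu : ℕ → ℕ) (T : ℕ → ℕ → ℕ) : Prop :=
  (∀ i, m i ≤ l i) ∧
  (∀ i j, T i j ≠ 0 ↔ InSkew l m i j) ∧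
  (∀ i j k, InSkew l m i j → InSkew l m i k → j ≤ k → T i j ≤ T i k) ∧
  (∀ i k j, InSkew l m i j → InSkew l m k j → i < k → T i j < T k j) ∧
  (∀ r, Set.ncard {p : ℕ × ℕ | T p.1 p.2 = r + 1} = nu r) ∧
  (∀ i j r, Set.ncard {p : ℕ × ℕ | (p.1 < i ∨ (p.1 = i ∧ j ≤ p.2)) ∧ T p.1 p.2 = r + 2}
          ≤ Set.ncard {p : ℕ × ℕ | (p.1 < i ∨ (p.1 = i ∧ j ≤ p.2)) ∧ T p.1 p.2 = r + 1})

def lrCoeff (l m nu : ℕ → ℕ) : ℕ := Set.ncard {T : ℕ → ℕ → ℕ | IsLRTableau l m nu T}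

section Reps

variable {G : Type*} [Group G] {V W : Type*}
  [AddCommGroup V] [Module ℂ V] [AddCommGroup W] [Module ℂ W]

def IsSubrep (ρ : Representation ℂ G V) (U : Submodule ℂ V) : Prop :=
  ∀ g : G, ∀ x ∈ U, ρ g x ∈ U

def IsIrreducibleRep (ρ : Representation ℂ G V) : Prop :=
  Nontrivial V ∧ ∀ U : Submodule ℂ V, IsSubrep ρ U → U = ⊥ ∨ U = ⊤

def equivariantMaps (π : Representation ℂ G W) (ρ : Representation ℂ G V) :
    Submodule ℂ (W →ₗ[ℂ] V) where
  carrier := {f | ∀ g : G, f ∘ₗ (π g) = (ρ g) ∘ₗ f}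
  add_mem' := by
    intro f h hf hh g
    simp only [Set.mem_setOf_eq] at *
    rw [LinearMap.add_comp, LinearMap.comp_add, hf g, hh g]
  zero_mem' := by
    intro g
    simp only [Set.mem_setOf_eq, LinearMap.zero_comp, LinearMap.comp_zero]
  smul_mem' := by
    intro c f hf g
    simp only [Set.mem_setOf_eq] at *
    rw [LinearMap.smul_comp, LinearMap.comp_smul, hf g]

def repMult (ρ : Representation ℂ G V) (π : Representation ℂ G W) : ℕ :=
  Module.finrank ℂ (equivariantMaps π ρ)

end Reps

def IsUpperUni {N : ℕ} (A : Matrix (Fin N) (Fin N) ℂ) : Prop :=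
  (∀ i, A i i = 1) ∧ ∀ i j : Fin N, (j : ℕ) < (i : ℕ) → A i j = 0

def IsGLHW (n : ℕ) (a : Fin n → ℤ) {V : Type*} [AddCommGroup V] [Module ℂ V]
    (ρ : Representation ℂ (GL (Fin n) ℂ) V) : Prop :=
  IsIrreducibleRep ρ ∧ FiniteDimensional ℂ V ∧
  ∃ v : V, v ≠ 0 ∧
    (∀ g : GL (Fin n) ℂ, IsUpperUni (g : Matrix (Fin n) (Fin n) ℂ) → ρ g v = v) ∧
    (∀ (g : GL (Fin n) ℂ) (d : Fin n → ℂ),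
      (g : Matrix (Fin n) (Fin n) ℂ) = Matrix.diagonal d →
      ρ g v = (∏ i, d i ^ (a i)) • v)

def polyWeight (n : ℕ) (lam : ℕ → ℕ) : Fin n → ℤ := fun i => (lam (i : ℕ) : ℤ)

def ratWeight (n : ℕ) (lp lm : ℕ → ℕ) : Fin n → ℤ :=
  fun i => (lp (i : ℕ) : ℤ) - (lm (n - 1 - (i : ℕ)) : ℤ)

def formGroup {ι : Type*} [Fintype ι] [DecidableEq ι] (S : Matrix ι ι ℂ) :
    Subgroup (GL ι ℂ) where
  carrier := {g | (g : Matrix ι ι ℂ)ᵀ * S * (g : Matrix ι ι ℂ) = S}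
  one_mem' := by
    simp [Matrix.transpose_one]
  mul_mem' := by
    intro a b ha hb
    set A : Matrix ι ι ℂ := (a : Matrix ι ι ℂ) with hA
    set B : Matrix ι ι ℂ := (b : Matrix ι ι ℂ) with hB
    have ha' : Aᵀ * S * A = S := ha
    have hb' : Bᵀ * S * B = S := hb
    show ((↑(a * b) : Matrix ι ι ℂ))ᵀ * S * (↑(a * b) : Matrix ι ι ℂ) = S
    have hab : (↑(a * b) : Matrix ι ι ℂ) = A * B := Units.val_mul a b
    rw [hab, Matrix.transpose_mul]
    calc Bᵀ * Aᵀ * S * (A * B) = Bᵀ * (Aᵀ * S * A) * B := by noncomm_ring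
    _ = S := by rw [ha', hb']
  inv_mem' := by
    intro a ha
    set A : Matrix ι ι ℂ := (a : Matrix ι ι ℂ) with hA
    have ha' : Aᵀ * S * A = S := ha
    set C : Matrix ι ι ℂ := ((a⁻¹ : GL ι ℂ) : Matrix ι ι ℂ) with hC
    show Cᵀ * S * C = S
    have hac : A * C = 1 := by
      rw [hA, hC, ← Units.val_mul, mul_inv_cancel, Units.val_one]
    calc Cᵀ * S * C = Cᵀ * (Aᵀ * S * A) * C := by rw [ha']
    _ = (A * C)ᵀ * S * (A * C) := by rw [Matrix.transpose_mul]; noncomm_ring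
    _ = S := by rw [hac]; simp [Matrix.transpose_one]

def symForm (n : ℕ) : Matrix (Fin n) (Fin n) ℂ :=
  Matrix.of fun i j => if (i : ℕ) + (j : ℕ) = n - 1 then 1 else 0

def sympForm (n : ℕ) : Matrix (Fin (2 * n)) (Fin (2 * n)) ℂ :=
  Matrix.of fun i j =>
    if (i : ℕ) + (j : ℕ) = 2 * n - 1 then (if (i : ℕ) < n then 1 else -1) else 0

def OGL (n : ℕ) : Subgroup (GL (Fin n) ℂ) := formGroup (symForm n)

def SpGL (n : ℕ) : Subgroup (GL (Fin (2 * n)) ℂ) := formGroup (sympForm n)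

/-- The matrix of a distinguished reflection (an element of `O_n(ℂ)` of determinant `-1`
fixing the highest weight vectors of the representations `E^mu_(n)` for
`ℓ(mu) < n/2`): for odd `n`, the reflection negating the middle basis vector; for even
`n`, the permutation swapping the two middle basis vectors. -/
def reflMatrix (n : ℕ) : Matrix (Fin n) (Fin n) ℂ :=
  Matrix.of fun i j =>
    if 2 * (i : ℕ) + 1 = n ∧ i = j then -1
    else if (2 * (i : ℕ) = n ∧ 2 * (j : ℕ) + 2 = n) ∨ (2 * (i : ℕ) + 2 = n ∧ 2 * (j : ℕ) = n)
      then 1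
    else if i = j ∧ ¬(2 * (i : ℕ) = n ∨ 2 * (i : ℕ) + 2 = n) then 1
    else 0

/-- The partition associated to `mu` (with `(mu')_1 + (mu')_2 ≤ n`): the first column
length `(mu')_1` is replaced by `n - (mu')_1`.  One has `E^{assoc n mu} = E^mu ⊗ det`. -/
def assocPtn (n : ℕ) (mu : ℕ → ℕ) : ℕ → ℕ :=
  conj (fun j => if j = 0 then n - conj mu 0 else conj mu j)

/-- `v` is a highest weight vector of weight `mu` for (the identity component of)
`O_n(ℂ)`: it is fixed by all upper triangular unipotent elements, and the diagonal
torus elements of determinant one act via the character attached to `mu`. -/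
def IsOHWvec (n : ℕ) (mu : ℕ → ℕ) {V : Type*} [AddCommGroup V] [Module ℂ V]
    (ρ : Representation ℂ (OGL n) V) (v : V) : Prop :=
  (∀ g : OGL n, IsUpperUni ((g : GL (Fin n) ℂ) : Matrix (Fin n) (Fin n) ℂ) → ρ g v = v) ∧
  (∀ (g : OGL n) (d : Fin n → ℂ),
    ((g : GL (Fin n) ℂ) : Matrix (Fin n) (Fin n) ℂ) = Matrix.diagonal d →
    (∏ i, d i) = 1 →
    ρ g v = (∏ i, d i ^ (mu (i : ℕ))) • v)

/-- `ρ` is the irreducible rational representation `E^mu_(n)` of the complex orthogonal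
group `O_n(ℂ)`, indexed by a partition `mu` with `(mu')_1 + (mu')_2 ≤ n`. -/
def IsOIrrep (n : ℕ) (mu : ℕ → ℕ) {V : Type*} [AddCommGroup V] [Module ℂ V]
    (ρ : Representation ℂ (OGL n) V) : Prop :=
  IsIrreducibleRep ρ ∧ FiniteDimensional ℂ V ∧
  (if 2 * conj mu 0 ≤ n then
    ∃ v : V, v ≠ 0 ∧ IsOHWvec n mu ρ v ∧
      (2 * conj mu 0 = n ∨
        ∀ g : OGL n, ((g : GL (Fin n) ℂ) : Matrix (Fin n) (Fin n) ℂ) = reflMatrix n →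
          ρ g v = v)
  else
    ∃ v : V, v ≠ 0 ∧ IsOHWvec n (assocPtn n mu) ρ v ∧
      (∀ g : OGL n, ((g : GL (Fin n) ℂ) : Matrix (Fin n) (Fin n) ℂ) = reflMatrix n →
        ρ g v = - v))

/-- `ρ` is the irreducible rational representation `V^mu_(2n)` of `Sp_{2n}(ℂ)` with
highest weight `mu` (a partition with at most `n` parts). -/
def IsSpHW (n : ℕ) (mu : ℕ → ℕ) {V : Type*} [AddCommGroup V] [Module ℂ V]
    (ρ : Representation ℂ (SpGL n) V) : Prop :=
  IsIrreducibleRep ρ ∧ FiniteDimensional ℂ V ∧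
  ∃ v : V, v ≠ 0 ∧
    (∀ g : SpGL n,
      IsUpperUni ((g : GL (Fin (2 * n)) ℂ) : Matrix (Fin (2 * n)) (Fin (2 * n)) ℂ) →
      ρ g v = v) ∧
    (∀ (g : SpGL n) (d : Fin (2 * n) → ℂ),
      ((g : GL (Fin (2 * n)) ℂ) : Matrix (Fin (2 * n)) (Fin (2 * n)) ℂ) = Matrix.diagonal d →
      ρ g v = (∏ i, d i ^ (mu (i : ℕ))) • v)


section Combinatorics

open Finset

/-- The partitions of `d`, as functions `ℕ → ℕ`. -/
def partsOf (d : ℕ) : Finset (ℕ → ℕ) := by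
  classical exact ((Finset.range d).piAntidiag d).filter Antitone

theorem mem_partsOf {d : ℕ} {f : ℕ → ℕ} :
    f ∈ partsOf d ↔ Antitone f ∧ (∀ i, d ≤ i → f i = 0) ∧ ∑ i ∈ range d, f i = d := by
  classical
  simp only [partsOf, mem_filter, mem_piAntidiag, mem_range]
  constructor
  · rintro ⟨⟨h1, h2⟩, h3⟩
    exact ⟨h3, fun i hi => by by_contra h; exact absurd (h2 i h) (by omega), h1⟩
  · rintro ⟨h3, h2, h1⟩
    exact ⟨⟨h1, fun i hi => by by_contra h; exact hi (h2 i (by omega))⟩, h3⟩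

theorem sum_range_eq_of_zero {f : ℕ → ℕ} {L M : ℕ} (hL : ∀ i, L ≤ i → f i = 0)
    (hM : ∀ i, M ≤ i → f i = 0) : ∑ i ∈ range L, f i = ∑ i ∈ range M, f i := by
  rcases le_total L M with h | h
  · exact Finset.sum_subset (range_mono h) fun i _ hi => hL i (by simpa using hi)
  · exact (Finset.sum_subset (range_mono h) fun i _ hi => hM i (by simpa using hi)).symm

theorem mem_partsOf_iff {d L : ℕ} {f : ℕ → ℕ} (hL : ∀ i, L ≤ i → f i = 0) :
    f ∈ partsOf d ↔ Antitone f ∧ ∑ i ∈ range L, f i = d := by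
  rw [mem_partsOf]
  constructor
  · rintro ⟨h1, h2, h3⟩
    exact ⟨h1, by rw [sum_range_eq_of_zero hL h2, h3]⟩
  · rintro ⟨h1, h3⟩
    have h2 : ∀ i, d ≤ i → f i = 0 := by
      intro i hi
      by_contra h
      have hiL : i < L := by by_contra h'; exact h (hL i (by omega))
      have : ∑ j ∈ range (i + 1), 1 ≤ ∑ j ∈ range L, f j := by
        refine (Finset.sum_le_sum fun j hj => ?_).trans
          (Finset.sum_le_sum_of_subset (range_mono hiL))
        have := h1 (show j ≤ i by simp at hj; omega)
        omega
      simp at this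
      omega
    exact ⟨h1, h2, by rw [sum_range_eq_of_zero h2 hL, h3]⟩

theorem sum_range_partsOf {d L : ℕ} {f : ℕ → ℕ} (hf : f ∈ partsOf d)
    (hL : ∀ i, L ≤ i → f i = 0) : ∑ i ∈ range L, f i = d :=
  ((mem_partsOf_iff hL).1 hf).2

/-- `l / k` is a horizontal strip. -/
def HStrip (k l : ℕ → ℕ) : Prop := ∀ i, k i ≤ l i ∧ l (i + 1) ≤ k i

theorem HStrip.antitone_left {k l : ℕ → ℕ} (h : HStrip k l) : Antitone k :=
  antitone_nat_of_succ_le fun i => (h (i + 1)).1.trans (h i).2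

theorem HStrip.antitone_right {k l : ℕ → ℕ} (h : HStrip k l) : Antitone l :=
  antitone_nat_of_succ_le fun i => (h i).2.trans (h i).1

variable {R : Type*} [CommRing R] (x : ℕ → R)

open Classical in
/-- The Schur polynomial in `m` variables, for a partition of `d`. -/
def schurS : ℕ → ℕ → (ℕ → ℕ) → R
  | 0, d, _ => if d = 0 then 1 else 0
  | m + 1, d, l => ∑ p ∈ antidiagonal d,
      (∑ k ∈ partsOf p.1 with HStrip k l, schurS m p.1 k) * x m ^ p.2

/-- The complete homogeneous polynomial of degree `k` in `m` variables. -/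
def compH : ℕ → ℕ → R
  | 0, k => if k = 0 then 1 else 0
  | m + 1, k => ∑ p ∈ antidiagonal k, compH m p.1 * x m ^ p.2

theorem partsOf_zero : partsOf 0 = {0} := by
  ext f
  rw [mem_partsOf, mem_singleton]
  constructor
  · rintro ⟨-, h, -⟩; funext i; exact h i (Nat.zero_le i)
  · rintro rfl; exact ⟨antitone_const, by simp, by simp⟩

/-- The horizontal strip over `k` and `t` obtained by toggling one under both. -/
def toggleUp (k t s : ℕ → ℕ) (j : ℕ) : ℕ → ℕ
  | 0 => max (k 0) (t 0) + j
  | i + 1 => max (k (i + 1)) (t (i + 1)) + min (k i) (t i) - s i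

/-- The inverse of `toggleUp`. -/
def toggleDown (k t u : ℕ → ℕ) : ℕ → ℕ :=
  fun i => max (k (i + 1)) (t (i + 1)) + min (k i) (t i) - u (i + 1)

theorem toggleUp_strip {k t s : ℕ → ℕ} {j : ℕ} (h1 : HStrip s k) (h2 : HStrip s t) :
    HStrip k (toggleUp k t s j) ∧ HStrip t (toggleUp k t s j) := by
  constructor <;> intro i <;> cases i with
  | zero => have := h1 0; have := h2 0; simp only [toggleUp]; omega
  | succ i =>
    have := h1 i; have := h2 i; have := h1 (i + 1); have := h2 (i + 1)
    simp only [toggleUp]; omega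

theorem toggleDown_strip {k t u : ℕ → ℕ} (h1 : HStrip k u) (h2 : HStrip t u) :
    HStrip (toggleDown k t u) k ∧ HStrip (toggleDown k t u) t := by
  constructor <;> intro i <;>
  · have := h1 i; have := h2 i; have := h1 (i + 1); have := h2 (i + 1)
    simp only [toggleDown]; omega

theorem toggleUp_sum {k t s : ℕ → ℕ} {j : ℕ} (h1 : HStrip s k) (h2 : HStrip s t) (L : ℕ) :
    ∑ i ∈ range (L + 1), toggleUp k t s j i + ∑ i ∈ range L, s i + min (k L) (t L) =
      j + ∑ i ∈ range (L + 1), k i + ∑ i ∈ range (L + 1), t i := by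
  induction L with
  | zero => simp [toggleUp]; omega
  | succ L ih =>
    rw [sum_range_succ _ (L + 1), sum_range_succ s, sum_range_succ k (L + 1),
      sum_range_succ t (L + 1)]
    have := h1 L; have := h2 L; have := h1 (L + 1); have := h2 (L + 1)
    rw [show toggleUp k t s j (L + 1) =
      max (k (L + 1)) (t (L + 1)) + min (k L) (t L) - s L from rfl]
    omega

theorem toggleUp_toggleDown {k t u : ℕ → ℕ} (h1 : HStrip k u) (h2 : HStrip t u) :
    toggleUp k t (toggleDown k t u) (u 0 - max (k 0) (t 0)) = u := by
  funext i
  cases i with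
  | zero => have := h1 0; have := h2 0; simp only [toggleUp]; omega
  | succ i =>
    have := h1 i; have := h2 i; have := h1 (i + 1); have := h2 (i + 1)
    simp only [toggleUp, toggleDown]; omega

theorem toggleDown_toggleUp {k t s : ℕ → ℕ} {j : ℕ} (h1 : HStrip s k) (h2 : HStrip s t) :
    toggleDown k t (toggleUp k t s j) = s := by
  funext i
  have := h1 i; have := h2 i; have := h1 (i + 1); have := h2 (i + 1)
  simp only [toggleUp, toggleDown]; omega

theorem HStrip.mem_partsOf_left {k l : ℕ → ℕ} {d : ℕ} (h : HStrip k l) (hl : l ∈ partsOf d) :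
    k ∈ partsOf (∑ i ∈ range d, k i) ∧ ∑ i ∈ range d, k i ≤ d := by
  have h0 : ∀ i, d ≤ i → k i = 0 := fun i hi => by
    have := (mem_partsOf.1 hl).2.1 i hi; have := h i; omega
  refine ⟨(mem_partsOf_iff h0).2 ⟨h.antitone_left, rfl⟩, ?_⟩
  conv_rhs => rw [← (mem_partsOf.1 hl).2.2]
  exact sum_le_sum fun i _ => (h i).1

theorem pieri (m : ℕ) : ∀ (k d : ℕ) (c : ℕ → ℕ), c ∈ partsOf d →
    compH x m k * schurS x m d c =
      open Classical in ∑ u ∈ partsOf (d + k) with HStrip c u, schurS x m (d + k) u := by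
  classical
  induction m with
  | zero =>
    intro k d c hc
    simp only [compH, schurS]
    by_cases hd : d = 0
    · by_cases hk : k = 0
      · subst hd hk
        rw [partsOf_zero, mem_singleton] at hc
        subst hc
        simp [partsOf_zero, HStrip, filter_singleton]
      · simp [hk]
    · simp [hd]
  | succ m ih =>
    intro k d c hc
    have step : ∀ (p q : ℕ × ℕ), (compH x m p.1 * x m ^ p.2) *
        ((∑ s ∈ partsOf q.1 with HStrip s c, schurS x m q.1 s) * x m ^ q.2) =
        ∑ s ∈ partsOf q.1 with HStrip s c, ∑ t ∈ partsOf (q.1 + p.1) with HStrip s t,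
          schurS x m (q.1 + p.1) t * x m ^ (p.2 + q.2) := by
      intro p q
      rw [sum_mul, mul_sum]
      refine sum_congr rfl fun s hs => ?_
      rw [mem_filter] at hs
      rw [← sum_mul, ← ih _ _ _ hs.1]
      ring
    simp only [compH, schurS]
    rw [sum_mul_sum]
    simp only [step]
    simp only [sum_mul]
    simp only [sum_sigma']
    have hc' := mem_partsOf.1 hc
    have key : ∀ (u t : ℕ → ℕ) (e f : ℕ), (u ∈ partsOf (d + k) ∧ HStrip c u) ∧ e + f = d + k ∧
        t ∈ partsOf e ∧ HStrip t u →
        toggleDown c t u ∈ partsOf (∑ i ∈ range d, toggleDown c t u i) ∧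
        HStrip (toggleDown c t u) c ∧ HStrip (toggleDown c t u) t ∧
        ∑ i ∈ range d, toggleDown c t u i ≤ d ∧ ∑ i ∈ range d, toggleDown c t u i ≤ e ∧
        d + k + ∑ i ∈ range d, toggleDown c t u i = u 0 - max (c 0) (t 0) + d + e := by
      intro u t e f h
      obtain ⟨⟨h1, h2⟩, h3, h4, h5⟩ := h
      obtain ⟨g1, g2⟩ := toggleDown_strip h2 h5
      obtain ⟨g3, g4⟩ := g1.mem_partsOf_left hc
      have e1 := toggleUp_sum (j := u 0 - max (c 0) (t 0)) g1 g2 (d + k + e)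
      rw [toggleUp_toggleDown h2 h5] at e1
      have hc0 := hc'.2.1
      have ht0 := (mem_partsOf.1 h4).2.1
      have hs0 := (mem_partsOf.1 g3).2.1
      rw [sum_range_partsOf hc fun i hi => hc0 i (by omega),
        sum_range_partsOf h4 fun i hi => ht0 i (by omega),
        sum_range_partsOf h1 fun i hi => (mem_partsOf.1 h1).2.1 i (by omega),
        sum_range_partsOf g3 fun i hi => hs0 i (by omega), hc0 (d + k + e) (by omega)] at e1
      have hle : ∑ i ∈ range d, toggleDown c t u i ≤ e := by
        rw [← (mem_partsOf.1 h4).2.2]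
        have : ∑ i ∈ range e, toggleDown c t u i = ∑ i ∈ range d, toggleDown c t u i :=
          sum_range_eq_of_zero (fun i hi => by have := ht0 i hi; have := g2 i; omega)
            (fun i hi => by have := hc0 i hi; have := g1 i; omega)
        rw [← this]
        exact sum_le_sum fun i _ => (g2 i).1
      exact ⟨g3, g1, g2, g4, hle, by omega⟩
    refine sum_bij'
      (fun z _ => ⟨toggleUp c z.2.2.2 z.2.2.1 z.1.2, (z.2.1.1 + z.1.1, z.1.2 + z.2.1.2), z.2.2.2⟩)
      (fun z _ => ⟨(k - (z.1 0 - max (c 0) (z.2.2 0)), z.1 0 - max (c 0) (z.2.2 0)),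
        (∑ i ∈ range d, toggleDown c z.2.2 z.1 i,
          d - ∑ i ∈ range d, toggleDown c z.2.2 z.1 i), toggleDown c z.2.2 z.1, z.2.2⟩)
      ?_ ?_ ?_ ?_ ?_
    · rintro ⟨⟨a, j⟩, ⟨b, j'⟩, s, t⟩ h
      simp only [mem_sigma, mem_filter, HasAntidiagonal.mem_antidiagonal] at h ⊢
      obtain ⟨h1, h2, ⟨h3, h4⟩, h5, h6⟩ := h
      obtain ⟨g1, g2⟩ := toggleUp_strip (j := j) h4 h6
      refine ⟨⟨?_, g1⟩, by omega, h5, g2⟩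
      have := toggleUp_sum (j := j) h4 h6 (d + (b + a))
      have hc0 := hc'.2.1
      have ht0 := (mem_partsOf.1 h5).2.1
      have hs0 := (mem_partsOf.1 h3).2.1
      have e0 : ∀ i, d + (b + a) + 1 ≤ i → toggleUp c t s j i = 0 := by
        intro i hi
        obtain ⟨i, rfl⟩ : ∃ i', i = i' + 1 := ⟨i - 1, by omega⟩
        have := hc0 i (by omega); have := hc0 (i + 1) (by omega); have := ht0 (i + 1) (by omega)
        simp only [toggleUp]; omega
      refine (mem_partsOf_iff e0).2 ⟨g1.antitone_right, ?_⟩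
      rw [sum_range_partsOf hc fun i hi => hc0 i (by omega),
        sum_range_partsOf h5 fun i hi => ht0 i (by omega),
        sum_range_partsOf h3 fun i hi => hs0 i (by omega), hc0 (d + (b + a)) (by omega)] at this
      omega
    · rintro ⟨u, ⟨e, f⟩, t⟩ h
      simp only [mem_sigma, mem_filter, HasAntidiagonal.mem_antidiagonal] at h ⊢
      obtain ⟨g3, g1, g2, g4, hle, e1⟩ := key u t e f h
      refine ⟨by omega, by omega, ⟨g3, g1⟩, ?_, g2⟩
      convert h.2.2.1 using 2
      omega
    · rintro ⟨⟨a, j⟩, ⟨b, j'⟩, s, t⟩ h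
      simp only [mem_sigma, mem_filter, HasAntidiagonal.mem_antidiagonal] at h
      obtain ⟨h1, h2, ⟨h3, h4⟩, h5, h6⟩ := h
      have e1 : toggleUp c t s j 0 - max (c 0) (t 0) = j := by simp [toggleUp]
      have e2 := toggleDown_toggleUp (j := j) h4 h6
      have e3 : ∑ i ∈ range d, s i = b := sum_range_partsOf h3 fun i hi =>
        (mem_partsOf.1 h3).2.1 i (by omega)
      have e4 : k - j = a := by omega
      have e5 : d - b = j' := by omega
      simp only [e1, e2, e3, e4, e5]
    · rintro ⟨u, ⟨e, f⟩, t⟩ h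
      simp only [mem_sigma, mem_filter, HasAntidiagonal.mem_antidiagonal] at h
      obtain ⟨g3, g1, g2, g4, hle, e1⟩ := key u t e f h
      obtain ⟨⟨h1, h2⟩, h3, h4, h5⟩ := h
      have e2 := toggleUp_toggleDown h2 h5
      have e3 : ∑ i ∈ range d, toggleDown c t u i + (k - (u 0 - max (c 0) (t 0))) = e := by omega
      have e4 : u 0 - max (c 0) (t 0) + (d - ∑ i ∈ range d, toggleDown c t u i) = f := by omega
      simp only [e2, e3, e4]
    · rintro ⟨⟨a, j⟩, ⟨b, j'⟩, s, t⟩ h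
      rfl

end Combinatorics

section Chains

open Finset

variable {R : Type*} [CommRing R] (x : ℕ → R)

/-- Chains of horizontal strips of length `m` with sizes `d + a 0 + ⋯ + a (r - 1)`. -/
def IsStripChain (m d : ℕ) (a : ℕ → ℕ) (u : ℕ → ℕ) (c : ℕ → ℕ → ℕ) : Prop :=
  c 0 = u ∧ (∀ r ≤ m, c r ∈ partsOf (d + ∑ i ∈ range r, a i)) ∧
    (∀ r < m, HStrip (c r) (c (r + 1))) ∧ ∀ r, m ≤ r → c r = c m

theorem finite_stripChains (m d : ℕ) (a u : ℕ → ℕ) : {c | IsStripChain m d a u c}.Finite := by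
  classical
  let F : Finset (ℕ → ℕ) := (range (m + 1)).biUnion fun r => partsOf (d + ∑ i ∈ range r, a i)
  refine (Set.finite_range
    (fun (g : Fin (m + 1) → F) (r : ℕ) => (g ⟨min r m, by omega⟩ : ℕ → ℕ))).subset ?_
  rintro c ⟨-, h2, -, h4⟩
  refine ⟨fun r => ⟨c r, ?_⟩, ?_⟩
  · simp only [F, mem_biUnion, mem_range]
    exact ⟨r, r.2, h2 r (by omega)⟩
  · funext r
    rcases le_total r m with h | h
    · simp [min_eq_left h]
    · simp [min_eq_right h, h4 r h]

/-- The finite set of chains of horizontal strips. -/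
def stripChains (m d : ℕ) (a u : ℕ → ℕ) : Finset (ℕ → ℕ → ℕ) :=
  (finite_stripChains m d a u).toFinset

theorem mem_stripChains {m d : ℕ} {a u : ℕ → ℕ} {c : ℕ → ℕ → ℕ} :
    c ∈ stripChains m d a u ↔ IsStripChain m d a u c := by simp [stripChains]

theorem prod_compH_mul_schurS (n m d : ℕ) (a u : ℕ → ℕ) (hu : u ∈ partsOf d) :
    (∏ r ∈ range m, compH x n (a r)) * schurS x n d u =
      ∑ c ∈ stripChains m d a u, schurS x n (d + ∑ i ∈ range m, a i) (c m) := by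
  classical
  induction m with
  | zero =>
    have : stripChains 0 d a u = {fun _ => u} := by
      ext c
      rw [mem_stripChains, mem_singleton]
      constructor
      · rintro ⟨h1, -, -, h4⟩
        funext r
        rw [h4 r (Nat.zero_le r), h1]
      · rintro rfl
        exact ⟨rfl, by intro r hr; obtain rfl : r = 0 := by omega
                       simpa using hu, by simp, fun _ _ => rfl⟩
    simp [this]
  | succ m ih =>
    rw [prod_range_succ, mul_comm (∏ r ∈ range m, _), mul_assoc, ih, mul_sum]
    have step : ∀ c ∈ stripChains m d a u,
        compH x n (a m) * schurS x n (d + ∑ i ∈ range m, a i) (c m) =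
        ∑ v ∈ partsOf (d + ∑ i ∈ range (m + 1), a i) with HStrip (c m) v,
          schurS x n (d + ∑ i ∈ range (m + 1), a i) v := by
      intro c hc
      rw [pieri x n _ _ _ ((mem_stripChains.1 hc).2.1 m le_rfl), sum_range_succ, add_assoc]
    rw [sum_congr rfl step, sum_sigma']
    refine sum_bij' (fun z _ => fun r => if r ≤ m then z.1 r else z.2)
      (fun c _ => ⟨fun r => c (min r m), c (m + 1)⟩) ?_ ?_ ?_ ?_ ?_
    · rintro ⟨c, v⟩ h
      simp only [mem_sigma, mem_filter, mem_stripChains] at h ⊢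
      obtain ⟨⟨h1, h2, h3, h4⟩, h5, h6⟩ := h
      refine ⟨by simpa using h1, ?_, ?_, ?_⟩
      · intro r hr
        by_cases h : r ≤ m
        · simpa [h] using h2 r h
        · obtain rfl : r = m + 1 := by omega
          simpa using h5
      · intro r hr
        by_cases h : r < m
        · have e1 : r ≤ m := h.le
          have e2 : r + 1 ≤ m := h
          simpa [e1, e2] using h3 r h
        · obtain rfl : r = m := by omega
          simpa using h6
      · intro r hr
        have : ¬ r ≤ m := by omega
        simp [this]
    · intro c h
      simp only [mem_sigma, mem_filter, mem_stripChains] at h ⊢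
      obtain ⟨h1, h2, h3, h4⟩ := h
      refine ⟨⟨by simpa using h1, ?_, ?_, ?_⟩, h2 _ le_rfl, by simpa using h3 m (by omega)⟩
      · intro r hr
        beta_reduce
        rw [min_eq_left hr]
        exact h2 r (by omega)
      · intro r hr
        beta_reduce
        rw [min_eq_left hr.le, min_eq_left (show r + 1 ≤ m from hr)]
        exact h3 r (by omega)
      · intro r hr
        simp [hr]
    · rintro ⟨c, v⟩ h
      simp only [mem_sigma, mem_filter, mem_stripChains] at h
      have h4 := h.1.2.2.2
      simp only [min_le_iff, le_refl, or_true, if_true]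
      refine Sigma.ext ?_ ?_
      · funext r
        rcases le_total r m with h | h
        · simp [h]
        · simp [h, h4 r h]
      · simp
    · intro c h
      rw [mem_stripChains] at h
      funext r
      by_cases hr : r ≤ m
      · simp [hr]
      · simp only [hr, if_false]
        exact (h.2.2.2 r (by omega)).symm
    · rintro ⟨c, v⟩ h
      simp

/-- The lattice condition of a chain of strips fails at row `i` between steps `r` and `r + 1`. -/
def LatticeFails (c : ℕ → ℕ → ℕ) (i r : ℕ) : Prop :=
  ∑ k ∈ range i, c (r + 1) k + ∑ k ∈ range (i + 1), c (r + 1) k <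
    ∑ k ∈ range i, c r k + ∑ k ∈ range (i + 1), c (r + 2) k

/-- The row flip used in the sign-reversing involution. -/
def rowFlip (i D : ℕ) (P Q y : ℕ → ℕ) (k : ℕ) : ℕ :=
  if k < i then y k else if k = i then max (P k) (Q (k + 1)) + (Q k - D - 1) - y k
  else max (P k) (Q (k + 1)) + min (Q k) (P (k - 1)) - y k

theorem rowFlip_facts {i D : ℕ} {P Q y : ℕ → ℕ} (h1 : HStrip P y) (h2 : HStrip y Q)
    (hD : D + ∑ k ∈ range i, P k + ∑ k ∈ range i, Q k = 2 * ∑ k ∈ range i, y k)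
    (hi : D + y i < Q i) (hi' : i ≠ 0 → y (i - 1) ≤ D + P (i - 1)) :
    HStrip P (rowFlip i D P Q y) ∧ HStrip (rowFlip i D P Q y) Q ∧
    D + rowFlip i D P Q y i < Q i ∧
    rowFlip i D P Q (rowFlip i D P Q y) = y ∧
    ∀ L, i ≤ L → ∑ k ∈ range (L + 1), rowFlip i D P Q y k + ∑ k ∈ range (L + 1), y k + 1 +
      min (Q (L + 1)) (P L) = ∑ k ∈ range (L + 1), P k + ∑ k ∈ range (L + 1), Q k + Q (L + 1) := by
  have hb : ∀ k, P k ≤ y k ∧ Q (k + 1) ≤ y k ∧ y (k + 1) ≤ P k ∧ y k ≤ Q k :=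
    fun k => ⟨(h1 k).1, (h2 k).2, (h1 k).2, (h2 k).1⟩
  have hb' : ∀ k, P k ≤ rowFlip i D P Q y k ∧ Q (k + 1) ≤ rowFlip i D P Q y k ∧
      rowFlip i D P Q y (k + 1) ≤ P k ∧ rowFlip i D P Q y k ≤ Q k := by
    intro k
    have a0 := hb k
    have a1 := hb (k + 1)
    refine ⟨?_, ?_, ?_, ?_⟩
    · unfold rowFlip
      split_ifs with g1 g2
      · omega
      · subst g2; omega
      · obtain ⟨k, rfl⟩ : ∃ k', k = k' + 1 := ⟨k - 1, by omega⟩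
        have := hb k
        simp only [Nat.add_sub_cancel]
        omega
    · unfold rowFlip
      split_ifs with g1 g2
      · omega
      · subst g2; omega
      · obtain ⟨k, rfl⟩ : ∃ k', k = k' + 1 := ⟨k - 1, by omega⟩
        have := hb k
        simp only [Nat.add_sub_cancel]
        omega
    · unfold rowFlip
      split_ifs with g1 g2
      · omega
      · subst g2
        have := hi' (by omega)
        simp only [Nat.add_sub_cancel] at this
        omega
      · simp only [Nat.add_sub_cancel]
        omega
    · unfold rowFlip
      split_ifs with g1 g2
      · omega
      · subst g2; omega
      · obtain ⟨k, rfl⟩ : ∃ k', k = k' + 1 := ⟨k - 1, by omega⟩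
        have := hb k
        simp only [Nat.add_sub_cancel]
        omega
  refine ⟨fun k => ⟨(hb' k).1, (hb' k).2.2.1⟩, fun k => ⟨(hb' k).2.2.2, (hb' k).2.1⟩, ?_, ?_, ?_⟩
  · have := hb i
    simp only [rowFlip, lt_irrefl, if_false, if_true]
    omega
  · funext k
    have a0 := hb k
    have a1 := hb (k + 1)
    by_cases g1 : k < i
    · simp [rowFlip, g1]
    · by_cases g2 : k = i
      · subst g2
        simp only [rowFlip, lt_irrefl, if_false, if_true]
        omega
      · obtain ⟨k, rfl⟩ : ∃ k', k = k' + 1 := ⟨k - 1, by omega⟩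
        have := hb k
        simp only [rowFlip, g1, g2, if_false, Nat.add_sub_cancel]
        omega
  · intro L hL
    induction L, hL using Nat.le_induction with
    | base =>
      have e : ∑ k ∈ range i, rowFlip i D P Q y k = ∑ k ∈ range i, y k :=
        sum_congr rfl fun k hk => by simp [rowFlip, mem_range.1 hk]
      rw [sum_range_succ, sum_range_succ y, sum_range_succ P, sum_range_succ Q, e]
      have := hb i
      have e2 : rowFlip i D P Q y i = max (P i) (Q (i + 1)) + (Q i - D - 1) - y i := by
        simp [rowFlip]
      rw [e2]
      omega
    | succ L hL ih =>
      rw [sum_range_succ _ (L + 1), sum_range_succ y (L + 1), sum_range_succ P (L + 1),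
        sum_range_succ Q (L + 1)]
      have := hb L
      have := hb (L + 1)
      have e2 : rowFlip i D P Q y (L + 1) =
          max (P (L + 1)) (Q (L + 1 + 1)) + min (Q (L + 1)) (P L) - y (L + 1) := by
        simp [rowFlip, show ¬ L + 1 < i by omega, show L + 1 ≠ i by omega]
      rw [e2]
      omega

end Chains

section Involution

open Finset

/-- The distinguished failure of the lattice condition of a chain. -/
def IsSelected (m : ℕ) (c : ℕ → ℕ → ℕ) (i r : ℕ) : Prop :=
  (r + 1 < m ∧ LatticeFails c i r) ∧
  (∀ i' < i, ∀ r', r' + 1 < m → ¬ LatticeFails c i' r') ∧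
  ∀ r', r < r' → r' + 1 < m → ¬ LatticeFails c i r'

/-- Chains satisfying the lattice condition. -/
def IsLatticeChain (m : ℕ) (c : ℕ → ℕ → ℕ) : Prop :=
  ∀ i r, r + 1 < m → ¬ LatticeFails c i r

theorem exists_isSelected {m : ℕ} {c : ℕ → ℕ → ℕ} (h : ¬ IsLatticeChain m c) :
    ∃ p : ℕ × ℕ, IsSelected m c p.1 p.2 := by
  classical
  have h' : ∃ i, ∃ r, r + 1 < m ∧ LatticeFails c i r := by
    by_contra hc
    exact h fun i r h1 h2 => hc ⟨i, r, h1, h2⟩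
  obtain ⟨r0, hr0⟩ := Nat.find_spec h'
  have hg := Nat.findGreatest_spec (P := fun r => r + 1 < m ∧ LatticeFails c (Nat.find h') r)
    (show r0 ≤ m by omega) hr0
  refine ⟨(Nat.find h', Nat.findGreatest
    (fun r => r + 1 < m ∧ LatticeFails c (Nat.find h') r) m), hg, ?_, ?_⟩
  · intro i' hi' r' h1 h2
    exact Nat.find_min h' hi' ⟨r', h1, h2⟩
  · intro r' hr' h1 h2
    exact absurd (Nat.le_findGreatest (P := fun r => r + 1 < m ∧ LatticeFails c (Nat.find h') r)
      (show r' ≤ m by omega) ⟨h1, h2⟩) (by simpa using hr')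

theorem IsSelected.unique {m : ℕ} {c : ℕ → ℕ → ℕ} {i r i' r' : ℕ} (h : IsSelected m c i r)
    (h' : IsSelected m c i' r') : i = i' ∧ r = r' := by
  have hi : i = i' := by
    rcases lt_trichotomy i i' with hlt | heq | hgt
    · exact absurd h.1.2 (h'.2.1 i hlt r h.1.1)
    · exact heq
    · exact absurd h'.1.2 (h.2.1 i' hgt r' h'.1.1)
  subst hi
  refine ⟨rfl, ?_⟩
  rcases lt_trichotomy r r' with hlt | heq | hgt
  · exact absurd h'.1.2 (h.2.2 r' hlt h'.1.1)
  · exact heq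
  · exact absurd h.1.2 (h'.2.2 r hgt h.1.1)

/-- The partial excess of the lattice condition. -/
def latticeExcess (c : ℕ → ℕ → ℕ) (i r : ℕ) : ℕ :=
  2 * ∑ k ∈ range i, c (r + 1) k - ∑ k ∈ range i, c r k - ∑ k ∈ range i, c (r + 2) k

/-- The flip of a chain at level `r + 1`, from row `i` on. -/
def chainFlip (i r : ℕ) (c : ℕ → ℕ → ℕ) : ℕ → ℕ → ℕ :=
  Function.update c (r + 1) (rowFlip i (latticeExcess c i r) (c r) (c (r + 2)) (c (r + 1)))

section

variable {m d i r : ℕ} {a u : ℕ → ℕ} {c : ℕ → ℕ → ℕ}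

theorem chainFlip_of_ne {s : ℕ} (hs : s ≠ r + 1) : chainFlip i r c s = c s := by
  simp [chainFlip, hs]

theorem chainFlip_self : chainFlip i r c (r + 1) =
    rowFlip i (latticeExcess c i r) (c r) (c (r + 2)) (c (r + 1)) := by
  simp [chainFlip]

theorem chainFlip_apply_of_lt {s k : ℕ} (hk : k < i) : chainFlip i r c s k = c s k := by
  by_cases hs : s = r + 1
  · subst hs
    simp [chainFlip_self, rowFlip, hk]
  · rw [chainFlip_of_ne hs]

theorem sum_chainFlip {s j : ℕ} (hj : j ≤ i) :
    ∑ k ∈ range j, chainFlip i r c s k = ∑ k ∈ range j, c s k :=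
  sum_congr rfl fun k hk => chainFlip_apply_of_lt (by simp at hk; omega)

theorem rowFlip_facts_of_isSelected (hc : IsStripChain m d a u c) (h : IsSelected m c i r) :
    latticeExcess c i r + ∑ k ∈ range i, c r k + ∑ k ∈ range i, c (r + 2) k =
      2 * ∑ k ∈ range i, c (r + 1) k ∧
    latticeExcess c i r + c (r + 1) i < c (r + 2) i ∧
    (i ≠ 0 → c (r + 1) (i - 1) ≤ latticeExcess c i r + c r (i - 1)) := by
  have h1 := h.1.2
  have hP := hc.2.2.1 r (by have := h.1.1; omega)
  have hQ := hc.2.2.1 (r + 1) h.1.1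
  unfold LatticeFails at h1
  rw [sum_range_succ, sum_range_succ] at h1
  unfold latticeExcess
  rcases Nat.eq_zero_or_pos i with rfl | hi
  · simp at h1 ⊢
    omega
  · obtain ⟨i, rfl⟩ : ∃ i', i = i' + 1 := ⟨i - 1, by omega⟩
    have h2 := h.2.1 i (by omega) r h.1.1
    unfold LatticeFails at h2
    rw [sum_range_succ, sum_range_succ] at h2
    rw [sum_range_succ _ i, sum_range_succ _ i, sum_range_succ _ i] at h1 ⊢
    have := hP i
    have := hQ i
    simp only [Nat.add_sub_cancel] at *
    refine ⟨?_, ?_, fun _ => ?_⟩ <;> omega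

theorem latticeExcess_chainFlip : latticeExcess (chainFlip i r c) i r = latticeExcess c i r := by
  simp only [latticeExcess, sum_chainFlip le_rfl]

theorem latticeFails_chainFlip_of_lt {i' r' : ℕ} (hi : i' < i) :
    LatticeFails (chainFlip i r c) i' r' ↔ LatticeFails c i' r' := by
  unfold LatticeFails
  rw [sum_chainFlip hi.le, sum_chainFlip hi, sum_chainFlip hi.le, sum_chainFlip hi]

theorem latticeFails_chainFlip_of_gt {r' : ℕ} (hr : r < r') :
    LatticeFails (chainFlip i r c) i r' ↔ LatticeFails c i r' := by
  unfold LatticeFails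
  rw [sum_chainFlip le_rfl, sum_chainFlip le_rfl, chainFlip_of_ne (by omega),
    chainFlip_of_ne (by omega)]

theorem isSelected_chainFlip (hc : IsStripChain m d a u c) (h : IsSelected m c i r) :
    IsSelected m (chainFlip i r c) i r := by
  obtain ⟨f1, f2, f3⟩ := rowFlip_facts_of_isSelected hc h
  obtain ⟨-, -, g, -, -⟩ := rowFlip_facts (hc.2.2.1 r (by have := h.1.1; omega))
    (show HStrip (c (r + 1)) (c (r + 2)) from hc.2.2.1 (r + 1) h.1.1) f1 f2 f3
  refine ⟨⟨h.1.1, ?_⟩, ?_, ?_⟩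
  · unfold LatticeFails
    rw [sum_range_succ, sum_range_succ, sum_chainFlip le_rfl, sum_chainFlip le_rfl,
      sum_chainFlip le_rfl, chainFlip_self, chainFlip_of_ne (show r + 2 ≠ r + 1 by omega)]
    omega
  · intro i' hi' r' hr'
    rw [latticeFails_chainFlip_of_lt hi']
    exact h.2.1 i' hi' r' hr'
  · intro r' hr hr'
    rw [latticeFails_chainFlip_of_gt hr]
    exact h.2.2 r' hr hr'

theorem chainFlip_chainFlip (hc : IsStripChain m d a u c) (h : IsSelected m c i r) :
    chainFlip i r (chainFlip i r c) = c := by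
  obtain ⟨f1, f2, f3⟩ := rowFlip_facts_of_isSelected hc h
  obtain ⟨-, -, -, g, -⟩ := rowFlip_facts (hc.2.2.1 r (by have := h.1.1; omega))
    (show HStrip (c (r + 1)) (c (r + 2)) from hc.2.2.1 (r + 1) h.1.1) f1 f2 f3
  funext s
  by_cases hs : s = r + 1
  · subst hs
    rw [chainFlip_self, latticeExcess_chainFlip, chainFlip_self, chainFlip_of_ne (by omega),
      chainFlip_of_ne (by omega)]
    exact g
  · rw [chainFlip_of_ne hs, chainFlip_of_ne hs]

theorem sum_range_stripChain (hc : IsStripChain m d a u c) {s L : ℕ} (hs : s ≤ m)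
    (hL : d + ∑ i ∈ range m, a i ≤ L) :
    ∑ k ∈ range L, c s k = d + ∑ i ∈ range s, a i :=
  sum_range_partsOf (hc.2.1 s hs) fun k hk => (mem_partsOf.1 (hc.2.1 s hs)).2.1 k <| by
    have := sum_le_sum_of_subset (f := a) (range_mono hs)
    omega

theorem sizes_chainFlip (hc : IsStripChain m d a u c) (h : IsSelected m c i r) :
    ∃ b, a (r + 1) = b + 1 ∧
      chainFlip i r c (r + 1) ∈ partsOf (d + ∑ k ∈ range r, a k + b) := by
  obtain ⟨f1, f2, f3⟩ := rowFlip_facts_of_isSelected hc h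
  obtain ⟨g1, g2, -, -, g⟩ := rowFlip_facts (hc.2.2.1 r (by have := h.1.1; omega))
    (show HStrip (c (r + 1)) (c (r + 2)) from hc.2.2.1 (r + 1) h.1.1) f1 f2 f3
  have hr := h.1.1
  set L := i + (d + ∑ i ∈ range m, a i) with hLdef
  have e := g L (by omega)
  have z : ∀ s ≤ m, ∀ k, L ≤ k → c s k = 0 := fun s hs k hk =>
    (mem_partsOf.1 (hc.2.1 s hs)).2.1 k <| by
      have := sum_le_sum_of_subset (f := a) (range_mono hs)
      omega
  rw [sum_range_stripChain hc (s := r) (by omega) (by omega),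
    sum_range_stripChain hc (s := r + 1) (by omega) (by omega),
    sum_range_stripChain hc (s := r + 2) (by omega) (by omega), z (r + 2) (by omega) _ (by omega),
    sum_range_succ _ (r + 1), sum_range_succ _ r] at e
  have hpos : a (r + 1) ≠ 0 := by
    intro h0
    have e1 := sum_range_stripChain hc (s := r + 1) (L := L + 1) (by omega) (by omega)
    have e2 := sum_range_stripChain hc (s := r + 2) (L := L + 1) (by omega) (by omega)
    rw [sum_range_succ _ (r + 1), h0] at e2
    have : ∑ k ∈ range (L + 1), c (r + 1) k < ∑ k ∈ range (L + 1), c (r + 2) k :=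
      sum_lt_sum (fun k _ => (hc.2.2.1 (r + 1) h.1.1 k).1)
        ⟨i, by simp; omega, by omega⟩
    omega
  refine ⟨a (r + 1) - 1, by omega, ?_⟩
  rw [chainFlip_self]
  refine (mem_partsOf_iff (L := L + 1) fun k hk => ?_).2 ⟨g1.antitone_right, by omega⟩
  have := (g2 k).1
  have := z (r + 2) (by omega) k (by omega)
  omega

theorem isStripChain_chainFlip (hc : IsStripChain m d a u c) (h : IsSelected m c i r)
    {a' : ℕ → ℕ} (h1 : a' r + 1 = a (r + 1)) (h2 : a' (r + 1) = a r + 1)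
    (h3 : ∀ s, s ≠ r → s ≠ r + 1 → a' s = a s) :
    IsStripChain m d a' u (chainFlip i r c) := by
  obtain ⟨f1, f2, f3⟩ := rowFlip_facts_of_isSelected hc h
  obtain ⟨g1, g2, -, -, -⟩ := rowFlip_facts (hc.2.2.1 r (by have := h.1.1; omega))
    (show HStrip (c (r + 1)) (c (r + 2)) from hc.2.2.1 (r + 1) h.1.1) f1 f2 f3
  have hr := h.1.1
  have e1 : ∀ s ≤ r, ∑ k ∈ range s, a' k = ∑ k ∈ range s, a k := fun s hs =>
    sum_congr rfl fun k hk => by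
      have := mem_range.1 hk
      exact h3 k (by omega) (by omega)
  have e2 : ∀ s, r + 2 ≤ s → ∑ k ∈ range s, a' k = ∑ k ∈ range s, a k := by
    intro s hs
    induction s, hs using Nat.le_induction with
    | base =>
      have := e1 r le_rfl
      rw [sum_range_succ, sum_range_succ, sum_range_succ _ (r + 1), sum_range_succ a r]
      omega
    | succ s hs ih => rw [sum_range_succ, sum_range_succ, ih, h3 s (by omega) (by omega)]
  refine ⟨?_, ?_, ?_, ?_⟩
  · rw [chainFlip_of_ne (by omega)]; exact hc.1
  · intro s hs
    rcases lt_trichotomy s (r + 1) with hlt | rfl | hgt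
    · rw [chainFlip_of_ne (by omega), e1 s (by omega)]; exact hc.2.1 s hs
    · obtain ⟨b, hb1, hb2⟩ := sizes_chainFlip hc h
      convert hb2 using 2
      rw [sum_range_succ, e1 r le_rfl]
      omega
    · rw [chainFlip_of_ne (by omega), e2 s (by omega)]; exact hc.2.1 s hs
  · intro s hs
    by_cases hs1 : s = r
    · subst hs1
      rw [chainFlip_self, chainFlip_of_ne (by omega)]
      exact g1
    · by_cases hs2 : s = r + 1
      · subst hs2
        rw [chainFlip_self, chainFlip_of_ne (by omega)]
        exact g2
      · rw [chainFlip_of_ne (by omega), chainFlip_of_ne (by omega)]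
        exact hc.2.2.1 s hs
  · intro s hs
    rw [chainFlip_of_ne (by omega), chainFlip_of_ne (by omega)]
    exact hc.2.2.2 s hs

end

section JacobiTrudi

variable {R : Type*} [CommRing R] (x : ℕ → R) {m : ℕ} {v : ℕ → ℕ}

/-- The exponents in the term of a permutation in the Jacobi-Trudi determinant. -/
def permContent (m : ℕ) (v : ℕ → ℕ) (w : Equiv.Perm (Fin m)) (r : ℕ) : ℕ :=
  if h : r < m then v (w ⟨r, h⟩) + r - w ⟨r, h⟩ else 0

/-- The condition that the exponents are nonnegative. -/
def PermNonneg (v : ℕ → ℕ) (w : Equiv.Perm (Fin m)) : Prop :=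
  ∀ r, (w r : ℕ) ≤ v (w r) + r

theorem sum_permContent {w : Equiv.Perm (Fin m)} (hw : PermNonneg v w) :
    ∑ r ∈ range m, permContent m v w r = ∑ r ∈ range m, v r := by
  have h1 : ∑ r : Fin m, (permContent m v w r + (w r : ℕ)) = ∑ r : Fin m, (v (w r) + (r : ℕ)) :=
    sum_congr rfl fun r _ => by
      have := hw r
      simp only [permContent, r.2, dite_true, Fin.eta]
      omega
  rw [sum_add_distrib, sum_add_distrib, Equiv.sum_comp w fun r => (r : ℕ),
    Equiv.sum_comp w fun r => v r] at h1
  rw [← Fin.sum_univ_eq_sum_range, ← Fin.sum_univ_eq_sum_range v]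
  omega

open Classical in
/-- The Jacobi-Trudi determinant, expanded. -/
def jacobiTrudi (n m : ℕ) (v : ℕ → ℕ) : R :=
  ∑ w : Equiv.Perm (Fin m) with PermNonneg v w,
    (Equiv.Perm.sign w : ℤ) • ∏ r ∈ range m, compH x n (permContent m v w r)

theorem permContent_one (hv : ∀ r, m ≤ r → v r = 0) : permContent m v 1 = v := by
  funext r
  by_cases h : r < m
  · simp [permContent, h]
  · simp [permContent, h, hv r (by omega)]

theorem eq_one_of_lattice {d : ℕ} {u : ℕ → ℕ} {c : ℕ → ℕ → ℕ} {w : Equiv.Perm (Fin m)}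
    (hv : Antitone v) (hw : PermNonneg v w) (hc : IsStripChain m d (permContent m v w) u c)
    (hl : IsLatticeChain m c) : w = 1 := by
  have h1 : ∀ r (h : r + 1 < m), w ⟨r, by omega⟩ < w ⟨r + 1, h⟩ := by
    intro r h
    set L := d + ∑ i ∈ range m, permContent m v w i
    have h2 := hl L r h
    unfold LatticeFails at h2
    rw [sum_range_stripChain hc (by omega) le_rfl, sum_range_stripChain hc (by omega) le_rfl,
      sum_range_stripChain hc (by omega) (by omega), sum_range_stripChain hc (by omega) (by omega),
      sum_range_succ _ (r + 1), sum_range_succ _ r] at h2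
    have e1 : permContent m v w r = v (w ⟨r, by omega⟩) + r - w ⟨r, by omega⟩ := by
      simp [permContent, show r < m by omega]
    have e2 : permContent m v w (r + 1) = v (w ⟨r + 1, h⟩) + (r + 1) - w ⟨r + 1, h⟩ := by
      simp [permContent, h]
    have e3 := hw ⟨r, by omega⟩
    have e4 := hw ⟨r + 1, h⟩
    simp only at e3 e4
    by_contra hcon
    have hcon' : (w ⟨r + 1, h⟩ : ℕ) ≤ w ⟨r, by omega⟩ := by simpa using hcon
    have := hv hcon'
    omega
  have h2 : StrictMono w := by
    have key : ∀ (k r : ℕ) (h : r + k + 1 < m), w ⟨r, by omega⟩ < w ⟨r + k + 1, h⟩ := by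
      intro k
      induction k with
      | zero => intro r h; exact h1 r h
      | succ k ih => intro r h; exact (ih r (by omega)).trans (h1 (r + k + 1) h)
    intro p q hpq
    obtain ⟨k, hk⟩ : ∃ k, (q : ℕ) = p + k + 1 := ⟨q - p - 1, by have : (p : ℕ) < q := hpq; omega⟩
    have := key k p (by omega)
    rwa [show q = ⟨p + k + 1, by omega⟩ from Fin.ext hk]
  have h3 : StrictMono.orderIsoOfSurjective w h2 w.surjective = OrderIso.refl _ :=
    Subsingleton.elim _ _
  ext r
  have := congrArg (fun f => ((f r : Fin m) : ℕ)) h3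
  simpa using this

theorem permNonneg_mul_swap {d i r : ℕ} {u : ℕ → ℕ} {c : ℕ → ℕ → ℕ} {w : Equiv.Perm (Fin m)}
    (hw : PermNonneg v w) (hc : IsStripChain m d (permContent m v w) u c)
    (h : IsSelected m c i r) :
    PermNonneg v (w * Equiv.swap ⟨r, by have := h.1.1; omega⟩ ⟨r + 1, h.1.1⟩) ∧
    IsStripChain m d (permContent m v (w * Equiv.swap ⟨r, by have := h.1.1; omega⟩ ⟨r + 1, h.1.1⟩))
      u (chainFlip i r c) := by
  obtain ⟨b, hb, -⟩ := sizes_chainFlip hc h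
  have hr := h.1.1
  have e1 : permContent m v w r = v (w ⟨r, by omega⟩) + r - w ⟨r, by omega⟩ := by
    simp [permContent, show r < m by omega]
  have e2 : permContent m v w (r + 1) = v (w ⟨r + 1, hr⟩) + (r + 1) - w ⟨r + 1, hr⟩ := by
    simp [permContent, hr]
  have e3 := hw ⟨r, by omega⟩
  have e4 := hw ⟨r + 1, hr⟩
  simp only at e3 e4
  refine ⟨?_, isStripChain_chainFlip hc h ?_ ?_ ?_⟩
  · intro s
    rw [Equiv.Perm.mul_apply]
    by_cases hs1 : s = ⟨r, by omega⟩
    · subst hs1; rw [Equiv.swap_apply_left]; simp only; omega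
    · by_cases hs2 : s = ⟨r + 1, hr⟩
      · subst hs2; rw [Equiv.swap_apply_right]; simp only; omega
      · rw [Equiv.swap_apply_of_ne_of_ne hs1 hs2]; exact hw s
  · rw [permContent, dif_pos (show r < m by omega), Equiv.Perm.mul_apply, Equiv.swap_apply_left]
    omega
  · rw [permContent, dif_pos hr, Equiv.Perm.mul_apply, Equiv.swap_apply_right]
    omega
  · intro s hs1 hs2
    unfold permContent
    split_ifs with h3
    · rw [Equiv.Perm.mul_apply, Equiv.swap_apply_of_ne_of_ne]
      · simpa using hs1
      · simpa using hs2
    · rfl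

open Classical in
theorem jacobiTrudi_mul_schurS (n d : ℕ) {u : ℕ → ℕ} (hu : u ∈ partsOf d) (hv : Antitone v)
    (hvm : ∀ r, m ≤ r → v r = 0) :
    jacobiTrudi x n m v * schurS x n d u =
      ∑ c ∈ stripChains m d v u with IsLatticeChain m c,
        schurS x n (d + ∑ r ∈ range m, v r) (c m) := by
  have h1 : jacobiTrudi x n m v * schurS x n d u =
      ∑ z ∈ (univ.filter fun w : Equiv.Perm (Fin m) => PermNonneg v w).sigma
        fun w => stripChains m d (permContent m v w) u,
        (Equiv.Perm.sign z.1 : ℤ) • schurS x n (d + ∑ r ∈ range m, v r) (z.2 m) := by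
    rw [sum_sigma, jacobiTrudi, sum_mul]
    refine sum_congr rfl fun w hw => ?_
    rw [smul_mul_assoc, prod_compH_mul_schurS x n m d _ u hu, smul_sum,
      sum_permContent (mem_filter.1 hw).2]
  rw [h1, ← sum_filter_add_sum_filter_not _ (fun z => IsLatticeChain m z.2)]
  have h2 : ∑ z ∈ ((univ.filter fun w : Equiv.Perm (Fin m) => PermNonneg v w).sigma
        fun w => stripChains m d (permContent m v w) u) with ¬ IsLatticeChain m z.2,
        (Equiv.Perm.sign z.1 : ℤ) • schurS x n (d + ∑ r ∈ range m, v r) (z.2 m) = 0 := by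
    have sel : ∀ z : (_ : Equiv.Perm (Fin m)) × (ℕ → ℕ → ℕ),
        z ∈ ((univ.filter fun w : Equiv.Perm (Fin m) => PermNonneg v w).sigma
        fun w => stripChains m d (permContent m v w) u).filter (fun z => ¬ IsLatticeChain m z.2) →
        ∃ p : ℕ × ℕ, IsSelected m z.2 p.1 p.2 := fun z hz => exists_isSelected (mem_filter.1 hz).2
    refine sum_involution (fun z hz =>
      ⟨z.1 * Equiv.swap ⟨(sel z hz).choose.2, by have := (sel z hz).choose_spec.1.1; omega⟩
        ⟨(sel z hz).choose.2 + 1, (sel z hz).choose_spec.1.1⟩,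
        chainFlip (sel z hz).choose.1 (sel z hz).choose.2 z.2⟩) ?_ ?_ ?_ ?_
    · intro z hz
      have hs := (sel z hz).choose_spec
      have hne : (sel z hz).choose.2 + 1 ≠ m := by have := hs.1.1; omega
      have hsw : (⟨(sel z hz).choose.2, by have := hs.1.1; omega⟩ : Fin m) ≠
        ⟨(sel z hz).choose.2 + 1, hs.1.1⟩ := by simp
      simp only [Equiv.Perm.sign_mul, Equiv.Perm.sign_swap hsw, chainFlip_of_ne hne.symm]
      simp
    · intro z hz _ heq
      have hs := (sel z hz).choose_spec
      have hsw : (⟨(sel z hz).choose.2, by have := hs.1.1; omega⟩ : Fin m) ≠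
        ⟨(sel z hz).choose.2 + 1, hs.1.1⟩ := by simp
      have := congrArg Sigma.fst heq
      simp only [mul_eq_left, Equiv.swap_eq_one_iff] at this
      exact hsw this
    · intro z hz
      have hs := (sel z hz).choose_spec
      have hz' := hz
      simp only [mem_filter, mem_sigma, mem_univ, true_and, mem_stripChains] at hz' ⊢
      obtain ⟨g1, g2⟩ := permNonneg_mul_swap hz'.1.1 hz'.1.2 hs
      refine ⟨⟨g1, g2⟩, fun hl => ?_⟩
      exact hl _ _ hs.1.1 (isSelected_chainFlip hz'.1.2 hs).1.2
    · intro z hz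
      have hs := (sel z hz).choose_spec
      have hz' := hz
      simp only [mem_filter, mem_sigma, mem_univ, true_and, mem_stripChains] at hz'
      obtain ⟨w, c⟩ := z
      generalize_proofs pf1 pf2 pf3 pf4 pf5 pf6 pf7
      obtain ⟨e1, e2⟩ := pf4.choose_spec.unique (isSelected_chainFlip hz'.1.2 hs)
      refine Sigma.ext ?_ ?_
      · simp only [e2]
        rw [mul_assoc, Equiv.swap_mul_self, mul_one]
      · simp only [e1, e2, heq_eq_eq]
        exact chainFlip_chainFlip hz'.1.2 hs
  rw [h2, add_zero]
  refine sum_bij' (fun z _ => z.2) (fun c _ => ⟨1, c⟩) ?_ ?_ ?_ ?_ ?_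
  · intro z hz
    simp only [mem_filter, mem_sigma, mem_univ, true_and, mem_stripChains] at hz ⊢
    have := eq_one_of_lattice hv hz.1.1 hz.1.2 hz.2
    rw [this, permContent_one hvm] at hz
    exact ⟨hz.1.2, hz.2⟩
  · intro c hc
    simp only [mem_filter, mem_sigma, mem_univ, true_and, mem_stripChains] at hc ⊢
    rw [permContent_one hvm]
    exact ⟨⟨fun r => by simp, hc.1⟩, hc.2⟩
  · rintro ⟨w, c⟩ hz
    simp only [mem_filter, mem_sigma, mem_univ, true_and, mem_stripChains] at hz ⊢
    rw [eq_one_of_lattice hv hz.1.1 hz.1.2 hz.2]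
  · intro c hc
    rfl
  · rintro ⟨w, c⟩ hz
    simp only [mem_filter, mem_sigma, mem_univ, true_and, mem_stripChains] at hz ⊢
    rw [eq_one_of_lattice hv hz.1.1 hz.1.2 hz.2]
    simp

end JacobiTrudi

end Involution

section LittlewoodRichardson

open Finset

section

variable {R : Type*} [CommRing R] (x : ℕ → R)

theorem schurS_zero (n : ℕ) : schurS x n 0 0 = 1 := by
  classical
  induction n with
  | zero => simp [schurS]
  | succ n ih => simp [schurS, partsOf_zero, filter_singleton, HStrip, ih]

theorem latticeChain_zero_unique {m : ℕ} {v : ℕ → ℕ} {c : ℕ → ℕ → ℕ}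
    (hc : IsStripChain m 0 v 0 c) (hl : IsLatticeChain m c) :
    ∀ r ≤ m, c r = fun i => if i < r then v i else 0 := by
  have h0 : ∀ r ≤ m, ∀ i, r ≤ i → c r i = 0 := by
    intro r
    induction r with
    | zero => intro _ i _; rw [hc.1]; rfl
    | succ r ih =>
      intro hr i hi
      obtain ⟨i, rfl⟩ : ∃ i', i = i' + 1 := ⟨i - 1, by omega⟩
      have := (hc.2.2.1 r (by omega) i).2
      have := ih (by omega) i (by omega)
      omega
  have hmono : ∀ r, r < m → ∀ i, c r i ≤ c (r + 1) i := fun r hr i => (hc.2.2.1 r hr i).1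
  have h1 : ∀ i, ∀ r, i ≤ r → r + 1 < m → c (r + 2) i = c (r + 1) i := by
    intro i
    induction i using Nat.strong_induction_on with
    | _ i ih =>
      intro r hir hr
      have h2 := hl i r hr
      unfold LatticeFails at h2
      have e1 : ∑ k ∈ range i, c (r + 1) k = ∑ k ∈ range i, c r k := by
        refine sum_congr rfl fun k hk => ?_
        have hk' := mem_range.1 hk
        obtain ⟨s, rfl⟩ : ∃ s, r = s + 1 := ⟨r - 1, by omega⟩
        exact ih k hk' s (by omega) (by omega)
      have e2 : ∑ k ∈ range i, c (r + 1) k ≤ ∑ k ∈ range i, c (r + 2) k :=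
        sum_le_sum fun k _ => hmono (r + 1) hr k
      rw [sum_range_succ, sum_range_succ] at h2
      have := hmono (r + 1) hr i
      rw [show r + 1 + 1 = r + 2 from rfl] at this
      omega
  have h2 : ∀ r, r < m → ∀ i < r, c (r + 1) i = c r i := by
    intro r hr i hi
    obtain ⟨s, rfl⟩ : ∃ s, r = s + 1 := ⟨r - 1, by omega⟩
    exact h1 i s (by omega) hr
  have h3 : ∀ r ≤ m, ∑ k ∈ range r, c r k = ∑ k ∈ range r, v k := by
    intro r hr
    have := sum_range_partsOf (hc.2.1 r hr) (h0 r hr)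
    rw [this, zero_add]
  intro r
  induction r with
  | zero => intro _; rw [hc.1]; funext i; simp
  | succ r ih =>
    intro hr
    funext i
    have ih' := ih (by omega)
    rcases lt_trichotomy i r with h | h | h
    · rw [h2 r (by omega) i h, ih']
      beta_reduce
      rw [if_pos h, if_pos (by omega)]
    · subst h
      have e1 := h3 (i + 1) hr
      have e2 := h3 i (by omega)
      have e3 : ∑ k ∈ range i, c (i + 1) k = ∑ k ∈ range i, c i k :=
        sum_congr rfl fun k hk => h2 i (by omega) k (mem_range.1 hk)
      rw [sum_range_succ, sum_range_succ] at e1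
      rw [if_pos (by omega)]
      omega
    · rw [h0 (r + 1) hr i (by omega), if_neg (by omega)]

theorem latticeChain_zero_exists {m e : ℕ} {v : ℕ → ℕ} (hv : v ∈ partsOf e)
    (hvm : ∀ r, m ≤ r → v r = 0) :
    IsStripChain m 0 v 0 (fun r i => if i < r then v i else 0) ∧
    IsLatticeChain m (fun r i => if i < r then v i else 0) := by
  have hanti := (mem_partsOf.1 hv).1
  have hsum : ∀ j r, ∑ k ∈ range j, (if k < r then v k else 0) =
      ∑ k ∈ range (min j r), v k := by
    intro j r
    rw [← sum_filter]
    congr 1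
    ext k
    simp
  refine ⟨⟨by funext i; simp, ?_, ?_, ?_⟩, ?_⟩
  · intro r _
    refine (mem_partsOf_iff (L := r) fun i hi => ?_).2 ⟨?_, ?_⟩
    · simp [show ¬ i < r by omega]
    · intro i j hij
      simp only
      split_ifs with h1 h2
      · exact hanti hij
      · omega
      · omega
      · rfl
    · rw [hsum, min_self, zero_add]
  · intro r _ i
    have := hanti (Nat.le_succ i)
    simp only
    split_ifs <;> refine ⟨?_, ?_⟩ <;> omega
  · intro r hr
    funext i
    by_cases h : i < m
    · simp [h, show i < r by omega]
    · simp [h, hvm i (by omega)]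
  · intro i r hr
    unfold LatticeFails
    rw [hsum, hsum, hsum, hsum]
    rcases Nat.lt_or_ge i (r + 1) with h | h
    · rw [min_eq_left (by omega), min_eq_left (by omega), min_eq_left (by omega),
        min_eq_left (by omega)]
      omega
    · rw [min_eq_right (show r ≤ i by omega), min_eq_right (show r + 1 ≤ i by omega),
        min_eq_right (show r + 1 ≤ i + 1 by omega), min_eq_right (show r + 2 ≤ i + 1 by omega),
        sum_range_succ _ (r + 1), sum_range_succ _ r]
      have := hanti (Nat.le_succ r)
      simp only [Nat.succ_eq_add_one] at this
      omega

theorem jacobiTrudi_eq_schurS (n : ℕ) {m e : ℕ} {v : ℕ → ℕ} (hv : v ∈ partsOf e)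
    (hvm : ∀ r, m ≤ r → v r = 0) : jacobiTrudi x n m v = schurS x n e v := by
  classical
  have h := jacobiTrudi_mul_schurS x n 0 (u := 0) (m := m) (by simp [partsOf_zero])
    (mem_partsOf.1 hv).1 hvm
  rw [schurS_zero, mul_one, zero_add, sum_range_partsOf hv hvm] at h
  rw [h]
  obtain ⟨g1, g2⟩ := latticeChain_zero_exists hv hvm
  have hm : (fun i => if i < m then v i else 0) = v := by
    funext i
    by_cases h : i < m
    · simp [h]
    · simp [h, hvm i (by omega)]
  rw [sum_eq_single_of_mem (fun r i => if i < r then v i else 0)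
    (mem_filter.2 ⟨mem_stripChains.2 g1, g2⟩)]
  · beta_reduce
    rw [hm]
  intro c hc hne
  exfalso
  rw [mem_filter, mem_stripChains] at hc
  have hu := latticeChain_zero_unique hc.1 hc.2
  apply hne
  funext r
  rcases le_total r m with hr | hr
  · rw [hu r hr]
  · rw [hc.1.2.2.2 r hr, hu m le_rfl]
    exact (g1.2.2.2 r hr).symm

end

/-- The correspondence between tableaux and chains of partitions. -/
def TableauChain (c T : ℕ → ℕ → ℕ) : Prop :=
  ∀ i j r, T i j = r + 1 ↔ c r i ≤ j ∧ j < c (r + 1) i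

theorem ncard_sections (L : ℕ) (g : ℕ → Finset ℕ) :
    Set.ncard {p : ℕ × ℕ | p.1 < L ∧ p.2 ∈ g p.1} = ∑ i ∈ range L, (g i).card := by
  classical
  have : {p : ℕ × ℕ | p.1 < L ∧ p.2 ∈ g p.1} =
      (((range L).sigma g).map (Equiv.sigmaEquivProd ℕ ℕ).toEmbedding : Finset (ℕ × ℕ)) := by
    ext ⟨i, j⟩
    simp
  rw [this, Set.ncard_coe_finset, card_map, card_sigma]

section

variable {m : ℕ} {l u v : ℕ → ℕ} {c T : ℕ → ℕ → ℕ}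

theorem TableauChain.le_iff (h : TableauChain c T) (h0 : c 0 = u)
    (hm : ∀ r i, c r i ≤ c (r + 1) i) (hl : ∀ r, m ≤ r → c r = l) {i j r : ℕ}
    (hs : InSkew l u i j) : 1 ≤ T i j ∧ (T i j ≤ r ↔ j < c r i) := by
  have hmono : ∀ i, Monotone fun r => c r i := fun i => monotone_nat_of_le_succ fun r => hm r i
  have h1 : 1 ≤ T i j := by
    classical
    have hex : ∃ r, j < c r i := ⟨m, by rw [hl m le_rfl]; exact hs.2⟩
    have hne : Nat.find hex ≠ 0 := fun h0' => by
      have := Nat.find_spec hex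
      rw [h0', h0] at this
      have := hs.1
      omega
    obtain ⟨s, hs'⟩ : ∃ s, Nat.find hex = s + 1 := ⟨Nat.find hex - 1, by omega⟩
    have := (h i j s).2 ⟨by have := Nat.find_min hex (show s < _ by omega); omega,
      by rw [← hs']; exact Nat.find_spec hex⟩
    omega
  refine ⟨h1, ?_⟩
  obtain ⟨s, hs'⟩ : ∃ s, T i j = s + 1 := ⟨T i j - 1, by omega⟩
  have h2 := (h i j s).1 hs'
  constructor
  · intro hr
    exact h2.2.trans_le (hmono i (show s + 1 ≤ r by omega))
  · intro hr
    by_contra hcon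
    have := hmono i (show r ≤ s by omega)
    simp only at this
    omega

theorem TableauChain.ne_zero_iff (h : TableauChain c T) (h0 : c 0 = u)
    (hm : ∀ r i, c r i ≤ c (r + 1) i) (hl : ∀ r, m ≤ r → c r = l) (i j : ℕ) :
    T i j ≠ 0 ↔ InSkew l u i j := by
  have hmono : ∀ i, Monotone fun r => c r i := fun i => monotone_nat_of_le_succ fun r => hm r i
  constructor
  · intro hne
    obtain ⟨s, hs'⟩ : ∃ s, T i j = s + 1 := ⟨T i j - 1, by omega⟩
    have h2 := (h i j s).1 hs'
    refine ⟨?_, ?_⟩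
    · rw [← h0]; exact (hmono i (Nat.zero_le s)).trans h2.1
    · rw [← hl (max m (s + 1)) (le_max_left _ _)]
      exact h2.2.trans_le (hmono i (le_max_right _ _))
  · intro hs
    have := (h.le_iff h0 hm hl (r := 0) hs).1
    omega

theorem TableauChain.ncard_eq (h : TableauChain c T) (h0 : c 0 = u)
    (hm : ∀ r i, c r i ≤ c (r + 1) i) (hl : ∀ r, m ≤ r → c r = l) {L : ℕ}
    (hL : ∀ i, L ≤ i → l i = 0) (r : ℕ) :
    Set.ncard {p : ℕ × ℕ | T p.1 p.2 = r + 1} + ∑ i ∈ range L, c r i =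
      ∑ i ∈ range L, c (r + 1) i := by
  have : {p : ℕ × ℕ | T p.1 p.2 = r + 1} =
      {p : ℕ × ℕ | p.1 < L ∧ p.2 ∈ Ico (c r p.1) (c (r + 1) p.1)} := by
    ext ⟨i, j⟩
    simp only [Set.mem_ofPred_eq, mem_Ico]
    rw [h i j r]
    refine ⟨fun hh => ⟨?_, hh⟩, fun hh => hh.2⟩
    by_contra hi
    have h1 := (h.ne_zero_iff h0 hm hl i j).1 (by rw [(h i j r).2 hh]; omega)
    have := hL i (by omega)
    have := h1.2
    omega
  rw [this, ncard_sections L fun i => Ico (c r i) (c (r + 1) i), ← sum_add_distrib]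
  refine sum_congr rfl fun i _ => ?_
  rw [Nat.card_Ico]
  have := hm r i
  omega

theorem TableauChain.ncard_row_eq (h : TableauChain c T) (i j r : ℕ) :
    Set.ncard {p : ℕ × ℕ | (p.1 < i ∨ (p.1 = i ∧ j ≤ p.2)) ∧ T p.1 p.2 = r + 1} =
      ∑ k ∈ range i, (c (r + 1) k - c r k) + (c (r + 1) i - max j (c r i)) := by
  have : {p : ℕ × ℕ | (p.1 < i ∨ (p.1 = i ∧ j ≤ p.2)) ∧ T p.1 p.2 = r + 1} =
      {p : ℕ × ℕ | p.1 < i + 1 ∧ p.2 ∈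
        (fun k => if k = i then Ico (max j (c r i)) (c (r + 1) i)
          else Ico (c r k) (c (r + 1) k)) p.1} := by
    ext ⟨k, q⟩
    simp only [Set.mem_ofPred_eq]
    rw [h k q r]
    by_cases hk : k = i
    · subst hk; simp; omega
    · have hk' : k < i + 1 ↔ k < i := by omega
      simp only [hk, if_false, mem_Ico, false_and, or_false, hk']
  rw [this, ncard_sections (i + 1) fun k => if k = i then Ico (max j (c r i)) (c (r + 1) i)
    else Ico (c r k) (c (r + 1) k), sum_range_succ]
  congr 1
  · refine sum_congr rfl fun k hk => ?_
    have : k ≠ i := by have := mem_range.1 hk; omega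
    simp [this]
  · simp

theorem TableauChain.isLRTableau_iff (h : TableauChain c T) (h0 : c 0 = u)
    (hm : ∀ r i, c r i ≤ c (r + 1) i) (hl : ∀ r, m ≤ r → c r = l) {L : ℕ}
    (hL : ∀ i, L ≤ i → l i = 0) (hla : Antitone l) (hua : Antitone u) :
    IsLRTableau l u v T ↔ (∀ r, HStrip (c r) (c (r + 1))) ∧
      (∀ r, v r + ∑ i ∈ range L, c r i = ∑ i ∈ range L, c (r + 1) i) ∧
      ∀ i r, ¬ LatticeFails c i r := by
  have hmono : ∀ i, Monotone fun r => c r i := fun i => monotone_nat_of_le_succ fun r => hm r i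
  have hsub : ∀ r j, ∑ k ∈ range j, (c (r + 1) k - c r k) + ∑ k ∈ range j, c r k =
      ∑ k ∈ range j, c (r + 1) k := by
    intro r j
    rw [← sum_add_distrib]
    exact sum_congr rfl fun k _ => by have := hm r k; omega
  have hlat : (∀ i j r, Set.ncard
      {p : ℕ × ℕ | (p.1 < i ∨ (p.1 = i ∧ j ≤ p.2)) ∧ T p.1 p.2 = r + 2} ≤
      Set.ncard {p : ℕ × ℕ | (p.1 < i ∨ (p.1 = i ∧ j ≤ p.2)) ∧ T p.1 p.2 = r + 1}) ↔
      ∀ i r, ¬ LatticeFails c i r := by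
    have hF : ∀ i r, ¬ LatticeFails c i r ↔
        ∑ k ∈ range i, (c (r + 2) k - c (r + 1) k) + (c (r + 2) i - c (r + 1) i) ≤
        ∑ k ∈ range i, (c (r + 1) k - c r k) := by
      intro i r
      unfold LatticeFails
      rw [sum_range_succ, sum_range_succ]
      have := hsub r i
      have e := hsub (r + 1) i
      rw [show r + 1 + 1 = r + 2 from rfl] at e
      have := hm (r + 1) i
      rw [show r + 1 + 1 = r + 2 from rfl] at this
      omega
    simp only [hF]
    have e2 : ∀ i j r, Set.ncard
      {p : ℕ × ℕ | (p.1 < i ∨ (p.1 = i ∧ j ≤ p.2)) ∧ T p.1 p.2 = r + 2} =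
      ∑ k ∈ range i, (c (r + 2) k - c (r + 1) k) + (c (r + 2) i - max j (c (r + 1) i)) :=
      fun i j r => h.ncard_row_eq i j (r + 1)
    simp only [e2, h.ncard_row_eq]
    constructor
    · intro hh i r
      have := hh i (c (r + 1) i) r
      have := hm r i
      omega
    · intro hh i j r
      have := hh i r
      omega
  constructor
  · rintro ⟨-, -, -, p4, p5, p6⟩
    refine ⟨fun r i => ⟨hm r i, ?_⟩, fun r => ?_, hlat.1 p6⟩
    · by_contra hcon
      have b1 : u i ≤ c r i := by rw [← h0]; exact hmono i (Nat.zero_le r)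
      have b2 : c (r + 1) (i + 1) ≤ l (i + 1) := by
        rw [← hl (max m (r + 1)) (le_max_left _ _)]
        exact hmono (i + 1) (le_max_right _ _)
      have b3 := hla (Nat.le_succ i)
      have b4 := hua (Nat.le_succ i)
      simp only [Nat.succ_eq_add_one] at b3 b4
      have s1 : InSkew l u i (c r i) := ⟨b1, by omega⟩
      have s2 : InSkew l u (i + 1) (c r i) := ⟨by omega, by omega⟩
      have t1 := p4 i (i + 1) (c r i) s1 s2 (by omega)
      have t2 := (h.le_iff h0 hm hl (r := r) s1).2
      have t3 := (h.le_iff h0 hm hl (r := r + 1) s2).2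
      omega
    · rw [← p5 r]; exact h.ncard_eq h0 hm hl hL r
  · rintro ⟨q1, q2, q3⟩
    refine ⟨?_, h.ne_zero_iff h0 hm hl, ?_, ?_, ?_, hlat.2 q3⟩
    · intro i
      rw [← h0, ← hl m le_rfl]
      exact hmono i (Nat.zero_le m)
    · intro i j k s1 s2 hjk
      have t2 := (h.le_iff h0 hm hl (r := T i k) s1).2
      have t3 := (h.le_iff h0 hm hl (r := T i k) s2).2
      omega
    · intro i k j s1 s2 hik
      obtain ⟨s, hs⟩ : ∃ s, T k j = s + 1 :=
        ⟨T k j - 1, by have := (h.le_iff h0 hm hl (r := 0) s2).1; omega⟩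
      have t1 := ((h k j s).1 hs).2
      have t2 := (h.le_iff h0 hm hl (r := s) s1).2
      have t3 := (q1 s i).2
      have t4 := (q1 (s + 1)).antitone_left (show i + 1 ≤ k by omega)
      omega
    · intro r
      have := h.ncard_eq h0 hm hl hL r
      have := q2 r
      omega

/-- The tableau of a chain. -/
def chainTableau (m : ℕ) (c : ℕ → ℕ → ℕ) (i j : ℕ) : ℕ :=
  if c 0 i ≤ j ∧ j < c m i then ((range m).filter fun r => c r i ≤ j).card else 0

theorem tableauChain_chainTableau (hm : ∀ r i, c r i ≤ c (r + 1) i)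
    (hl : ∀ r, m ≤ r → c r = c m) : TableauChain c (chainTableau m c) := by
  classical
  have hmono : ∀ i, Monotone fun r => c r i := fun i => monotone_nat_of_le_succ fun r => hm r i
  have key : ∀ i j r, c r i ≤ j ∧ j < c (r + 1) i → chainTableau m c i j = r + 1 := by
    rintro i j r ⟨h1, h2⟩
    have hr : r < m := by
      by_contra hcon
      rw [hl r (by omega)] at h1
      rw [hl (r + 1) (by omega)] at h2
      omega
    have hs : c 0 i ≤ j ∧ j < c m i :=
      ⟨(hmono i (Nat.zero_le r)).trans h1, h2.trans_le (hmono i (show r + 1 ≤ m from hr))⟩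
    rw [chainTableau, if_pos hs]
    have : (range m).filter (fun r => c r i ≤ j) = range (r + 1) := by
      ext s
      simp only [mem_filter, mem_range]
      constructor
      · rintro ⟨-, h3⟩
        by_contra hcon
        have := hmono i (show r + 1 ≤ s by omega)
        simp only at this
        omega
      · intro h3
        exact ⟨by omega, (hmono i (show s ≤ r by omega)).trans h1⟩
    rw [this, card_range]
  intro i j r
  refine ⟨fun h => ?_, key i j r⟩
  have hs : c 0 i ≤ j ∧ j < c m i := by
    by_contra hcon
    rw [chainTableau, if_neg hcon] at h
    omega
  have hex : ∃ r, j < c r i := ⟨m, hs.2⟩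
  have hne : Nat.find hex ≠ 0 := fun h0' => by
    have := Nat.find_spec hex
    rw [h0'] at this
    omega
  obtain ⟨s, hs'⟩ : ∃ s, Nat.find hex = s + 1 := ⟨Nat.find hex - 1, by omega⟩
  have h3 : c s i ≤ j ∧ j < c (s + 1) i := by
    refine ⟨by have := Nat.find_min hex (show s < _ by omega); omega, ?_⟩
    rw [← hs']; exact Nat.find_spec hex
  have := key i j s h3
  obtain rfl : r = s := by omega
  exact h3

/-- The chain of a tableau. -/
def tableauChain (l u : ℕ → ℕ) (T : ℕ → ℕ → ℕ) (r i : ℕ) : ℕ :=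
  u i + ((Ico (u i) (l i)).filter fun j => T i j ≤ r).card

theorem lt_tableauChain_iff
    (hT : ∀ i j k, InSkew l u i j → InSkew l u i k → j ≤ k → T i j ≤ T i k) {i j r : ℕ}
    (hs : InSkew l u i j) : j < tableauChain l u T r i ↔ T i j ≤ r := by
  unfold tableauChain
  constructor
  · intro h
    by_contra hcon
    have : (Ico (u i) (l i)).filter (fun j => T i j ≤ r) ⊆ Ico (u i) j := by
      intro k hk
      simp only [mem_filter, mem_Ico] at hk ⊢
      refine ⟨hk.1.1, ?_⟩
      by_contra hjk
      have := hT i j k hs hk.1 (by omega)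
      omega
    have := card_le_card this
    rw [Nat.card_Ico] at this
    have := hs.1
    omega
  · intro h
    have : Ico (u i) (j + 1) ⊆ (Ico (u i) (l i)).filter (fun j => T i j ≤ r) := by
      intro k hk
      simp only [mem_filter, mem_Ico] at hk ⊢
      have h1 : InSkew l u i k := ⟨hk.1, by have := hs.2; omega⟩
      exact ⟨h1, (hT i k j h1 hs (by omega)).trans h⟩
    have := card_le_card this
    rw [Nat.card_Ico] at this
    have := hs.1
    omega

theorem tableauChain_facts (hT : IsLRTableau l u v T) (hv : ∀ r, m ≤ r → v r = 0) {L : ℕ}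
    (hL : ∀ i, L ≤ i → l i = 0) :
    TableauChain (tableauChain l u T) T ∧ tableauChain l u T 0 = u ∧
    (∀ r i, tableauChain l u T r i ≤ tableauChain l u T (r + 1) i) ∧
    ∀ r, m ≤ r → tableauChain l u T r = l := by
  obtain ⟨p1, p2, p3, -, p5, -⟩ := hT
  have hbd : ∀ r i, tableauChain l u T r i ≤ l i := by
    intro r i
    have := card_le_card (filter_subset (fun j => T i j ≤ r) (Ico (u i) (l i)))
    rw [Nat.card_Ico] at this
    have := p1 i
    unfold tableauChain
    omega
  have h0 : ∀ r i, u i ≤ tableauChain l u T r i := fun r i => Nat.le_add_right _ _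
  have hmono : ∀ r i, tableauChain l u T r i ≤ tableauChain l u T (r + 1) i := by
    intro r i
    refine Nat.add_le_add_left (card_le_card fun j hj => ?_) _
    simp only [mem_filter] at hj ⊢
    exact ⟨hj.1, by omega⟩
  have hle : ∀ i j, T i j ≤ m := by
    intro i j
    by_contra hcon
    obtain ⟨s, hs⟩ : ∃ s, T i j = s + 1 := ⟨T i j - 1, by omega⟩
    have h1 := p5 s
    rw [hv s (by omega)] at h1
    have hfin : {p : ℕ × ℕ | T p.1 p.2 = s + 1}.Finite := by
      refine ((range L ×ˢ range (∑ i ∈ range L, l i)).finite_toSet).subset ?_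
      rintro ⟨a, b⟩ hab
      simp only [Set.mem_ofPred_eq] at hab
      have h2 := (p2 a b).1 (by omega)
      have h3 : a < L := by
        by_contra ha
        have := hL a (by omega)
        have := h2.2
        omega
      have := single_le_sum (f := l) (fun _ _ => Nat.zero_le _) (mem_range.2 h3)
      have := h2.2
      simp only [coe_product, Set.mem_prod, mem_coe, mem_range]
      omega
    rw [Set.ncard_eq_zero hfin] at h1
    have : ((i, j) : ℕ × ℕ) ∈ {p : ℕ × ℕ | T p.1 p.2 = s + 1} := hs
    rw [h1] at this
    exact this
  refine ⟨?_, ?_, hmono, ?_⟩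
  · intro i j r
    constructor
    · intro h
      have hs := (p2 i j).1 (by omega)
      have h1 := lt_tableauChain_iff p3 (r := r) hs
      have h2 := lt_tableauChain_iff p3 (r := r + 1) hs
      omega
    · rintro ⟨h1, h2⟩
      have hs : InSkew l u i j := ⟨(h0 r i).trans h1, h2.trans_le (hbd _ _)⟩
      have h1 := lt_tableauChain_iff p3 (r := r) hs
      have h2 := lt_tableauChain_iff p3 (r := r + 1) hs
      omega
  · funext i
    simp only [tableauChain, add_eq_left, card_eq_zero]
    ext j
    simp only [mem_filter, mem_Ico, notMem_empty, iff_false, not_and]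
    intro hs
    have := (p2 i j).2 hs
    omega
  · intro r hr
    funext i
    have : (Ico (u i) (l i)).filter (fun j => T i j ≤ r) = Ico (u i) (l i) :=
      filter_true_of_mem fun j _ => (hle i j).trans hr
    rw [tableauChain, this, Nat.card_Ico]
    have := p1 i
    omega

theorem TableauChain.chain_unique {c' : ℕ → ℕ → ℕ} (h : TableauChain c T)
    (h' : TableauChain c' T) (h0 : c 0 = c' 0) (hm : ∀ r i, c r i ≤ c (r + 1) i)
    (hm' : ∀ r i, c' r i ≤ c' (r + 1) i) : c = c' := by
  funext r
  induction r with
  | zero => exact h0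
  | succ r ih =>
    funext i
    have hi := congrFun ih i
    have h1 := hm r i
    have h2 := hm' r i
    have key := fun j => (h i j r).symm.trans (h' i j r)
    by_contra hne
    rcases Nat.lt_or_ge (c (r + 1) i) (c' (r + 1) i) with hlt | hge
    · have := (key (c (r + 1) i)).2 ⟨by omega, hlt⟩
      omega
    · have := (key (c' (r + 1) i)).1 ⟨by omega, by omega⟩
      omega

theorem size_eq_of_isLRTableau (hT : IsLRTableau l u v T) (hla : Antitone l) (hua : Antitone u)
    (hv : ∀ r, m ≤ r → v r = 0) {L : ℕ} (hL : ∀ i, L ≤ i → l i = 0) :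
    ∑ i ∈ range L, l i = ∑ i ∈ range L, u i + ∑ r ∈ range m, v r := by
  obtain ⟨h1, h2, h3, h4⟩ := tableauChain_facts hT hv hL
  have h5 := ((h1.isLRTableau_iff h2 h3 h4 hL hla hua).1 hT).2.1
  have h6 : ∀ r, ∑ i ∈ range L, tableauChain l u T r i =
      ∑ i ∈ range L, u i + ∑ r ∈ range r, v r := by
    intro r
    induction r with
    | zero => rw [h2]; simp
    | succ r ih => rw [← h5 r, ih, sum_range_succ]; ring
  rw [← h6 m, h4 m le_rfl]

open Classical in
theorem lrCoeff_eq_card {d e : ℕ} (hu : u ∈ partsOf d) (hv : v ∈ partsOf e)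
    (hvm : ∀ r, m ≤ r → v r = 0) (hl : l ∈ partsOf (d + e)) :
    lrCoeff l u v = ((stripChains m d v u).filter
      fun c => IsLatticeChain m c ∧ c m = l).card := by
  rw [lrCoeff, ← Set.ncard_coe_finset]
  symm
  have hL := (mem_partsOf.1 hl).2.1
  have hla := (mem_partsOf.1 hl).1
  have hua := (mem_partsOf.1 hu).1
  have base : ∀ c ∈ (((stripChains m d v u).filter
      fun c => IsLatticeChain m c ∧ c m = l : Finset _) : Set (ℕ → ℕ → ℕ)),
      c 0 = u ∧ (∀ r i, c r i ≤ c (r + 1) i) ∧ (∀ r, m ≤ r → c r = l) ∧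
      (∀ r, HStrip (c r) (c (r + 1))) ∧
      (∀ r, v r + ∑ i ∈ range (d + e), c r i = ∑ i ∈ range (d + e), c (r + 1) i) ∧
      ∀ i r, ¬ LatticeFails c i r := by
    intro c hc
    simp only [coe_filter, Set.mem_ofPred_eq, mem_stripChains] at hc
    obtain ⟨h1, h2, h3⟩ := hc
    have h4 : ∀ r, m ≤ r → c r = l := fun r hr => by rw [h1.2.2.2 r hr, h3]
    have h5 : ∀ r, HStrip (c r) (c (r + 1)) := by
      intro r
      by_cases hr : r < m
      · exact h1.2.2.1 r hr
      · rw [h4 r (by omega), h4 (r + 1) (by omega)]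
        exact fun i => ⟨le_rfl, hla (Nat.le_succ i)⟩
    have hsum : d + ∑ i ∈ range m, v i = d + e := by rw [sum_range_partsOf hv hvm]
    refine ⟨h1.1, fun r i => (h5 r i).1, h4, h5, ?_, ?_⟩
    · intro r
      by_cases hr : r < m
      · rw [sum_range_stripChain h1 (s := r) (by omega) hsum.le,
          sum_range_stripChain h1 (s := r + 1) (by omega) hsum.le, sum_range_succ]
        omega
      · rw [h4 r (by omega), h4 (r + 1) (by omega), hvm r (by omega), zero_add]
    · intro i r
      by_cases hr : r + 1 < m
      · exact h2 i r hr
      · unfold LatticeFails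
        rw [h4 (r + 1) (by omega), h4 (r + 2) (by omega), sum_range_succ]
        have : ∑ k ∈ range i, c r k ≤ ∑ k ∈ range i, l k :=
          sum_le_sum fun k _ => by rw [← h4 (r + 1) (by omega)]; exact (h5 r k).1
        omega
  refine Set.ncard_congr (fun c _ => chainTableau m c) ?_ ?_ ?_
  · intro c hc
    obtain ⟨b1, b2, b3, b4, b5, b6⟩ := base c hc
    have ht := tableauChain_chainTableau (m := m) b2 fun r hr => by rw [b3 r hr, b3 m le_rfl]
    exact (ht.isLRTableau_iff b1 b2 b3 hL hla hua).2 ⟨b4, b5, b6⟩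
  · intro c c' hc hc' heq
    obtain ⟨b1, b2, b3, -⟩ := base c hc
    obtain ⟨b1', b2', b3', -⟩ := base c' hc'
    have ht := tableauChain_chainTableau (m := m) b2 fun r hr => by rw [b3 r hr, b3 m le_rfl]
    have ht' := tableauChain_chainTableau (m := m) b2' fun r hr => by rw [b3' r hr, b3' m le_rfl]
    rw [← heq] at ht'
    exact ht.chain_unique ht' (by rw [b1, b1']) b2 b2'
  · intro T hT
    obtain ⟨h1, h2, h3, h4⟩ := tableauChain_facts hT hvm hL
    obtain ⟨h5, h6, h7⟩ := (h1.isLRTableau_iff h2 h3 h4 hL hla hua).1 hT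
    have h8 : ∀ r, ∑ i ∈ range (d + e), tableauChain l u T r i = d + ∑ r ∈ range r, v r := by
      intro r
      induction r with
      | zero =>
        rw [h2, sum_range_partsOf hu fun i hi => (mem_partsOf.1 hu).2.1 i (by omega)]; simp
      | succ r ih => rw [← h6 r, ih, sum_range_succ]; ring
    have h9 : tableauChain l u T ∈ (((stripChains m d v u).filter
        fun c => IsLatticeChain m c ∧ c m = l : Finset _) : Set (ℕ → ℕ → ℕ)) := by
      simp only [coe_filter, Set.mem_ofPred_eq, mem_stripChains]
      refine ⟨⟨h2, ?_, fun r _ => h5 r, fun r hr => by rw [h4 r hr, h4 m le_rfl]⟩,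
        fun i r _ => h7 i r, h4 m le_rfl⟩
      intro r hr
      refine (mem_partsOf_iff (L := d + e) fun i hi => ?_).2 ⟨(h5 r).antitone_left, h8 r⟩
      have := monotone_nat_of_le_succ (f := fun r => tableauChain l u T r i)
        (fun r => h3 r i) hr
      simp only [h4 m le_rfl, hL i hi] at this
      omega
    refine ⟨_, h9, ?_⟩
    have ht := tableauChain_chainTableau (m := m) h3 fun r hr => by rw [h4 r hr, h4 m le_rfl]
    funext i j
    rcases Nat.eq_zero_or_pos (T i j) with h | h
    · by_contra hne
      obtain ⟨s, hs⟩ : ∃ s, chainTableau m (tableauChain l u T) i j = s + 1 :=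
        ⟨chainTableau m (tableauChain l u T) i j - 1, by omega⟩
      have := (h1 i j s).2 ((ht i j s).1 hs)
      omega
    · obtain ⟨s, hs⟩ : ∃ s, T i j = s + 1 := ⟨T i j - 1, by omega⟩
      rw [hs]
      exact (ht i j s).2 ((h1 i j s).1 hs)

end

theorem schurS_mul_schurS {R : Type*} [CommRing R] (x : ℕ → R) (n : ℕ) {d e : ℕ} {u v : ℕ → ℕ}
    (hu : u ∈ partsOf d) (hv : v ∈ partsOf e) :
    schurS x n d u * schurS x n e v =
      ∑ l ∈ partsOf (d + e), (lrCoeff l u v : R) * schurS x n (d + e) l := by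
  classical
  have hvm := (mem_partsOf.1 hv).2.1
  have hsum : d + ∑ r ∈ range e, v r = d + e := by rw [(mem_partsOf.1 hv).2.2]
  rw [mul_comm, ← jacobiTrudi_eq_schurS x n hv hvm,
    jacobiTrudi_mul_schurS x n d hu (mem_partsOf.1 hv).1 hvm, hsum,
    ← sum_fiberwise_of_maps_to (t := partsOf (d + e)) (g := fun c => c e)]
  · refine sum_congr rfl fun l hl => ?_
    rw [lrCoeff_eq_card hu hv hvm hl, filter_filter, ← nsmul_eq_mul, ← sum_const]
    refine sum_congr (by congr!) fun c hc => ?_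
    rw [(mem_filter.1 hc).2.2]
  · intro c hc
    rw [mem_filter, mem_stripChains] at hc
    have := hc.1.2.1 e le_rfl
    rwa [hsum] at this

end LittlewoodRichardson

section Kostka

open Finset

variable {R : Type*} [CommRing R] (x : ℕ → R)

theorem sum_piAntidiag_range_succ {M : Type*} [AddCommMonoid M] (m d : ℕ) (F : (ℕ → ℕ) → M) :
    ∑ a ∈ piAntidiag (range (m + 1)) d, F a =
      ∑ p ∈ antidiagonal d, ∑ a ∈ piAntidiag (range m) p.1, F (Function.update a m p.2) := by
  classical
  have hz : ∀ {e : ℕ} {a : ℕ → ℕ}, a ∈ piAntidiag (range m) e → a m = 0 := by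
    intro e a ha
    by_contra h
    have := (mem_piAntidiag.1 ha).2 m h
    simp at this
  have hs : ∀ (a : ℕ → ℕ) (k : ℕ), ∑ i ∈ range m, Function.update a m k i =
      ∑ i ∈ range m, a i := fun a k => sum_congr rfl fun i hi =>
    Function.update_of_ne (by have := mem_range.1 hi; omega) _ _
  rw [sum_sigma']
  refine (sum_bij' (fun q _ => Function.update q.2 m q.1.2)
    (fun a _ => ⟨(∑ i ∈ range m, a i, a m), Function.update a m 0⟩) ?_ ?_ ?_ ?_ ?_).symm
  · rintro ⟨⟨e, k⟩, a⟩ h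
    simp only [mem_sigma, HasAntidiagonal.mem_antidiagonal] at h
    rw [mem_piAntidiag, sum_range_succ, hs, (mem_piAntidiag.1 h.2).1, Function.update_self]
    refine ⟨h.1, fun i hi => ?_⟩
    by_cases him : i = m
    · simp [him]
    · rw [Function.update_of_ne him] at hi
      have := mem_range.1 ((mem_piAntidiag.1 h.2).2 i hi)
      exact mem_range.2 (by omega)
  · intro a ha
    rw [mem_piAntidiag, sum_range_succ] at ha
    simp only [mem_sigma, HasAntidiagonal.mem_antidiagonal, mem_piAntidiag, hs]
    refine ⟨ha.1, trivial, fun i hi => ?_⟩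
    by_cases him : i = m
    · simp [him] at hi
    · rw [Function.update_of_ne him] at hi
      have := mem_range.1 (ha.2 i hi)
      exact mem_range.2 (by omega)
  · rintro ⟨⟨e, k⟩, a⟩ h
    simp only [mem_sigma, HasAntidiagonal.mem_antidiagonal] at h
    have h1 : Function.update (Function.update a m k) m 0 = a := by
      rw [Function.update_idem, ← hz h.2, Function.update_eq_self]
    simp only [hs, (mem_piAntidiag.1 h.2).1, Function.update_self, h1]
  · intro a _
    simp
  · intro q _
    rfl

theorem compH_eq_sum (m k : ℕ) :
    compH x m k = ∑ a ∈ piAntidiag (range m) k, ∏ r ∈ range m, x r ^ a r := by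
  induction m generalizing k with
  | zero =>
    simp only [compH, range_zero, piAntidiag_empty, prod_empty]
    split_ifs <;> simp
  | succ m ih =>
    rw [compH, sum_piAntidiag_range_succ]
    refine sum_congr rfl fun p _ => ?_
    rw [ih, sum_mul]
    refine sum_congr rfl fun a _ => ?_
    rw [prod_range_succ, Function.update_self]
    congr 1
    exact prod_congr rfl fun r hr => by
      rw [Function.update_of_ne (by have := mem_range.1 hr; omega)]

open Classical in
/-- The Kostka number of a partition `l` with content `a`, in `m` letters. -/
def kost : ℕ → (ℕ → ℕ) → (ℕ → ℕ) → ℕ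
  | 0, _, l => if l = 0 then 1 else 0
  | m + 1, a, l => ∑ k ∈ partsOf (∑ r ∈ range m, a r) with HStrip k l, kost m a k

theorem kost_congr {m : ℕ} {a b l : ℕ → ℕ} (h : ∀ r < m, a r = b r) :
    kost m a l = kost m b l := by
  induction m generalizing l with
  | zero => rfl
  | succ m ih =>
    rw [kost, kost, sum_congr rfl fun r hr => h r (by have := mem_range.1 hr; omega)]
    exact sum_congr rfl fun k _ => ih fun r hr => h r (by omega)

theorem prod_compH_eq_sum_kost (m n : ℕ) (a : ℕ → ℕ) :
    ∏ r ∈ range m, compH x n (a r) =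
      ∑ l ∈ partsOf (∑ r ∈ range m, a r), (kost m a l : R) *
        schurS x n (∑ r ∈ range m, a r) l := by
  classical
  induction m with
  | zero => simp [partsOf_zero, kost, schurS_zero]
  | succ m ih =>
    rw [prod_range_succ, ih, mul_comm, mul_sum, sum_range_succ]
    have : ∀ k ∈ partsOf (∑ r ∈ range m, a r), compH x n (a m) *
        ((kost m a k : R) * schurS x n (∑ r ∈ range m, a r) k) =
        ∑ u ∈ partsOf (∑ r ∈ range m, a r + a m), if HStrip k u then
          (kost m a k : R) * schurS x n (∑ r ∈ range m, a r + a m) u else 0 := by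
      intro k hk
      rw [mul_left_comm, pieri x n _ _ _ hk, mul_sum, sum_filter]
    rw [sum_congr rfl this, sum_comm]
    refine sum_congr rfl fun u _ => ?_
    rw [kost, Nat.cast_sum, sum_mul, sum_filter]

theorem schurS_eq_sum_kost (m d : ℕ) {l : ℕ → ℕ} (hl : l ∈ partsOf d) :
    schurS x m d l = ∑ a ∈ piAntidiag (range m) d, (kost m a l : R) * ∏ r ∈ range m, x r ^ a r := by
  classical
  induction m generalizing d l with
  | zero =>
    simp only [schurS, range_zero, piAntidiag_empty, prod_empty, kost]
    split_ifs with h1 h2 h2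
    · simp
    · subst h1
      rw [partsOf_zero, mem_singleton] at hl
      exact absurd hl h2
    · simp
    · simp
  | succ m ih =>
    rw [schurS, sum_piAntidiag_range_succ]
    refine sum_congr rfl fun p _ => ?_
    have h1 : ∀ k ∈ (partsOf p.1).filter fun k => HStrip k l, schurS x m p.1 k =
        ∑ a ∈ piAntidiag (range m) p.1, (kost m a k : R) * ∏ r ∈ range m, x r ^ a r :=
      fun k hk => ih p.1 (mem_filter.1 hk).1
    rw [sum_congr rfl h1, sum_comm, sum_mul]
    refine sum_congr rfl fun a ha => ?_
    have hu : ∀ r < m, Function.update a m p.2 r = a r := fun r hr =>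
      Function.update_of_ne (by omega) _ _
    have hs : ∑ r ∈ range m, Function.update a m p.2 r = p.1 := by
      rw [← (mem_piAntidiag.1 ha).1]
      exact sum_congr rfl fun r hr => hu r (mem_range.1 hr)
    have hp : ∏ r ∈ range m, x r ^ Function.update a m p.2 r = ∏ r ∈ range m, x r ^ a r :=
      prod_congr rfl fun r hr => by rw [hu r (mem_range.1 hr)]
    rw [kost, hs, prod_range_succ, Function.update_self, Nat.cast_sum, ← sum_mul, hp]
    simp only [kost_congr hu]
    ring

theorem kost_eq_zero_of_ne {m : ℕ} {a l : ℕ → ℕ} (hl : Antitone l) (hm : l m ≠ 0) :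
    kost m a l = 0 := by
  classical
  induction m generalizing l with
  | zero =>
    rw [kost, if_neg]
    rintro rfl
    exact hm rfl
  | succ m ih =>
    refine sum_eq_zero fun k hk => ?_
    have h := (mem_filter.1 hk).2
    exact ih h.antitone_left (by have := (h m).2; omega)

/-- The statistic measuring the triangularity of Kostka numbers. -/
theorem kost_dominance {m : ℕ} {a l : ℕ → ℕ} (h : kost m a l ≠ 0)
    (hl : l ∈ partsOf (∑ r ∈ range m, a r)) :
    ∀ s ≤ m, ∑ r ∈ range s, a r ≤ ∑ r ∈ range s, l r := by
  classical
  induction m generalizing l with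
  | zero =>
    intro s hs
    obtain rfl : s = 0 := by omega
    simp
  | succ m ih =>
    intro s hs
    obtain rfl | hs' := Nat.eq_or_lt_of_le hs
    · have hz : l (m + 1) = 0 := by
        by_contra hne
        exact h (kost_eq_zero_of_ne (mem_partsOf.1 hl).1 hne)
      rw [sum_range_partsOf hl fun i hi =>
        Nat.le_zero.1 (((mem_partsOf.1 hl).1 hi).trans hz.le)]
    · obtain ⟨k, hk, hne⟩ := exists_ne_zero_of_sum_ne_zero h
      rw [mem_filter] at hk
      exact (ih hne hk.1 s (by omega)).trans (sum_le_sum fun r _ => (hk.2 r).1)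

theorem kost_self {m : ℕ} {l : ℕ → ℕ} (hl : Antitone l) :
    kost m l (fun i => if i < m then l i else 0) = 1 := by
  classical
  induction m with
  | zero =>
    rw [kost, if_pos]
    funext i
    simp
  | succ m ih =>
    rw [kost, sum_eq_single (fun i => if i < m then l i else 0), ih]
    · intro k hk hne
      rw [mem_filter] at hk
      by_contra hne'
      apply hne
      have hd := kost_dominance hne' hk.1
      have hz : ∀ i, m ≤ i → k i = 0 := fun i hi => by
        by_contra hc
        exact hne' (kost_eq_zero_of_ne (mem_partsOf.1 hk.1).1
          (by have := (mem_partsOf.1 hk.1).1 hi; omega))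
      have hle : ∀ i < m, k i ≤ l i := fun i hi => by
        have := (hk.2 i).1
        beta_reduce at this
        rwa [if_pos (by omega)] at this
      have hs := sum_range_partsOf hk.1 hz
      funext i
      by_cases hi : i < m
      · rw [if_pos hi]
        exact (sum_eq_sum_iff_of_le fun i hi => hle i (mem_range.1 hi)).1 hs i (mem_range.2 hi)
      · rw [if_neg hi, hz i (by omega)]
    · intro hk
      exfalso
      apply hk
      rw [mem_filter]
      refine ⟨(mem_partsOf_iff (L := m) fun i hi => if_neg (by omega)).2 ⟨?_, ?_⟩, ?_⟩
      · intro i j hij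
        beta_reduce
        have := hl hij
        split_ifs <;> omega
      · exact sum_congr rfl fun i hi => if_pos (mem_range.1 hi)
      · intro i
        have := hl (Nat.le_succ i)
        beta_reduce
        split_ifs <;> refine ⟨?_, ?_⟩ <;> omega

end Kostka

section Littlewood

open Finset

variable {R : Type*} [CommRing R] (x : ℕ → R)

/-- Partitions all of whose columns have even length. -/
def EvenCol (f : ℕ → ℕ) : Prop := ∀ i, f (2 * i) = f (2 * i + 1)

/-- The product `∏_{i<j<m} (1 - x_i x_j)⁻¹`, in degree `d`. -/
def altZ : ℕ → ℕ → R
  | 0, d => if d = 0 then 1 else 0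
  | m + 1, d => ∑ p ∈ antidiagonal d, if p.2 ≤ p.1 then
      compH x m p.2 * altZ m (p.1 - p.2) * x m ^ p.2 else 0

theorem evenCol_hstrip_left_iff {u k : ℕ → ℕ} (hu : Antitone u) :
    EvenCol k ∧ HStrip k u ↔ k = fun i => u (2 * (i / 2) + 1) := by
  constructor
  · rintro ⟨h1, h2⟩
    funext i
    have a1 := h1 (i / 2)
    have a2 := h2 (2 * (i / 2))
    have a3 := h2 (2 * (i / 2) + 1)
    rcases Nat.even_or_odd' i with ⟨q, rfl | rfl⟩
    · rw [show 2 * q / 2 = q by omega] at *; omega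
    · rw [show (2 * q + 1) / 2 = q by omega] at *; omega
  · rintro rfl
    refine ⟨fun i => ?_, fun i => ⟨hu ?_, hu ?_⟩⟩
    · beta_reduce
      rw [show 2 * i / 2 = i by omega, show (2 * i + 1) / 2 = i by omega]
    · omega
    · omega

theorem evenCol_hstrip_right_iff {u k : ℕ → ℕ} (hu : Antitone u) :
    EvenCol k ∧ HStrip u k ↔ k = fun i => u (2 * (i / 2)) := by
  constructor
  · rintro ⟨h1, h2⟩
    funext i
    have a1 := h1 (i / 2)
    have a2 := h2 (2 * (i / 2))
    have a3 := h2 (2 * (i / 2) + 1)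
    rcases Nat.even_or_odd' i with ⟨q, rfl | rfl⟩
    · rw [show 2 * q / 2 = q by omega] at *; omega
    · rw [show (2 * q + 1) / 2 = q by omega] at *; omega
  · rintro rfl
    refine ⟨fun i => ?_, fun i => ⟨hu ?_, hu ?_⟩⟩
    · beta_reduce
      rw [show 2 * i / 2 = i by omega, show (2 * i + 1) / 2 = i by omega]
    · omega
    · omega

theorem sum_pairs (u : ℕ → ℕ) (L : ℕ) :
    ∑ i ∈ range (2 * L), u (2 * (i / 2)) + ∑ i ∈ range (2 * L), u (2 * (i / 2) + 1) =
      2 * ∑ i ∈ range (2 * L), u i := by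
  induction L with
  | zero => simp
  | succ L ih =>
    rw [show 2 * (L + 1) = 2 * L + 1 + 1 by ring]
    simp only [sum_range_succ]
    rw [show 2 * L / 2 = L by omega, show (2 * L + 1) / 2 = L by omega]
    omega

theorem evenCol_pairs {a : ℕ} {u : ℕ → ℕ} (hu : u ∈ partsOf a) :
    (∑ i ∈ range (2 * a), u (2 * (i / 2)) + ∑ i ∈ range (2 * a), u (2 * (i / 2) + 1) = 2 * a) ∧
    (∀ d, (fun i => u (2 * (i / 2))) ∈ partsOf d ↔ ∑ i ∈ range (2 * a), u (2 * (i / 2)) = d) ∧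
    ∀ d, (fun i => u (2 * (i / 2) + 1)) ∈ partsOf d ↔
      ∑ i ∈ range (2 * a), u (2 * (i / 2) + 1) = d := by
  have h := mem_partsOf.1 hu
  refine ⟨?_, fun d => ?_, fun d => ?_⟩
  · rw [sum_pairs, sum_range_partsOf hu fun i hi => h.2.1 i (by omega)]
  · rw [mem_partsOf_iff (L := 2 * a) fun i hi => h.2.1 _ (by omega), and_iff_right]
    exact fun i j hij => h.1 (by omega)
  · rw [mem_partsOf_iff (L := 2 * a) fun i hi => h.2.1 _ (by omega), and_iff_right]
    exact fun i j hij => h.1 (by omega)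

open Classical in
theorem altZ_eq (m d : ℕ) :
    altZ x m d = ∑ l ∈ partsOf d with EvenCol l, schurS x m d l := by
  induction m generalizing d with
  | zero =>
    rw [altZ]
    split_ifs with h
    · subst h
      rw [partsOf_zero, sum_filter, sum_singleton, if_pos (show EvenCol 0 from fun i => rfl),
        schurS_zero]
    · simp [schurS, h]
  | succ m ih =>
    simp only [schurS]
    rw [altZ, sum_comm]
    refine sum_congr rfl fun p hp => ?_
    rw [HasAntidiagonal.mem_antidiagonal] at hp
    have hR : ∑ l ∈ partsOf d with EvenCol l,
        (∑ k ∈ partsOf p.1 with HStrip k l, schurS x m p.1 k) * x m ^ p.2 =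
        ∑ u ∈ partsOf p.1, if (fun i => u (2 * (i / 2))) ∈ partsOf d then
          schurS x m p.1 u * x m ^ p.2 else 0 := by
      simp only [sum_mul]
      rw [sum_comm' (t' := partsOf p.1)
        (s' := fun u => (partsOf d).filter fun l => EvenCol l ∧ HStrip u l)
        (by intro l u; simp only [mem_filter]; tauto)]
      refine sum_congr rfl fun u hu => ?_
      simp only [evenCol_hstrip_right_iff (mem_partsOf.1 hu).1]
      rw [sum_filter, sum_ite_eq']
    rw [hR]
    have hL : p.2 ≤ p.1 → compH x m p.2 * altZ x m (p.1 - p.2) * x m ^ p.2 =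
        ∑ u ∈ partsOf p.1, if (fun i => u (2 * (i / 2) + 1)) ∈ partsOf (p.1 - p.2) then
          schurS x m p.1 u * x m ^ p.2 else 0 := by
      intro h
      rw [ih, mul_sum, sum_mul]
      have : ∀ k ∈ (partsOf (p.1 - p.2)).filter EvenCol,
          compH x m p.2 * schurS x m (p.1 - p.2) k * x m ^ p.2 =
          ∑ u ∈ partsOf p.1 with HStrip k u, schurS x m p.1 u * x m ^ p.2 := by
        intro k hk
        rw [pieri x m _ _ _ (mem_filter.1 hk).1, sum_mul, Nat.sub_add_cancel h]
      rw [sum_congr rfl this, sum_comm' (t' := partsOf p.1)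
        (s' := fun u => (partsOf (p.1 - p.2)).filter fun k => EvenCol k ∧ HStrip k u)
        (by intro l u; simp only [mem_filter]; tauto)]
      refine sum_congr rfl fun u hu => ?_
      simp only [evenCol_hstrip_left_iff (mem_partsOf.1 hu).1]
      rw [sum_filter, sum_ite_eq']
    split_ifs with h
    · rw [hL h]
      refine sum_congr rfl fun u hu => ?_
      obtain ⟨e1, e2, e3⟩ := evenCol_pairs hu
      refine if_congr ?_ rfl rfl
      rw [e2, e3]
      omega
    · refine (sum_eq_zero fun u hu => if_neg ?_).symm
      obtain ⟨e1, e2, e3⟩ := evenCol_pairs hu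
      rw [e2]
      omega

theorem lt_conj_iff {f : ℕ → ℕ} (hf : IsPartition f) {i j : ℕ} : j < conj f i ↔ i < f j := by
  obtain ⟨hf1, N, hN⟩ := hf
  have hex : ∃ k, f k ≤ i := ⟨N, by omega⟩
  have : {j | i < f j} = ((range (Nat.find hex) : Finset ℕ) : Set ℕ) := by
    ext k
    simp only [Set.mem_ofPred_eq, coe_range, Set.mem_Iio]
    constructor
    · intro h
      by_contra hc
      have := hf1 (show Nat.find hex ≤ k by omega)
      have := Nat.find_spec hex
      omega
    · intro h
      have := Nat.find_min hex h
      omega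
  rw [conj, this, Set.ncard_coe_finset, card_range]
  constructor
  · intro h
    have := Nat.find_min hex h
    omega
  · intro h
    by_contra hc
    have := hf1 (show Nat.find hex ≤ j by omega)
    have := Nat.find_spec hex
    omega

theorem isPartition_conj {f : ℕ → ℕ} (hf : IsPartition f) : IsPartition (conj f) := by
  refine ⟨fun i j hij => ?_, f 0, ?_⟩
  · by_contra hc
    have h1 := (lt_conj_iff hf).1 (not_le.1 hc)
    have := (lt_conj_iff hf (i := i) (j := conj f i)).2 (by omega)
    omega
  · by_contra hc
    have := (lt_conj_iff hf).1 (Nat.pos_of_ne_zero hc)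
    omega

theorem conj_conj {f : ℕ → ℕ} (hf : IsPartition f) : conj (conj f) = f := by
  funext i
  refine eq_of_forall_lt_iff fun j => ?_
  rw [lt_conj_iff (isPartition_conj hf), lt_conj_iff hf]

theorem isPartition_double {f : ℕ → ℕ} (hf : IsPartition f) : IsPartition (double f) := by
  obtain ⟨h1, N, hN⟩ := hf
  exact ⟨fun i j hij => Nat.mul_le_mul_left 2 (h1 hij), N, by simp [double, hN]⟩

theorem conj_double {f : ℕ → ℕ} (hf : IsPartition f) (i : ℕ) :
    conj (double f) i = conj f (i / 2) := by
  refine eq_of_forall_lt_iff fun j => ?_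
  rw [lt_conj_iff (isPartition_double hf), lt_conj_iff hf, double]
  omega

theorem conj_double_injective : Function.Injective fun δ : Ptn => conj (double δ.1) := by
  intro δ ε h
  have h1 : conj δ.1 = conj ε.1 := by
    funext i
    have := congrFun h (2 * i)
    simp only [conj_double δ.2, conj_double ε.2] at this
    rwa [show 2 * i / 2 = i by omega] at this
  exact Subtype.ext (by rw [← conj_conj δ.2, h1, conj_conj ε.2])

theorem range_conj_double : Set.range (fun δ : Ptn => conj (double δ.1)) =
    {f | IsPartition f ∧ EvenCol f} := by
  ext f
  constructor
  · rintro ⟨δ, rfl⟩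
    refine ⟨isPartition_conj (isPartition_double δ.2), fun i => ?_⟩
    simp only [conj_double δ.2]
    congr 1
    omega
  · rintro ⟨h1, h2⟩
    have h3 : IsPartition fun i => f (2 * i) := by
      obtain ⟨h1, N, hN⟩ := h1
      exact ⟨fun i j hij => h1 (by omega), N, Nat.le_zero.1 ((h1 (by omega)).trans hN.le)⟩
    refine ⟨⟨_, isPartition_conj h3⟩, ?_⟩
    funext i
    simp only [conj_double (isPartition_conj h3), conj_conj h3]
    rcases Nat.even_or_odd' i with ⟨q, rfl | rfl⟩
    · rw [show 2 * q / 2 = q by omega]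
    · rw [show (2 * q + 1) / 2 = q by omega, h2]

open Classical in
theorem finsum_lrCoeff_eq {d e : ℕ} {u l : ℕ → ℕ} (hu : u ∈ partsOf d) (hl : l ∈ partsOf (d + e)) :
    ∑ᶠ δ : Ptn, lrCoeff l u (conj (double δ.1)) =
      ∑ v ∈ partsOf e with EvenCol v, lrCoeff l u v := by
  have h1 : ∑ᶠ δ : Ptn, lrCoeff l u (conj (double δ.1)) =
      ∑ᶠ v ∈ Set.range (fun δ : Ptn => conj (double δ.1)), lrCoeff l u v :=
    (finsum_mem_range conj_double_injective).symm
  rw [h1, range_conj_double]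
  refine finsum_mem_eq_sum_of_inter_support_eq _ ?_
  ext v
  simp only [Set.mem_inter_iff, Set.mem_ofPred_eq, Function.mem_support, coe_filter]
  refine and_congr_left fun hne => ?_
  have hne' : {T | IsLRTableau l u v T}.Nonempty := by
    by_contra hc
    rw [Set.not_nonempty_iff_eq_empty] at hc
    exact hne (by rw [lrCoeff, hc, Set.ncard_empty])
  obtain ⟨T, hT⟩ := hne'
  refine and_congr_left fun _ => ⟨fun hp => ?_, fun hp => ?_⟩
  · obtain ⟨h1, N, hN⟩ := hp
    have hz : ∀ r, N ≤ r → v r = 0 := fun r hr => Nat.le_zero.1 ((h1 hr).trans hN.le)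
    refine (mem_partsOf_iff hz).2 ⟨h1, ?_⟩
    have := size_eq_of_isLRTableau hT (mem_partsOf.1 hl).1 (mem_partsOf.1 hu).1 hz
      (mem_partsOf.1 hl).2.1
    rw [(mem_partsOf.1 hl).2.2, sum_range_partsOf hu fun i hi =>
      (mem_partsOf.1 hu).2.1 i (by omega)] at this
    omega
  · have := mem_partsOf.1 hp
    exact ⟨this.1, e, this.2.1 e le_rfl⟩

theorem finsum_lrCoeff_eq_zero {d e : ℕ} {u l : ℕ → ℕ} (hu : u ∈ partsOf d) (hl : l ∈ partsOf e)
    (hde : e < d) : ∑ᶠ δ : Ptn, lrCoeff l u (conj (double δ.1)) = 0 := by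
  refine finsum_eq_zero_of_forall_eq_zero fun δ => ?_
  have hp := isPartition_conj (isPartition_double δ.2)
  obtain ⟨h1, N, hN⟩ := hp
  by_contra hne
  have hne' : {T | IsLRTableau l u (conj (double δ.1)) T}.Nonempty := by
    by_contra hc
    rw [Set.not_nonempty_iff_eq_empty] at hc
    exact hne (by rw [lrCoeff, hc, Set.ncard_empty])
  obtain ⟨T, hT⟩ := hne'
  have := size_eq_of_isLRTableau (L := d) hT (mem_partsOf.1 hl).1 (mem_partsOf.1 hu).1
    (fun r hr => Nat.le_zero.1 ((h1 hr).trans hN.le))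
    (fun i hi => (mem_partsOf.1 hl).2.1 i (by omega))
  rw [(mem_partsOf.1 hu).2.2, sum_range_partsOf hl fun i hi =>
    (mem_partsOf.1 hl).2.1 i (by omega)] at this
  omega

end Littlewood

section GeneratingFunctions

open Finset

variable {R : Type*} [CommRing R]

/-- The sum of all monomials of degree `k` in the elements `y i`, for `i ∈ s`. -/
def monoSum {ι : Type*} (s : Finset ι) (y : ι → R) (k : ℕ) : R :=
  PowerSeries.coeff k (∏ i ∈ s, PowerSeries.mk fun j => y i ^ j)

theorem monoSum_eq {ι : Type*} [DecidableEq ι] (s : Finset ι) (y : ι → R) (k : ℕ) :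
    monoSum s y k = ∑ a ∈ piAntidiag s k, ∏ i ∈ s, y i ^ a i := by
  rw [monoSum, PowerSeries.coeff_prod]
  refine sum_bij (fun a _ => (a : ι → ℕ)) ?_ ?_ ?_ ?_
  · intro a ha
    rw [mem_finsuppAntidiag] at ha
    exact mem_piAntidiag.2 ⟨ha.1, fun i hi => ha.2 (Finsupp.mem_support_iff.2 hi)⟩
  · intro a _ b _ h
    exact DFunLike.coe_injective h
  · intro a ha
    rw [mem_piAntidiag] at ha
    refine ⟨Finsupp.onFinset s a ha.2, ?_, rfl⟩
    rw [mem_finsuppAntidiag]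
    exact ⟨ha.1, Finsupp.support_onFinset_subset⟩
  · intro a _
    simp

theorem compH_eq_monoSum (x : ℕ → R) (m k : ℕ) : compH x m k = monoSum (range m) x k := by
  rw [compH_eq_sum, monoSum_eq]

theorem monoSum_mul_left {ι : Type*} (s : Finset ι) (y : ι → R) (c : R) (k : ℕ) :
    monoSum s (fun i => c * y i) k = c ^ k * monoSum s y k := by
  have : ∀ i, (PowerSeries.mk fun j => (c * y i) ^ j) =
      PowerSeries.rescale c (PowerSeries.mk fun j => y i ^ j) := by
    intro i
    ext j
    simp [mul_pow]
  simp only [monoSum, this, ← map_prod, PowerSeries.coeff_rescale]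

theorem altZ_odd (x : ℕ → R) (m k : ℕ) : altZ x m (2 * k + 1) = 0 := by
  induction m generalizing k with
  | zero => simp [altZ]
  | succ m ih =>
    rw [altZ]
    refine sum_eq_zero fun p hp => ?_
    rw [HasAntidiagonal.mem_antidiagonal] at hp
    split_ifs with h
    · rw [show p.1 - p.2 = 2 * (k - p.2) + 1 by omega, ih]
      simp
    · rfl

theorem altZ_even (x : ℕ → R) (m k : ℕ) : altZ x m (2 * k) =
    PowerSeries.coeff k
      (∏ j ∈ range m, ∏ i ∈ range j, PowerSeries.mk fun q => (x i * x j) ^ q) := by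
  induction m generalizing k with
  | zero => simp [altZ, PowerSeries.coeff_one]
  | succ m ih =>
    rw [altZ, prod_range_succ, PowerSeries.coeff_mul, ← sum_filter]
    symm
    refine sum_bij (fun q _ => (2 * q.1 + q.2, q.2)) ?_ ?_ ?_ ?_
    · intro q hq
      rw [HasAntidiagonal.mem_antidiagonal] at hq
      simp only [mem_filter, HasAntidiagonal.mem_antidiagonal]
      omega
    · rintro ⟨a, b⟩ _ ⟨c, d⟩ _ h
      simp only [Prod.mk.injEq] at h ⊢
      omega
    · rintro ⟨a, b⟩ h
      simp only [mem_filter, HasAntidiagonal.mem_antidiagonal] at h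
      obtain ⟨h, hba⟩ := h
      refine ⟨(k - b, b), ?_, ?_⟩
      · rw [HasAntidiagonal.mem_antidiagonal]; change k - b + b = k; omega
      · simp only [Prod.mk.injEq, and_true]; omega
    · intro q hq
      rw [show 2 * q.1 + q.2 - q.2 = 2 * q.1 by omega, ih, compH_eq_monoSum]
      have := monoSum_mul_left (range m) x (x m) q.2
      simp only [mul_comm (x m)] at this
      rw [monoSum] at this
      rw [this]
      ring

theorem sum_blocks {κ B : Type*} [Fintype κ] [Fintype B] [DecidableEq κ] [DecidableEq B]
    (blk : κ → B) (c : B → ℕ) (y : κ → R) :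
    ∑ a ∈ piAntidiag (univ : Finset κ) (∑ b, c b) with
        (∀ b, ∑ v with blk v = b, a v = c b), ∏ v, y v ^ a v =
      ∏ b, monoSum (univ.filter fun v => blk v = b) y (c b) := by
  simp only [monoSum_eq]
  rw [prod_univ_sum]
  refine sum_bij' (fun a _ b v => if blk v = b then a v else 0) (fun p _ v => p (blk v) v)
    ?_ ?_ ?_ ?_ ?_
  · intro a ha
    rw [mem_filter] at ha
    rw [Fintype.mem_piFinset]
    intro b
    rw [mem_piAntidiag]
    refine ⟨?_, fun v hv => ?_⟩
    · rw [← ha.2 b]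
      exact sum_congr rfl fun v hv => if_pos (mem_filter.1 hv).2
    · simp only [mem_filter, mem_univ, true_and]
      by_contra h
      exact hv (if_neg h)
  · intro p hp
    rw [Fintype.mem_piFinset] at hp
    have h : ∀ b, ∑ v with blk v = b, p (blk v) v = c b := fun b => by
      rw [← (mem_piAntidiag.1 (hp b)).1]
      exact sum_congr rfl fun v hv => by rw [(mem_filter.1 hv).2]
    rw [mem_filter, mem_piAntidiag]
    refine ⟨⟨?_, by simp⟩, h⟩
    rw [← sum_fiberwise (g := blk)]
    exact sum_congr rfl fun b _ => h b
  · intro a _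
    simp
  · intro p hp
    rw [Fintype.mem_piFinset] at hp
    funext b v
    beta_reduce
    split_ifs with h
    · rw [h]
    · by_contra hne
      have := (mem_piAntidiag.1 (hp b)).2 v (Ne.symm hne)
      simp [h] at this
  · intro a _
    rw [← prod_fiberwise (g := blk)]
    refine prod_congr rfl fun b _ => prod_congr rfl fun v hv => ?_
    beta_reduce
    rw [if_pos (mem_filter.1 hv).2]

end GeneratingFunctions

section Counting

open Finset

variable {n : ℕ}

/-- Extension of a weight by zero. -/
def extZ (a : Fin n → ℕ) (i : ℕ) : ℕ := if h : i < n then a ⟨i, h⟩ else 0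

theorem sum_extZ (a : Fin n → ℕ) : ∑ r ∈ range n, extZ a r = ∑ i, a i := by
  rw [← Fin.sum_univ_eq_sum_range]
  exact sum_congr rfl fun i _ => by simp [extZ]

/-- The variables, extended by zero. -/
def varZ (n : ℕ) (i : ℕ) : MvPolynomial (Fin n) ℤ :=
  if h : i < n then MvPolynomial.X ⟨i, h⟩ else 0

theorem prod_varZ (a : ℕ → ℕ) : ∏ r ∈ range n, varZ n r ^ a r =
    MvPolynomial.monomial (Finsupp.equivFunOnFinite.symm fun i : Fin n => a i) 1 := by
  rw [← Fin.prod_univ_eq_prod_range, MvPolynomial.monomial_eq, Finsupp.prod_fintype _ _ (by simp)]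
  simp [varZ]

theorem coeff_schurS {d : ℕ} {l : ℕ → ℕ} (hl : l ∈ partsOf d) (b : Fin n → ℕ) :
    MvPolynomial.coeff (Finsupp.equivFunOnFinite.symm b) (schurS (varZ n) n d l) =
      if ∑ i, b i = d then (kost n (extZ b) l : ℤ) else 0 := by
  classical
  rw [schurS_eq_sum_kost _ _ _ hl, MvPolynomial.coeff_sum]
  simp only [prod_varZ]
  have : ∀ a : ℕ → ℕ, MvPolynomial.coeff (Finsupp.equivFunOnFinite.symm b)
      ((kost n a l : MvPolynomial (Fin n) ℤ) * MvPolynomial.monomial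
        (Finsupp.equivFunOnFinite.symm fun i : Fin n => a i) 1) =
      if (fun i : Fin n => a i) = b then (kost n a l : ℤ) else 0 := by
    intro a
    rw [← map_natCast (MvPolynomial.C : ℤ →+* _), MvPolynomial.coeff_C_mul,
      MvPolynomial.coeff_monomial]
    simp
  rw [sum_congr rfl fun a _ => this a]
  have hiff : ∀ a ∈ piAntidiag (range n) d, (fun i : Fin n => a i) = b ↔ a = extZ b := by
    intro a ha
    constructor
    · rintro rfl
      funext i
      unfold extZ
      split_ifs with h
      · rfl
      · by_contra hne
        exact h (mem_range.1 ((mem_piAntidiag.1 ha).2 i hne))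
    · rintro rfl
      funext i
      simp [extZ]
  rw [sum_congr rfl fun a ha => if_congr (hiff a ha) rfl rfl, sum_ite_eq']
  refine if_congr ?_ rfl rfl
  rw [mem_piAntidiag]
  rw [show (range n).sum (extZ b) = ∑ i, b i from sum_extZ b]
  refine and_iff_left fun i hi => ?_
  by_contra h
  exact hi (dif_neg (by simpa using h))

theorem coeff_sum_monomials {κ : Type*} [Fintype κ] (s : Finset (κ → ℕ))
    (w : κ → Fin n → ℕ) (b : Fin n → ℕ) :
    MvPolynomial.coeff (Finsupp.equivFunOnFinite.symm b) (∑ a ∈ s, ∏ v,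
      (MvPolynomial.monomial (Finsupp.equivFunOnFinite.symm (w v)) (1 : ℤ)) ^ a v) =
      ((s.filter fun a => (fun i => ∑ v, a v * w v i) = b).card : ℤ) := by
  classical
  have : ∀ a : κ → ℕ, ∏ v,
      (MvPolynomial.monomial (Finsupp.equivFunOnFinite.symm (w v)) (1 : ℤ)) ^ a v =
      MvPolynomial.monomial (Finsupp.equivFunOnFinite.symm fun i => ∑ v, a v * w v i) 1 := by
    intro a
    simp only [MvPolynomial.monomial_pow, one_pow]
    rw [← MvPolynomial.monomial_sum_one]
    refine congrArg (fun f => MvPolynomial.monomial f (1 : ℤ)) (Finsupp.ext fun i => ?_)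
    simp
  simp only [MvPolynomial.coeff_sum, this, MvPolynomial.coeff_monomial, card_filter, Nat.cast_sum]
  refine sum_congr rfl fun a _ => ?_
  simp

/-- Counting non-negative integer matrices with prescribed row and column sums. -/
theorem card_matrices (a b : Fin n → ℕ) (hab : ∑ i, a i = ∑ i, b i) :
    Set.ncard {e : Fin n × Fin n → ℕ | (∀ r, ∑ c, e (r, c) = a r) ∧ ∀ c, ∑ r, e (r, c) = b c} =
      ∑ l ∈ partsOf (∑ i, a i), kost n (extZ a) l * kost n (extZ b) l := by
  classical
  have h1 := sum_blocks (Prod.fst : Fin n × Fin n → Fin n) a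
    fun v => (MvPolynomial.X v.2 : MvPolynomial (Fin n) ℤ)
  have hrow : ∀ (r : Fin n) (e : Fin n × Fin n → ℕ),
      ∑ v with v.1 = r, e v = ∑ c, e (r, c) := by
    intro r e
    rw [sum_filter, Fintype.sum_prod_type, sum_eq_single r (by intro b _ hb; simp [hb]) (by simp)]
    simp
  have hH : ∀ r, monoSum (univ.filter fun v : Fin n × Fin n => v.1 = r)
      (fun v => (MvPolynomial.X v.2 : MvPolynomial (Fin n) ℤ)) (a r) =
      compH (varZ n) n (extZ a r) := by
    intro r
    rw [compH_eq_monoSum, monoSum, monoSum, prod_filter, Fintype.prod_prod_type,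
      ← Fin.prod_univ_eq_prod_range (fun i => PowerSeries.mk fun j => varZ n i ^ j)]
    simp [extZ, varZ]
  simp only [hH] at h1
  rw [Fin.prod_univ_eq_prod_range (fun r => compH (varZ n) n (extZ a r)),
    prod_compH_eq_sum_kost, sum_extZ] at h1
  have h2 := congrArg (MvPolynomial.coeff (Finsupp.equivFunOnFinite.symm b)) h1
  simp only [MvPolynomial.X] at h2
  have hX : ∀ v : Fin n × Fin n, (Finsupp.single v.2 1 : Fin n →₀ ℕ) =
      Finsupp.equivFunOnFinite.symm (Pi.single v.2 1) := by
    intro v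
    ext i
    simp [Finsupp.single_apply, eq_comm]
  simp only [hX] at h2
  rw [coeff_sum_monomials, MvPolynomial.coeff_sum] at h2
  have h3 : ∀ l ∈ partsOf (∑ i, a i), MvPolynomial.coeff (Finsupp.equivFunOnFinite.symm b)
      ((kost n (extZ a) l : MvPolynomial (Fin n) ℤ) * schurS (varZ n) n (∑ i, a i) l) =
      (kost n (extZ a) l : ℤ) * kost n (extZ b) l := by
    intro l hl
    rw [← map_natCast (MvPolynomial.C : ℤ →+* _), MvPolynomial.coeff_C_mul, coeff_schurS hl,
      if_pos hab.symm]
  rw [sum_congr rfl h3] at h2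
  refine Nat.cast_injective (R := ℤ) ?_
  simp only [Nat.cast_sum, Nat.cast_mul]
  rw [← h2, ← Set.ncard_coe_finset]
  congr 2
  ext e
  simp only [Set.mem_ofPred_eq, coe_filter, mem_filter, mem_piAntidiag, hrow]
  have hcol : ∀ c, ∑ v : Fin n × Fin n, e v * (Pi.single v.2 1 : Fin n → ℕ) c =
      ∑ r, e (r, c) := by
    intro c
    rw [Fintype.sum_prod_type]
    simp [Pi.single_apply]
  simp only [funext_iff, hcol]
  refine ⟨fun h => ⟨⟨⟨?_, by simp⟩, h.1⟩, h.2⟩, fun h => ⟨h.1.2, h.2⟩⟩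
  show ∑ v, e v = _
  rw [Fintype.sum_prod_type]
  exact sum_congr rfl fun r _ => h.1 r

theorem prod_pairs {M : Type*} [CommMonoid M] (n : ℕ) (f : ℕ → ℕ → M) :
    ∏ p : {p : Fin n × Fin n // p.1 < p.2}, f p.1.1 p.1.2 =
      ∏ j ∈ range n, ∏ i ∈ range j, f i j := by
  rw [prod_sigma']
  refine prod_bij (fun p _ => ⟨p.1.2, p.1.1⟩) ?_ ?_ ?_ ?_
  · rintro ⟨⟨i, j⟩, h⟩ _
    simpa using h
  · rintro ⟨⟨i, j⟩, h⟩ _ ⟨⟨i', j'⟩, h'⟩ _ e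
    simp only [Sigma.mk.injEq, heq_eq_eq, Fin.val_inj] at e
    simp [e.1, e.2]
  · rintro ⟨j, i⟩ h
    simp only [mem_sigma, mem_range] at h
    exact ⟨⟨(⟨i, h.2.trans h.1⟩, ⟨j, h.1⟩), h.2⟩, mem_univ _, rfl⟩
  · intro p _
    rfl

/-- The entries of a square matrix together with those of an alternating matrix. -/
abbrev PairIdx (n : ℕ) : Type := (Fin n × Fin n) ⊕ {p : Fin n × Fin n // p.1 < p.2}

/-- The column weights of the entries of a square matrix and of an alternating matrix. -/
def colWt (n : ℕ) : PairIdx n → Fin n → ℕ :=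
  Sum.elim (fun v => Pi.single v.2 1) (fun p => Pi.single p.1.1 1 + Pi.single p.1.2 1)

/-- The branching coefficients attached to the Littlewood–Richardson rule. -/
def branchLR (e : ℕ) (l u : ℕ → ℕ) : ℕ :=
  open Classical in ∑ v ∈ partsOf e with EvenCol v, lrCoeff l u v

theorem coeff_prod_compH_mul_altZ (a b : Fin n → ℕ) (e : ℕ) (hab : ∑ i, b i = (∑ i, a i) + e) :
    MvPolynomial.coeff (Finsupp.equivFunOnFinite.symm b)
      ((∏ r ∈ range n, compH (varZ n) n (extZ a r)) * altZ (varZ n) n e) =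
      ((∑ m ∈ partsOf (∑ i, a i), ∑ l ∈ partsOf (∑ i, b i),
        kost n (extZ a) m * branchLR e l m * kost n (extZ b) l : ℕ) : ℤ) := by
  classical
  rw [prod_compH_eq_sum_kost, sum_extZ, altZ_eq, sum_mul, MvPolynomial.coeff_sum, Nat.cast_sum]
  refine sum_congr rfl fun m hm => ?_
  rw [mul_assoc, mul_sum, ← map_natCast (MvPolynomial.C : ℤ →+* _), MvPolynomial.coeff_C_mul,
    MvPolynomial.coeff_sum]
  have : ∀ v ∈ (partsOf e).filter EvenCol, MvPolynomial.coeff (Finsupp.equivFunOnFinite.symm b)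
      (schurS (varZ n) n (∑ i, a i) m * schurS (varZ n) n e v) =
      ∑ l ∈ partsOf (∑ i, b i), (lrCoeff l m v : ℤ) * kost n (extZ b) l := by
    intro v hv
    rw [schurS_mul_schurS _ _ hm (mem_filter.1 hv).1, MvPolynomial.coeff_sum, ← hab]
    refine sum_congr rfl fun l hl => ?_
    rw [← map_natCast (MvPolynomial.C : ℤ →+* _), MvPolynomial.coeff_C_mul, coeff_schurS hl,
      if_pos rfl]
  rw [sum_congr rfl this, sum_comm, mul_sum, Nat.cast_sum]
  refine sum_congr rfl fun l _ => ?_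
  rw [← sum_mul, branchLR]
  push_cast
  ring_nf

/-- Counting pairs of a non-negative integer matrix and of an alternating one, with prescribed
row sums for the first and prescribed total column sums. -/
theorem card_pairs (a b : Fin n → ℕ) (e : ℕ) (hab : ∑ i, b i = (∑ i, a i) + e) :
    Set.ncard {f : PairIdx n → ℕ | (∀ r, ∑ c, f (Sum.inl (r, c)) = a r) ∧
        ∀ c, ∑ v, f v * colWt n v c = b c} =
      ∑ m ∈ partsOf (∑ i, a i), ∑ l ∈ partsOf (∑ i, b i),
        kost n (extZ a) m * branchLR e l m * kost n (extZ b) l := by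
  classical
  refine Nat.cast_injective (R := ℤ) ?_
  rw [← coeff_prod_compH_mul_altZ a b e hab]
  have htot : ∀ f : PairIdx n → ℕ, ∑ c, ∑ v, f v * colWt n v c =
      (∑ r, ∑ c, f (Sum.inl (r, c))) + 2 * ∑ p, f (Sum.inr p) := by
    intro f
    rw [sum_comm, Fintype.sum_sum_type, Fintype.sum_prod_type, mul_sum]
    congr 1
    · simp [colWt, ← mul_sum]
    · refine sum_congr rfl fun p _ => ?_
      simp only [colWt, Sum.elim_inr, ← mul_sum, Pi.add_apply, sum_add_distrib]
      simp
      ring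
  rcases Nat.even_or_odd' e with ⟨k, rfl | rfl⟩
  · have h1 := sum_blocks
      (Sum.elim (fun v => some v.1) (fun _ => none) : PairIdx n → Option (Fin n))
      (fun o => o.elim k a)
      (fun v => (MvPolynomial.monomial (Finsupp.equivFunOnFinite.symm (colWt n v)) (1 : ℤ)))
    have hrow : ∀ (r : Fin n) (f : PairIdx n → ℕ),
        ∑ v with (Sum.elim (fun v => some v.1) (fun _ => none) : PairIdx n → Option (Fin n)) v =
          some r, f v = ∑ c, f (Sum.inl (r, c)) := by
      intro r f
      rw [sum_filter, Fintype.sum_sum_type, Fintype.sum_prod_type,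
        sum_eq_single r (by intro b _ hb; simp [hb]) (by simp)]
      simp
    have hnone : ∀ (f : PairIdx n → ℕ),
        ∑ v with (Sum.elim (fun v => some v.1) (fun _ => none) : PairIdx n → Option (Fin n)) v =
          none, f v = ∑ p, f (Sum.inr p) := by
      intro f
      rw [sum_filter, Fintype.sum_sum_type]
      simp
    have hH : ∀ r, monoSum (univ.filter fun v : PairIdx n =>
        (Sum.elim (fun v => some v.1) (fun _ => none) : PairIdx n → Option (Fin n)) v = some r)
        (fun v => (MvPolynomial.monomial (Finsupp.equivFunOnFinite.symm (colWt n v)) (1 : ℤ)))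
        (a r) = compH (varZ n) n (extZ a r) := by
      intro r
      rw [compH_eq_monoSum, monoSum, monoSum, prod_filter, Fintype.prod_sum_type,
        Fintype.prod_prod_type, prod_eq_single r (by intro b _ hb; simp [hb]) (by simp),
        ← Fin.prod_univ_eq_prod_range (fun i => PowerSeries.mk fun j => varZ n i ^ j)]
      have : extZ a r = a r := by simp [extZ]
      rw [this]
      simp [varZ, colWt, MvPolynomial.X]
    have hA : monoSum (univ.filter fun v : PairIdx n =>
        (Sum.elim (fun v => some v.1) (fun _ => none) : PairIdx n → Option (Fin n)) v = none)
        (fun v => (MvPolynomial.monomial (Finsupp.equivFunOnFinite.symm (colWt n v)) (1 : ℤ)))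
        k = altZ (varZ n) n (2 * k) := by
      rw [altZ_even, monoSum, prod_filter, Fintype.prod_sum_type,
        ← prod_pairs n fun i j => PowerSeries.mk fun q => (varZ n i * varZ n j) ^ q]
      have hs : ∀ i j : Fin n, (Finsupp.equivFunOnFinite.symm (Pi.single i 1 + Pi.single j 1) :
          Fin n →₀ ℕ) = Finsupp.single i 1 + Finsupp.single j 1 := by
        intro i j
        ext x
        simp [Finsupp.single_apply, Pi.single_apply, eq_comm]
      simp [varZ, colWt, MvPolynomial.X, hs]
    rw [Fintype.prod_option, Fintype.sum_option] at h1
    simp only [Option.elim] at h1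
    rw [hA, Fintype.prod_congr _ _ hH,
      Fin.prod_univ_eq_prod_range (fun r => compH (varZ n) n (extZ a r)), mul_comm] at h1
    rw [← h1, coeff_sum_monomials, ← Set.ncard_coe_finset]
    congr 2
    ext f
    simp only [Set.mem_ofPred_eq, coe_filter, mem_filter, mem_piAntidiag, Option.forall, hrow,
      hnone, funext_iff]
    constructor
    · intro h
      have h2 := htot f
      simp only [h.1, h.2, hab] at h2
      have h3 : ∑ p, f (Sum.inr p) = k := by omega
      refine ⟨⟨⟨?_, by simp⟩, h3, h.1⟩, h.2⟩
      show ∑ v, f v = _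
      rw [Fintype.sum_sum_type, Fintype.sum_prod_type, h3, add_comm]
      simp only [h.1]
    · intro h
      exact ⟨h.1.2.2, h.2⟩
  · rw [altZ_odd, mul_zero, MvPolynomial.coeff_zero, Nat.cast_eq_zero]
    refine (congrArg Set.ncard (Set.eq_empty_of_forall_notMem fun f h => ?_)).trans
      (Set.ncard_empty _)
    have h2 := htot f
    simp only [h.1, h.2, hab] at h2
    omega

end Counting

section Cells

variable {G : Type*} [Group G]

/-- A group with a big cell `L T U`, generated by `T` and one-parameter subgroups which send every
element of `L` into the big cell for almost all parameters. -/
structure CellData (G : Type*) [Group G] where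
  L : Subgroup G
  T : Subgroup G
  U : Subgroup G
  params : Set (ℂ → G)
  map_add : ∀ f ∈ params, ∀ a b, f (a + b) = f a * f b
  conj_mem : ∀ t ∈ T, ∀ l ∈ L, t * l * t⁻¹ ∈ L
  cofinite : ∀ f ∈ params, ∀ l ∈ L,
    {c | ¬ ∃ l' ∈ L, ∃ t ∈ T, ∃ u ∈ U, f c * l = l' * t * u}.Finite
  closure_eq : Subgroup.closure ((T : Set G) ∪ ⋃ f ∈ params, Set.range f) = ⊤

variable {V W M : Type*} [AddCommGroup V] [Module ℂ V] [AddCommGroup W] [Module ℂ W]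
  [AddCommGroup M] [Module ℂ M]

/-- The space of highest weight vectors of weight `χ`. -/
def CellData.hwSpace (D : CellData G) (ρ : Representation ℂ G V) (χ : G → ℂ) : Submodule ℂ V where
  carrier := {x | (∀ u ∈ D.U, ρ u x = x) ∧ ∀ t ∈ D.T, ρ t x = χ t • x}
  add_mem' := by
    intro x y hx hy
    refine ⟨fun u hu => ?_, fun t ht => ?_⟩
    · rw [LinearMap.map_add, hx.1 u hu, hy.1 u hu]
    · rw [LinearMap.map_add, hx.2 t ht, hy.2 t ht, smul_add]
  zero_mem' := by simp
  smul_mem' := by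
    intro c x hx
    refine ⟨fun u hu => ?_, fun t ht => ?_⟩
    · rw [map_smul, hx.1 u hu]
    · rw [map_smul, hx.2 t ht, smul_comm]

theorem CellData.mem_hwSpace {D : CellData G} {ρ : Representation ℂ G V} {χ : G → ℂ} {x : V} :
    x ∈ D.hwSpace ρ χ ↔ (∀ u ∈ D.U, ρ u x = x) ∧ ∀ t ∈ D.T, ρ t x = χ t • x := Iff.rfl

/-- The span of the `L`-orbit of a vector. -/
def CellData.lowerSpan (D : CellData G) (ρ : Representation ℂ G V) (v : V) : Submodule ℂ V :=
  Submodule.span ℂ {x | ∃ l ∈ D.L, ρ l v = x}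

theorem CellData.lowerSpan_stable [FiniteDimensional ℂ V] (D : CellData G)
    (ρ : Representation ℂ G V) {χ : G → ℂ} {v : V} (hv : v ∈ D.hwSpace ρ χ) (g : G) :
    ∀ x ∈ D.lowerSpan ρ v, ρ g x ∈ D.lowerSpan ρ v := by
  set E := D.lowerSpan ρ v with hE
  have hmem : ∀ l ∈ D.L, ρ l v ∈ E := fun l hl => Submodule.subset_span ⟨l, hl, rfl⟩
  have hspan : ∀ g : G, (∀ l ∈ D.L, ρ g (ρ l v) ∈ E) → E.map (ρ g) ≤ E := by
    intro g h
    rw [hE, CellData.lowerSpan, Submodule.map_span, Submodule.span_le]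
    rintro _ ⟨_, ⟨l, hl, rfl⟩, rfl⟩
    exact h l hl
  have hT : ∀ t ∈ D.T, E.map (ρ t) ≤ E := by
    intro t ht
    refine hspan t fun l hl => ?_
    have : ρ t (ρ l v) = ρ (t * l * t⁻¹) (χ t • v) := by
      rw [← hv.2 t ht, ← Module.End.mul_apply, ← Module.End.mul_apply, ← map_mul, ← map_mul]
      simp
    rw [this, map_smul]
    exact E.smul_mem _ (hmem _ (D.conj_mem t ht l hl))
  have hparam : ∀ f ∈ D.params, ∀ c, E.map (ρ (f c)) ≤ E := by
    intro f hf
    obtain ⟨s, hs, hsE⟩ := (Submodule.fg_span_iff_fg_span_finset_subset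
      {x | ∃ l ∈ D.L, ρ l v = x}).1 (IsNoetherian.noetherian (R := ℂ) _)
    have hs' : ∀ x ∈ s, ∃ l ∈ D.L, ρ l v = x := fun x hx => hs hx
    choose! lw hlw using hs'
    set bad : Set ℂ := ⋃ x ∈ s, {c | ¬ ∃ l' ∈ D.L, ∃ t ∈ D.T, ∃ u ∈ D.U,
      f c * lw x = l' * t * u} with hbad
    have hfin : bad.Finite := by
      refine Set.Finite.biUnion s.finite_toSet fun x hx => D.cofinite f hf _ (hlw _ hx).1
    have hgood : ∀ c ∉ bad, E.map (ρ (f c)) ≤ E := by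
      intro c hc
      rw [hE, CellData.lowerSpan, hsE, Submodule.map_span, ← hsE, Submodule.span_le]
      rintro _ ⟨x, hx, rfl⟩
      have hc' : ∃ l' ∈ D.L, ∃ t ∈ D.T, ∃ u ∈ D.U, f c * lw x = l' * t * u := by
        by_contra hcon
        exact hc (Set.mem_biUnion hx hcon)
      obtain ⟨l', hl', t, ht, u, hu, h⟩ := hc'
      rw [← (hlw _ hx).2, ← Module.End.mul_apply, ← map_mul, h, map_mul, map_mul,
        Module.End.mul_apply, Module.End.mul_apply, hv.1 u hu, hv.2 t ht, map_smul]
      exact E.smul_mem _ (hmem _ hl')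
    intro c
    obtain ⟨a, ha⟩ := ((hfin.union (hfin.preimage (f := fun a => c - a)
      (sub_right_injective.injOn))).infinite_compl).nonempty
    have ha1 : a ∉ bad := fun h => ha (Or.inl h)
    have ha2 : c - a ∉ bad := fun h => ha (Or.inr h)
    rw [show f c = f a * f (c - a) by rw [← D.map_add f hf]; simp, map_mul]
    rw [Module.End.mul_eq_comp, Submodule.map_comp]
    exact (Submodule.map_mono (hgood _ ha2)).trans (hgood _ ha1)
  have hkey : ∀ g : G, E.map (ρ g) = E := by
    intro g
    have hg : g ∈ Subgroup.closure ((D.T : Set G) ∪ ⋃ f ∈ D.params, Set.range f) := by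
      rw [D.closure_eq]; trivial
    have heq : ∀ g : G, E.map (ρ g) ≤ E → E.map (ρ g⁻¹) ≤ E → E.map (ρ g) = E := by
      intro g h1 h2
      refine le_antisymm h1 ?_
      have := Submodule.map_mono (f := ρ g) h2
      rwa [← Submodule.map_comp, ← Module.End.mul_eq_comp, ← map_mul, mul_inv_cancel, map_one,
        Module.End.one_eq_id, Submodule.map_id] at this
    induction hg using Subgroup.closure_induction with
    | mem x hx =>
      rcases hx with hx | hx
      · exact heq x (hT x hx) (hT _ (D.T.inv_mem hx))
      · simp only [Set.mem_iUnion] at hx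
        obtain ⟨f, hf, c, rfl⟩ := hx
        refine heq _ (hparam f hf c) ?_
        have h0 : f 0 = 1 := by
          have := D.map_add f hf 0 0
          simpa using this
        have : (f c)⁻¹ = f (-c) := by
          rw [inv_eq_iff_mul_eq_one, ← D.map_add f hf]
          simp [h0]
        rw [this]
        exact hparam f hf _
    | one => simp [Module.End.one_eq_id]
    | mul x y _ _ hx hy =>
      rw [map_mul, Module.End.mul_eq_comp, Submodule.map_comp, hy, hx]
    | inv x _ hx =>
      conv_lhs => rw [← hx]
      rw [← Submodule.map_comp, ← Module.End.mul_eq_comp, ← map_mul, inv_mul_cancel, map_one,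
        Module.End.one_eq_id, Submodule.map_id]
  intro x hx
  rw [← hkey g]
  exact Submodule.mem_map_of_mem hx

/-- A positive contravariant form. -/
structure ContraForm (dag : G → G) (ρ : Representation ℂ G M) where
  B : M →ₗ[ℂ] M →ₛₗ[starRingEnd ℂ] ℂ
  contra : ∀ g x y, B (ρ g x) y = B x (ρ (dag g) y)
  definite : ∀ x, B x x = 0 → x = 0

theorem lowerSpan_eq_top (D : CellData G) [FiniteDimensional ℂ W] {π : Representation ℂ G W}
    (hπ : IsIrreducibleRep π) {χ : G → ℂ} {w : W} (hw : w ∈ D.hwSpace π χ) (hw0 : w ≠ 0) :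
    D.lowerSpan π w = ⊤ := by
  rcases hπ.2 _ fun g => D.lowerSpan_stable π hw g with h | h
  · refine absurd ?_ hw0
    have : w ∈ D.lowerSpan π w := Submodule.subset_span ⟨1, D.L.one_mem, by simp⟩
    rwa [h, Submodule.mem_bot] at this
  · exact h

theorem exists_equivariant (D : CellData G) (dag : G → G) (hdag : ∀ g, dag (dag g) = g)
    (hdagL : ∀ l ∈ D.L, dag l ∈ D.U)
    [FiniteDimensional ℂ W] [FiniteDimensional ℂ M]
    {π : Representation ℂ G W} (hπ : IsIrreducibleRep π) {χ : G → ℂ} {w : W}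
    (hw : w ∈ D.hwSpace π χ) (hw0 : w ≠ 0) {ξ : W →ₗ[ℂ] ℂ} (hξ0 : ξ ≠ 0)
    (hξ : ∀ l ∈ D.L, ∀ x, ξ (π l x) = ξ x)
    {ρ : Representation ℂ G M} (F : ContraForm dag ρ) {x : M} (hx : x ∈ D.hwSpace ρ χ) :
    ∃ f ∈ equivariantMaps π ρ, f w = x := by
  have hξw : ξ w ≠ 0 := by
    intro h
    refine hξ0 (LinearMap.ext fun y => ?_)
    have hy : y ∈ D.lowerSpan π w := by rw [lowerSpan_eq_top D hπ hw hw0]; trivial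
    induction hy using Submodule.span_induction with
    | mem y hy =>
      obtain ⟨l, hl, rfl⟩ := hy
      rw [hξ l hl, h, LinearMap.zero_apply]
    | zero => simp
    | add a b _ _ ha hb => rw [map_add, ha, hb, map_add]
    | smul c a _ ha => rw [map_smul, ha, map_smul]
  let ρ' : Representation ℂ G (W × M) :=
    { toFun := fun g => (π g).prodMap (ρ g)
      map_one' := by ext <;> simp
      map_mul' := fun g h => by ext <;> simp }
  have hρ' : ∀ g a b, ρ' g (a, b) = (π g a, ρ g b) := fun g a b => rfl
  have hwx : (w, x) ∈ D.hwSpace ρ' χ := by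
    refine ⟨fun u hu => ?_, fun t ht => ?_⟩
    · rw [hρ', hw.1 u hu, hx.1 u hu]
    · rw [hρ', hw.2 t ht, hx.2 t ht, Prod.smul_mk]
  set E := D.lowerSpan ρ' (w, x) with hE
  have hstable := D.lowerSpan_stable ρ' hwx
  have hF : ∀ p ∈ E, F.B p.2 x * ξ w = F.B x x * ξ p.1 := by
    intro p hp
    induction hp using Submodule.span_induction with
    | mem p hp =>
      obtain ⟨l, hl, rfl⟩ := hp
      rw [hρ']
      simp only
      rw [hξ l hl, F.contra, hx.1 _ (hdagL l hl)]
    | zero => simp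
    | add a b _ _ ha hb =>
      simp only [Prod.fst_add, Prod.snd_add, map_add, LinearMap.add_apply, add_mul, mul_add, ha, hb]
    | smul c a _ ha =>
      simp only [Prod.smul_fst, Prod.smul_snd, map_smul, LinearMap.smul_apply, smul_eq_mul,
        mul_assoc, ha]
      ring
  have hinj : ∀ m, (0, m) ∈ E → m = 0 := by
    intro m hm
    have h1 : ∀ g, F.B m (ρ (dag g) x) = 0 := by
      intro g
      have h2 := hF _ (hstable g _ hm)
      rw [hρ'] at h2
      simp only [map_zero, mul_zero, mul_eq_zero, hξw, or_false] at h2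
      rw [← F.contra, h2]
    have h3 : ∀ p ∈ E, F.B m p.2 = 0 := by
      intro p hp
      induction hp using Submodule.span_induction with
      | mem p hp =>
        obtain ⟨l, hl, rfl⟩ := hp
        rw [hρ', ← hdag l]
        exact h1 _
      | zero => simp
      | add a b _ _ ha hb => rw [Prod.snd_add, map_add, ha, hb, add_zero]
      | smul c a _ ha => rw [Prod.smul_snd, map_smulₛₗ, ha, smul_zero]
    exact F.definite m (h3 _ hm)
  have hbij : Function.Bijective ((LinearMap.fst ℂ W M).domRestrict E) := by
    constructor
    · rw [← LinearMap.ker_eq_bot, LinearMap.ker_eq_bot']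
      rintro ⟨⟨a, m⟩, hp⟩ h
      obtain rfl : a = 0 := h
      simp [hinj m hp]
    · rw [← LinearMap.range_eq_top, LinearMap.range_domRestrict, eq_top_iff,
        ← lowerSpan_eq_top D hπ hw hw0, CellData.lowerSpan, Submodule.span_le]
      rintro _ ⟨l, hl, rfl⟩
      exact ⟨(π l w, ρ l x), Submodule.subset_span ⟨l, hl, rfl⟩, rfl⟩
  let e := LinearEquiv.ofBijective _ hbij
  have he : ∀ p : E, e p = p.1.1 := fun p => rfl
  refine ⟨(LinearMap.snd ℂ W M).domRestrict E ∘ₗ e.symm.toLinearMap, ?_, ?_⟩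
  · intro g
    ext a
    obtain ⟨p, rfl⟩ := e.surjective a
    have : π g (e p) = e ⟨ρ' g p.1, hstable g _ p.2⟩ := rfl
    simp only [LinearMap.comp_apply, this, LinearEquiv.coe_coe, LinearEquiv.symm_apply_apply]
    rfl
  · have : w = e ⟨(w, x), Submodule.subset_span ⟨1, D.L.one_mem, by simp⟩⟩ := rfl
    rw [LinearMap.comp_apply, LinearEquiv.coe_coe, this, LinearEquiv.symm_apply_apply]
    rfl

theorem finrank_equivariantMaps (D : CellData G) (dag : G → G) (hdag : ∀ g, dag (dag g) = g)
    (hdagL : ∀ l ∈ D.L, dag l ∈ D.U) [FiniteDimensional ℂ W] [FiniteDimensional ℂ M]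
    {π : Representation ℂ G W} (hπ : IsIrreducibleRep π) {χ : G → ℂ} {w : W}
    (hw : w ∈ D.hwSpace π χ) (hw0 : w ≠ 0) {ξ : W →ₗ[ℂ] ℂ} (hξ0 : ξ ≠ 0)
    (hξ : ∀ l ∈ D.L, ∀ x, ξ (π l x) = ξ x)
    {ρ : Representation ℂ G M} (F : ContraForm dag ρ) :
    Module.finrank ℂ (equivariantMaps π ρ) = Module.finrank ℂ (D.hwSpace ρ χ) := by
  have heq : ∀ f ∈ equivariantMaps π ρ, ∀ g y, f (π g y) = ρ g (f y) := fun f hf g y =>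
    LinearMap.congr_fun (hf g) y
  let Φ : equivariantMaps π ρ →ₗ[ℂ] D.hwSpace ρ χ :=
    { toFun := fun f => ⟨f.1 w, fun u hu => by rw [← heq f.1 f.2, hw.1 u hu],
        fun t ht => by rw [← heq f.1 f.2, hw.2 t ht, map_smul]⟩
      map_add' := fun f g => rfl
      map_smul' := fun c f => rfl }
  refine (LinearEquiv.ofBijective Φ ⟨?_, ?_⟩).finrank_eq
  · rw [← LinearMap.ker_eq_bot, LinearMap.ker_eq_bot']
    rintro ⟨f, hf⟩ h
    have h0 : f w = 0 := congrArg Subtype.val h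
    refine Subtype.ext (LinearMap.ext fun y => ?_)
    have hy : y ∈ D.lowerSpan π w := by rw [lowerSpan_eq_top D hπ hw hw0]; trivial
    show f y = 0
    induction hy using Submodule.span_induction with
    | mem y hy =>
      obtain ⟨l, hl, rfl⟩ := hy
      rw [heq f hf, h0, map_zero]
    | zero => simp
    | add a b _ _ ha hb => rw [map_add, ha, hb, add_zero]
    | smul c a _ ha => rw [map_smul, ha, smul_zero]
  · rintro ⟨x, hx⟩
    obtain ⟨f, hf, h⟩ := exists_equivariant D dag hdag hdagL hπ hw hw0 hξ0 hξ F hx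
    exact ⟨⟨f, hf⟩, Subtype.ext h⟩

end Cells

section Unipotent

variable {N : ℕ}

/-- Matrices supported on the diagonals of index at least `d`. -/
def SuppFrom (d : ℕ) (A : Matrix (Fin N) (Fin N) ℂ) : Prop :=
  ∀ i j : Fin N, (j : ℕ) < i + d → A i j = 0

theorem SuppFrom.mul {d e : ℕ} {A B : Matrix (Fin N) (Fin N) ℂ} (hA : SuppFrom d A)
    (hB : SuppFrom e B) : SuppFrom (d + e) (A * B) := by
  intro i j h
  rw [Matrix.mul_apply]
  refine Finset.sum_eq_zero fun k _ => ?_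
  by_cases hk : (k : ℕ) < i + d
  · rw [hA i k hk, zero_mul]
  · rw [hB k j (by omega), mul_zero]

theorem SuppFrom.add {d : ℕ} {A B : Matrix (Fin N) (Fin N) ℂ} (hA : SuppFrom d A)
    (hB : SuppFrom d B) : SuppFrom d (A + B) := fun i j h => by
  rw [Matrix.add_apply, hA i j h, hB i j h, add_zero]

theorem SuppFrom.sub {d : ℕ} {A B : Matrix (Fin N) (Fin N) ℂ} (hA : SuppFrom d A)
    (hB : SuppFrom d B) : SuppFrom d (A - B) := fun i j h => by
  rw [Matrix.sub_apply, hA i j h, hB i j h, sub_zero]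

theorem SuppFrom.mono {d e : ℕ} {A : Matrix (Fin N) (Fin N) ℂ} (hA : SuppFrom d A) (h : e ≤ d) :
    SuppFrom e A := fun i j hij => hA i j (by omega)

theorem SuppFrom.one : SuppFrom 0 (1 : Matrix (Fin N) (Fin N) ℂ) := fun i j h =>
  Matrix.one_apply_ne (by rintro rfl; simp at h)

theorem suppFrom_inv {g : GL (Fin N) ℂ} (hg : SuppFrom 0 (g : Matrix (Fin N) (Fin N) ℂ)) :
    SuppFrom 0 ((g⁻¹ : GL (Fin N) ℂ) : Matrix (Fin N) (Fin N) ℂ) := by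
  have h1 : (g : Matrix (Fin N) (Fin N) ℂ).BlockTriangular id := fun i j h => hg i j h
  have : Invertible (g : Matrix (Fin N) (Fin N) ℂ) := g.invertible
  have h2 := Matrix.blockTriangular_inv_of_blockTriangular h1
  intro i j h
  rw [Matrix.coe_units_inv]
  exact h2 h

theorem suppFrom_of_sub_one {d : ℕ} {A : Matrix (Fin N) (Fin N) ℂ} (h : SuppFrom d (A - 1)) :
    SuppFrom 0 A := by
  have := (h.mono (Nat.zero_le d)).add SuppFrom.one
  rwa [sub_add_cancel] at this

theorem suppFrom_pow_sub {d : ℕ} (hd : 1 ≤ d) {A : Matrix (Fin N) (Fin N) ℂ}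
    (h : SuppFrom d (A - 1)) (m : ℕ) : SuppFrom (d + 1) (A ^ m - 1 - (m : ℂ) • (A - 1)) := by
  induction m with
  | zero => intro i j _; simp
  | succ m ih =>
    have h0 : SuppFrom 0 A := suppFrom_of_sub_one h
    have h1 := ih.mul h0
    have h2 := (h.mul h).mono (show d + 1 ≤ d + d by omega)
    have h3 : SuppFrom (d + 1) ((m : ℂ) • ((A - 1) * (A - 1))) := fun i j hij => by
      rw [Matrix.smul_apply, h2 i j hij, smul_zero]
    have : A ^ (m + 1) - 1 - ((m + 1 : ℕ) : ℂ) • (A - 1) =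
        (A ^ m - 1 - (m : ℂ) • (A - 1)) * A + (m : ℂ) • ((A - 1) * (A - 1)) := by
      push_cast
      simp only [sub_mul, mul_sub, smul_sub, add_smul, pow_succ, smul_mul_assoc, one_mul, mul_one,
        one_smul]
      abel
    rw [this]
    exact h1.add h3

theorem spectrum_eq_one_of_forall_pow {S : Set ℂ} (hfin : S.Finite) (h0 : (0 : ℂ) ∉ S)
    (h : ∀ m : ℕ, 0 < m → S = (· ^ m) '' S) : ∀ s ∈ S, s = 1 := by
  have h1 : ∀ s ∈ S, ∃ k : ℕ, 0 < k ∧ s ^ k = 1 := by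
    intro s hs
    have hmem : ∀ k : ℕ, s ^ (k + 1) ∈ S := fun k => by
      rw [h (k + 1) k.succ_pos]; exact ⟨s, hs, rfl⟩
    have hs0 : s ≠ 0 := fun h => h0 (h ▸ hs)
    have hninj : ¬ Function.Injective fun k : ℕ => (⟨s ^ (k + 1), hmem k⟩ : S) := by
      intro hinj
      have := hfin.to_subtype
      exact not_injective_infinite_finite _ hinj
    simp only [Function.Injective, not_forall, Subtype.mk.injEq] at hninj
    obtain ⟨a, b, hab, hne⟩ := hninj
    rcases lt_or_gt_of_ne hne with hlt | hlt
    · refine ⟨b - a, by omega, ?_⟩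
      have : s ^ (b + 1) = s ^ (a + 1) * s ^ (b - a) := by rw [← pow_add]; congr 1; omega
      rw [← hab] at this
      exact (mul_eq_left₀ (pow_ne_zero _ hs0)).1 this.symm
    · refine ⟨a - b, by omega, ?_⟩
      have : s ^ (a + 1) = s ^ (b + 1) * s ^ (a - b) := by rw [← pow_add]; congr 1; omega
      rw [hab] at this
      exact (mul_eq_left₀ (pow_ne_zero _ hs0)).1 this.symm
  choose! k hk0 hk using h1
  intro s hs
  have hm : 0 < ∏ x ∈ hfin.toFinset, k x :=
    Finset.prod_pos fun x hx => hk0 x (hfin.mem_toFinset.1 hx)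
  rw [h _ hm] at hs
  obtain ⟨x, hx, rfl⟩ := hs
  obtain ⟨c, hc⟩ := Finset.dvd_prod_of_mem k (hfin.mem_toFinset.2 hx)
  beta_reduce
  rw [hc, pow_mul, hk x hx, one_pow]

/-- The subgroup contains the torus `diag(z ^ (N - 1), z ^ (N - 3), …)`. -/
def HasPrincipalTorus (H : Subgroup (GL (Fin N) ℂ)) : Prop :=
  ∀ z : ℂ, z ≠ 0 → ∃ t ∈ H, (t : Matrix (Fin N) (Fin N) ℂ) =
    Matrix.diagonal fun i : Fin N => z ^ ((N : ℤ) - 1 - 2 * ((i : ℕ) : ℤ))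

variable {V : Type*} [AddCommGroup V] [Module ℂ V]

/-- The vectors fixed by the elements supported on the diagonals `0` and at least `d`. -/
def fixedFrom (H : Subgroup (GL (Fin N) ℂ)) (ρ : Representation ℂ H V) (d : ℕ) :
    Submodule ℂ V where
  carrier := {x | ∀ h : H, SuppFrom d (((h : GL (Fin N) ℂ) : Matrix (Fin N) (Fin N) ℂ) - 1) →
    ρ h x = x}
  add_mem' := fun hx hy h hh => by rw [LinearMap.map_add, hx h hh, hy h hh]
  zero_mem' := fun h _ => map_zero _
  smul_mem' := fun c x hx h hh => by rw [map_smul, hx h hh]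

theorem apply_eq_of_suppFrom {H : Subgroup (GL (Fin N) ℂ)} {ρ : Representation ℂ H V} {d : ℕ}
    {x : V} (hx : x ∈ fixedFrom H ρ d) {a b : H}
    (hb : SuppFrom 0 ((b : GL (Fin N) ℂ) : Matrix (Fin N) (Fin N) ℂ))
    (h : SuppFrom d (((a : GL (Fin N) ℂ) : Matrix (Fin N) (Fin N) ℂ) -
      ((b : GL (Fin N) ℂ) : Matrix (Fin N) (Fin N) ℂ))) : ρ a x = ρ b x := by
  have h1 : ρ (b⁻¹ * a) x = x := by
    refine hx _ ?_
    have h2 := (suppFrom_inv hb).mul h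
    rw [zero_add, mul_sub, ← Units.val_mul, ← Units.val_mul, inv_mul_cancel] at h2
    exact h2
  conv_rhs => rw [← h1]
  rw [← Module.End.mul_apply, ← map_mul, mul_inv_cancel_left]

theorem fixedFrom_stable {H : Subgroup (GL (Fin N) ℂ)} {ρ : Representation ℂ H V} {d : ℕ}
    {x : V} (hx : x ∈ fixedFrom H ρ d) {g : H}
    (hg : SuppFrom 0 ((g : GL (Fin N) ℂ) : Matrix (Fin N) (Fin N) ℂ)) :
    ρ g x ∈ fixedFrom H ρ d := by
  intro h hh
  rw [← Module.End.mul_apply, ← map_mul]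
  refine apply_eq_of_suppFrom hx hg ?_
  have h2 := hh.mul hg
  rw [sub_mul, one_mul, add_zero, ← Units.val_mul] at h2
  exact h2

theorem exists_fixed_step [FiniteDimensional ℂ V] {H : Subgroup (GL (Fin N) ℂ)}
    (hH : HasPrincipalTorus H) (ρ : Representation ℂ H V) {d : ℕ} (hd : 1 ≤ d)
    (h : fixedFrom H ρ (d + 1) ≠ ⊥) : fixedFrom H ρ d ≠ ⊥ := by
  set X := fixedFrom H ρ (d + 1) with hX
  -- eigenvalues on `X` are equal to one
  have hspec : ∀ g : H, SuppFrom d (((g : GL (Fin N) ℂ) : Matrix (Fin N) (Fin N) ℂ) - 1) →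
      ∀ x ∈ X, x ≠ 0 → ∀ c : ℂ, ρ g x = c • x → c = 1 := by
    intro g hg x hx hx0 c hc
    have hg0 := suppFrom_of_sub_one hg
    have hres : ∀ k : H, SuppFrom 0 ((k : GL (Fin N) ℂ) : Matrix (Fin N) (Fin N) ℂ) →
      ∀ y ∈ X, ρ k y ∈ X := fun k hk y hy => fixedFrom_stable hy hk
    have hginv : SuppFrom 0 (((g⁻¹ : H) : GL (Fin N) ℂ) : Matrix (Fin N) (Fin N) ℂ) :=
      suppFrom_inv hg0
    let gX : Module.End ℂ X := (ρ g).restrict (hres g hg0)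
    have hgX : ∀ y : X, (gX y : V) = ρ g y := fun y => rfl
    have hgXpow : ∀ (m : ℕ) (y : X), ((gX ^ m) y : V) = ρ (g ^ m) y := by
      intro m
      induction m with
      | zero => intro y; simp
      | succ m ih =>
        intro y
        rw [pow_succ, Module.End.mul_apply, ih, hgX, pow_succ, map_mul, Module.End.mul_apply]
    have hmem : c ∈ spectrum ℂ gX := by
      rw [← Module.End.hasEigenvalue_iff_mem_spectrum]
      refine Module.End.hasEigenvalue_of_hasEigenvector (x := ⟨x, hx⟩) ?_
      rw [Module.End.hasEigenvector_iff, Module.End.mem_eigenspace_iff]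
      refine ⟨Subtype.ext ?_, fun h0 => hx0 (congrArg Subtype.val h0)⟩
      rw [hgX]; exact hc
    refine spectrum_eq_one_of_forall_pow (Module.End.finite_spectrum gX) ?_ ?_ c hmem
    · intro h0
      rw [← Module.End.hasEigenvalue_iff_mem_spectrum] at h0
      obtain ⟨y, hy⟩ := h0.exists_hasEigenvector
      have h1 : ρ g y = 0 := by
        rw [← hgX, hy.apply_eq_smul, zero_smul]; rfl
      refine hy.2 (Subtype.ext ?_)
      have h2 : ρ g⁻¹ (ρ g y) = y := by
        rw [← Module.End.mul_apply, ← map_mul]; simp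
      rw [← h2, h1, map_zero]; rfl
    · intro m hm
      have hm0 : (m : ℂ) ≠ 0 := by exact_mod_cast hm.ne'
      obtain ⟨z, hz⟩ := IsAlgClosed.exists_pow_nat_eq (m : ℂ) (show 0 < 2 * d by omega)
      have hz0 : z ≠ 0 := by
        rintro rfl
        rw [zero_pow (by omega)] at hz
        exact hm0 hz.symm
      obtain ⟨t, htH, ht⟩ := hH z hz0
      have htd : SuppFrom 0 (t : Matrix (Fin N) (Fin N) ℂ) := by
        intro i j hij
        rw [ht, Matrix.diagonal_apply_ne]
        rintro rfl
        simp at hij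
      have htinv : SuppFrom 0 ((t⁻¹ : GL (Fin N) ℂ) : Matrix (Fin N) (Fin N) ℂ) :=
        suppFrom_inv htd
      let u : (Module.End ℂ X)ˣ :=
        { val := (ρ ⟨t, htH⟩).restrict (hres ⟨t, htH⟩ htd)
          inv := (ρ (⟨t, htH⟩⁻¹ : H)).restrict (hres _ htinv)
          val_inv := by
            ext y
            show ρ _ (ρ _ (y : V)) = y
            rw [← Module.End.mul_apply, ← map_mul]; simp
          inv_val := by
            ext y
            show ρ _ (ρ _ (y : V)) = y
            rw [← Module.End.mul_apply, ← map_mul]; simp }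
      have hconj : (u : Module.End ℂ X) * gX * (u⁻¹ : (Module.End ℂ X)ˣ) = gX ^ m := by
        ext y
        rw [hgXpow]
        show ρ _ (ρ g (ρ _ (y : V))) = _
        rw [← Module.End.mul_apply, ← Module.End.mul_apply, ← map_mul, ← map_mul]
        have hpow : SuppFrom 0 (((g ^ m : H) : GL (Fin N) ℂ) : Matrix (Fin N) (Fin N) ℂ) := by
          have : ∀ k : ℕ, SuppFrom 0 (((g ^ k : H) : GL (Fin N) ℂ) : Matrix (Fin N) (Fin N) ℂ) := by
            intro k
            induction k with
            | zero => simpa using SuppFrom.one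
            | succ k ih => rw [pow_succ]; exact ih.mul hg0
          exact this m
        refine apply_eq_of_suppFrom y.2 hpow ?_
        have h1 := suppFrom_pow_sub hd hg m
        set A := ((g : GL (Fin N) ℂ) : Matrix (Fin N) (Fin N) ℂ) with hA
        have h2 : SuppFrom (d + 1) ((t : Matrix (Fin N) (Fin N) ℂ) * A *
            ((t⁻¹ : GL (Fin N) ℂ) : Matrix (Fin N) (Fin N) ℂ) - 1 -
            (m : ℂ) • (A - 1)) := by
          have hti : ((t⁻¹ : GL (Fin N) ℂ) : Matrix (Fin N) (Fin N) ℂ) =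
              Matrix.diagonal fun i : Fin N => (z ^ ((N : ℤ) - 1 - 2 * ((i : ℕ) : ℤ)))⁻¹ := by
            rw [Matrix.coe_units_inv]
            refine Matrix.inv_eq_right_inv ?_
            rw [ht, Matrix.diagonal_mul_diagonal, ← Matrix.diagonal_one]
            congr 1
            funext i
            exact mul_inv_cancel₀ (zpow_ne_zero _ hz0)
          have h3 : (t : Matrix (Fin N) (Fin N) ℂ) * A *
              ((t⁻¹ : GL (Fin N) ℂ) : Matrix (Fin N) (Fin N) ℂ) - 1 =
              (t : Matrix (Fin N) (Fin N) ℂ) * (A - 1) *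
                ((t⁻¹ : GL (Fin N) ℂ) : Matrix (Fin N) (Fin N) ℂ) := by
            rw [mul_sub, sub_mul, mul_one, ← Units.val_mul t t⁻¹, mul_inv_cancel, Units.val_one]
          rw [h3, ht, hti]
          intro i j hij
          rw [Matrix.sub_apply, Matrix.mul_diagonal, Matrix.diagonal_mul, Matrix.smul_apply]
          rcases Nat.lt_or_ge j (i + d) with hlt | hge
          · rw [hg i j hlt]; simp
          · have hj : ((j : ℕ) : ℤ) = ((i : ℕ) : ℤ) + d := by omega
            rw [hj]
            have : z ^ ((N : ℤ) - 1 - 2 * ((i : ℕ) : ℤ)) *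
                (z ^ ((N : ℤ) - 1 - 2 * (((i : ℕ) : ℤ) + d)))⁻¹ =
                m := by
              rw [← hz, ← _root_.zpow_neg, ← zpow_add₀ hz0, ← zpow_natCast]
              congr 1
              push_cast
              ring
            rw [mul_right_comm, this, smul_eq_mul, sub_self]
        have h4 := h2.sub h1
        have h5 : (t : Matrix (Fin N) (Fin N) ℂ) * A *
            ((t⁻¹ : GL (Fin N) ℂ) : Matrix (Fin N) (Fin N) ℂ) - A ^ m =
          (t : Matrix (Fin N) (Fin N) ℂ) * A *
            ((t⁻¹ : GL (Fin N) ℂ) : Matrix (Fin N) (Fin N) ℂ) - 1 - (m : ℂ) • (A - 1) -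
            (A ^ m - 1 - (m : ℂ) • (A - 1)) := by abel
        rw [← h5] at h4
        exact h4
      have h6 := spectrum.map_pow_of_pos (𝕜 := ℂ) gX hm
      rw [← hconj, spectrum.units_conjugate] at h6
      exact h6
  have hcomm : ∀ g k : H, SuppFrom d (((g : GL (Fin N) ℂ) : Matrix (Fin N) (Fin N) ℂ) - 1) →
      SuppFrom d (((k : GL (Fin N) ℂ) : Matrix (Fin N) (Fin N) ℂ) - 1) →
      ∀ x ∈ X, ρ g (ρ k x) = ρ k (ρ g x) := by
    intro g k hg hk x hx
    rw [← Module.End.mul_apply, ← Module.End.mul_apply, ← map_mul, ← map_mul]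
    refine apply_eq_of_suppFrom hx ?_ ?_
    · exact (suppFrom_of_sub_one hk).mul (suppFrom_of_sub_one hg)
    · have h1 := ((hg.mul hk).sub (hk.mul hg)).mono (show d + 1 ≤ d + d by omega)
      convert h1 using 1
      simp only [Subgroup.coe_mul, Units.val_mul]
      noncomm_ring
  obtain ⟨E, ⟨hEX, hE0, hEs⟩, hmin⟩ := IsArtinian.set_has_minimal
    {E : Submodule ℂ V | E ≤ X ∧ E ≠ ⊥ ∧ ∀ g : H,
      SuppFrom d (((g : GL (Fin N) ℂ) : Matrix (Fin N) (Fin N) ℂ) - 1) → ∀ x ∈ E, ρ g x ∈ E}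
    ⟨X, le_rfl, h, fun g hg x hx => fixedFrom_stable hx (suppFrom_of_sub_one hg)⟩
  have hEfix : E ≤ fixedFrom H ρ d := by
    intro x hx g hg
    have : Nontrivial E := Submodule.nontrivial_iff_ne_bot.2 hE0
    obtain ⟨c, hc⟩ := Module.End.exists_eigenvalue ((ρ g).restrict (hEs g hg))
    obtain ⟨y, hy⟩ := hc.exists_hasEigenvector
    have hy1 : ρ g (y : V) = c • (y : V) := congrArg Subtype.val hy.apply_eq_smul
    have hy0 : (y : V) ≠ 0 := fun h0 => hy.2 (Subtype.ext h0)
    have hc1 := hspec g hg y (hEX y.2) hy0 c hy1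
    rw [hc1, one_smul] at hy1
    let E1 : Submodule ℂ V := E ⊓ LinearMap.ker (ρ g - 1)
    have hmem : ∀ v, v ∈ E1 ↔ v ∈ E ∧ ρ g v = v := by
      intro v
      simp [E1, sub_eq_zero]
    have hE1 : E1 = E := by
      by_contra hne
      refine hmin E1 ⟨inf_le_left.trans hEX, ?_, ?_⟩ (lt_of_le_of_ne inf_le_left hne)
      · exact (Submodule.ne_bot_iff _).2 ⟨y, (hmem _).2 ⟨y.2, hy1⟩, hy0⟩
      · intro k hk v hv
        rw [hmem] at hv ⊢
        refine ⟨hEs k hk v hv.1, ?_⟩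
        rw [hcomm g k hg hk v (hEX hv.1), hv.2]
    rw [← hE1, hmem] at hx
    exact hx.2
  exact ne_bot_of_le_ne_bot hE0 hEfix

theorem exists_fixed_of_hasPrincipalTorus [FiniteDimensional ℂ V] [Nontrivial V]
    {H : Subgroup (GL (Fin N) ℂ)} (hH : HasPrincipalTorus H) (ρ : Representation ℂ H V) :
    ∃ v ≠ 0, ∀ h : H, IsUpperUni ((h : GL (Fin N) ℂ) : Matrix (Fin N) (Fin N) ℂ) → ρ h v = v := by
  have key : ∀ k d : ℕ, 1 ≤ d → N ≤ d + k → fixedFrom H ρ d ≠ ⊥ := by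
    intro k
    induction k with
    | zero =>
      intro d _ hd
      have : fixedFrom H ρ d = ⊤ := by
        rw [eq_top_iff]
        intro x _ h hh
        have : h = 1 := by
          ext i j
          have := hh i j (by omega)
          rw [Matrix.sub_apply, sub_eq_zero] at this
          exact this
        rw [this, map_one, Module.End.one_apply]
      rw [this]
      exact top_ne_bot
    | succ k ih =>
      intro d h1 hd
      exact exists_fixed_step hH ρ h1 (ih (d + 1) (by omega) (by omega))
  obtain ⟨v, hv, hv0⟩ := (Submodule.ne_bot_iff _).1 (key N 1 le_rfl (by omega))
  refine ⟨v, hv0, fun h hh => hv h fun i j hij => ?_⟩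
  rw [Matrix.sub_apply]
  rcases eq_or_ne i j with rfl | hne
  · rw [hh.1, Matrix.one_apply_eq, sub_self]
  · rw [hh.2 i j (by have := Fin.val_ne_of_ne hne; omega), Matrix.one_apply_ne hne, sub_self]

end Unipotent

section LeadingMinors

open Finset

variable {R S : Type*} [CommRing R] [CommRing S] {N m p : ℕ}

/-- The entries of a matrix, extended by zero. -/
def extM (X : Matrix (Fin N) (Fin m) R) (i j : ℕ) : R :=
  if h : i < N ∧ j < m then X ⟨i, h.1⟩ ⟨j, h.2⟩ else 0

@[simp] theorem extM_val (X : Matrix (Fin N) (Fin m) R) (i : Fin N) (j : Fin m) :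
    extM X i j = X i j := by simp [extM]

theorem extM_of_lt (X : Matrix (Fin N) (Fin m) R) {i j : ℕ} (hi : i < N) (hj : j < m) :
    extM X i j = X ⟨i, hi⟩ ⟨j, hj⟩ := by simp [extM, hi, hj]

theorem extM_mul (X : Matrix (Fin N) (Fin m) R) (Y : Matrix (Fin m) (Fin p) R) (i j : ℕ) :
    extM (X * Y) i j = ∑ a ∈ range m, extM X i a * extM Y a j := by
  rw [← Fin.sum_univ_eq_sum_range (fun a => extM X i a * extM Y a j)]
  by_cases h : i < N ∧ j < p
  · simp [extM, h, Matrix.mul_apply]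
  · rw [extM, dif_neg h]
    symm
    refine sum_eq_zero fun a _ => ?_
    rcases not_and_or.1 h with h | h <;> simp [extM, h]

/-- The leading square submatrix of size `k`. -/
def leadBlock (X : Matrix (Fin N) (Fin m) R) (k : ℕ) : Matrix (Fin k) (Fin k) R :=
  Matrix.of fun i j => extM X i j

/-- The leading principal minors. -/
def lead (X : Matrix (Fin N) (Fin m) R) (k : ℕ) : R := (leadBlock X k).det

theorem map_lead (f : R →+* S) (X : Matrix (Fin N) (Fin m) R) (k : ℕ) :
    f (lead X k) = lead (X.map f) k := by
  rw [lead, lead, RingHom.map_det]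
  congr 1
  ext i j
  simp only [leadBlock, RingHom.mapMatrix_apply, Matrix.map_apply, Matrix.of_apply, extM]
  split_ifs <;> simp

theorem leadBlock_mul_of_lower (l : Matrix (Fin N) (Fin N) R) (X : Matrix (Fin N) (Fin m) R)
    (hl : ∀ i j : Fin N, (i : ℕ) < j → l i j = 0) {k : ℕ} (hk : k ≤ N) :
    leadBlock (l * X) k = leadBlock l k * leadBlock X k := by
  ext i j
  rw [Matrix.mul_apply]
  simp only [leadBlock, Matrix.of_apply]
  rw [extM_mul, Fin.sum_univ_eq_sum_range (fun a => extM l i a * extM X a j)]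
  symm
  refine sum_subset (range_subset_range.2 hk) fun a ha hak => ?_
  rw [mem_range] at ha hak
  rw [extM_of_lt l (i.2.trans_le hk) ha, hl _ _ (show (i : ℕ) < a by omega), zero_mul]

theorem leadBlock_mul_of_upper (X : Matrix (Fin N) (Fin m) R) (b : Matrix (Fin m) (Fin m) R)
    (hb : ∀ i j : Fin m, (j : ℕ) < i → b i j = 0) {k : ℕ} (hk : k ≤ m) :
    leadBlock (X * b) k = leadBlock X k * leadBlock b k := by
  ext i j
  rw [Matrix.mul_apply]
  simp only [leadBlock, Matrix.of_apply]
  rw [extM_mul, Fin.sum_univ_eq_sum_range (fun a => extM X i a * extM b a j)]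
  symm
  refine sum_subset (range_subset_range.2 hk) fun a ha hak => ?_
  rw [mem_range] at ha hak
  rw [extM_of_lt b ha (j.2.trans_le hk), hb _ _ (show (j : ℕ) < a by omega), mul_zero]

theorem lead_of_upper (b : Matrix (Fin N) (Fin m) R)
    (hb : ∀ (i : Fin N) (j : Fin m), (j : ℕ) < i → b i j = 0) (k : ℕ) :
    lead b k = ∏ i ∈ range k, extM b i i := by
  rw [lead, Matrix.det_of_isUpperTriangular, ← Fin.prod_univ_eq_prod_range (fun i => extM b i i)]
  · rfl
  · intro i j h
    simp only [leadBlock, Matrix.of_apply, extM]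
    split_ifs with h'
    · exact hb _ _ h
    · rfl

theorem lead_of_lower (b : Matrix (Fin N) (Fin m) R)
    (hb : ∀ (i : Fin N) (j : Fin m), (i : ℕ) < j → b i j = 0) (k : ℕ) :
    lead b k = ∏ i ∈ range k, extM b i i := by
  rw [lead, Matrix.det_of_isLowerTriangular, ← Fin.prod_univ_eq_prod_range (fun i => extM b i i)]
  · rfl
  · intro i j h
    simp only [leadBlock, Matrix.of_apply, extM]
    split_ifs with h'
    · exact hb _ _ h
    · rfl

end LeadingMinors

section Factorization

variable {N m : ℕ}

/-- Lower triangular unipotent matrices. -/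
def IsLowerUni (A : Matrix (Fin N) (Fin N) ℂ) : Prop :=
  (∀ i, A i i = 1) ∧ ∀ i j : Fin N, (i : ℕ) < (j : ℕ) → A i j = 0

theorem IsLowerUni.lead_eq_one {A : Matrix (Fin N) (Fin N) ℂ} (hA : IsLowerUni A) {k : ℕ}
    (hk : k ≤ N) : lead A k = 1 := by
  rw [lead_of_lower A hA.2]
  refine Finset.prod_eq_one fun i hi => ?_
  have := (Finset.mem_range.1 hi).trans_le hk
  rw [extM_of_lt A this this, hA.1]

theorem IsLowerUni.det_eq_one {A : Matrix (Fin N) (Fin N) ℂ} (hA : IsLowerUni A) : A.det = 1 := by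
  rw [Matrix.det_of_isLowerTriangular _ (fun i j h => hA.2 i j h)]
  exact Finset.prod_eq_one fun i _ => hA.1 i

theorem isUpperUni_transpose {A : Matrix (Fin N) (Fin N) ℂ} : IsUpperUni Aᵀ ↔ IsLowerUni A :=
  and_congr Iff.rfl ⟨fun h i j hij => h j i hij, fun h i j hij => h j i hij⟩

theorem isUpperUni_iff {A : Matrix (Fin N) (Fin N) ℂ} : IsUpperUni A ↔ SuppFrom 1 (A - 1) := by
  constructor
  · intro hh i j hij
    rw [Matrix.sub_apply]
    rcases eq_or_ne i j with rfl | hne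
    · rw [hh.1, Matrix.one_apply_eq, sub_self]
    · rw [hh.2 i j (by have := Fin.val_ne_of_ne hne; omega), Matrix.one_apply_ne hne, sub_self]
  · intro h
    constructor
    · intro i
      have := h i i (by omega)
      rwa [Matrix.sub_apply, Matrix.one_apply_eq, sub_eq_zero] at this
    · intro i j hij
      have := h i j (by omega)
      rwa [Matrix.sub_apply, Matrix.one_apply_ne (by rintro rfl; simp at hij), sub_eq_zero] at this

theorem IsUpperUni.mul {A B : Matrix (Fin N) (Fin N) ℂ} (hA : IsUpperUni A) (hB : IsUpperUni B) :
    IsUpperUni (A * B) := by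
  rw [isUpperUni_iff] at *
  have h := (hA.mul (suppFrom_of_sub_one hB)).add hB
  rwa [sub_mul, one_mul, sub_add_sub_cancel] at h

theorem IsUpperUni.one : IsUpperUni (1 : Matrix (Fin N) (Fin N) ℂ) :=
  isUpperUni_iff.2 fun i j _ => by simp

theorem IsUpperUni.inv {g : GL (Fin N) ℂ} (hg : IsUpperUni (g : Matrix (Fin N) (Fin N) ℂ)) :
    IsUpperUni ((g⁻¹ : GL (Fin N) ℂ) : Matrix (Fin N) (Fin N) ℂ) := by
  rw [isUpperUni_iff] at *
  have h := (suppFrom_inv (suppFrom_of_sub_one hg)).mul hg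
  rw [mul_sub, ← Units.val_mul, inv_mul_cancel, Units.val_one, mul_one, zero_add] at h
  have h2 : SuppFrom 1 (0 - (1 - ((g⁻¹ : GL (Fin N) ℂ) : Matrix (Fin N) (Fin N) ℂ))) :=
    SuppFrom.sub (fun i j _ => rfl) h
  rwa [zero_sub, neg_sub] at h2

theorem IsLowerUni.mul {A B : Matrix (Fin N) (Fin N) ℂ} (hA : IsLowerUni A) (hB : IsLowerUni B) :
    IsLowerUni (A * B) := by
  rw [← isUpperUni_transpose] at *
  rw [Matrix.transpose_mul]
  exact hB.mul hA

theorem IsLowerUni.one : IsLowerUni (1 : Matrix (Fin N) (Fin N) ℂ) :=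
  isUpperUni_transpose.1 (by rw [Matrix.transpose_one]; exact IsUpperUni.one)

/-- The transpose as an element of the general linear group. -/
def glT (g : GL (Fin N) ℂ) : GL (Fin N) ℂ where
  val := (g : Matrix (Fin N) (Fin N) ℂ)ᵀ
  inv := ((g⁻¹ : GL (Fin N) ℂ) : Matrix (Fin N) (Fin N) ℂ)ᵀ
  val_inv := by rw [← Matrix.transpose_mul, ← Units.val_mul]; simp
  inv_val := by rw [← Matrix.transpose_mul, ← Units.val_mul]; simp

@[simp] theorem coe_glT (g : GL (Fin N) ℂ) :
    (glT g : Matrix (Fin N) (Fin N) ℂ) = (g : Matrix (Fin N) (Fin N) ℂ)ᵀ := rfl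

theorem IsLowerUni.inv {g : GL (Fin N) ℂ} (hg : IsLowerUni (g : Matrix (Fin N) (Fin N) ℂ)) :
    IsLowerUni ((g⁻¹ : GL (Fin N) ℂ) : Matrix (Fin N) (Fin N) ℂ) := by
  rw [← isUpperUni_transpose] at *
  exact IsUpperUni.inv (g := glT g) hg

/-- A rectangular matrix with non-zero leading minors is the product of a lower triangular
unipotent and of an upper triangular matrix. -/
theorem exists_lower_mul_upper (hm : m ≤ N) (X : Matrix (Fin N) (Fin m) ℂ)
    (hX : ∀ k ≤ m, lead X k ≠ 0) :
    ∃ l : GL (Fin N) ℂ, IsLowerUni (l : Matrix (Fin N) (Fin N) ℂ) ∧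
      ∃ b : Matrix (Fin N) (Fin m) ℂ, (∀ (i : Fin N) (j : Fin m), (j : ℕ) < i → b i j = 0) ∧
      X = (l : Matrix (Fin N) (Fin N) ℂ) * b := by
  have hsolve : ∀ i : Fin N, ∃ c : Fin N → ℂ, (∀ a : Fin N, (i : ℕ) ≤ a → c a = 0) ∧
      ∀ j : Fin m, (j : ℕ) < i → ∑ a, c a * X a j = - X i j := by
    intro i
    set k := min (i : ℕ) m with hk
    have hdet : IsUnit (leadBlock X k).det := (hX k (min_le_right _ _)).isUnit
    have hkN : k ≤ N := (min_le_right _ _).trans hm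
    let y : Fin k → ℂ := fun j => - extM X i j
    let c' := y ᵥ* (leadBlock X k)⁻¹
    have hc' : c' ᵥ* leadBlock X k = y := by
      rw [Matrix.vecMul_vecMul, Matrix.nonsing_inv_mul _ hdet, Matrix.vecMul_one]
    refine ⟨fun a => if h : (a : ℕ) < k then c' ⟨a, h⟩ else 0, fun a ha => ?_, fun j hj => ?_⟩
    · exact dif_neg (by omega)
    · have hjk : (j : ℕ) < k := by omega
      have h1 := congrFun hc' ⟨j, hjk⟩
      simp only [Matrix.vecMul, dotProduct, leadBlock, Matrix.of_apply, y, extM_val] at h1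
      rw [← h1]
      let F : ℕ → ℂ := fun q => (if h : q < k then c' ⟨q, h⟩ else 0) * extM X q j
      have h2 : ∀ a : Fin N, (if h : (a : ℕ) < k then c' ⟨a, h⟩ else 0) * X a j = F a :=
        fun a => by simp [F]
      have h3 : ∀ a : Fin k, c' a * extM X a j = F a := fun a => by simp [F]
      rw [Finset.sum_congr rfl fun a _ => h2 a, Finset.sum_congr rfl fun a _ => h3 a,
        Fin.sum_univ_eq_sum_range F, Fin.sum_univ_eq_sum_range F]
      symm
      refine Finset.sum_subset (Finset.range_subset_range.2 hkN) fun q _ hq => ?_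
      rw [Finset.mem_range] at hq
      simp [F, hq]
  choose c hc0 hc using hsolve
  let A : Matrix (Fin N) (Fin N) ℂ :=
    Matrix.of fun i a => (1 : Matrix (Fin N) (Fin N) ℂ) i a + c i a
  have hA : IsLowerUni A := by
    constructor
    · intro i; simp [A, hc0 i i le_rfl]
    · intro i j hij
      simp [A, hc0 i j hij.le, Matrix.one_apply_ne (show i ≠ j by rintro rfl; simp at hij)]
  let g : GL (Fin N) ℂ := Matrix.GeneralLinearGroup.mkOfDetNeZero A (by rw [hA.det_eq_one]; simp)
  have hg : (g : Matrix (Fin N) (Fin N) ℂ) = A := rfl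
  refine ⟨g⁻¹, IsLowerUni.inv (hg ▸ hA), A * X, fun i j hij => ?_, ?_⟩
  · rw [Matrix.mul_apply]
    simp only [A, Matrix.of_apply, add_mul, Finset.sum_add_distrib, hc i j hij]
    simp [Matrix.one_apply]
  · rw [← hg, ← Matrix.mul_assoc, ← Units.val_mul, inv_mul_cancel, Units.val_one, Matrix.one_mul]

theorem exists_LDU (g : GL (Fin N) ℂ)
    (hg : ∀ k ≤ N, lead (g : Matrix (Fin N) (Fin N) ℂ) k ≠ 0) :
    ∃ l t u : GL (Fin N) ℂ, IsLowerUni (l : Matrix (Fin N) (Fin N) ℂ) ∧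
      (∃ d, (t : Matrix (Fin N) (Fin N) ℂ) = Matrix.diagonal d) ∧
      IsUpperUni (u : Matrix (Fin N) (Fin N) ℂ) ∧ g = l * t * u := by
  obtain ⟨l, hl, b, hb, h⟩ := exists_lower_mul_upper le_rfl _ hg
  let d : Fin N → ℂ := fun i => b i i
  have hb' : b = ((l⁻¹ * g : GL (Fin N) ℂ) : Matrix (Fin N) (Fin N) ℂ) := by
    rw [Units.val_mul, h, ← Matrix.mul_assoc, ← Units.val_mul, inv_mul_cancel, Units.val_one,
      Matrix.one_mul]
  have hd : ∀ i, d i ≠ 0 := by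
    have h1 : b.det ≠ 0 := by rw [hb']; exact ((l⁻¹ * g).isUnit.map Matrix.detMonoidHom).ne_zero
    rw [Matrix.det_of_isUpperTriangular (fun i j h => hb i j h), Finset.prod_ne_zero_iff] at h1
    exact fun i => h1 i (Finset.mem_univ i)
  let t : GL (Fin N) ℂ := Matrix.GeneralLinearGroup.mkOfDetNeZero (Matrix.diagonal d) (by
    rw [Matrix.det_diagonal]; exact Finset.prod_ne_zero_iff.2 fun i _ => hd i)
  have ht : (t : Matrix (Fin N) (Fin N) ℂ) = Matrix.diagonal d := rfl
  have htinv : ((t⁻¹ : GL (Fin N) ℂ) : Matrix (Fin N) (Fin N) ℂ) =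
      Matrix.diagonal fun i => (d i)⁻¹ := by
    rw [Matrix.coe_units_inv]
    refine Matrix.inv_eq_right_inv ?_
    rw [ht, Matrix.diagonal_mul_diagonal, ← Matrix.diagonal_one]
    congr 1
    funext i
    exact mul_inv_cancel₀ (hd i)
  refine ⟨l, t, t⁻¹ * (l⁻¹ * g), hl, ⟨d, ht⟩, ?_, by group⟩
  rw [Units.val_mul, ← hb', htinv]
  refine ⟨fun i => ?_, fun i j hij => ?_⟩
  · rw [Matrix.diagonal_mul]; exact inv_mul_cancel₀ (hd i)
  · rw [Matrix.diagonal_mul, hb i j hij, mul_zero]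

theorem finite_lead_eq_zero (E l : Matrix (Fin N) (Fin N) ℂ) (hl : IsLowerUni l) :
    {c : ℂ | ∃ k ≤ N, lead ((1 + c • E) * l) k = 0}.Finite := by
  let M : Matrix (Fin N) (Fin N) (Polynomial ℂ) :=
    l.map Polynomial.C + (Polynomial.X : Polynomial ℂ) • (E * l).map Polynomial.C
  have hM : ∀ c : ℂ, M.map (Polynomial.evalRingHom c) = (1 + c • E) * l := by
    intro c
    ext i j
    simp only [M, Matrix.map_apply, Matrix.add_apply, Matrix.smul_apply, map_add, add_mul]
    simp [mul_comm c]
  have hM0 : ∀ k ≤ N, lead M k ≠ 0 := by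
    intro k hk h0
    have h1 := map_lead (Polynomial.evalRingHom 0) M k
    rw [hM, h0, zero_smul, add_zero, one_mul, hl.lead_eq_one hk] at h1
    simp at h1
  have hfin : (⋃ k ∈ Finset.range (N + 1), {c : ℂ | (lead M k).IsRoot c}).Finite := by
    refine Set.Finite.biUnion (Finset.finite_toSet _) fun k hk => ?_
    exact Polynomial.finite_setOfPred_isRoot (hM0 k (by simpa [Nat.lt_succ_iff] using hk))
  refine hfin.subset ?_
  rintro c ⟨k, hk, h⟩
  simp only [Set.mem_iUnion]
  refine ⟨k, by simpa [Nat.lt_succ_iff] using hk, ?_⟩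
  show Polynomial.eval c _ = 0
  rw [← hM, ← map_lead] at h
  exact h

end Factorization

section Subgroups

variable {N : ℕ}

theorem diagonal_inv_eq {t : GL (Fin N) ℂ} {d : Fin N → ℂ}
    (ht : (t : Matrix (Fin N) (Fin N) ℂ) = Matrix.diagonal d) :
    (∀ i, d i ≠ 0) ∧
    ((t⁻¹ : GL (Fin N) ℂ) : Matrix (Fin N) (Fin N) ℂ) = Matrix.diagonal fun i => (d i)⁻¹ := by
  have hd : ∀ i, d i ≠ 0 := by
    have h1 : (Matrix.diagonal d).det ≠ 0 := by
      rw [← ht]; exact (t.isUnit.map Matrix.detMonoidHom).ne_zero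
    rw [Matrix.det_diagonal, Finset.prod_ne_zero_iff] at h1
    exact fun i => h1 i (Finset.mem_univ i)
  refine ⟨hd, ?_⟩
  rw [Matrix.coe_units_inv]
  refine Matrix.inv_eq_right_inv ?_
  rw [ht, Matrix.diagonal_mul_diagonal, ← Matrix.diagonal_one]
  congr 1
  funext i
  exact mul_inv_cancel₀ (hd i)

/-- The underlying matrix of an element of a subgroup of the general linear group. -/
abbrev matOf {H : Subgroup (GL (Fin N) ℂ)} (h : H) : Matrix (Fin N) (Fin N) ℂ :=
  ((h : GL (Fin N) ℂ) : Matrix (Fin N) (Fin N) ℂ)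

theorem matOf_injective {H : Subgroup (GL (Fin N) ℂ)} :
    Function.Injective (matOf : H → Matrix (Fin N) (Fin N) ℂ) := fun _ _ h =>
  Subtype.ext (Units.ext h)

/-- The lower triangular unipotent elements of `H`. -/
def lowerSub (H : Subgroup (GL (Fin N) ℂ)) : Subgroup H where
  carrier := {h | IsLowerUni (matOf h)}
  mul_mem' := fun ha hb => ha.mul hb
  one_mem' := IsLowerUni.one
  inv_mem' := fun ha => IsLowerUni.inv ha

/-- The upper triangular unipotent elements of `H`. -/
def upperSub (H : Subgroup (GL (Fin N) ℂ)) : Subgroup H where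
  carrier := {h | IsUpperUni (matOf h)}
  mul_mem' := fun ha hb => ha.mul hb
  one_mem' := IsUpperUni.one
  inv_mem' := fun ha => IsUpperUni.inv ha

/-- The diagonal elements of `H`. -/
def diagSub (H : Subgroup (GL (Fin N) ℂ)) : Subgroup H where
  carrier := {h | ∃ d, matOf h = Matrix.diagonal d}
  mul_mem' := by
    rintro a b ⟨d, hd⟩ ⟨e, he⟩
    refine ⟨fun i => d i * e i, ?_⟩
    show matOf a * matOf b = _
    rw [hd, he, Matrix.diagonal_mul_diagonal]
  one_mem' := ⟨1, Matrix.diagonal_one.symm⟩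
  inv_mem' := by
    rintro a ⟨d, hd⟩
    exact ⟨_, (diagonal_inv_eq hd).2⟩

theorem mem_lowerSub {H : Subgroup (GL (Fin N) ℂ)} {h : H} :
    h ∈ lowerSub H ↔ IsLowerUni (matOf h) := Iff.rfl

/-- The one-parameter subgroups `c ↦ 1 + c E` of `H`. -/
def oneParams (H : Subgroup (GL (Fin N) ℂ)) : Set (ℂ → H) :=
  {f | ∃ E, E * E = 0 ∧ ∀ c, matOf (f c) = 1 + c • E}

/-- The cell structure on a subgroup of the general linear group. -/
def cellOf (H : Subgroup (GL (Fin N) ℂ))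
    (hLDU : ∀ h : H, (∀ k ≤ N, lead (matOf h) k ≠ 0) →
      ∃ l ∈ lowerSub H, ∃ t ∈ diagSub H, ∃ u ∈ upperSub H, h = l * t * u)
    (hgen : Subgroup.closure ((diagSub H : Set H) ∪ ⋃ f ∈ oneParams H, Set.range f) = ⊤) :
    CellData H where
  L := lowerSub H
  T := diagSub H
  U := upperSub H
  params := oneParams H
  map_add := by
    rintro f ⟨E, hE, hf⟩ a b
    refine matOf_injective ?_
    show _ = matOf (f a) * matOf (f b)
    rw [hf, hf, hf, add_mul, mul_add, mul_add, one_mul, mul_one, smul_mul_smul_comm, hE,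
      smul_zero, add_smul, add_zero, one_mul, add_assoc, add_comm (a • E)]
  conj_mem := by
    rintro t ⟨d, hd⟩ l ⟨hl1, hl2⟩
    obtain ⟨hd0, hinv⟩ := diagonal_inv_eq hd
    have h : matOf (t * l * t⁻¹) = Matrix.diagonal d * matOf l *
        Matrix.diagonal fun i => (d i)⁻¹ := by
      rw [← hinv, ← hd]; rfl
    rw [mem_lowerSub, h]
    refine ⟨fun i => ?_, fun i j hij => ?_⟩
    · rw [Matrix.mul_diagonal, Matrix.diagonal_mul, hl1, mul_one, mul_inv_cancel₀ (hd0 i)]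
    · rw [Matrix.mul_diagonal, Matrix.diagonal_mul, hl2 i j hij, mul_zero, zero_mul]
  cofinite := by
    rintro f ⟨E, -, hf⟩ l hl
    refine (finite_lead_eq_zero E _ hl).subset fun c hc => ?_
    by_contra hcon
    refine hc (hLDU _ fun k hk h0 => hcon ⟨k, hk, ?_⟩)
    rw [← hf]
    exact h0
  closure_eq := hgen

theorem lower_upper_eq_one {A : Matrix (Fin N) (Fin N) ℂ} (hA : IsLowerUni A)
    (h : SuppFrom 0 A) : A = 1 := by
  ext i j
  rcases lt_trichotomy (i : ℕ) j with hij | hij | hij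
  · rw [hA.2 i j hij, Matrix.one_apply_ne (by rintro rfl; simp at hij)]
  · rw [Fin.ext hij, hA.1, Matrix.one_apply_eq]
  · rw [h i j hij, Matrix.one_apply_ne (by rintro rfl; simp at hij)]

theorem suppFrom_diagonal (d : Fin N → ℂ) : SuppFrom 0 (Matrix.diagonal d) := fun i j h =>
  Matrix.diagonal_apply_ne _ (by rintro rfl; simp at h)

theorem IsUpperUni.suppFrom {A : Matrix (Fin N) (Fin N) ℂ} (h : IsUpperUni A) : SuppFrom 0 A :=
  suppFrom_of_sub_one (isUpperUni_iff.1 h)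

theorem LDU_unique {l t u l' t' u' : GL (Fin N) ℂ} {d d' : Fin N → ℂ}
    (hl : IsLowerUni (l : Matrix (Fin N) (Fin N) ℂ))
    (hl' : IsLowerUni (l' : Matrix (Fin N) (Fin N) ℂ))
    (ht : (t : Matrix (Fin N) (Fin N) ℂ) = Matrix.diagonal d)
    (ht' : (t' : Matrix (Fin N) (Fin N) ℂ) = Matrix.diagonal d')
    (hu : IsUpperUni (u : Matrix (Fin N) (Fin N) ℂ))
    (hu' : IsUpperUni (u' : Matrix (Fin N) (Fin N) ℂ))
    (h : l * t * u = l' * t' * u') : l = l' ∧ t = t' ∧ u = u' := by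
  have h1 : l'⁻¹ * l = t' * u' * (u⁻¹ * t⁻¹) := by
    have : l'⁻¹ * (l * t * u) * (u⁻¹ * t⁻¹) = l'⁻¹ * (l' * t' * u') * (u⁻¹ * t⁻¹) := by rw [h]
    simpa [mul_assoc] using this
  have h2 : l'⁻¹ * l = 1 := by
    refine Units.ext (lower_upper_eq_one ((IsLowerUni.inv hl').mul hl) ?_)
    rw [h1]
    have a1 := suppFrom_diagonal d'
    have a2 := suppFrom_inv (g := t) (by rw [ht]; exact suppFrom_diagonal d)
    rw [← ht'] at a1
    exact (a1.mul hu'.suppFrom).mul ((IsUpperUni.inv hu).suppFrom.mul a2)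
  have h3 : l = l' := by rwa [inv_mul_eq_one, eq_comm] at h2
  subst h3
  rw [mul_assoc, mul_assoc, mul_right_inj] at h
  have h4 : (t : Matrix (Fin N) (Fin N) ℂ) * u = t' * u' := by
    rw [← Units.val_mul, h, Units.val_mul]
  have h5 : t = t' := by
    refine Units.ext ?_
    rw [ht, ht']
    congr 1
    funext i
    have := congrFun (congrFun h4 i) i
    rwa [ht, ht', Matrix.diagonal_mul, Matrix.diagonal_mul, hu.1, hu'.1, mul_one, mul_one] at this
  subst h5
  exact ⟨rfl, rfl, mul_left_cancel h⟩

/-- The cell structure on the general linear group. -/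
def glCell (N : ℕ) : CellData (⊤ : Subgroup (GL (Fin N) ℂ)) :=
  cellOf ⊤ (by
    intro h hlead
    obtain ⟨l, t, u, hl, ht, hu, e⟩ := exists_LDU (h : GL (Fin N) ℂ) hlead
    exact ⟨⟨l, trivial⟩, hl, ⟨t, trivial⟩, ht, ⟨u, trivial⟩, hu, Subtype.ext e⟩) (by
    rw [eq_top_iff]
    rintro ⟨g, hg⟩ -
    set C := Subgroup.closure ((diagSub (⊤ : Subgroup (GL (Fin N) ℂ)) : Set _) ∪
      ⋃ f ∈ oneParams (⊤ : Subgroup (GL (Fin N) ℂ)), Set.range f) with hC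
    suffices h : ∀ A : Matrix (Fin N) (Fin N) ℂ, A.det ≠ 0 →
        ∃ x ∈ C, matOf x = A by
      obtain ⟨x, hx, e⟩ := h g (g.isUnit.map Matrix.detMonoidHom).ne_zero
      have : x = ⟨g, hg⟩ := matOf_injective e
      rwa [← this]
    intro A hA
    refine Matrix.diagonal_transvection_induction_of_det_ne_zero
      (fun A => ∃ x ∈ C, matOf x = A) A hA ?_ ?_ ?_
    · intro d hd
      exact ⟨⟨Matrix.GeneralLinearGroup.mkOfDetNeZero (Matrix.diagonal d) hd, trivial⟩,
        Subgroup.subset_closure (Or.inl ⟨d, rfl⟩), rfl⟩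
    · intro t
      let f : ℂ → (⊤ : Subgroup (GL (Fin N) ℂ)) := fun c =>
        ⟨Matrix.GeneralLinearGroup.mkOfDetNeZero (Matrix.transvection t.i t.j c) (by
          rw [Matrix.det_transvection_of_ne _ _ t.hij]; simp), trivial⟩
      refine ⟨f t.c, Subgroup.subset_closure (Or.inr ?_), rfl⟩
      simp only [Set.mem_iUnion]
      refine ⟨f, ⟨Matrix.single t.i t.j 1, ?_, fun c => ?_⟩, t.c, rfl⟩
      · rw [Matrix.single_mul_single_of_ne _ _ _ _ t.hij.symm]
      · show Matrix.transvection t.i t.j c = _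
        rw [Matrix.transvection, Matrix.smul_single, smul_eq_mul, mul_one]
    · rintro A B _ _ ⟨x, hx, rfl⟩ ⟨y, hy, rfl⟩
      exact ⟨x * y, C.mul_mem hx hy, rfl⟩)

end Subgroups

section Symplectic

variable {n : ℕ}

/-- The sign occurring in row `i` of the symplectic form. -/
def sympSign (i : Fin (2 * n)) : ℂ := if (i : ℕ) < n then 1 else -1

theorem sympSign_mul_self (i : Fin (2 * n)) : sympSign i * sympSign i = 1 := by
  unfold sympSign; split_ifs <;> norm_num

theorem sympSign_rev (i : Fin (2 * n)) : sympSign i.rev = -sympSign i := by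
  unfold sympSign
  have := i.2
  rw [Fin.val_rev]
  by_cases h : (i : ℕ) < n
  · rw [if_pos h, if_neg (by omega)]
  · rw [if_neg h, if_pos (by omega), neg_neg]

theorem sympForm_apply (i j : Fin (2 * n)) :
    sympForm n i j = if j = i.rev then sympSign i else 0 := by
  unfold sympForm sympSign
  rw [Matrix.of_apply]
  have : (i : ℕ) + j = 2 * n - 1 ↔ j = i.rev := by
    rw [Fin.ext_iff, Fin.val_rev]; omega
  simp only [this]

theorem mul_sympForm_apply (A : Matrix (Fin (2 * n)) (Fin (2 * n)) ℂ) (i j : Fin (2 * n)) :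
    (A * sympForm n) i j = -(sympSign j * A i j.rev) := by
  rw [Matrix.mul_apply, Finset.sum_eq_single j.rev]
  · rw [sympForm_apply, Fin.rev_rev, if_pos rfl, sympSign_rev]; ring
  · intro k _ hk
    rw [sympForm_apply, if_neg, mul_zero]
    rintro rfl
    exact hk (Fin.rev_rev k).symm
  · simp

theorem sympForm_mul_apply (A : Matrix (Fin (2 * n)) (Fin (2 * n)) ℂ) (i j : Fin (2 * n)) :
    (sympForm n * A) i j = sympSign i * A i.rev j := by
  rw [Matrix.mul_apply, Finset.sum_eq_single i.rev]
  · rw [sympForm_apply, if_pos rfl]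
  · intro k _ hk
    rw [sympForm_apply, if_neg hk, zero_mul]
  · simp

theorem sympForm_mul_self : sympForm n * sympForm n = -1 := by
  ext i j
  rw [sympForm_mul_apply, sympForm_apply, Fin.rev_rev, Matrix.neg_apply, Matrix.one_apply]
  by_cases h : i = j
  · rw [if_pos h.symm, if_pos h, sympSign_rev, mul_neg, sympSign_mul_self]
  · rw [if_neg (Ne.symm h), if_neg h, mul_zero, neg_zero]

theorem sympForm_transpose : (sympForm n)ᵀ = -sympForm n := by
  ext i j
  rw [Matrix.transpose_apply, Matrix.neg_apply, sympForm_apply, sympForm_apply]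
  by_cases h : j = i.rev
  · subst h
    rw [Fin.rev_rev, if_pos rfl, if_pos rfl, sympSign_rev]
  · rw [if_neg h, if_neg, neg_zero]
    rintro rfl
    exact h (Fin.rev_rev j).symm

theorem sympForm_conjTranspose : (sympForm n)ᴴ = -sympForm n := by
  rw [Matrix.conjTranspose, sympForm_transpose]
  ext i j
  rw [Matrix.map_apply, Matrix.neg_apply, sympForm_apply, star_neg, sympSign]
  split_ifs <;> simp

/-- The adjoint with respect to the symplectic form. -/
def sympStar (A : Matrix (Fin (2 * n)) (Fin (2 * n)) ℂ) : Matrix (Fin (2 * n)) (Fin (2 * n)) ℂ :=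
  -(sympForm n * Aᵀ * sympForm n)

theorem sympStar_apply (A : Matrix (Fin (2 * n)) (Fin (2 * n)) ℂ) (i j : Fin (2 * n)) :
    sympStar A i j = sympSign i * sympSign j * A j.rev i.rev := by
  rw [sympStar, Matrix.neg_apply, mul_sympForm_apply, sympForm_mul_apply, Matrix.transpose_apply]
  ring

theorem sympStar_mul (A B : Matrix (Fin (2 * n)) (Fin (2 * n)) ℂ) :
    sympStar (A * B) = sympStar B * sympStar A := by
  have h := sympForm_mul_self (n := n)
  simp only [sympStar, Matrix.transpose_mul]
  calc _ = sympForm n * Bᵀ * (-1) * Aᵀ * sympForm n := by noncomm_ring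
    _ = _ := by rw [← h]; noncomm_ring

theorem sympStar_one : sympStar (1 : Matrix (Fin (2 * n)) (Fin (2 * n)) ℂ) = 1 := by
  rw [sympStar, Matrix.transpose_one, mul_one, sympForm_mul_self, neg_neg]

/-- The symplectic adjoint on the general linear group. -/
def glStar (g : GL (Fin (2 * n)) ℂ) : GL (Fin (2 * n)) ℂ where
  val := sympStar (g : Matrix (Fin (2 * n)) (Fin (2 * n)) ℂ)
  inv := sympStar ((g⁻¹ : GL (Fin (2 * n)) ℂ) : Matrix (Fin (2 * n)) (Fin (2 * n)) ℂ)
  val_inv := by rw [← sympStar_mul, ← Units.val_mul, inv_mul_cancel, Units.val_one, sympStar_one]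
  inv_val := by rw [← sympStar_mul, ← Units.val_mul, mul_inv_cancel, Units.val_one, sympStar_one]

theorem glStar_mul (g h : GL (Fin (2 * n)) ℂ) : glStar (g * h) = glStar h * glStar g :=
  Units.ext (sympStar_mul _ _)

theorem mem_SpGL {g : GL (Fin (2 * n)) ℂ} : g ∈ SpGL n ↔
    (g : Matrix (Fin (2 * n)) (Fin (2 * n)) ℂ)ᵀ * sympForm n * g = sympForm n := Iff.rfl

theorem mem_SpGL_iff {g : GL (Fin (2 * n)) ℂ} : g ∈ SpGL n ↔ glStar g * g = 1 := by
  rw [mem_SpGL]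
  constructor
  · intro h
    refine Units.ext ?_
    show -(sympForm n * _ᵀ * sympForm n) * _ = 1
    rw [neg_mul, mul_assoc, mul_assoc, ← mul_assoc _ (sympForm n), h, sympForm_mul_self, neg_neg]
  · intro h
    have h1 : -(sympForm n * (g : Matrix (Fin (2 * n)) (Fin (2 * n)) ℂ)ᵀ * sympForm n) * g = 1 :=
      congrArg Units.val h
    calc _ = -(sympForm n * sympForm n) *
          ((g : Matrix (Fin (2 * n)) (Fin (2 * n)) ℂ)ᵀ * sympForm n * g) := by
            rw [sympForm_mul_self, neg_neg, one_mul]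
      _ = sympForm n * (-(sympForm n * (g : Matrix (Fin (2 * n)) (Fin (2 * n)) ℂ)ᵀ *
          sympForm n) * g) := by noncomm_ring
      _ = _ := by rw [h1, mul_one]

theorem sympStar_lower {A : Matrix (Fin (2 * n)) (Fin (2 * n)) ℂ} (hA : IsLowerUni A) :
    IsLowerUni (sympStar A) := by
  refine ⟨fun i => ?_, fun i j hij => ?_⟩
  · rw [sympStar_apply, hA.1, sympSign_mul_self, mul_one]
  · rw [sympStar_apply, hA.2, mul_zero]
    have := j.2
    rw [Fin.val_rev, Fin.val_rev]; omega

theorem sympStar_upper {A : Matrix (Fin (2 * n)) (Fin (2 * n)) ℂ} (hA : IsUpperUni A) :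
    IsUpperUni (sympStar A) := by
  refine ⟨fun i => ?_, fun i j hij => ?_⟩
  · rw [sympStar_apply, hA.1, sympSign_mul_self, mul_one]
  · rw [sympStar_apply, hA.2, mul_zero]
    have := i.2
    rw [Fin.val_rev, Fin.val_rev]; omega

theorem sympStar_diagonal (d : Fin (2 * n) → ℂ) :
    sympStar (Matrix.diagonal d) = Matrix.diagonal fun i => d i.rev := by
  ext i j
  rw [sympStar_apply, Matrix.diagonal_apply, Matrix.diagonal_apply]
  by_cases h : i = j
  · subst h; rw [if_pos rfl, if_pos rfl, sympSign_mul_self, one_mul]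
  · rw [if_neg h, if_neg, mul_zero]
    exact fun e => h (Fin.rev_injective e).symm

theorem SpGL_LDU (h : SpGL n) (hh : ∀ k ≤ 2 * n, lead (matOf h) k ≠ 0) :
    ∃ l ∈ lowerSub (SpGL n), ∃ t ∈ diagSub (SpGL n), ∃ u ∈ upperSub (SpGL n), h = l * t * u := by
  obtain ⟨l, t, u, hl, ⟨d, ht⟩, hu, e⟩ := exists_LDU (h : GL (Fin (2 * n)) ℂ) hh
  obtain ⟨-, hti⟩ := diagonal_inv_eq ht
  have hS := mem_SpGL_iff.1 h.2
  have h1 : (h : GL (Fin (2 * n)) ℂ) = (glStar l)⁻¹ * (glStar t)⁻¹ * (glStar u)⁻¹ := by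
    rw [← _root_.mul_inv_rev, ← _root_.mul_inv_rev, ← glStar_mul, ← glStar_mul, ← e]
    exact (inv_eq_of_mul_eq_one_right hS).symm
  have h2 : (glStar t : Matrix (Fin (2 * n)) (Fin (2 * n)) ℂ) =
      Matrix.diagonal fun i => d i.rev := by
    show sympStar _ = _
    rw [ht, sympStar_diagonal]
  obtain ⟨e1, e2, e3⟩ := LDU_unique hl (IsLowerUni.inv (g := glStar l) (sympStar_lower hl)) ht
    (diagonal_inv_eq h2).2 hu (IsUpperUni.inv (g := glStar u) (sympStar_upper hu)) (e ▸ h1)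
  have key : ∀ g : GL (Fin (2 * n)) ℂ, g = (glStar g)⁻¹ → g ∈ SpGL n := fun g hg => by
    rw [mem_SpGL_iff]
    conv_lhs => rw [hg]
    rw [← hg]
    nth_rw 2 [hg]
    exact mul_inv_cancel _
  exact ⟨⟨l, key l e1⟩, hl, ⟨t, key t e2⟩, ⟨d, ht⟩, ⟨u, key u e3⟩, hu, Subtype.ext e⟩

/-- The symplectic pairing. -/
def sympPair (x y : Fin (2 * n) → ℂ) : ℂ := (x ᵥ* sympForm n) ⬝ᵥ y

theorem sympPair_swap (x y : Fin (2 * n) → ℂ) : sympPair x y = -sympPair y x := by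
  unfold sympPair
  rw [← Matrix.dotProduct_mulVec, ← Matrix.vecMul_transpose, sympForm_transpose, dotProduct_comm,
    Matrix.vecMul_neg, neg_dotProduct]

theorem sympPair_self (x : Fin (2 * n) → ℂ) : sympPair x x = 0 := by
  have := sympPair_swap x x
  linear_combination this / 2

theorem sympPair_sub_left (x y z : Fin (2 * n) → ℂ) :
    sympPair (x - y) z = sympPair x z - sympPair y z := by
  unfold sympPair; rw [Matrix.sub_vecMul, sub_dotProduct]

theorem sympPair_add_right (x y z : Fin (2 * n) → ℂ) :
    sympPair x (y + z) = sympPair x y + sympPair x z := dotProduct_add _ _ _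

theorem sympPair_smul_right (c : ℂ) (x y : Fin (2 * n) → ℂ) :
    sympPair x (c • y) = c * sympPair x y := dotProduct_smul _ _ _

theorem exists_sympPair_ne {x : Fin (2 * n) → ℂ} (hx : x ≠ 0) : ∃ y, sympPair x y ≠ 0 := by
  by_contra! h
  apply hx
  have h1 : x ᵥ* sympForm n = 0 := by
    funext j
    have := h (Pi.single j 1)
    rwa [sympPair, dotProduct_single, mul_one] at this
  have h2 : x ᵥ* (sympForm n * sympForm n) = 0 := by
    rw [← Matrix.vecMul_vecMul, h1, Matrix.zero_vecMul]
  rw [sympForm_mul_self, Matrix.vecMul_neg, Matrix.vecMul_one] at h2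
  exact neg_eq_zero.1 h2

theorem sympPair_map (g : SpGL n) (x y : Fin (2 * n) → ℂ) :
    sympPair (matOf g *ᵥ x) (matOf g *ᵥ y) = sympPair x y := by
  have h : (matOf g)ᵀ * sympForm n * matOf g = sympForm n := g.2
  unfold sympPair
  rw [Matrix.dotProduct_mulVec, Matrix.vecMul_vecMul, ← Matrix.vecMul_transpose,
    Matrix.vecMul_vecMul, ← mul_assoc, h]

/-- The nilpotent rank one matrix attached to a vector. -/
def sympNil (u : Fin (2 * n) → ℂ) : Matrix (Fin (2 * n)) (Fin (2 * n)) ℂ :=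
  Matrix.vecMulVec u (u ᵥ* sympForm n)

theorem sympNil_mulVec (u x : Fin (2 * n) → ℂ) : sympNil u *ᵥ x = sympPair u x • u := by
  rw [sympNil, Matrix.vecMulVec_mulVec, op_smul_eq_smul, sympPair]

theorem sympNil_sq (u : Fin (2 * n) → ℂ) : sympNil u * sympNil u = 0 := by
  refine Matrix.toLin'.injective (LinearMap.ext fun x => ?_)
  rw [Matrix.toLin'_mul, LinearMap.comp_apply, Matrix.toLin'_apply, Matrix.toLin'_apply,
    sympNil_mulVec, sympNil_mulVec, sympPair_smul_right, sympPair_self, mul_zero, zero_smul]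
  simp

theorem sympNil_transpose_mul (u : Fin (2 * n) → ℂ) :
    (sympNil u)ᵀ * sympForm n = -(sympForm n * sympNil u) := by
  have h : sympForm n *ᵥ u = -(u ᵥ* sympForm n) := by
    rw [← Matrix.vecMul_transpose, sympForm_transpose, Matrix.vecMul_neg]
  rw [sympNil, Matrix.transpose_vecMulVec, Matrix.vecMulVec_mul, Matrix.mul_vecMulVec, h,
    Matrix.neg_vecMulVec, neg_neg]

/-- Symplectic transvections. -/
def sympTrans (u : Fin (2 * n) → ℂ) (c : ℂ) : SpGL n :=
  ⟨⟨1 + c • sympNil u, 1 - c • sympNil u, by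
      rw [add_mul, mul_sub, mul_sub, smul_mul_smul_comm, sympNil_sq]; simp, by
      rw [sub_mul, mul_add, mul_add, smul_mul_smul_comm, sympNil_sq]; simp⟩, by
    rw [mem_SpGL]
    show (1 + c • sympNil u)ᵀ * sympForm n * (1 + c • sympNil u) = _
    have h : sympForm n * sympNil u * sympNil u = 0 := by
      rw [mul_assoc, sympNil_sq, mul_zero]
    rw [Matrix.transpose_add, Matrix.transpose_one, Matrix.transpose_smul, add_mul, one_mul,
      Matrix.smul_mul, sympNil_transpose_mul, mul_add, mul_one, Matrix.mul_smul, add_mul,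
      Matrix.smul_mul, Matrix.neg_mul, h]
    simp⟩

theorem matOf_sympTrans (u : Fin (2 * n) → ℂ) (c : ℂ) :
    matOf (sympTrans u c) = 1 + c • sympNil u := rfl

theorem sympTrans_mulVec (u x : Fin (2 * n) → ℂ) (c : ℂ) :
    matOf (sympTrans u c) *ᵥ x = x + (c * sympPair u x) • u := by
  rw [matOf_sympTrans, Matrix.add_mulVec, Matrix.one_mulVec, Matrix.smul_mulVec, sympNil_mulVec,
    smul_smul]

/-- The subspace of vectors fixed by a group element. -/
def fixSub (g : SpGL n) : Submodule ℂ (Fin (2 * n) → ℂ) :=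
  LinearMap.eqLocus (Matrix.mulVecLin (matOf g)) LinearMap.id

theorem mem_fixSub {g : SpGL n} {x : Fin (2 * n) → ℂ} : x ∈ fixSub g ↔ matOf g *ᵥ x = x := Iff.rfl

theorem matOf_mul_mulVec (g h : SpGL n) (x : Fin (2 * n) → ℂ) :
    matOf (g * h) *ᵥ x = matOf g *ᵥ (matOf h *ᵥ x) := (Matrix.mulVec_mulVec _ _ _).symm

theorem sympPair_sub_fix (g : SpGL n) {x : Fin (2 * n) → ℂ} (hx : x ∈ fixSub g)
    (y : Fin (2 * n) → ℂ) : sympPair (matOf g *ᵥ y - y) x = 0 := by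
  rw [sympPair_sub_left]
  nth_rw 1 [← mem_fixSub.1 hx]
  rw [sympPair_map, sub_self]

theorem mem_of_sympPair_ne (C : Subgroup (SpGL n)) (hC : ∀ u c, sympTrans u c ∈ C)
    {F : Submodule ℂ (Fin (2 * n) → ℂ)} (hF : ∀ h : SpGL n, F < fixSub h → h ∈ C)
    (g : SpGL n) (hg : F ≤ fixSub g) {v : Fin (2 * n) → ℂ}
    (hv : sympPair v (matOf g *ᵥ v) ≠ 0) : g ∈ C := by
  set u := matOf g *ᵥ v - v with hu
  have h1 : sympPair u v ≠ 0 := by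
    rw [hu, sympPair_sub_left, sympPair_self, sub_zero, sympPair_swap]
    exact neg_ne_zero.2 hv
  set τ := sympTrans u (sympPair u v)⁻¹ with hτ
  have h2 : matOf τ *ᵥ v = matOf g *ᵥ v := by
    rw [hτ, sympTrans_mulVec, inv_mul_cancel₀ h1, one_smul, hu, add_sub_cancel]
  have h3 : ∀ x y, matOf τ *ᵥ x = y → matOf τ⁻¹ *ᵥ y = x := by
    rintro x _ rfl
    rw [← matOf_mul_mulVec, inv_mul_cancel]
    exact Matrix.one_mulVec x
  have h4 : τ⁻¹ * g ∈ C := by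
    refine hF _ (lt_of_le_of_ne (fun x hx => ?_) fun e => ?_)
    · rw [mem_fixSub, matOf_mul_mulVec, mem_fixSub.1 (hg hx)]
      refine h3 _ _ ?_
      rw [hτ, sympTrans_mulVec, sympPair_sub_fix g (hg hx), mul_zero, zero_smul, add_zero]
    · have hvF : v ∈ F := by
        rw [e, mem_fixSub, matOf_mul_mulVec]
        exact h3 _ _ h2
      rw [mem_fixSub.1 (hg hvF), sympPair_self] at hv
      exact hv rfl
  have := C.mul_mem (hC u (sympPair u v)⁻¹) h4
  rwa [← hτ, mul_inv_cancel_left] at this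

theorem SpGL_generated (C : Subgroup (SpGL n)) (hC : ∀ u c, sympTrans u c ∈ C) (g : SpGL n) :
    g ∈ C := by
  suffices h : ∀ F : Submodule ℂ (Fin (2 * n) → ℂ), ∀ g : SpGL n, fixSub g = F → g ∈ C from
    h _ g rfl
  intro F
  induction F using WellFoundedGT.induction with
  | ind F ih =>
  intro g hg
  replace ih : ∀ h : SpGL n, F < fixSub h → h ∈ C := fun h hh => ih _ hh h rfl
  by_cases hv : ∃ v, sympPair v (matOf g *ᵥ v) ≠ 0
  · obtain ⟨v, hv⟩ := hv
    exact mem_of_sympPair_ne C hC ih g hg.ge hv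
  push Not at hv
  by_cases hg1 : ∀ y, matOf g *ᵥ y = y
  · have : g = 1 := by
      refine matOf_injective (Matrix.toLin'.injective (LinearMap.ext fun y => ?_))
      rw [Matrix.toLin'_apply, hg1]
      show _ = Matrix.toLin' (1 : Matrix _ _ ℂ) y
      rw [Matrix.toLin'_one]; rfl
    rw [this]; exact C.one_mem
  push Not at hg1
  obtain ⟨y, hy⟩ := hg1
  set u := matOf g *ᵥ y - y with hu
  have hu0 : u ≠ 0 := sub_ne_zero.2 hy
  obtain ⟨x, hx⟩ := exists_sympPair_ne hu0
  obtain ⟨v, hv1, hv2⟩ : ∃ v, sympPair u (matOf g *ᵥ v) ≠ 0 ∧ sympPair u v ≠ 0 := by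
    have hx' : sympPair u (matOf g *ᵥ (matOf g⁻¹ *ᵥ x)) ≠ 0 := by
      rw [← matOf_mul_mulVec, mul_inv_cancel]
      show sympPair u ((1 : Matrix _ _ ℂ) *ᵥ x) ≠ 0
      rwa [Matrix.one_mulVec]
    by_cases h1 : sympPair u (matOf g *ᵥ x) = 0
    · by_cases h2 : sympPair u (matOf g⁻¹ *ᵥ x) = 0
      · refine ⟨x + matOf g⁻¹ *ᵥ x, ?_, ?_⟩
        · rwa [Matrix.mulVec_add, sympPair_add_right, h1, zero_add]
        · rwa [sympPair_add_right, h2, add_zero]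
      · exact ⟨_, hx', h2⟩
    · exact ⟨x, h1, hx⟩
  have h1 : sympTrans u 1 * g ∈ C := by
    refine mem_of_sympPair_ne C hC ih _ (v := v) (fun z hz => ?_) ?_
    · rw [← hg] at hz
      rw [mem_fixSub, matOf_mul_mulVec, mem_fixSub.1 hz, sympTrans_mulVec,
        sympPair_sub_fix g hz, mul_zero, zero_smul, add_zero]
    · rw [matOf_mul_mulVec, sympTrans_mulVec, sympPair_add_right, hv, zero_add,
        sympPair_smul_right, sympPair_swap v u, one_mul]
      exact mul_ne_zero hv1 (neg_ne_zero.2 hv2)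
  have := C.mul_mem (C.inv_mem (hC u 1)) h1
  rwa [inv_mul_cancel_left] at this

/-- The cell structure on the symplectic group. -/
def spCell (n : ℕ) : CellData (SpGL n) :=
  cellOf (SpGL n) SpGL_LDU (by
    rw [eq_top_iff]
    refine fun g _ => SpGL_generated _ (fun u c => ?_) g
    refine Subgroup.subset_closure (Or.inr ?_)
    simp only [Set.mem_iUnion]
    exact ⟨sympTrans u, ⟨sympNil u, sympNil_sq u, fun c => rfl⟩, c, rfl⟩)

/-- The conjugate transpose on the general linear group. -/
def glH {N : ℕ} (g : GL (Fin N) ℂ) : GL (Fin N) ℂ where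
  val := (g : Matrix (Fin N) (Fin N) ℂ)ᴴ
  inv := ((g⁻¹ : GL (Fin N) ℂ) : Matrix (Fin N) (Fin N) ℂ)ᴴ
  val_inv := by
    rw [← Matrix.conjTranspose_mul, ← Units.val_mul, inv_mul_cancel, Units.val_one,
      Matrix.conjTranspose_one]
  inv_val := by
    rw [← Matrix.conjTranspose_mul, ← Units.val_mul, mul_inv_cancel, Units.val_one,
      Matrix.conjTranspose_one]

@[simp] theorem coe_glH {N : ℕ} (g : GL (Fin N) ℂ) :
    (glH g : Matrix (Fin N) (Fin N) ℂ) = (g : Matrix (Fin N) (Fin N) ℂ)ᴴ := rfl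

theorem mem_SpGL_iff' {g : GL (Fin (2 * n)) ℂ} : g ∈ SpGL n ↔
    (g : Matrix (Fin (2 * n)) (Fin (2 * n)) ℂ) * sympForm n *
      (g : Matrix (Fin (2 * n)) (Fin (2 * n)) ℂ)ᵀ = sympForm n := by
  rw [mem_SpGL_iff, mul_eq_one_iff_eq_inv, eq_comm, inv_eq_iff_mul_eq_one, Units.ext_iff]
  show _ * -(sympForm n * _ᵀ * sympForm n) = 1 ↔ _
  constructor
  · intro h
    calc _ = ((g : Matrix (Fin (2 * n)) (Fin (2 * n)) ℂ) *
          -(sympForm n * (g : Matrix (Fin (2 * n)) (Fin (2 * n)) ℂ)ᵀ * sympForm n)) *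
          sympForm n := by
          rw [mul_neg, neg_mul]
          simp only [mul_assoc]
          rw [sympForm_mul_self]; simp
      _ = _ := by rw [h, one_mul]
  · intro h
    rw [mul_neg, ← mul_assoc, ← mul_assoc, h, sympForm_mul_self, neg_neg]

theorem glT_mem_SpGL {g : GL (Fin (2 * n)) ℂ} (hg : g ∈ SpGL n) : glT g ∈ SpGL n := by
  rw [mem_SpGL_iff', coe_glT, Matrix.transpose_transpose]
  exact hg

theorem glH_mem_SpGL {g : GL (Fin (2 * n)) ℂ} (hg : g ∈ SpGL n) : glH g ∈ SpGL n := by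
  rw [mem_SpGL_iff', coe_glH]
  have h := congrArg Matrix.conjTranspose (mem_SpGL.1 hg)
  rw [Matrix.conjTranspose_mul, Matrix.conjTranspose_mul, sympForm_conjTranspose, neg_mul,
    mul_neg, ← mul_assoc] at h
  exact neg_injective h

theorem hasPrincipalTorus_top (N : ℕ) : HasPrincipalTorus (⊤ : Subgroup (GL (Fin N) ℂ)) := by
  intro z hz
  refine ⟨Matrix.GeneralLinearGroup.mkOfDetNeZero (Matrix.diagonal _) ?_, trivial, rfl⟩
  rw [Matrix.det_diagonal]
  exact Finset.prod_ne_zero_iff.2 fun i _ => zpow_ne_zero _ hz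

theorem hasPrincipalTorus_SpGL (n : ℕ) : HasPrincipalTorus (SpGL n) := by
  intro z hz
  obtain ⟨t, -, ht⟩ := hasPrincipalTorus_top (2 * n) z hz
  refine ⟨t, ?_, ht⟩
  rw [mem_SpGL_iff]
  refine Units.ext ?_
  show sympStar _ * _ = 1
  rw [ht, sympStar_diagonal, Matrix.diagonal_mul_diagonal, ← Matrix.diagonal_one]
  congr 1
  funext i
  rw [← zpow_add₀ hz, Fin.val_rev, Nat.cast_sub (by have := i.2; omega)]
  convert zpow_zero z using 2
  push_cast
  ring

end Symplectic

section Substitution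

open MvPolynomial

variable {σ : Type*} [Fintype σ]

/-- The linear substitution of variables given by a matrix. -/
def linSub (A : Matrix σ σ ℂ) : MvPolynomial σ ℂ →ₐ[ℂ] MvPolynomial σ ℂ :=
  aeval fun i => ∑ j, C (A j i) * X j

theorem linSub_X (A : Matrix σ σ ℂ) (i : σ) : linSub A (X i) = ∑ j, C (A j i) * X j :=
  aeval_X _ _

theorem linSub_mul (A B : Matrix σ σ ℂ) (p : MvPolynomial σ ℂ) :
    linSub (A * B) p = linSub A (linSub B p) := by
  rw [← AlgHom.comp_apply]
  refine DFunLike.congr_fun (algHom_ext fun i => ?_) p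
  rw [AlgHom.comp_apply, linSub_X, linSub_X, map_sum]
  simp_rw [map_mul, linSub_X, algHom_C, Finset.mul_sum]
  rw [Finset.sum_comm]
  refine Finset.sum_congr rfl fun k _ => ?_
  rw [Matrix.mul_apply, map_sum, Finset.sum_mul]
  refine Finset.sum_congr rfl fun j _ => ?_
  rw [C_mul, algebraMap_eq]
  ring

theorem linSub_one [DecidableEq σ] (p : MvPolynomial σ ℂ) : linSub (1 : Matrix σ σ ℂ) p = p := by
  conv_rhs => rw [← AlgHom.id_apply (R := ℂ) p]
  refine DFunLike.congr_fun (algHom_ext fun i => ?_) p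
  rw [linSub_X, AlgHom.id_apply, Finset.sum_eq_single i]
  · rw [Matrix.one_apply_eq, C_1, one_mul]
  · intro j _ hj
    rw [Matrix.one_apply_ne hj, C_0, zero_mul]
  · simp

theorem eval_linSub (A : Matrix σ σ ℂ) (x : σ → ℂ) (p : MvPolynomial σ ℂ) :
    eval x (linSub A p) = eval (x ᵥ* A) p := by
  rw [linSub, ← coe_aeval_eq_eval, RingHom.coe_coe, ← AlgHom.comp_apply, comp_aeval,
    ← coe_aeval_eq_eval, RingHom.coe_coe]
  congr 2
  funext i
  rw [map_sum, Matrix.vecMul, dotProduct]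
  refine Finset.sum_congr rfl fun j _ => ?_
  rw [map_mul, aeval_X, algHom_C, mul_comm]
  rfl

theorem pderiv_linSub (A : Matrix σ σ ℂ) (i : σ) (p : MvPolynomial σ ℂ) :
    pderiv i (linSub A p) = ∑ j, C (A i j) * linSub A (pderiv j p) := by
  classical
  induction p using MvPolynomial.induction_on with
  | C a => simp [algHom_C]
  | add p q hp hq => simp only [map_add, hp, hq, mul_add, Finset.sum_add_distrib]
  | mul_X p k hp =>
    rw [map_mul, pderiv_mul, hp, linSub_X, map_sum]
    simp_rw [pderiv_mul, pderiv_C, zero_mul, zero_add, pderiv_X, Pi.single_apply, mul_ite, mul_one,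
      mul_zero, map_add, map_mul, mul_add, Finset.sum_add_distrib]
    simp only [Finset.sum_ite_eq', Finset.sum_ite_eq, Finset.mem_univ, if_true,
      apply_ite (linSub A),
      map_zero, mul_ite, mul_zero, Finset.sum_mul, linSub_X]
    congr 1
    · refine Finset.sum_congr rfl fun j _ => ?_
      ring
    · ring

/-- The Fischer inner product on polynomials. -/
def fischer (σ : Type*) [Fintype σ] :
    MvPolynomial σ ℂ →ₗ[ℂ] MvPolynomial σ ℂ →ₛₗ[starRingEnd ℂ] ℂ :=
  (basisMonomials σ ℂ).constr ℂ fun a =>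
    { toFun := fun q => (∏ s, ((a s).factorial : ℂ)) * starRingEnd ℂ (coeff a q)
      map_add' := fun p q => by rw [coeff_add, map_add, mul_add]
      map_smul' := fun c p => by
        rw [coeff_smul, smul_eq_mul, map_mul, smul_eq_mul]; ring }

theorem fischer_monomial (a : σ →₀ ℕ) (c : ℂ) (q : MvPolynomial σ ℂ) :
    fischer σ (monomial a c) q =
      c * ((∏ s, ((a s).factorial : ℂ)) * starRingEnd ℂ (coeff a q)) := by
  have h : monomial a c = c • basisMonomials σ ℂ a := by
    rw [coe_basisMonomials, smul_monomial, smul_eq_mul, mul_one]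
  rw [h, map_smul, fischer, Module.Basis.constr_basis]
  rfl

theorem fischer_apply (p q : MvPolynomial σ ℂ) :
    fischer σ p q = ∑ a ∈ p.support,
      coeff a p * ((∏ s, ((a s).factorial : ℂ)) * starRingEnd ℂ (coeff a q)) := by
  conv_lhs => rw [p.as_sum]
  rw [map_sum, LinearMap.sum_apply]
  exact Finset.sum_congr rfl fun a _ => fischer_monomial _ _ _

theorem fischer_definite (p : MvPolynomial σ ℂ) (h : fischer σ p p = 0) : p = 0 := by
  have h1 : ∑ a ∈ p.support, (∏ s, ((a s).factorial : ℝ)) * Complex.normSq (coeff a p) = 0 := by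
    rw [fischer_apply] at h
    rw [← Complex.ofReal_inj, Complex.ofReal_zero, ← h, Complex.ofReal_sum]
    refine Finset.sum_congr rfl fun a _ => ?_
    rw [Complex.ofReal_mul, Complex.normSq_eq_conj_mul_self, Complex.ofReal_prod]
    push_cast
    ring
  ext a
  rw [coeff_zero]
  by_contra hne
  have h2 := (Finset.sum_eq_zero_iff_of_nonneg fun b _ => mul_nonneg
    (Finset.prod_nonneg fun s _ => Nat.cast_nonneg _) (Complex.normSq_nonneg _)).1 h1 a
    (mem_support_iff.2 hne)
  rcases mul_eq_zero.1 h2 with h3 | h3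
  · exact Finset.prod_ne_zero_iff.2 (fun s _ => Nat.cast_ne_zero.2 (Nat.factorial_ne_zero _)) h3
  · exact hne (Complex.normSq_eq_zero.1 h3)

theorem fischer_mul_X (p q : MvPolynomial σ ℂ) (i : σ) :
    fischer σ (p * X i) q = fischer σ p (pderiv i q) := by
  classical
  induction p using MvPolynomial.induction_on' with
  | add p p' h h' => rw [add_mul, map_add, map_add, LinearMap.add_apply, LinearMap.add_apply, h, h']
  | monomial a c =>
    rw [X, monomial_mul, mul_one, fischer_monomial, fischer_monomial]
    congr 1
    have h : coeff a (pderiv i q) = (a i + 1) * coeff (a + Finsupp.single i 1) q := by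
      induction q using MvPolynomial.induction_on' with
      | add p p' h h' => rw [map_add, coeff_add, coeff_add, h, h', mul_add]
      | monomial b d =>
        rw [pderiv_monomial, coeff_monomial, coeff_monomial]
        by_cases hb : b = a + Finsupp.single i 1
        · subst hb
          rw [if_pos (by simp), if_pos rfl]
          simp; ring
        · rw [if_neg hb, mul_zero]
          split_ifs with h
          · have : b i = 0 := by
              by_contra h0
              refine hb ?_
              rw [← h]
              refine (tsub_add_cancel_of_le ?_).symm
              rw [Finsupp.single_le_iff]; omega
            rw [this]; simp
          · rfl
    rw [h, map_mul, map_add, map_one, Complex.conj_natCast, ← mul_assoc]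
    congr 1
    rw [← Finset.mul_prod_erase _ _ (Finset.mem_univ i), ← Finset.mul_prod_erase Finset.univ
      (fun s => ((a s).factorial : ℂ)) (Finset.mem_univ i)]
    rw [Finset.prod_congr rfl (g := fun s => ((a s).factorial : ℂ))]
    · simp [Nat.factorial_succ]; ring
    · intro s hs
      simp [(Finset.ne_of_mem_erase hs).symm]

theorem fischer_linSub (A : Matrix σ σ ℂ) (p q : MvPolynomial σ ℂ) :
    fischer σ (linSub A p) q = fischer σ p (linSub Aᴴ q) := by
  classical
  induction p using MvPolynomial.induction_on generalizing q with
  | C a =>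
    rw [algHom_C, algebraMap_eq, ← monomial_zero', fischer_monomial, fischer_monomial]
    congr 3
    show constantCoeff q = constantCoeff _
    rw [← eval_zero', eval_linSub]
    show _ = eval ((0 : σ → ℂ) ᵥ* Aᴴ) q
    rw [Matrix.zero_vecMul]
    rfl
  | add p p' h h' => rw [map_add, map_add, map_add, LinearMap.add_apply, LinearMap.add_apply, h, h']
  | mul_X p i hp =>
    rw [map_mul, linSub_X, fischer_mul_X, pderiv_linSub, Finset.mul_sum, map_sum, map_sum,
      LinearMap.sum_apply]
    refine Finset.sum_congr rfl fun j _ => ?_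
    rw [mul_left_comm, ← smul_eq_C_mul, ← smul_eq_C_mul, map_smul, LinearMap.smul_apply,
      fischer_mul_X, hp, LinearMap.map_smulₛₗ, Matrix.conjTranspose_apply, starRingEnd_apply,
      star_star]

/-- The coefficient of a diagonal substitution. -/
theorem coeff_linSub_diagonal [DecidableEq σ] (d : σ → ℂ) (p : MvPolynomial σ ℂ) (a : σ →₀ ℕ) :
    coeff a (linSub (Matrix.diagonal d) p) = (∏ s, d s ^ a s) * coeff a p := by
  have hX : ∀ i, linSub (Matrix.diagonal d) (X i) = C (d i) * X i := fun i => by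
    rw [linSub_X, Finset.sum_eq_single i]
    · rw [Matrix.diagonal_apply_eq]
    · intro j _ hj
      rw [Matrix.diagonal_apply_ne _ hj, C_0, zero_mul]
    · simp
  induction p using MvPolynomial.induction_on' with
  | add p p' h h' => rw [map_add, coeff_add, coeff_add, h, h', mul_add]
  | monomial b c =>
    have : linSub (Matrix.diagonal d) (monomial b c) = monomial b ((∏ s, d s ^ b s) * c) := by
      rw [monomial_eq, map_mul, algHom_C, Finsupp.prod_fintype _ _ (by simp), map_prod]
      simp_rw [map_pow, hX, mul_pow]
      rw [Finset.prod_mul_distrib, monomial_eq, Finsupp.prod_fintype _ _ (by simp), C_mul, map_prod,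
        algebraMap_eq]
      simp_rw [map_pow]
      ring
    rw [this, coeff_monomial, coeff_monomial]
    split_ifs with h
    · rw [h]
    · rw [mul_zero]

theorem continuous_coeff_linSub {Z : Type*} [TopologicalSpace Z] {F : Z → Matrix σ σ ℂ}
    (hF : Continuous F) (p : MvPolynomial σ ℂ) (a : σ →₀ ℕ) :
    Continuous fun z => coeff a (linSub (F z) p) := by
  classical
  induction p using MvPolynomial.induction_on generalizing a with
  | C c => simp only [algHom_C]; exact continuous_const
  | add p q hp hq =>
    simp only [map_add, coeff_add]
    exact (hp a).add (hq a)
  | mul_X p i hp =>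
    simp only [map_mul, coeff_mul]
    refine continuous_finsetSum _ fun b _ => (hp b.1).mul ?_
    simp only [linSub_X, coeff_sum, coeff_C_mul]
    exact continuous_finsetSum _ fun j _ => (hF.matrix_elem j i).mul continuous_const

end Substitution

section OrthogonalComplement

open MvPolynomial

namespace PolyAct

variable {σ : Type*} [Fintype σ] {M K : Submodule ℂ (MvPolynomial σ ℂ)}

/-- The orthogonal complement inside a submodule. -/
def orth (M K : Submodule ℂ (MvPolynomial σ ℂ)) : Submodule ℂ (MvPolynomial σ ℂ) where
  carrier := {y | y ∈ M ∧ ∀ x ∈ K, fischer σ y x = 0}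
  add_mem' := by
    rintro a b ⟨ha, ha'⟩ ⟨hb, hb'⟩
    exact ⟨M.add_mem ha hb, fun x hx => by
      rw [LinearMap.map_add, LinearMap.add_apply, ha' x hx, hb' x hx, add_zero]⟩
  zero_mem' := ⟨M.zero_mem, fun x _ => by rw [LinearMap.map_zero, LinearMap.zero_apply]⟩
  smul_mem' := by
    rintro c a ⟨ha, ha'⟩
    exact ⟨M.smul_mem c ha, fun x hx => by
      rw [LinearMap.map_smul, LinearMap.smul_apply, ha' x hx, smul_zero]⟩

theorem orth_le : orth M K ≤ M := fun _ h => h.1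

theorem disjoint_orth : Disjoint K (orth M K) := by
  rw [Submodule.disjoint_def]
  exact fun x hx hx' => fischer_definite x (hx'.2 x hx)

theorem le_sup_orth [FiniteDimensional ℂ K] (hKM : K ≤ M) : M ≤ K ⊔ orth M K := by
  intro y hy
  let b := Module.finBasis ℂ K
  let Φ : K →ₗ[ℂ] (Fin (Module.finrank ℂ K) → ℂ) :=
    LinearMap.pi fun i => (((fischer σ).flip (b i)).domRestrict K)
  have hker : ∀ z : MvPolynomial σ ℂ, (∀ i, fischer σ z (b i) = 0) →
      ∀ x ∈ K, fischer σ z x = 0 := by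
    intro z hz x hx
    have h1 : ∀ x : K, fischer σ z x = 0 := by
      intro x
      rw [← b.sum_repr x, Submodule.coe_sum, map_sum]
      refine Finset.sum_eq_zero fun i _ => ?_
      rw [Submodule.coe_smul, LinearMap.map_smulₛₗ, hz, smul_zero]
    exact h1 ⟨x, hx⟩
  have hinj : Function.Injective Φ := by
    rw [← LinearMap.ker_eq_bot, LinearMap.ker_eq_bot']
    intro k hk
    exact Subtype.ext (fischer_definite _ (hker k (fun i => congrFun hk i) k k.2))
  have hsurj : Function.Surjective Φ :=
    (LinearMap.injective_iff_surjective_of_finrank_eq_finrank (by simp)).1 hinj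
  obtain ⟨k, hk⟩ := hsurj fun i => fischer σ y (b i)
  rw [← add_sub_cancel (k : MvPolynomial σ ℂ) y]
  refine Submodule.add_mem_sup k.2 ⟨M.sub_mem hy (hKM k.2), hker _ fun i => ?_⟩
  rw [map_sub, LinearMap.sub_apply, sub_eq_zero]
  exact (congrFun hk i).symm

end PolyAct

end OrthogonalComplement

section PolynomialActions

open MvPolynomial

variable {n : ℕ} {σ : Type*} [Fintype σ] [DecidableEq σ]

/-- A polynomial action of `n × n` matrices by linear substitutions of variables, such that
diagonal matrices act diagonally with nonnegative weights. -/
structure PolyAct (n : ℕ) (σ : Type*) [Fintype σ] [DecidableEq σ] where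
  A : Matrix (Fin n) (Fin n) ℂ →* Matrix σ σ ℂ
  w : σ → Fin n → ℕ
  conjT : ∀ g, A gᴴ = (A g)ᴴ
  diag : ∀ t : Fin n → ℂ, A (Matrix.diagonal t) = Matrix.diagonal fun s => ∏ i, t i ^ w s i
  cont : Continuous A

namespace PolyAct

variable (P : PolyAct n σ)

/-- Submodules stable under the general linear group. -/
def Stable (M : Submodule ℂ (MvPolynomial σ ℂ)) : Prop :=
  ∀ g : GL (Fin n) ℂ, ∀ p ∈ M, linSub (P.A g) p ∈ M

variable {P} {M K O : Submodule ℂ (MvPolynomial σ ℂ)}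

/-- The representation on a stable submodule. -/
def rep (hM : P.Stable M) (H : Subgroup (GL (Fin n) ℂ)) : Representation ℂ H M where
  toFun h := (linSub (P.A (matOf h))).toLinearMap.restrict (hM h)
  map_one' := LinearMap.ext fun x => Subtype.ext (by
    show linSub (P.A 1) (x : MvPolynomial σ ℂ) = x
    rw [map_one, linSub_one])
  map_mul' g h := LinearMap.ext fun x => Subtype.ext (by
    show linSub (P.A (matOf g * matOf h)) (x : MvPolynomial σ ℂ) = _
    rw [map_mul, linSub_mul]; rfl)

theorem coe_rep (hM : P.Stable M) {H : Subgroup (GL (Fin n) ℂ)} (h : H) (x : M) :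
    (rep hM H h x : MvPolynomial σ ℂ) = linSub (P.A (matOf h)) x := rfl

/-- The contravariant form on a stable submodule. -/
def form (hM : P.Stable M) {H : Subgroup (GL (Fin n) ℂ)} {dag : H → H}
    (hdag : ∀ h, matOf (dag h) = (matOf h)ᴴ) : ContraForm dag (rep hM H) where
  B := (((fischer σ).domRestrict M).flip.comp M.subtype).flip
  contra g x y := by
    show fischer σ (linSub (P.A (matOf g)) x) y = fischer σ x (linSub (P.A (matOf (dag g))) y)
    rw [hdag, P.conjT, fischer_linSub]
  definite x hx := Subtype.ext (fischer_definite _ hx)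

theorem orth_stable (hM : P.Stable M) (hK : P.Stable K) : P.Stable (orth M K) := by
  rintro g y ⟨hy, hy'⟩
  refine ⟨hM g y hy, fun x hx => ?_⟩
  rw [fischer_linSub, ← P.conjT, ← coe_glH]
  exact hy' _ (hK _ x hx)

theorem eigen_of_add (hK : P.Stable K) (hO : P.Stable O) (hd : Disjoint K O) {g : GL (Fin n) ℂ}
    {c : ℂ} {k z : MvPolynomial σ ℂ} (hk : k ∈ K) (hz : z ∈ O)
    (h : linSub (P.A g) (k + z) = c • (k + z)) :
    linSub (P.A g) k = c • k ∧ linSub (P.A g) z = c • z := by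
  have h1 : linSub (P.A g) k - c • k = c • z - linSub (P.A g) z := by
    rw [map_add, smul_add] at h
    linear_combination h
  have h2 : linSub (P.A g) k - c • k = 0 :=
    Submodule.disjoint_def.1 hd _ (K.sub_mem (hK g k hk) (K.smul_mem c hk))
      (h1 ▸ O.sub_mem (O.smul_mem c hz) (hO g z hz))
  exact ⟨sub_eq_zero.1 h2, (sub_eq_zero.1 (h1 ▸ h2)).symm⟩

variable (P)

/-- The weight of a monomial. -/
def wt (a : σ →₀ ℕ) (i : Fin n) : ℕ := ∑ s, a s * P.w s i

/-- The space of polynomials of a given weight. -/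
def wtSub (β : Fin n → ℕ) : Submodule ℂ (MvPolynomial σ ℂ) where
  carrier := {p | ∀ a, coeff a p ≠ 0 → P.wt a = β}
  add_mem' := by
    intro p q hp hq a ha
    by_cases h : coeff a p = 0
    · refine hq a fun h' => ha ?_
      rw [coeff_add, h, h', add_zero]
    · exact hp a h
  zero_mem' := fun a ha => absurd (coeff_zero a) ha
  smul_mem' := by
    intro c p hp a ha
    refine hp a fun h => ha ?_
    rw [coeff_smul, h, smul_zero]

variable {P}

theorem mem_wtSub {β : Fin n → ℕ} {p : MvPolynomial σ ℂ} :
    p ∈ P.wtSub β ↔ ∀ a, coeff a p ≠ 0 → P.wt a = β := Iff.rfl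

theorem coeff_torus (t : Fin n → ℂ) (p : MvPolynomial σ ℂ) (a : σ →₀ ℕ) :
    coeff a (linSub (P.A (Matrix.diagonal t)) p) = (∏ i, t i ^ P.wt a i) * coeff a p := by
  rw [P.diag, coeff_linSub_diagonal]
  congr 1
  simp_rw [← Finset.prod_pow, wt, ← Finset.prod_pow_eq_pow_sum]
  rw [Finset.prod_comm]
  refine Finset.prod_congr rfl fun i _ => Finset.prod_congr rfl fun s _ => ?_
  rw [← pow_mul, mul_comm]

theorem torus_of_mem {β : Fin n → ℕ} {p : MvPolynomial σ ℂ} (hp : p ∈ P.wtSub β)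
    (t : Fin n → ℂ) : linSub (P.A (Matrix.diagonal t)) p = (∏ i, t i ^ β i) • p := by
  ext a
  rw [coeff_torus, coeff_smul, smul_eq_mul]
  by_cases h : coeff a p = 0
  · rw [h, mul_zero, mul_zero]
  · rw [hp a h]

/-- A generic element of the torus. -/
def genTorus (n : ℕ) : GL (Fin n) ℂ :=
  Matrix.GeneralLinearGroup.mkOfDetNeZero
    (Matrix.diagonal fun i : Fin n => ((Nat.nth Nat.Prime i : ℕ) : ℂ)) (by
    rw [Matrix.det_diagonal]
    exact Finset.prod_ne_zero_iff.2 fun i _ => Nat.cast_ne_zero.2 (Nat.prime_nth_prime i).ne_zero)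

theorem coe_genTorus : (genTorus n : Matrix (Fin n) (Fin n) ℂ) =
    Matrix.diagonal fun i : Fin n => ((Nat.nth Nat.Prime i : ℕ) : ℂ) := rfl

theorem genTorus_separates {β γ : Fin n → ℕ}
    (h : ∏ i : Fin n, ((Nat.nth Nat.Prime i : ℕ) : ℂ) ^ β i =
      ∏ i : Fin n, ((Nat.nth Nat.Prime i : ℕ) : ℂ) ^ γ i) : β = γ := by
  have h1 : ∏ i : Fin n, (Nat.nth Nat.Prime i) ^ β i =
      ∏ i : Fin n, (Nat.nth Nat.Prime i) ^ γ i := by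
    exact_mod_cast h
  have key : ∀ (β : Fin n → ℕ) (j : Fin n),
      (∏ i : Fin n, (Nat.nth Nat.Prime i) ^ β i).factorization (Nat.nth Nat.Prime j) = β j := by
    intro β j
    rw [Nat.factorization_prod (S := Finset.univ)
      (g := fun i : Fin n => (Nat.nth Nat.Prime i) ^ β i)
      fun i _ => pow_ne_zero _ (Nat.prime_nth_prime i).ne_zero, Finset.sum_apply',
      Finset.sum_eq_single j]
    · rw [(Nat.prime_nth_prime j).factorization_pow, Finsupp.single_eq_same]
    · intro i _ hij
      rw [(Nat.prime_nth_prime i).factorization_pow, Finsupp.single_eq_of_ne]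
      intro e
      exact hij (Fin.ext (Nat.nth_injective Nat.infinite_setOfPred_prime e.symm))
    · simp
  funext j
  rw [← key β j, h1, key γ j]

theorem mem_wtSub_iff {β : Fin n → ℕ} {p : MvPolynomial σ ℂ} :
    p ∈ P.wtSub β ↔ linSub (P.A (genTorus n)) p =
      (∏ i : Fin n, ((Nat.nth Nat.Prime i : ℕ) : ℂ) ^ β i) • p := by
  refine ⟨fun h => torus_of_mem h _, fun h a ha => genTorus_separates ?_⟩
  have := congrArg (coeff a) h
  rw [coe_genTorus, coeff_torus, coeff_smul, smul_eq_mul] at this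
  exact mul_right_cancel₀ ha this

variable (P)

/-- The space of highest weight polynomials of a given weight. -/
def hwSub (β : Fin n → ℕ) : Submodule ℂ (MvPolynomial σ ℂ) where
  carrier := {p | p ∈ P.wtSub β ∧
    ∀ u : GL (Fin n) ℂ, IsUpperUni (u : Matrix (Fin n) (Fin n) ℂ) → linSub (P.A u) p = p}
  add_mem' := by
    rintro p q ⟨hp, hp'⟩ ⟨hq, hq'⟩
    exact ⟨Submodule.add_mem _ hp hq, fun u hu => by rw [map_add, hp' u hu, hq' u hu]⟩
  zero_mem' := ⟨Submodule.zero_mem _, fun u _ => map_zero _⟩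
  smul_mem' := by
    rintro c p ⟨hp, hp'⟩
    exact ⟨Submodule.smul_mem _ c hp, fun u hu => by rw [map_smul, hp' u hu]⟩

variable {P}

theorem mem_hwSub {β : Fin n → ℕ} {p : MvPolynomial σ ℂ} : p ∈ P.hwSub β ↔ p ∈ P.wtSub β ∧
    ∀ u : GL (Fin n) ℂ, IsUpperUni (u : Matrix (Fin n) (Fin n) ℂ) → linSub (P.A u) p = p := Iff.rfl

/-- The character of the torus attached to a weight. -/
def torusChar {H : Subgroup (GL (Fin n) ℂ)} (β : Fin n → ℕ) (h : H) : ℂ := ∏ i, matOf h i i ^ β i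

theorem mem_hwSpace_iff (hM : P.Stable M) {β : Fin n → ℕ} {x : M} :
    x ∈ (glCell n).hwSpace (rep hM ⊤) (torusChar β) ↔ (x : MvPolynomial σ ℂ) ∈ P.hwSub β := by
  constructor
  · rintro ⟨h1, h2⟩
    refine ⟨mem_wtSub_iff.2 ?_, fun u hu => congrArg Subtype.val (h1 ⟨u, trivial⟩ hu)⟩
    have := congrArg Subtype.val (h2 ⟨genTorus n, trivial⟩ ⟨_, rfl⟩)
    rw [coe_rep, Submodule.coe_smul, torusChar] at this
    rw [this]
    congr 1
    refine Finset.prod_congr rfl fun i _ => ?_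
    congr 1
    exact Matrix.diagonal_apply_eq _ _
  · rintro ⟨h1, h2⟩
    refine ⟨fun u hu => Subtype.ext (h2 _ hu), ?_⟩
    rintro t ⟨d, hd⟩
    refine Subtype.ext ?_
    rw [coe_rep, hd, torus_of_mem h1, Submodule.coe_smul, torusChar, hd]
    congr 1
    exact Finset.prod_congr rfl fun i _ => by rw [Matrix.diagonal_apply_eq]

theorem exists_hw (hM : P.Stable M) [FiniteDimensional ℂ M] (hM0 : M ≠ ⊥) :
    ∃ β, ∃ x ∈ M, x ∈ P.hwSub β ∧ x ≠ 0 := by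
  have : Nontrivial M := Submodule.nontrivial_iff_ne_bot.2 hM0
  obtain ⟨v, hv0, hv⟩ := exists_fixed_of_hasPrincipalTorus (hasPrincipalTorus_top n) (rep hM ⊤)
  let F : Submodule ℂ M :=
    { carrier := {x | ∀ u : GL (Fin n) ℂ, IsUpperUni (u : Matrix (Fin n) (Fin n) ℂ) →
        linSub (P.A u) (x : MvPolynomial σ ℂ) = x}
      add_mem' := fun {a b} ha hb u hu => by rw [Submodule.coe_add, map_add, ha u hu, hb u hu]
      zero_mem' := fun u _ => map_zero _
      smul_mem' := fun c a ha u hu => by rw [Submodule.coe_smul, map_smul, ha u hu] }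
  have hvF : v ∈ F := fun u hu => congrArg Subtype.val (hv ⟨u, trivial⟩ hu)
  have : Nontrivial F := ⟨⟨⟨v, hvF⟩, 0, fun h => hv0 (congrArg Subtype.val h)⟩⟩
  let τ : (⊤ : Subgroup (GL (Fin n) ℂ)) := ⟨genTorus n, trivial⟩
  have hF : ∀ x ∈ F, rep hM ⊤ τ x ∈ F := by
    intro x hx u hu
    have h1 : IsUpperUni (((genTorus n)⁻¹ * u * genTorus n : GL (Fin n) ℂ) :
        Matrix (Fin n) (Fin n) ℂ) := by
      obtain ⟨hd, hinv⟩ := diagonal_inv_eq (coe_genTorus (n := n))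
      rw [Units.val_mul, Units.val_mul, hinv, coe_genTorus]
      refine ⟨fun i => ?_, fun i j hij => ?_⟩
      · rw [Matrix.mul_diagonal, Matrix.diagonal_mul, hu.1, mul_one, inv_mul_cancel₀ (hd i)]
      · rw [Matrix.mul_diagonal, Matrix.diagonal_mul, hu.2 i j hij, mul_zero, zero_mul]
    rw [coe_rep]
    show linSub _ (linSub (P.A (genTorus n)) _) = linSub (P.A (genTorus n)) _
    conv_rhs => rw [← hx _ h1]
    rw [← linSub_mul, ← linSub_mul, ← map_mul, ← map_mul, ← Units.val_mul, ← Units.val_mul]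
    congr 3
    group
  let T : Module.End ℂ F := LinearMap.restrict (rep hM ⊤ τ) hF
  obtain ⟨μ, hμ⟩ := Module.End.exists_eigenvalue (K := ℂ) (V := F) T
  obtain ⟨x, hx⟩ := hμ.exists_hasEigenvector
  have hx1 : linSub (P.A (genTorus n)) ((x : M) : MvPolynomial σ ℂ) =
      μ • ((x : M) : MvPolynomial σ ℂ) :=
    congrArg (fun z : F => ((z : M) : MvPolynomial σ ℂ)) hx.apply_eq_smul
  have hx0 : ((x : M) : MvPolynomial σ ℂ) ≠ 0 := fun h => hx.2 (Subtype.ext (Subtype.ext h))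
  obtain ⟨a, ha⟩ := MvPolynomial.ne_zero_iff.1 hx0
  refine ⟨P.wt a, x, (x : M).2, ⟨mem_wtSub_iff.2 ?_, x.2⟩, hx0⟩
  rw [hx1]
  congr 1
  have := congrArg (coeff a) hx1
  rw [coe_genTorus, coeff_torus, coeff_smul, smul_eq_mul] at this
  exact (mul_right_cancel₀ ha this).symm

/-- The height of a weight. -/
def wtHeight (β : Fin n → ℕ) : ℕ := ∑ i : Fin n, (i : ℕ) * β i

theorem coeff_lower {β : Fin n → ℕ} {x : MvPolynomial σ ℂ} (hx : x ∈ P.wtSub β)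
    {l : Matrix (Fin n) (Fin n) ℂ} (hl : IsLowerUni l) (a : σ →₀ ℕ) :
    (wtHeight (P.wt a) < wtHeight β → coeff a (linSub (P.A l) x) = 0) ∧
    (wtHeight (P.wt a) = wtHeight β → coeff a (linSub (P.A l) x) = coeff a x) := by
  let F : ℂ → Matrix (Fin n) (Fin n) ℂ := fun z => Matrix.of fun i j =>
    if (j : ℕ) ≤ i then z ^ ((i : ℕ) - j) * l i j else 0
  have hF : Continuous F := by
    refine continuous_matrix fun i j => ?_
    simp only [F, Matrix.of_apply]
    split_ifs
    · fun_prop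
    · exact continuous_const
  have hF0 : F 0 = 1 := by
    ext i j
    simp only [F, Matrix.of_apply]
    by_cases hij : i = j
    · subst hij
      rw [if_pos le_rfl, Nat.sub_self, pow_zero, one_mul, hl.1, Matrix.one_apply_eq]
    · rw [Matrix.one_apply_ne hij]
      split_ifs with h
      · rw [zero_pow, zero_mul]
        have : (i : ℕ) ≠ j := fun e => hij (Fin.ext e)
        omega
      · rfl
  have hcomm : ∀ z : ℂ, Matrix.diagonal (fun i : Fin n => z ^ (i : ℕ)) * l =
      F z * Matrix.diagonal (fun i : Fin n => z ^ (i : ℕ)) := by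
    intro z
    ext i j
    rw [Matrix.diagonal_mul, Matrix.mul_diagonal]
    simp only [F, Matrix.of_apply]
    split_ifs with h
    · rw [mul_right_comm, ← pow_add, Nat.sub_add_cancel h]
    · rw [hl.2 i j (by omega), mul_zero, zero_mul]
  have hpow : ∀ (z : ℂ) (γ : Fin n → ℕ), ∏ i : Fin n, (z ^ (i : ℕ)) ^ γ i = z ^ wtHeight γ := by
    intro z γ
    simp_rw [← pow_mul, Finset.prod_pow_eq_pow_sum]
    rfl
  set c : ℂ → ℂ := fun z => coeff a (linSub (P.A (F z)) x) with hc
  have hcc : Continuous c := continuous_coeff_linSub (P.cont.comp hF) x a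
  have hc0 : c 0 = coeff a x := by rw [hc]; beta_reduce; rw [hF0, map_one, linSub_one]
  have key : ∀ z, z ^ wtHeight (P.wt a) * coeff a (linSub (P.A l) x) = z ^ wtHeight β * c z := by
    intro z
    rw [← hpow, ← coeff_torus, ← linSub_mul, ← map_mul, hcomm, map_mul, linSub_mul,
      torus_of_mem hx, hpow, map_smul, coeff_smul, smul_eq_mul]
  have lim : ∀ d : ℕ, wtHeight β = wtHeight (P.wt a) + d →
      coeff a (linSub (P.A l) x) = 0 ^ d * c 0 := by
    intro d hd
    have h1 : Filter.Tendsto (fun z : ℂ => z ^ d * c z) (nhdsWithin 0 {0}ᶜ) (nhds (0 ^ d * c 0)) :=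
      (((continuous_pow d).mul hcc).tendsto 0).mono_left nhdsWithin_le_nhds
    refine tendsto_nhds_unique (Filter.Tendsto.congr' ?_ tendsto_const_nhds) h1
    filter_upwards [self_mem_nhdsWithin] with z hz
    have := key z
    rw [hd, pow_add, mul_assoc] at this
    exact mul_left_cancel₀ (pow_ne_zero _ hz) this
  constructor
  · intro h
    rw [lim (wtHeight β - wtHeight (P.wt a)) (by omega), zero_pow (by omega), zero_mul]
  · intro h
    rw [lim 0 h.symm, pow_zero, one_mul, hc0]

theorem coeff_lowerSpan (hM : P.Stable M) {β : Fin n → ℕ} {x : M}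
    (hx : (x : MvPolynomial σ ℂ) ∈ P.wtSub β) {y : M}
    (hy : y ∈ (glCell n).lowerSpan (rep hM ⊤) x) :
    ∃ c : ℂ, ∀ a, (wtHeight (P.wt a) < wtHeight β → coeff a (y : MvPolynomial σ ℂ) = 0) ∧
      (wtHeight (P.wt a) = wtHeight β →
        coeff a (y : MvPolynomial σ ℂ) = c * coeff a (x : MvPolynomial σ ℂ)) := by
  induction hy using Submodule.span_induction with
  | mem y hy =>
    obtain ⟨l, hl, rfl⟩ := hy
    refine ⟨1, fun a => ?_⟩
    rw [one_mul, coe_rep]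
    exact coeff_lower hx hl a
  | zero => exact ⟨0, fun a => by simp⟩
  | add y z _ _ hy hz =>
    obtain ⟨c, hc⟩ := hy
    obtain ⟨d, hd⟩ := hz
    refine ⟨c + d, fun a => ⟨fun h => ?_, fun h => ?_⟩⟩
    · rw [Submodule.coe_add, coeff_add, (hc a).1 h, (hd a).1 h, add_zero]
    · rw [Submodule.coe_add, coeff_add, (hc a).2 h, (hd a).2 h, add_mul]
  | smul r y _ hy =>
    obtain ⟨c, hc⟩ := hy
    refine ⟨r * c, fun a => ⟨fun h => ?_, fun h => ?_⟩⟩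
    · rw [Submodule.coe_smul, coeff_smul, (hc a).1 h, smul_zero]
    · rw [Submodule.coe_smul, coeff_smul, (hc a).2 h, smul_eq_mul, mul_assoc]

theorem weight_lowerSpan (hM : P.Stable M) {β γ : Fin n → ℕ} {x : M}
    (hx : (x : MvPolynomial σ ℂ) ∈ P.wtSub β) {y : M}
    (hy : y ∈ (glCell n).lowerSpan (rep hM ⊤) x) (hy0 : y ≠ 0)
    (hyγ : (y : MvPolynomial σ ℂ) ∈ P.wtSub γ) :
    wtHeight β ≤ wtHeight γ ∧ (wtHeight γ = wtHeight β → γ = β ∧ ∃ c : ℂ, y = c • x) := by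
  obtain ⟨c, hc⟩ := coeff_lowerSpan hM hx hy
  have hy1 : (y : MvPolynomial σ ℂ) ≠ 0 := fun h => hy0 (Subtype.ext h)
  obtain ⟨a, ha⟩ := MvPolynomial.ne_zero_iff.1 hy1
  have hwa := hyγ a ha
  refine ⟨?_, fun h => ?_⟩
  · by_contra! h
    rw [← hwa] at h
    exact ha ((hc a).1 h)
  · have hγβ : γ = β := by
      rw [← hwa]
      refine hx a fun h0 => ha ?_
      rw [(hc a).2 (hwa ▸ h), h0, mul_zero]
    refine ⟨hγβ, c, Subtype.ext ?_⟩
    ext b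
    rw [Submodule.coe_smul, coeff_smul, smul_eq_mul]
    by_cases hb : P.wt b = γ
    · exact (hc b).2 (hb ▸ h)
    · have h1 : coeff b (y : MvPolynomial σ ℂ) = 0 := by
        by_contra h0; exact hb (hyγ b h0)
      have h2 : coeff b (x : MvPolynomial σ ℂ) = 0 := by
        by_contra h0; exact hb (hγβ ▸ hx b h0)
      rw [h1, h2, mul_zero]

theorem antitone_of_hw (hM : P.Stable M) [FiniteDimensional ℂ M] {β : Fin n → ℕ}
    {x : MvPolynomial σ ℂ} (hxM : x ∈ M) (hx : x ∈ P.hwSub β) (hx0 : x ≠ 0) : Antitone β := by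
  have hsucc : ∀ i j : Fin n, (j : ℕ) = i + 1 → β j ≤ β i := by
    intro i j hij
    let s : Equiv.Perm (Fin n) := Equiv.swap i j
    let S : Matrix (Fin n) (Fin n) ℂ := s.permMatrix ℂ
    have hSS : S * S = 1 := by
      show s.permMatrix ℂ * s.permMatrix ℂ = 1
      rw [← Matrix.permMatrix_mul, Equiv.swap_mul_self, Matrix.permMatrix_one]
    let g : (⊤ : Subgroup (GL (Fin n) ℂ)) := ⟨⟨S, S, hSS, hSS⟩, trivial⟩
    have hmem := (glCell n).lowerSpan_stable (rep hM ⊤)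
      ((mem_hwSpace_iff hM (x := ⟨x, hxM⟩)).2 hx) g
      ⟨x, hxM⟩ (Submodule.subset_span ⟨1, Subgroup.one_mem _, by simp⟩)
    have hne : rep hM ⊤ g ⟨x, hxM⟩ ≠ 0 := by
      intro h
      have h2 : rep hM ⊤ g⁻¹ (rep hM ⊤ g ⟨x, hxM⟩) = ⟨x, hxM⟩ := by
        rw [← Module.End.mul_apply, ← map_mul, inv_mul_cancel, map_one, Module.End.one_apply]
      rw [h, map_zero] at h2
      exact hx0 (congrArg Subtype.val h2).symm
    have hwt : (rep hM ⊤ g ⟨x, hxM⟩ : MvPolynomial σ ℂ) ∈ P.wtSub (fun k => β (s k)) := by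
      rw [mem_wtSub_iff, coe_rep, coe_genTorus]
      show linSub _ (linSub (P.A S) x) = _ • linSub (P.A S) x
      have hcomm : ∀ t : Fin n → ℂ, Matrix.diagonal t * S =
          S * Matrix.diagonal fun k => t (s k) := by
        intro t
        ext a b
        rw [Matrix.diagonal_mul, Matrix.mul_diagonal]
        show t a * (s.toPEquiv.toMatrix : Matrix _ _ ℂ) a b = s.toPEquiv.toMatrix a b * t (s b)
        rw [PEquiv.toMatrix_toPEquiv_apply]
        by_cases h : s a = b
        · subst h
          rw [show s (s a) = a from Equiv.swap_apply_self i j a, mul_comm]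
        · rw [Pi.single_eq_of_ne (Ne.symm h), mul_zero, zero_mul]
      rw [← linSub_mul, ← map_mul, hcomm, map_mul, linSub_mul, torus_of_mem hx.1, map_smul]
      congr 1
      refine (Fintype.prod_equiv s _ _ fun k => ?_)
      rw [show s (s k) = k from Equiv.swap_apply_self i j k]
    have h1 := (weight_lowerSpan hM (x := ⟨x, hxM⟩) hx.1 hmem hne hwt).1
    have hne : i ≠ j := by rintro rfl; omega
    have h2 : ∀ γ : Fin n → ℕ, wtHeight γ = (i : ℕ) * γ i + ((j : ℕ) * γ j +
        ∑ k ∈ (Finset.univ.erase i).erase j, (k : ℕ) * γ k) := by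
      intro γ
      rw [wtHeight, ← Finset.add_sum_erase _ _ (Finset.mem_univ i),
        ← Finset.add_sum_erase _ _ (Finset.mem_erase.2 ⟨hne.symm, Finset.mem_univ j⟩)]
    rw [h2, h2 (fun k => β (s k))] at h1
    have h3 : ∑ k ∈ (Finset.univ.erase i).erase j, (k : ℕ) * β (s k) =
        ∑ k ∈ (Finset.univ.erase i).erase j, (k : ℕ) * β k := by
      refine Finset.sum_congr rfl fun k hk => ?_
      rw [Finset.mem_erase, Finset.mem_erase] at hk
      rw [show s k = k from Equiv.swap_apply_of_ne_of_ne hk.2.1 hk.1]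
    rw [h3, show s i = j from Equiv.swap_apply_left i j,
      show s j = i from Equiv.swap_apply_right i j,
      hij] at h1
    nlinarith
  cases n with
  | zero => exact fun i => i.elim0
  | succ n => exact Fin.antitone_iff_succ_le.2 fun i => hsucc _ _ (by simp)

end PolyAct

end PolynomialActions

section RestrictSupport

namespace MvPolynomial

variable {σ : Type*}

theorem mem_restrictSupport_iff_coeff {s : Set (σ →₀ ℕ)} {p : MvPolynomial σ ℂ} :
    p ∈ restrictSupport ℂ s ↔ ∀ a, coeff a p ≠ 0 → a ∈ s := by
  rw [mem_restrictSupport_iff]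
  exact ⟨fun h a ha => h (mem_support_iff.2 ha), fun h a ha => h a (mem_support_iff.1 ha)⟩

theorem finiteDimensional_restrictSupport {s : Set (σ →₀ ℕ)} (hs : s.Finite) :
    FiniteDimensional ℂ (restrictSupport ℂ s) := by
  have := hs.to_subtype
  exact Module.Finite.of_basis (basisRestrictSupport ℂ s)

theorem finrank_restrictSupport (s : Set (σ →₀ ℕ)) :
    Module.finrank ℂ (restrictSupport ℂ s) = s.ncard := by
  rw [Module.finrank_eq_nat_card_basis (basisRestrictSupport ℂ s)]
  rfl

end MvPolynomial

end RestrictSupport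

section MatrixModels

open MvPolynomial PolyAct

namespace PolyAct

variable {n m : ℕ} {σ : Type*} [Fintype σ] [DecidableEq σ]

/-- Commuting polynomial actions. -/
def Commutes (P : PolyAct n σ) (Q : PolyAct m σ) : Prop := ∀ g h, P.A g * Q.A h = Q.A h * P.A g

variable {P : PolyAct n σ} {Q : PolyAct m σ}

theorem Commutes.symm (h : Commutes P Q) : Commutes Q P := fun a b => (h b a).symm

theorem Commutes.linSub_comm (hPQ : Commutes P Q) (g : Matrix (Fin n) (Fin n) ℂ)
    (h : Matrix (Fin m) (Fin m) ℂ) (p : MvPolynomial σ ℂ) :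
    linSub (P.A g) (linSub (Q.A h) p) = linSub (Q.A h) (linSub (P.A g) p) := by
  rw [← linSub_mul, hPQ, linSub_mul]

theorem Commutes.wtSub_stable (hPQ : Commutes P Q) (β : Fin m → ℕ) : P.Stable (Q.wtSub β) := by
  intro g p hp
  rw [mem_wtSub_iff] at hp ⊢
  rw [← hPQ.linSub_comm, hp, map_smul]

theorem Commutes.hwSub_stable (hPQ : Commutes P Q) (β : Fin m → ℕ) : P.Stable (Q.hwSub β) := by
  intro g p hp
  refine ⟨hPQ.wtSub_stable β g p hp.1, fun u hu => ?_⟩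
  rw [← hPQ.linSub_comm, hp.2 u hu]

theorem Stable.inf {M K : Submodule ℂ (MvPolynomial σ ℂ)} (hM : P.Stable M) (hK : P.Stable K) :
    P.Stable (M ⊓ K) := fun g p hp => ⟨hM g p hp.1, hK g p hp.2⟩

theorem hwSub_le (β : Fin n → ℕ) : P.hwSub β ≤ P.wtSub β := fun _ h => h.1

theorem wtSub_eq (β : Fin n → ℕ) : P.wtSub β = restrictSupport ℂ {a | P.wt a = β} := by
  ext p
  rw [mem_restrictSupport_iff_coeff]
  rfl

theorem finite_setOf_wt_eq (hw : ∀ s, P.w s ≠ 0) (β : Fin n → ℕ) :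
    {a : σ →₀ ℕ | P.wt a = β}.Finite := by
  have : ∀ a ∈ {a : σ →₀ ℕ | P.wt a = β}, ∀ s, a s ≤ ∑ i, β i := by
    rintro a rfl s
    obtain ⟨i, hi⟩ : ∃ i, P.w s i ≠ 0 := by
      by_contra! h
      exact hw s (funext h)
    calc a s ≤ a s * P.w s i := Nat.le_mul_of_pos_right _ (Nat.pos_of_ne_zero hi)
      _ ≤ P.wt a i := Finset.single_le_sum (f := fun s => a s * P.w s i)
          (fun _ _ => Nat.zero_le _) (Finset.mem_univ s)
      _ ≤ _ := Finset.single_le_sum (fun _ _ => Nat.zero_le _) (Finset.mem_univ i)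
  refine Set.Finite.subset (Set.finite_Iic (Finsupp.equivFunOnFinite.symm fun _ => ∑ i, β i)) ?_
  exact fun a ha s => this a ha s

theorem finiteDimensional_wtSub (hw : ∀ s, P.w s ≠ 0) (β : Fin n → ℕ) :
    FiniteDimensional ℂ (P.wtSub β) := by
  rw [wtSub_eq]
  exact finiteDimensional_restrictSupport (finite_setOf_wt_eq hw β)

theorem finrank_wtSub_inf (α : Fin n → ℕ) (β : Fin m → ℕ) :
    Module.finrank ℂ ↥(P.wtSub α ⊓ Q.wtSub β) =
      Set.ncard {a : σ →₀ ℕ | P.wt a = α ∧ Q.wt a = β} := by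
  rw [← finrank_restrictSupport]
  suffices h : P.wtSub α ⊓ Q.wtSub β = restrictSupport ℂ {a | P.wt a = α ∧ Q.wt a = β} by rw [h]
  ext p
  rw [Submodule.mem_inf, mem_restrictSupport_iff_coeff, mem_wtSub, mem_wtSub]
  exact ⟨fun h a ha => ⟨h.1 a ha, h.2 a ha⟩,
    fun h => ⟨fun a ha => (h a ha).1, fun a ha => (h a ha).2⟩⟩

end PolyAct

variable {N m : ℕ}

/-- Evaluation of a polynomial in the entries of a matrix. -/
abbrev evalMat (X : Matrix (Fin N) (Fin m) ℂ) : MvPolynomial (Fin N × Fin m) ℂ →+* ℂ :=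
  eval fun s => X s.1 s.2

theorem evalMat_ext {p q : MvPolynomial (Fin N × Fin m) ℂ} (h : ∀ X, evalMat X p = evalMat X q) :
    p = q := MvPolynomial.funext fun x => h (Matrix.of fun i j => x (i, j))

theorem map_evalMat_mvPolynomialX (X : Matrix (Fin N) (Fin m) ℂ) :
    (mvPolynomialX (Fin N) (Fin m) ℂ).map (evalMat X) = X := by
  ext i j
  rw [Matrix.map_apply, mvPolynomialX_apply, eval_X]

open scoped Kronecker

/-- The left action on matrices. -/
def leftAct (N m : ℕ) : PolyAct N (Fin N × Fin m) where
  A :=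
    { toFun := fun g => g ⊗ₖ (1 : Matrix (Fin m) (Fin m) ℂ)
      map_one' := one_kronecker_one
      map_mul' := fun g h => by rw [← mul_kronecker_mul, one_mul] }
  w s := Pi.single s.1 1
  conjT g := by
    show gᴴ ⊗ₖ _ = (g ⊗ₖ _)ᴴ
    rw [conjTranspose_kronecker, conjTranspose_one]
  diag t := by
    show Matrix.diagonal t ⊗ₖ 1 = _
    rw [← Matrix.diagonal_one, diagonal_kronecker_diagonal]
    congr 1
    funext s
    rw [Finset.prod_eq_single s.1, Pi.single_eq_same, pow_one, mul_one]
    · intro i _ hi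
      rw [Pi.single_eq_of_ne hi, pow_zero]
    · simp
  cont := continuous_matrix fun i j => by
    show Continuous fun g : Matrix (Fin N) (Fin N) ℂ =>
      g i.1 j.1 * (1 : Matrix (Fin m) (Fin m) ℂ) i.2 j.2
    fun_prop

/-- The right action on matrices. -/
def rightAct (N m : ℕ) : PolyAct m (Fin N × Fin m) where
  A :=
    { toFun := fun g => (1 : Matrix (Fin N) (Fin N) ℂ) ⊗ₖ g
      map_one' := one_kronecker_one
      map_mul' := fun g h => by rw [← mul_kronecker_mul, one_mul] }
  w s := Pi.single s.2 1
  conjT g := by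
    show _ ⊗ₖ gᴴ = (_ ⊗ₖ g)ᴴ
    rw [conjTranspose_kronecker, conjTranspose_one]
  diag t := by
    show 1 ⊗ₖ Matrix.diagonal t = _
    rw [← Matrix.diagonal_one, diagonal_kronecker_diagonal]
    congr 1
    funext s
    rw [Finset.prod_eq_single s.2, Pi.single_eq_same, pow_one, one_mul]
    · intro i _ hi
      rw [Pi.single_eq_of_ne hi, pow_zero]
    · simp
  cont := continuous_matrix fun i j => by
    show Continuous fun g : Matrix (Fin m) (Fin m) ℂ =>
      (1 : Matrix (Fin N) (Fin N) ℂ) i.1 j.1 * g i.2 j.2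
    fun_prop

theorem commutes_leftAct_rightAct : Commutes (leftAct N m) (rightAct N m) := by
  intro g h
  show g ⊗ₖ 1 * 1 ⊗ₖ h = 1 ⊗ₖ h * g ⊗ₖ 1
  rw [← mul_kronecker_mul, ← mul_kronecker_mul, mul_one, one_mul, mul_one, one_mul]

theorem evalMat_leftAct (g : Matrix (Fin N) (Fin N) ℂ) (X : Matrix (Fin N) (Fin m) ℂ)
    (p : MvPolynomial (Fin N × Fin m) ℂ) :
    evalMat X (linSub ((leftAct N m).A g) p) = evalMat (gᵀ * X) p := by
  rw [evalMat, eval_linSub]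
  congr 2
  funext s
  show ∑ r : Fin N × Fin m, X r.1 r.2 * (g r.1 s.1 * (1 : Matrix (Fin m) (Fin m) ℂ) r.2 s.2) = _
  rw [Fintype.sum_prod_type, Matrix.mul_apply]
  refine Finset.sum_congr rfl fun i _ => ?_
  rw [Finset.sum_eq_single s.2]
  · rw [Matrix.one_apply_eq, mul_one, mul_comm]; rfl
  · intro c _ hc
    rw [Matrix.one_apply_ne hc, mul_zero, mul_zero]
  · simp

theorem evalMat_rightAct (h : Matrix (Fin m) (Fin m) ℂ) (X : Matrix (Fin N) (Fin m) ℂ)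
    (p : MvPolynomial (Fin N × Fin m) ℂ) :
    evalMat X (linSub ((rightAct N m).A h) p) = evalMat (X * h) p := by
  rw [evalMat, eval_linSub]
  congr 2
  funext s
  show ∑ r : Fin N × Fin m, X r.1 r.2 * ((1 : Matrix (Fin N) (Fin N) ℂ) r.1 s.1 * h r.2 s.2) = _
  rw [Fintype.sum_prod_type_right, Matrix.mul_apply]
  refine Finset.sum_congr rfl fun i _ => ?_
  rw [Finset.sum_eq_single s.1]
  · rw [Matrix.one_apply_eq, one_mul]
  · intro c _ hc
    rw [Matrix.one_apply_ne hc, zero_mul, mul_zero]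
  · simp

theorem leftAct_w_ne_zero (s : Fin N × Fin m) : (leftAct N m).w s ≠ 0 :=
  fun h => one_ne_zero ((Pi.single_eq_same (M := fun _ => ℕ) s.1 1).symm.trans (congrFun h s.1))

theorem rightAct_w_ne_zero (s : Fin N × Fin m) : (rightAct N m).w s ≠ 0 :=
  fun h => one_ne_zero ((Pi.single_eq_same (M := fun _ => ℕ) s.2 1).symm.trans (congrFun h s.2))

/-- The product of leading minors attached to a dominant weight. -/
def leadProd {R : Type*} [CommRing R] (X : Matrix (Fin N) (Fin m) R) (lam : Fin m → ℕ) : R :=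
  ∏ k ∈ Finset.range m, lead X (k + 1) ^ (extZ lam k - extZ lam (k + 1))

/-- The polynomial given by the product of leading minors attached to a dominant weight. -/
def leadPoly (N : ℕ) (lam : Fin m → ℕ) : MvPolynomial (Fin N × Fin m) ℂ :=
  leadProd (mvPolynomialX (Fin N) (Fin m) ℂ) lam

theorem evalMat_leadPoly (lam : Fin m → ℕ) (X : Matrix (Fin N) (Fin m) ℂ) :
    evalMat X (leadPoly N lam) = leadProd X lam := by
  rw [leadPoly, leadProd, map_prod, leadProd]
  refine Finset.prod_congr rfl fun k _ => ?_
  rw [map_pow, map_lead, map_evalMat_mvPolynomialX]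

theorem antitone_extZ {lam : Fin m → ℕ} (hl : Antitone lam) : Antitone (extZ lam) := by
  intro i j hij
  unfold extZ
  split_ifs with h1 h2 h2
  · exact hl hij
  · omega
  · exact Nat.zero_le _
  · exact le_rfl

theorem prod_range_prod_pow (l : ℕ → ℕ) (hl : Antitone l) (t : ℕ → ℂ) (m : ℕ) :
    ∏ k ∈ Finset.range m, (∏ i ∈ Finset.range (k + 1), t i) ^ (l k - l (k + 1)) =
      ∏ i ∈ Finset.range m, t i ^ (l i - l m) := by
  induction m with
  | zero => rfl
  | succ m ih =>
    rw [Finset.prod_range_succ, ih, Finset.prod_range_succ (fun i => t i ^ (l i - l (m + 1))),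
      Finset.prod_range_succ t, mul_pow, ← mul_assoc, ← Finset.prod_pow, ← Finset.prod_mul_distrib]
    congr 1
    refine Finset.prod_congr rfl fun i hi => ?_
    rw [← pow_add]
    congr 1
    have h1 := hl (Finset.mem_range.1 hi).le
    have h2 := hl (Nat.le_succ m)
    simp only [Nat.succ_eq_add_one] at h2
    omega

theorem leadProd_of_lead_mul {lam : Fin m → ℕ} (hl : Antitone lam) {X Y : Matrix (Fin N) (Fin m) ℂ}
    {t : ℕ → ℂ} (h : ∀ k ≤ m, lead Y k = (∏ i ∈ Finset.range k, t i) * lead X k) :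
    leadProd Y lam = (∏ i : Fin m, t i ^ lam i) * leadProd X lam := by
  have h1 : leadProd Y lam = (∏ k ∈ Finset.range m, (∏ i ∈ Finset.range (k + 1), t i) ^
      (extZ lam k - extZ lam (k + 1))) * leadProd X lam := by
    rw [leadProd, leadProd, ← Finset.prod_mul_distrib]
    refine Finset.prod_congr rfl fun k hk => ?_
    rw [h _ (Finset.mem_range.1 hk), mul_pow]
  rw [h1, prod_range_prod_pow _ (antitone_extZ hl), ← Fin.prod_univ_eq_prod_range
    (fun i => t i ^ (extZ lam i - extZ lam m))]
  congr 1
  refine Finset.prod_congr rfl fun i _ => ?_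
  congr 1
  simp [extZ]

theorem lead_lower_mul {l : Matrix (Fin N) (Fin N) ℂ} (hl : IsLowerUni l)
    (X : Matrix (Fin N) (Fin m) ℂ) {k : ℕ} (hk : k ≤ N) : lead (l * X) k = lead X k := by
  rw [lead, leadBlock_mul_of_lower l X hl.2 hk, Matrix.det_mul]
  show lead l k * lead X k = _
  rw [hl.lead_eq_one hk, one_mul]

theorem lead_mul_upper {u : Matrix (Fin m) (Fin m) ℂ} (hu : ∀ i j : Fin m, (j : ℕ) < i → u i j = 0)
    (X : Matrix (Fin N) (Fin m) ℂ) {k : ℕ} (hk : k ≤ m) :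
    lead (X * u) k = (∏ i ∈ Finset.range k, extM u i i) * lead X k := by
  rw [lead, leadBlock_mul_of_upper X u hu hk, Matrix.det_mul, mul_comm]
  show lead u k * lead X k = _
  rw [lead_of_upper u hu]

theorem lead_diagonal_mul (t : Fin N → ℂ) (X : Matrix (Fin N) (Fin m) ℂ) {k : ℕ} (hk : k ≤ N) :
    lead (Matrix.diagonal t * X) k =
      (∏ i ∈ Finset.range k, extM (Matrix.diagonal t) i i) * lead X k := by
  rw [lead, leadBlock_mul_of_lower _ X
    (fun i j h => Matrix.diagonal_apply_ne _ (by rintro rfl; omega))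
    hk, Matrix.det_mul]
  show lead (Matrix.diagonal t) k * lead X k = _
  rw [lead_of_lower _ (fun i j h => Matrix.diagonal_apply_ne _ (by rintro rfl; omega))]

theorem extM_apply {R : Type*} [CommRing R] (X : Matrix (Fin N) (Fin m) R) {i j : ℕ} (hi : i < N)
    (hj : j < m) : extM X i j = X ⟨i, hi⟩ ⟨j, hj⟩ := dif_pos ⟨hi, hj⟩

theorem leadProd_lower_mul (hmN : m ≤ N) {l : Matrix (Fin N) (Fin N) ℂ} (hl : IsLowerUni l)
    (X : Matrix (Fin N) (Fin m) ℂ) (lam : Fin m → ℕ) : leadProd (l * X) lam = leadProd X lam := by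
  rw [leadProd, leadProd]
  refine Finset.prod_congr rfl fun k hk => ?_
  rw [Finset.mem_range] at hk
  rw [lead_lower_mul hl X (by omega)]

theorem leadProd_mul_upper {lam : Fin m → ℕ} (hl : Antitone lam) {u : Matrix (Fin m) (Fin m) ℂ}
    (hu : ∀ i j : Fin m, (j : ℕ) < i → u i j = 0) (X : Matrix (Fin N) (Fin m) ℂ) :
    leadProd (X * u) lam = (∏ i, u i i ^ lam i) * leadProd X lam := by
  rw [leadProd_of_lead_mul hl fun k hk => lead_mul_upper hu X hk]
  congr 1
  exact Finset.prod_congr rfl fun i _ => by rw [extM_apply u i.2 i.2]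

/-- The leading rectangular identity matrix. -/
def rectOne (N m : ℕ) : Matrix (Fin N) (Fin m) ℂ :=
  Matrix.of fun i j => if (i : ℕ) = j then 1 else 0

theorem lead_rectOne (hmN : m ≤ N) {k : ℕ} (hk : k ≤ m) : lead (rectOne N m) k = 1 := by
  rw [lead_of_upper (rectOne N m) fun i j h => if_neg (by omega)]
  refine Finset.prod_eq_one fun i hi => ?_
  rw [Finset.mem_range] at hi
  rw [extM_apply _ (by omega) (by omega)]
  exact if_pos rfl

theorem leadProd_rectOne (hmN : m ≤ N) (lam : Fin m → ℕ) : leadProd (rectOne N m) lam = 1 :=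
  Finset.prod_eq_one fun k hk => by rw [lead_rectOne hmN (Finset.mem_range.1 hk), one_pow]

variable {lam : Fin m → ℕ}

theorem leadPoly_ne_zero (hmN : m ≤ N) : leadPoly N lam ≠ 0 := by
  intro h
  have := evalMat_leadPoly (N := N) lam (rectOne N m)
  rw [h, map_zero, leadProd_rectOne hmN] at this
  exact zero_ne_one this

theorem leadPoly_mem_hwSub (hl : Antitone lam) : leadPoly N lam ∈ (rightAct N m).hwSub lam := by
  refine ⟨mem_wtSub_iff.2 (evalMat_ext fun X => ?_), fun u hu => evalMat_ext fun X => ?_⟩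
  · rw [evalMat_rightAct, smul_eval, evalMat_leadPoly, evalMat_leadPoly, coe_genTorus,
      leadProd_mul_upper hl fun i j h => Matrix.diagonal_apply_ne _ (by rintro rfl; omega)]
    congr 1
    exact Finset.prod_congr rfl fun i _ => by rw [Matrix.diagonal_apply_eq]
  · rw [evalMat_rightAct, evalMat_leadPoly, evalMat_leadPoly, leadProd_mul_upper hl hu.2]
    rw [Finset.prod_eq_one (fun i _ => by rw [hu.1, one_pow]), one_mul]

theorem leadPoly_mem_left (hmN : m ≤ N) (hl : Antitone lam) :
    leadPoly N lam ∈ (leftAct N m).hwSub fun i => extZ lam i := by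
  refine ⟨mem_wtSub_iff.2 (evalMat_ext fun X => ?_), fun u hu => evalMat_ext fun X => ?_⟩
  · rw [evalMat_leftAct, smul_eval, evalMat_leadPoly, evalMat_leadPoly, coe_genTorus,
      Matrix.diagonal_transpose,
      leadProd_of_lead_mul hl fun k hk => lead_diagonal_mul _ X (hk.trans hmN)]
    congr 1
    rw [Fin.prod_univ_eq_prod_range (fun i => ((Nat.nth Nat.Prime i : ℕ) : ℂ) ^ extZ lam i),
      ← Finset.prod_subset (Finset.range_subset_range.2 hmN), ← Fin.prod_univ_eq_prod_range
      (fun i => ((Nat.nth Nat.Prime i : ℕ) : ℂ) ^ extZ lam i)]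
    · refine Finset.prod_congr rfl fun i _ => ?_
      rw [extM_apply _ (i.2.trans_le hmN) (i.2.trans_le hmN), Matrix.diagonal_apply_eq]
      simp [extZ]
    · intro i _ hi
      rw [Finset.mem_range, not_lt] at hi
      rw [extZ, dif_neg (by omega), pow_zero]
  · rw [evalMat_leftAct, evalMat_leadPoly, evalMat_leadPoly, leadProd_lower_mul hmN]
    exact isUpperUni_transpose.1 (by rwa [Matrix.transpose_transpose])

theorem eq_smul_leadPoly (hmN : m ≤ N) (hl : Antitone lam) {p : MvPolynomial (Fin N × Fin m) ℂ}
    (hp : p ∈ (rightAct N m).hwSub lam)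
    (hu : ∀ u : GL (Fin N) ℂ, IsUpperUni (u : Matrix (Fin N) (Fin N) ℂ) →
      linSub ((leftAct N m).A u) p = p) :
    p = evalMat (rectOne N m) p • leadPoly N lam := by
  have key : ∀ X : Matrix (Fin N) (Fin m) ℂ, (∀ k ≤ m, lead X k ≠ 0) →
      evalMat X p = evalMat (rectOne N m) p * leadProd X lam := by
    intro X hX
    obtain ⟨l, hlow, b, hb, rfl⟩ := exists_lower_mul_upper hmN X hX
    have hlT : IsUpperUni ((glT l : GL (Fin N) ℂ) : Matrix (Fin N) (Fin N) ℂ) := by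
      rw [coe_glT, isUpperUni_transpose]; exact hlow
    let c : Matrix (Fin m) (Fin m) ℂ := Matrix.of fun i j => b (Fin.castLE hmN i) j
    have hbc : b = rectOne N m * c := by
      ext i j
      rw [Matrix.mul_apply]
      by_cases hi : (i : ℕ) < m
      · rw [Finset.sum_eq_single ⟨i, hi⟩]
        · rw [rectOne, Matrix.of_apply, if_pos rfl, one_mul]; rfl
        · intro k _ hk
          rw [rectOne, Matrix.of_apply, if_neg (fun e => hk (Fin.ext e.symm)), zero_mul]
        · simp
      · rw [hb i j (by omega), Finset.sum_eq_zero]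
        intro k _
        rw [rectOne, Matrix.of_apply, if_neg (by omega), zero_mul]
    have hcu : ∀ i j : Fin m, (j : ℕ) < i → c i j = 0 := fun i j h => hb _ _ h
    have hc0 : ∀ i, c i i ≠ 0 := by
      have h1 := hX m le_rfl
      rw [lead_lower_mul hlow _ hmN, lead_of_upper b hb, Finset.prod_ne_zero_iff] at h1
      intro i
      have := h1 i (Finset.mem_range.2 i.2)
      rwa [extM_apply _ (i.2.trans_le hmN) i.2] at this
    let u : Matrix (Fin m) (Fin m) ℂ := Matrix.diagonal (fun i => (c i i)⁻¹) * c
    have hua : ∀ i j, u i j = (c i i)⁻¹ * c i j := fun i j => Matrix.diagonal_mul _ _ _ _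
    have hu1 : IsUpperUni u := by
      refine ⟨fun i => ?_, fun i j h => ?_⟩
      · rw [hua, inv_mul_cancel₀ (hc0 i)]
      · rw [hua, hcu i j h, mul_zero]
    have hcfac : c = Matrix.diagonal (fun i => c i i) * u := by
      ext i j
      rw [Matrix.diagonal_mul, hua, mul_inv_cancel_left₀ (hc0 i)]
    have hdet : u.det ≠ 0 := by
      have h1 : IsLowerUni uᵀ := isUpperUni_transpose.1 (by rwa [Matrix.transpose_transpose])
      rw [← Matrix.det_transpose, h1.det_eq_one]
      exact one_ne_zero
    have hred : evalMat ((l : Matrix (Fin N) (Fin N) ℂ) * b) p = evalMat b p := by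
      conv_rhs => rw [← hu _ hlT, evalMat_leftAct, coe_glT, Matrix.transpose_transpose]
    have hpu : evalMat b p = (∏ i, c i i ^ lam i) * evalMat (rectOne N m) p := by
      have h1 : b = rectOne N m * Matrix.diagonal (fun i => c i i) * u := by
        rw [Matrix.mul_assoc, ← hcfac, hbc]
      have h2 : linSub ((rightAct N m).A u) p = p :=
        hp.2 (Matrix.GeneralLinearGroup.mkOfDetNeZero u hdet) hu1
      rw [h1, ← evalMat_rightAct u, h2, ← evalMat_rightAct, torus_of_mem hp.1, smul_eval]
    rw [hred, hpu, leadProd_lower_mul hmN hlow, hbc, leadProd_mul_upper hl hcu,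
      leadProd_rectOne hmN, mul_one, mul_comm]
  have hz : (∏ k ∈ Finset.range (m + 1), lead (mvPolynomialX (Fin N) (Fin m) ℂ) k) *
      (p - evalMat (rectOne N m) p • leadPoly N lam) = 0 := by
    refine evalMat_ext fun X => ?_
    rw [map_zero, map_mul, map_prod, map_sub, smul_eval, evalMat_leadPoly]
    by_cases h : ∀ k ≤ m, lead X k ≠ 0
    · rw [key X h, sub_self, mul_zero]
    · push Not at h
      obtain ⟨k, hk, h0⟩ := h
      rw [Finset.prod_eq_zero (Finset.mem_range.2 (Nat.lt_succ_of_le hk)), zero_mul]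
      rw [map_lead, map_evalMat_mvPolynomialX, h0]
  rcases mul_eq_zero.1 hz with h | h
  · have := congrArg (evalMat (rectOne N m)) h
    rw [map_prod, map_zero, Finset.prod_eq_zero_iff] at this
    obtain ⟨k, hk, h0⟩ := this
    rw [map_lead, map_evalMat_mvPolynomialX,
      lead_rectOne hmN (Nat.lt_succ_iff.1 (Finset.mem_range.1 hk))] at h0
    exact absurd h0 one_ne_zero
  · exact sub_eq_zero.1 h

theorem hwStable (N : ℕ) (lam : Fin m → ℕ) : (leftAct N m).Stable ((rightAct N m).hwSub lam) :=
  commutes_leftAct_rightAct.hwSub_stable lam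

instance finiteDimensional_hwSub_rightAct (lam : Fin m → ℕ) :
    FiniteDimensional ℂ ((rightAct N m).hwSub lam) := by
  have := finiteDimensional_wtSub (P := rightAct N m) rightAct_w_ne_zero lam
  exact Submodule.finiteDimensional_of_le (hwSub_le lam)

theorem finiteDimensional_of_le_hwSub {K : Submodule ℂ (MvPolynomial (Fin N × Fin m) ℂ)}
    (h : K ≤ (rightAct N m).hwSub lam) : FiniteDimensional ℂ K :=
  Submodule.finiteDimensional_of_le h

theorem leadPoly_mem_of_stable (hmN : m ≤ N) (hl : Antitone lam)
    {K : Submodule ℂ (MvPolynomial (Fin N × Fin m) ℂ)} (hK : (leftAct N m).Stable K)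
    (hle : K ≤ (rightAct N m).hwSub lam) (hK0 : K ≠ ⊥) : leadPoly N lam ∈ K := by
  have := finiteDimensional_of_le_hwSub hle
  obtain ⟨β, x, hxK, hx, hx0⟩ := exists_hw hK hK0
  have h1 := eq_smul_leadPoly hmN hl (hle hxK) hx.2
  have hc : evalMat (rectOne N m) x ≠ 0 := by
    intro h
    rw [h, zero_smul] at h1
    exact hx0 h1
  rw [← inv_smul_smul₀ hc (leadPoly N lam), ← h1]
  exact K.smul_mem _ hxK

theorem eq_of_stable (hmN : m ≤ N) (hl : Antitone lam)
    {K : Submodule ℂ (MvPolynomial (Fin N × Fin m) ℂ)} (hK : (leftAct N m).Stable K)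
    (hle : K ≤ (rightAct N m).hwSub lam) (hK0 : K ≠ ⊥) : K = (rightAct N m).hwSub lam := by
  have := finiteDimensional_of_le_hwSub hle
  have h1 := leadPoly_mem_of_stable hmN hl hK hle hK0
  have h2 : orth ((rightAct N m).hwSub lam) K = ⊥ := by
    by_contra h
    have h3 := leadPoly_mem_of_stable hmN hl (orth_stable (hwStable N lam) hK) orth_le h
    exact leadPoly_ne_zero hmN (Submodule.disjoint_def.1 disjoint_orth _ h1 h3)
  have h3 := le_sup_orth hle
  rw [h2, sup_bot_eq] at h3
  exact le_antisymm hle h3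

theorem isIrreducibleRep_hwSub (hmN : m ≤ N) (hl : Antitone lam) :
    IsIrreducibleRep (rep (hwStable N lam) ⊤) := by
  refine ⟨⟨⟨_, leadPoly_mem_hwSub hl⟩, 0, fun h => leadPoly_ne_zero hmN (congrArg Subtype.val h)⟩,
    fun Z hZ => ?_⟩
  by_cases h : Z.map (Submodule.subtype _) = ⊥
  · left
    exact Submodule.map_injective_of_injective (Submodule.injective_subtype _)
      (by rw [h, Submodule.map_bot])
  · right
    have h1 := eq_of_stable hmN hl (K := Z.map (Submodule.subtype _)) (by
      rintro g _ ⟨z, hz, rfl⟩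
      exact ⟨_, hZ ⟨g, trivial⟩ z hz, rfl⟩) (Submodule.map_subtype_le _ _) h
    exact Submodule.map_injective_of_injective (Submodule.injective_subtype _)
      (by rw [h1, Submodule.map_top, Submodule.range_subtype])

end MatrixModels

section CharacterFormula

open MvPolynomial PolyAct

variable {n m : ℕ} {σ τ : Type*} [Fintype σ] [DecidableEq σ]

/-- The conjugate transpose on the full general linear group. -/
def topDag (n : ℕ) (g : (⊤ : Subgroup (GL (Fin n) ℂ))) : (⊤ : Subgroup (GL (Fin n) ℂ)) :=
  ⟨glH g, trivial⟩

theorem topDag_topDag (g : (⊤ : Subgroup (GL (Fin n) ℂ))) : topDag n (topDag n g) = g :=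
  matOf_injective (Matrix.conjTranspose_conjTranspose _)

theorem IsLowerUni.conjTranspose {A : Matrix (Fin n) (Fin n) ℂ} (hA : IsLowerUni A) :
    IsUpperUni Aᴴ := by
  refine ⟨fun i => ?_, fun i j h => ?_⟩
  · rw [Matrix.conjTranspose_apply, hA.1, star_one]
  · rw [Matrix.conjTranspose_apply, hA.2 j i h, star_zero]

theorem leadPoly_mem_hwSpace {lam : Fin n → ℕ} (hl : Antitone lam) :
    (⟨leadPoly n lam, leadPoly_mem_hwSub hl⟩ : (rightAct n n).hwSub lam) ∈
      (glCell n).hwSpace (rep (hwStable n lam) ⊤) (torusChar lam) := by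
  rw [mem_hwSpace_iff]
  have h : (fun i : Fin n => extZ lam i) = lam := by
    funext i
    simp [extZ]
  have := leadPoly_mem_left le_rfl hl
  rwa [h] at this

/-- Pairing with the highest weight vector. -/
def leadFunctional (N : ℕ) (lam : Fin m → ℕ) : (rightAct N m).hwSub lam →ₗ[ℂ] ℂ :=
  ((fischer (Fin N × Fin m)).flip (leadPoly N lam)).comp (Submodule.subtype _)

theorem leadFunctional_apply {N : ℕ} {lam : Fin m → ℕ} (x : (rightAct N m).hwSub lam) :
    leadFunctional N lam x = fischer _ (x : MvPolynomial (Fin N × Fin m) ℂ) (leadPoly N lam) := rfl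

theorem leadFunctional_ne_zero {N : ℕ} (hmN : m ≤ N) {lam : Fin m → ℕ} (hl : Antitone lam) :
    leadFunctional N lam ≠ 0 := fun h =>
  leadPoly_ne_zero hmN (fischer_definite _
    (LinearMap.congr_fun h ⟨leadPoly N lam, leadPoly_mem_hwSub hl⟩))

theorem leadFunctional_fixed {N : ℕ} (hmN : m ≤ N) {lam : Fin m → ℕ} (hl : Antitone lam)
    {H : Subgroup (GL (Fin N) ℂ)} {l : H} (hlow : IsLowerUni (matOf l))
    (x : (rightAct N m).hwSub lam) :
    leadFunctional N lam (rep (hwStable N lam) H l x) = leadFunctional N lam x := by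
  rw [leadFunctional_apply, leadFunctional_apply, coe_rep, fischer_linSub, ← PolyAct.conjT]
  congr 1
  exact (leadPoly_mem_left hmN hl).2 (glH l) hlow.conjTranspose

variable {P : PolyAct n σ} {M : Submodule ℂ (MvPolynomial σ ℂ)}

theorem exists_map_of_hw (hM : P.Stable M) [FiniteDimensional ℂ M] {γ : Fin n → ℕ}
    (hγ : Antitone γ) {x : MvPolynomial σ ℂ} (hxM : x ∈ M) (hx : x ∈ P.hwSub γ) (hx0 : x ≠ 0) :
    ∃ φ : (rightAct n n).hwSub γ →ₗ[ℂ] MvPolynomial σ ℂ, Function.Injective φ ∧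
      LinearMap.range φ ≤ M ∧ ∀ (g : GL (Fin n) ℂ) (y : (rightAct n n).hwSub γ),
        φ (rep (hwStable n γ) ⊤ ⟨g, trivial⟩ y) = linSub (P.A g) (φ y) := by
  have hirr := isIrreducibleRep_hwSub (N := n) le_rfl hγ
  obtain ⟨f, hf, hfx⟩ := exists_equivariant (glCell n) (topDag n) topDag_topDag
    (fun l hl => IsLowerUni.conjTranspose hl) hirr (leadPoly_mem_hwSpace hγ)
    (fun h => leadPoly_ne_zero (N := n) le_rfl (congrArg Subtype.val h))
    (leadFunctional_ne_zero le_rfl hγ) (fun l hl x => leadFunctional_fixed le_rfl hγ hl x)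
    (form hM (dag := topDag n) fun _ => rfl)
    (x := ⟨x, hxM⟩) ((mem_hwSpace_iff hM).2 hx)
  have hker : LinearMap.ker f = ⊥ := by
    refine (hirr.2 (LinearMap.ker f) fun g y hy => ?_).resolve_right fun h => hx0 ?_
    · rw [LinearMap.mem_ker] at hy ⊢
      have := LinearMap.congr_fun (hf g) y
      rw [LinearMap.comp_apply, LinearMap.comp_apply, hy, map_zero] at this
      exact this
    · rw [LinearMap.ker_eq_top.1 h] at hfx
      exact (congrArg Subtype.val hfx).symm
  refine ⟨M.subtype.comp f, (Submodule.injective_subtype M).comp (LinearMap.ker_eq_bot.1 hker), ?_,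
    fun g y => ?_⟩
  · rintro _ ⟨y, rfl⟩
    exact (f y).2
  · exact congrArg Subtype.val (LinearMap.congr_fun (hf ⟨g, trivial⟩) y)

theorem finrank_inf_eq_of_map {V₁ V₂ : Type*} [AddCommGroup V₁] [Module ℂ V₁] [AddCommGroup V₂]
    [Module ℂ V₂] {M₁ S₁ : Submodule ℂ V₁} {S₂ : Submodule ℂ V₂} (φ : M₁ →ₗ[ℂ] V₂)
    (hφ : Function.Injective φ) (h : ∀ x : M₁, (x : V₁) ∈ S₁ ↔ φ x ∈ S₂) :
    Module.finrank ℂ ↥(LinearMap.range φ ⊓ S₂) = Module.finrank ℂ ↥(M₁ ⊓ S₁) := by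
  have h1 : (S₁.comap M₁.subtype).map φ = LinearMap.range φ ⊓ S₂ := by
    ext y
    constructor
    · rintro ⟨x, hx, rfl⟩
      exact ⟨⟨x, rfl⟩, (h x).1 hx⟩
    · rintro ⟨⟨x, rfl⟩, hx⟩
      exact ⟨x, (h x).2 hx, rfl⟩
  have h2 := Submodule.map_comap_subtype M₁ S₁
  rw [← h1, ← h2, ← (Submodule.equivMapOfInjective φ hφ _).finrank_eq,
    ← (Submodule.equivMapOfInjective _ (Submodule.injective_subtype M₁) _).finrank_eq]

/-- The dimension of a weight space of the irreducible representation with given highest weight. -/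
def weightMult (lam β : Fin n → ℕ) : ℕ :=
  Module.finrank ℂ ↥((rightAct n n).hwSub lam ⊓ (leftAct n n).wtSub β)

theorem sum_wt_leftAct (a : Fin n × Fin m →₀ ℕ) (i : Fin n) :
    (leftAct n m).wt a i = ∑ c, a (i, c) := by
  show ∑ s, a s * Pi.single (M := fun _ => ℕ) s.1 1 i = _
  rw [Fintype.sum_prod_type, Finset.sum_eq_single i]
  · exact Finset.sum_congr rfl fun c _ => by rw [Pi.single_eq_same, mul_one]
  · intro j _ hj
    exact Finset.sum_eq_zero fun c _ => by rw [Pi.single_eq_of_ne (Ne.symm hj), mul_zero]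
  · simp

theorem sum_wt_rightAct (a : Fin n × Fin m →₀ ℕ) (i : Fin m) :
    (rightAct n m).wt a i = ∑ r, a (r, i) := by
  show ∑ s, a s * Pi.single (M := fun _ => ℕ) s.2 1 i = _
  rw [Fintype.sum_prod_type_right, Finset.sum_eq_single i]
  · exact Finset.sum_congr rfl fun c _ => by rw [Pi.single_eq_same, mul_one]
  · intro j _ hj
    exact Finset.sum_eq_zero fun c _ => by rw [Pi.single_eq_of_ne (Ne.symm hj), mul_zero]
  · simp

theorem exists_of_weightMult_ne_zero {lam β : Fin n → ℕ} (h : weightMult lam β ≠ 0) :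
    ∃ y ∈ (rightAct n n).hwSub lam, y ∈ (leftAct n n).wtSub β ∧ y ≠ 0 := by
  by_contra! h0
  refine h ?_
  rw [weightMult, show (rightAct n n).hwSub lam ⊓ (leftAct n n).wtSub β = ⊥ from
    (Submodule.eq_bot_iff _).2 fun y hy => h0 y hy.1 hy.2, finrank_bot]

theorem weightMult_eq_zero {lam β : Fin n → ℕ} (h : ∑ i, lam i ≠ ∑ i, β i) :
    weightMult lam β = 0 := by
  by_contra h0
  obtain ⟨y, hy1, hy2, hy0⟩ := exists_of_weightMult_ne_zero h0
  obtain ⟨a, ha⟩ := MvPolynomial.ne_zero_iff.1 hy0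
  apply h
  rw [← hy1.1 a ha, ← hy2 a ha]
  simp_rw [sum_wt_leftAct, sum_wt_rightAct]
  exact Finset.sum_comm

theorem dominance_of_mem_hwSub_wtSub {lam β : Fin n → ℕ} (hl : Antitone lam)
    {y : MvPolynomial (Fin n × Fin n) ℂ} (hy : y ∈ (rightAct n n).hwSub lam)
    (hyβ : y ∈ (leftAct n n).wtSub β) (hy0 : y ≠ 0) :
    wtHeight lam ≤ wtHeight β ∧
      (wtHeight β = wtHeight lam → β = lam ∧ ∃ c : ℂ, y = c • leadPoly n lam) := by
  have h1 := leadPoly_mem_hwSpace hl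
  have h2 := lowerSpan_eq_top (glCell n) (isIrreducibleRep_hwSub (N := n) le_rfl hl) h1
    (fun h => leadPoly_ne_zero (N := n) le_rfl (congrArg Subtype.val h))
  obtain ⟨h3, h4⟩ := weight_lowerSpan (hwStable n lam) (y := ⟨y, hy⟩)
    ((mem_hwSpace_iff (hwStable n lam)).1 h1).1
    (h2 ▸ Submodule.mem_top) (fun h => hy0 (congrArg Subtype.val h)) hyβ
  refine ⟨h3, fun h => ⟨(h4 h).1, ?_⟩⟩
  obtain ⟨c, hc⟩ := (h4 h).2
  exact ⟨c, congrArg Subtype.val hc⟩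

theorem weightMult_triangular {lam β : Fin n → ℕ} (hl : Antitone lam) (h : weightMult lam β ≠ 0) :
    wtHeight lam ≤ wtHeight β ∧ (wtHeight β = wtHeight lam → β = lam) := by
  obtain ⟨y, hy1, hy2, hy0⟩ := exists_of_weightMult_ne_zero h
  obtain ⟨h1, h2⟩ := dominance_of_mem_hwSub_wtSub hl hy1 hy2 hy0
  exact ⟨h1, fun h => (h2 h).1⟩

theorem weightMult_self {lam : Fin n → ℕ} (hl : Antitone lam) : weightMult lam lam = 1 := by
  rw [weightMult, ← finrank_span_singleton (K := ℂ) (leadPoly_ne_zero (N := n) (lam := lam) le_rfl)]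
  suffices h : (rightAct n n).hwSub lam ⊓ (leftAct n n).wtSub lam =
      Submodule.span ℂ {leadPoly n lam} by rw [h]
  apply le_antisymm
  · rintro y ⟨hy1, hy2⟩
    by_cases hy0 : y = 0
    · rw [hy0]; exact Submodule.zero_mem _
    · obtain ⟨-, h⟩ := dominance_of_mem_hwSub_wtSub hl hy1 hy2 hy0
      obtain ⟨c, hc⟩ := (h rfl).2
      exact Submodule.mem_span_singleton.2 ⟨c, hc.symm⟩
  · rw [Submodule.span_singleton_le_iff_mem]
    exact ⟨leadPoly_mem_hwSub hl,
      ((mem_hwSpace_iff (hwStable n lam)).1 (leadPoly_mem_hwSpace hl)).1⟩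

theorem finrank_hwSub_inf_hwSub {lam : Fin n → ℕ} (hl : Antitone lam) (β : Fin n → ℕ) :
    Module.finrank ℂ ↥((rightAct n n).hwSub lam ⊓ (leftAct n n).hwSub β) =
      if β = lam then 1 else 0 := by
  have h0 := ((mem_hwSpace_iff (hwStable n lam)).1 (leadPoly_mem_hwSpace hl))
  split_ifs with h
  · subst h
    rw [← weightMult_self hl, weightMult]
    suffices h : (rightAct n n).hwSub β ⊓ (leftAct n n).hwSub β =
        (rightAct n n).hwSub β ⊓ (leftAct n n).wtSub β by rw [h]
    refine le_antisymm (inf_le_inf_left _ (hwSub_le β)) ?_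
    rintro y ⟨hy1, hy2⟩
    refine ⟨hy1, ?_⟩
    by_cases hy0 : y = 0
    · rw [hy0]; exact Submodule.zero_mem _
    · obtain ⟨-, h⟩ := dominance_of_mem_hwSub_wtSub hl hy1 hy2 hy0
      obtain ⟨c, hc⟩ := (h rfl).2
      rw [hc]
      exact Submodule.smul_mem _ c h0
  · rw [show (rightAct n n).hwSub lam ⊓ (leftAct n n).hwSub β = ⊥ from ?_, finrank_bot]
    rw [Submodule.eq_bot_iff]
    rintro y ⟨hy1, hy2⟩
    by_contra hy0
    apply h
    have h1 := eq_smul_leadPoly le_rfl hl hy1 hy2.2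
    obtain ⟨a, ha⟩ := MvPolynomial.ne_zero_iff.1 hy0
    rw [← hy2.1 a ha]
    refine h0.1 a fun hz => ha ?_
    rw [h1, coeff_smul, hz, smul_zero]

theorem sum_partsOf_ite {d : ℕ} {γ : Fin n → ℕ} (hγ : Antitone γ) (F : (Fin n → ℕ) → ℕ)
    (hF : ∀ l : Fin n → ℕ, ∑ i, l i ≠ d → F l = 0) :
    ∑ l ∈ partsOf d, (if (fun i : Fin n => l i) = γ then 1 else 0) * F (fun i => l i) = F γ := by
  have hext : (fun i : Fin n => extZ γ i) = γ := by
    funext i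
    simp [extZ]
  by_cases hd : ∑ i, γ i = d
  · rw [Finset.sum_eq_single (extZ γ)]
    · rw [hext, if_pos rfl, one_mul]
    · intro l hl hne
      rw [if_neg, zero_mul]
      intro h
      apply hne
      have hsum : ∑ i ∈ Finset.range n, l i = d := by
        rw [← hd, ← h, Fin.sum_univ_eq_sum_range (fun i => l i)]
      have hz : ∀ i, n ≤ i → l i = 0 := by
        intro i hi
        have h1 := sum_range_partsOf (L := d + i + 1) hl fun j hj =>
          (mem_partsOf.1 hl).2.1 j (by omega)
        have h2 := Finset.sum_range_add_sum_Ico l (show n ≤ d + i + 1 by omega)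
        have h3 := Finset.single_le_sum (f := l) (fun _ _ => Nat.zero_le _)
          (Finset.mem_Ico.2 ⟨hi, show i < d + i + 1 by omega⟩)
        omega
      funext i
      unfold extZ
      split_ifs with hi
      · exact congrFun h ⟨i, hi⟩
      · exact hz i (by omega)
    · intro h
      refine absurd ((mem_partsOf_iff (L := n) fun i hi => ?_).2 ⟨antitone_extZ hγ, ?_⟩) h
      · rw [extZ, dif_neg (by omega)]
      · rw [sum_extZ, hd]
  · rw [hF γ hd]
    refine Finset.sum_eq_zero fun l _ => ?_
    split_ifs with h
    · rw [h, hF γ hd, mul_zero]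
    · rw [zero_mul]

theorem finrank_inf_add {V : Type*} [AddCommGroup V] [Module ℂ V] {M K O S : Submodule ℂ V}
    [FiniteDimensional ℂ M] (hKM : K ≤ M) (hOM : O ≤ M) (hMKO : M ≤ K ⊔ O) (hd : Disjoint K O)
    (hS : ∀ k ∈ K, ∀ z ∈ O, k + z ∈ S → k ∈ S ∧ z ∈ S) :
    Module.finrank ℂ ↥(M ⊓ S) = Module.finrank ℂ ↥(K ⊓ S) + Module.finrank ℂ ↥(O ⊓ S) := by
  have := Submodule.finiteDimensional_of_le ((inf_le_left (b := S)).trans hKM)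
  have := Submodule.finiteDimensional_of_le ((inf_le_left (b := S)).trans hOM)
  have h1 : (K ⊓ S) ⊔ (O ⊓ S) = M ⊓ S := by
    apply le_antisymm
    · exact sup_le (inf_le_inf_right _ hKM) (inf_le_inf_right _ hOM)
    · rintro x ⟨hxM, hxS⟩
      obtain ⟨k, hk, z, hz, rfl⟩ := Submodule.mem_sup.1 (hMKO hxM)
      obtain ⟨h1, h2⟩ := hS k hk z hz hxS
      exact Submodule.add_mem_sup ⟨hk, h1⟩ ⟨hz, h2⟩
  have h2 : (K ⊓ S) ⊓ (O ⊓ S) = ⊥ :=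
    (hd.mono inf_le_left inf_le_left).eq_bot
  have := Submodule.finrank_sup_add_finrank_inf_eq (K ⊓ S) (O ⊓ S)
  rw [h1, h2, finrank_bot, add_zero] at this
  exact this

theorem finrank_inf_wtSub (hM : P.Stable M) [FiniteDimensional ℂ M] (β : Fin n → ℕ) {d : ℕ}
    (hd : ∑ i, β i = d) :
    Module.finrank ℂ ↥(M ⊓ P.wtSub β) = ∑ l ∈ partsOf d,
      Module.finrank ℂ ↥(M ⊓ P.hwSub fun i => l i) * weightMult (fun i => l i) β := by
  induction hr : Module.finrank ℂ M using Nat.strong_induction_on generalizing M with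
  | _ r ih =>
  by_cases hM0 : M = ⊥
  · subst hM0
    rw [bot_inf_eq, finrank_bot]
    refine (Finset.sum_eq_zero fun l _ => ?_).symm
    rw [bot_inf_eq, finrank_bot, zero_mul]
  obtain ⟨γ, x, hxM, hx, hx0⟩ := exists_hw hM hM0
  have hγ := antitone_of_hw hM hxM hx hx0
  obtain ⟨φ, hφ, hφM, hφe⟩ := exists_map_of_hw hM hγ hxM hx hx0
  have hK : P.Stable (LinearMap.range φ) := by
    rintro g _ ⟨y, rfl⟩
    exact ⟨_, hφe g y⟩
  have hO := orth_stable hM hK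
  have hwt : ∀ δ, Module.finrank ℂ ↥(LinearMap.range φ ⊓ P.wtSub δ) = weightMult γ δ := by
    intro δ
    refine finrank_inf_eq_of_map φ hφ fun y => ?_
    rw [mem_wtSub_iff, mem_wtSub_iff, ← hφe, ← map_smul, hφ.eq_iff, Subtype.ext_iff]
    rfl
  have hhw : ∀ δ, Module.finrank ℂ ↥(LinearMap.range φ ⊓ P.hwSub δ) = if δ = γ then 1 else 0 := by
    intro δ
    rw [← finrank_hwSub_inf_hwSub hγ δ]
    refine finrank_inf_eq_of_map φ hφ fun y => ?_
    rw [mem_hwSub, mem_hwSub]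
    refine and_congr ?_ (forall₂_congr fun u _ => ?_)
    · rw [mem_wtSub_iff, mem_wtSub_iff, ← hφe, ← map_smul, hφ.eq_iff, Subtype.ext_iff]
      rfl
    · rw [← hφe, hφ.eq_iff, Subtype.ext_iff]
      rfl
  have hfO : FiniteDimensional ℂ (orth M (LinearMap.range φ)) :=
    Submodule.finiteDimensional_of_le orth_le
  have hlt : Module.finrank ℂ (orth M (LinearMap.range φ)) < r := by
    rw [← hr]
    refine Submodule.finrank_lt_finrank_of_lt (lt_of_le_of_ne orth_le fun h => ?_)
    have h1 := hφM (LinearMap.mem_range_self φ ⟨leadPoly n γ, leadPoly_mem_hwSub hγ⟩)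
    rw [← h] at h1
    have h2 := Submodule.disjoint_def.1 disjoint_orth _ (LinearMap.mem_range_self φ _) h1
    exact leadPoly_ne_zero (N := n) le_rfl (congrArg Subtype.val (hφ (h2.trans (map_zero φ).symm)))
  have hsup := le_sup_orth hφM
  rw [finrank_inf_add hφM orth_le hsup disjoint_orth fun k hk z hz h => by
    rw [mem_wtSub_iff] at h ⊢
    rw [mem_wtSub_iff]
    exact eigen_of_add hK hO disjoint_orth hk hz h]
  rw [hwt, ih _ hlt hO rfl, ← sum_partsOf_ite hγ (fun l => weightMult l β)
    (fun l h => weightMult_eq_zero (hd ▸ h)), ← Finset.sum_add_distrib]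
  refine Finset.sum_congr rfl fun l _ => ?_
  rw [← add_mul]
  congr 1
  rw [finrank_inf_add hφM orth_le hsup disjoint_orth, hhw]
  intro k hk z hz h
  rw [mem_hwSub, mem_wtSub_iff] at h
  rw [mem_hwSub, mem_hwSub, mem_wtSub_iff, mem_wtSub_iff]
  have h1 := eigen_of_add hK hO disjoint_orth hk hz h.1
  refine ⟨⟨h1.1, fun u hu => ?_⟩, ⟨h1.2, fun u hu => ?_⟩⟩
  · have h2 := (eigen_of_add hK hO disjoint_orth hk hz (c := 1)
      (by rw [one_smul]; exact h.2 u hu)).1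
    rwa [one_smul] at h2
  · have h2 := (eigen_of_add hK hO disjoint_orth hk hz (c := 1)
      (by rw [one_smul]; exact h.2 u hu)).2
    rwa [one_smul] at h2

end CharacterFormula

section Unitriangular

variable {ι κ : Type*} {S : Finset ι} {r : ι → κ} {T : Set κ} {ht : κ → ℕ}

/-- `A` is unitriangular on `S × T` for the height `ht`, its diagonal being given by `r`. -/
structure Unitriangular (S : Finset ι) (T : Set κ) (r : ι → κ) (ht : κ → ℕ) (A : ι → κ → ℕ) :
    Prop where
  mem : ∀ l ∈ S, r l ∈ T
  inj : Set.InjOn r S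
  diag : ∀ l ∈ S, A l (r l) = 1
  lt : ∀ l ∈ S, ∀ b ∈ T, A l b ≠ 0 → b ≠ r l → ht (r l) < ht b

theorem Unitriangular.sum_mul {A : ι → κ → ℕ} (hA : Unitriangular S T r ht A) {l : ι}
    (hl : l ∈ S) (f : ι → ℕ) :
    ∑ k ∈ S, f k * A k (r l) = ∑ k ∈ S with ht (r k) < ht (r l), f k * A k (r l) + f l := by
  classical
  rw [← Finset.sum_filter_add_sum_filter_not S (fun k => ht (r k) < ht (r l))]
  congr 1
  rw [Finset.sum_eq_single_of_mem l (by simp [hl]), hA.diag l hl, mul_one]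
  intro k hk hkl
  rw [Finset.mem_filter] at hk
  by_contra h
  exact hk.2 (hA.lt k hk.1 _ (hA.mem l hl) (right_ne_zero_of_mul h)
    fun h' => hkl (hA.inj hk.1 hl h'.symm))

theorem Unitriangular.eq_of_sum_mul_eq {A : ι → κ → ℕ} (hA : Unitriangular S T r ht A)
    {f g : ι → ℕ} (h : ∀ b ∈ T, ∑ k ∈ S, f k * A k b = ∑ k ∈ S, g k * A k b) :
    ∀ l ∈ S, f l = g l := by
  intro l
  induction hd : ht (r l) using Nat.strong_induction_on generalizing l with
  | _ d ih =>
  intro hl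
  have h1 := h _ (hA.mem l hl)
  rw [hA.sum_mul hl, hA.sum_mul hl] at h1
  have h2 : ∑ k ∈ S with ht (r k) < ht (r l), f k * A k (r l)
      = ∑ k ∈ S with ht (r k) < ht (r l), g k * A k (r l) :=
    Finset.sum_congr rfl fun k hk => by
      rw [Finset.mem_filter] at hk
      rw [ih _ (hd ▸ hk.2) k rfl hk.1]
  omega

theorem Unitriangular.eq_of_gram_eq {A B : ι → κ → ℕ} (hA : Unitriangular S T r ht A)
    (hB : Unitriangular S T r ht B)
    (h : ∀ a ∈ T, ∀ b ∈ T, ∑ k ∈ S, A k b * A k a = ∑ k ∈ S, B k b * B k a) :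
    ∀ l ∈ S, ∀ b ∈ T, A l b = B l b := by
  intro l
  induction hd : ht (r l) using Nat.strong_induction_on generalizing l with
  | _ d ih =>
  intro hl b hb
  have h1 := h _ (hA.mem l hl) b hb
  rw [hA.sum_mul hl (fun k => A k b), hB.sum_mul hl (fun k => B k b)] at h1
  have h2 : ∑ k ∈ S with ht (r k) < ht (r l), A k b * A k (r l)
      = ∑ k ∈ S with ht (r k) < ht (r l), B k b * B k (r l) :=
    Finset.sum_congr rfl fun k hk => by
      rw [Finset.mem_filter] at hk
      rw [ih _ (hd ▸ hk.2) k rfl hk.1 b hb, ih _ (hd ▸ hk.2) k rfl hk.1 _ (hA.mem l hl)]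
  omega

end Unitriangular

section WeightMultEqKost

open MvPolynomial PolyAct

variable {n : ℕ}

/-- The partitions of `d` with at most `n` parts. -/
def partsLE (n d : ℕ) : Finset (ℕ → ℕ) := {l ∈ partsOf d | l n = 0}

theorem partsLE_zero {d : ℕ} {l : ℕ → ℕ} (hl : l ∈ partsLE n d) {i : ℕ} (hi : n ≤ i) : l i = 0 := by
  rw [partsLE, Finset.mem_filter, mem_partsOf] at hl
  exact Nat.le_zero.1 (hl.2 ▸ hl.1.1 hi)

theorem antitone_of_mem_partsLE {d : ℕ} {l : ℕ → ℕ} (hl : l ∈ partsLE n d) : Antitone l := by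
  rw [partsLE, Finset.mem_filter, mem_partsOf] at hl
  exact hl.1.1

theorem sum_range_partsLE {d : ℕ} {l : ℕ → ℕ} (hl : l ∈ partsLE n d) :
    ∑ i ∈ Finset.range n, l i = d :=
  sum_range_partsOf (Finset.mem_filter.1 hl).1 fun _ hi => partsLE_zero hl hi

theorem sum_fin_partsLE {d : ℕ} {l : ℕ → ℕ} (hl : l ∈ partsLE n d) :
    ∑ i : Fin n, l i = d := by
  rw [Fin.sum_univ_eq_sum_range (fun i => l i), sum_range_partsLE hl]

theorem extZ_restrict {d : ℕ} {l : ℕ → ℕ} (hl : l ∈ partsLE n d) :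
    extZ (fun i : Fin n => l i) = l := by
  funext i
  rw [extZ]
  split_ifs with h
  · rfl
  · exact (partsLE_zero hl (by omega)).symm

theorem sum_partsLE {d : ℕ} (F : (ℕ → ℕ) → ℕ)
    (hF : ∀ l ∈ partsOf d, l n ≠ 0 → F l = 0) :
    ∑ l ∈ partsOf d, F l = ∑ l ∈ partsLE n d, F l := by
  refine (Finset.sum_subset (Finset.filter_subset _ _) fun l hl h => hF l hl fun h' => h ?_).symm
  exact Finset.mem_filter.2 ⟨hl, h'⟩

theorem injOn_restrict (n d : ℕ) :
    Set.InjOn (fun (l : ℕ → ℕ) (i : Fin n) => l i) (partsLE n d) := by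
  intro l hl k hk h
  rw [← extZ_restrict hl, ← extZ_restrict hk]
  exact congrArg extZ h

theorem sum_partial_sums (f : ℕ → ℕ) (n : ℕ) :
    ∑ s ∈ Finset.range (n + 1), ∑ i ∈ Finset.range s, f i + ∑ i ∈ Finset.range n, i * f i =
      n * ∑ i ∈ Finset.range n, f i := by
  induction n with
  | zero => simp
  | succ n ih =>
    rw [Finset.sum_range_succ, Finset.sum_range_succ (fun i => i * f i), Finset.sum_range_succ f n,
      add_mul, mul_add, ← ih]
    ring

theorem wtHeight_eq_sum_range (b : Fin n → ℕ) :
    wtHeight b = ∑ i ∈ Finset.range n, i * extZ b i := by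
  rw [wtHeight, ← Fin.sum_univ_eq_sum_range (fun i => i * extZ b i)]
  refine Finset.sum_congr rfl fun i _ => ?_
  rw [extZ, dif_pos i.2]

theorem unitriangular_kost (n d : ℕ) :
    Unitriangular (partsLE n d) {b : Fin n → ℕ | ∑ i, b i = d} (fun l i => l i) wtHeight
      fun l b => kost n (extZ b) l where
  mem l hl := sum_fin_partsLE hl
  inj := injOn_restrict n d
  diag l hl := by
    rw [extZ_restrict hl]
    convert kost_self (m := n) (antitone_of_mem_partsLE hl) using 2
    funext i
    split_ifs with h
    · rfl
    · exact partsLE_zero hl (by omega)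
  lt l hl b hb h hne := by
    have hb' : ∑ r ∈ Finset.range n, extZ b r = d := (sum_extZ b).trans hb
    have hdom := kost_dominance h (by rw [hb']; exact (Finset.mem_filter.1 hl).1)
    have h1 := sum_partial_sums (extZ b) n
    have h2 := sum_partial_sums l n
    rw [hb', ← wtHeight_eq_sum_range] at h1
    have h3 := wtHeight_eq_sum_range fun i : Fin n => l i
    rw [extZ_restrict hl] at h3
    rw [sum_range_partsLE hl, ← h3] at h2
    suffices h4 : ∑ s ∈ Finset.range (n + 1), ∑ i ∈ Finset.range s, extZ b i <
        ∑ s ∈ Finset.range (n + 1), ∑ i ∈ Finset.range s, l i by omega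
    have hle : ∀ s ∈ Finset.range (n + 1), ∑ i ∈ Finset.range s, extZ b i ≤
        ∑ i ∈ Finset.range s, l i := fun s hs => hdom s (by rw [Finset.mem_range] at hs; omega)
    refine lt_of_le_of_ne (Finset.sum_le_sum hle) fun h4 => hne ?_
    rw [Finset.sum_eq_sum_iff_of_le hle] at h4
    funext i
    have h5 := h4 i (Finset.mem_range.2 (by omega))
    have h6 := h4 (i + 1) (Finset.mem_range.2 (by omega))
    rw [Finset.sum_range_succ, Finset.sum_range_succ, h5] at h6
    have h7 := Nat.add_left_cancel h6
    rwa [extZ, dif_pos i.2] at h7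

theorem unitriangular_weightMult (n d : ℕ) :
    Unitriangular (partsLE n d) {b : Fin n → ℕ | ∑ i, b i = d} (fun l i => l i) wtHeight
      fun l b => weightMult (fun i : Fin n => l i) b where
  mem l hl := sum_fin_partsLE hl
  inj := injOn_restrict n d
  diag l hl := weightMult_self fun _ _ h => antitone_of_mem_partsLE hl h
  lt l hl b _ h hne := by
    obtain ⟨h1, h2⟩ := weightMult_triangular (fun _ _ h => antitone_of_mem_partsLE hl h) h
    exact lt_of_le_of_ne h1 fun h3 => hne (h2 h3.symm)

theorem ncard_finsupp_eq {σ : Type*} [Finite σ] (p : (σ → ℕ) → Prop) :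
    Set.ncard {a : σ →₀ ℕ | p a} = Set.ncard {e : σ → ℕ | p e} := by
  refine Set.ncard_congr (fun a _ => ⇑a) (fun a h => h) (fun a b _ _ h => DFunLike.coe_injective h)
    fun e he => ⟨Finsupp.equivFunOnFinite.symm e, ?_, ?_⟩
  · exact he
  · rfl

theorem sum_fin_lt_of_mem_partsOf {d : ℕ} {l : ℕ → ℕ} (hl : l ∈ partsOf d) (h : l n ≠ 0) :
    ∑ i : Fin n, l i < d := by
  rw [Fin.sum_univ_eq_sum_range (fun i => l i)]
  rw [mem_partsOf] at hl
  have hnd : n < d := by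
    by_contra h'
    exact h (hl.2.1 n (by omega))
  calc ∑ i ∈ Finset.range n, l i < ∑ i ∈ Finset.range (n + 1), l i := by
        rw [Finset.sum_range_succ]; omega
    _ ≤ ∑ i ∈ Finset.range d, l i :=
        Finset.sum_le_sum_of_subset (Finset.range_mono (by omega))
    _ = d := hl.2.2

theorem weightMult_eq_zero_of_ne {d : ℕ} {l : ℕ → ℕ} (hl : l ∈ partsOf d) (h : l n ≠ 0)
    {b : Fin n → ℕ} (hb : ∑ i, b i = d) : weightMult (fun i : Fin n => l i) b = 0 :=
  weightMult_eq_zero (by have := sum_fin_lt_of_mem_partsOf hl h; omega)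

theorem weightMult_eq_kost {d : ℕ} {l : ℕ → ℕ} (hl : l ∈ partsLE n d) {b : Fin n → ℕ}
    (hb : ∑ i, b i = d) : weightMult (fun i : Fin n => l i) b = kost n (extZ b) l := by
  refine (unitriangular_weightMult n d).eq_of_gram_eq (unitriangular_kost n d) ?_ l hl b hb
  intro a ha b hb
  rw [Set.mem_ofPred_eq] at ha hb
  have h1 := card_matrices b a (hb.trans ha.symm)
  rw [hb, sum_partsLE (n := n) _ fun l hl h => by
    rw [kost_eq_zero_of_ne (mem_partsOf.1 hl).1 h, zero_mul]] at h1
  rw [← h1, ← ncard_finsupp_eq]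
  have hfd : FiniteDimensional ℂ ((leftAct n n).wtSub b) :=
    finiteDimensional_wtSub leftAct_w_ne_zero b
  have hst := (commutes_leftAct_rightAct (N := n) (m := n)).symm.wtSub_stable b
  have h2 := finrank_inf_wtSub hst a ha
  rw [finrank_wtSub_inf, sum_partsLE (n := n) _ fun l hl h => by
    rw [weightMult_eq_zero_of_ne hl h ha, mul_zero]] at h2
  have h3 : ∀ γ, Module.finrank ℂ ↥((leftAct n n).wtSub b ⊓ (rightAct n n).hwSub γ) =
      weightMult γ b := fun γ => by
    suffices h : (leftAct n n).wtSub b ⊓ (rightAct n n).hwSub γ =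
      (rightAct n n).hwSub γ ⊓ (leftAct n n).wtSub b by rw [h]; rfl
    exact inf_comm _ _
  simp only [h3] at h2
  refine Eq.trans h2.symm (congrArg Set.ncard ?_)
  ext e
  simp only [Set.mem_ofPred_eq, funext_iff, sum_wt_leftAct, sum_wt_rightAct]

end WeightMultEqKost

section PairActions

open MvPolynomial PolyAct
open scoped Kronecker

variable {n : ℕ}

theorem sum_prod_eq_sum_lt {R : Type*} [AddCommMonoid R] (F : Fin n → Fin n → R) :
    ∑ i, ∑ j, F i j = ∑ i, F i i +
      ∑ p : {p : Fin n × Fin n // p.1 < p.2}, (F p.1.1 p.1.2 + F p.1.2 p.1.1) := by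
  have h1 : ∀ G : Fin n × Fin n → R, ∑ p : {p : Fin n × Fin n // p.1 < p.2}, G p =
      ∑ p : Fin n × Fin n, if p.1 < p.2 then G p else 0 := fun G => by
    rw [← Finset.sum_filter, Finset.sum_subtype (p := fun p : Fin n × Fin n => p.1 < p.2)]
    simp
  have h2 : ∑ p : Fin n × Fin n, (if p.1 < p.2 then F p.2 p.1 else 0) =
      ∑ p : Fin n × Fin n, if p.2 < p.1 then F p.1 p.2 else 0 :=
    Fintype.sum_equiv (Equiv.prodComm _ _) _ _ fun p => rfl
  rw [Finset.sum_add_distrib, h1 fun p => F p.1 p.2, h1 fun p => F p.2 p.1, h2,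
    ← Finset.sum_add_distrib, Fintype.sum_prod_type, ← Finset.sum_add_distrib]
  refine Finset.sum_congr rfl fun i _ => ?_
  have h3 : F i i = ∑ j, if i = j then F i j else 0 := by simp
  rw [h3, ← Finset.sum_add_distrib]
  refine Finset.sum_congr rfl fun j _ => ?_
  rcases lt_trichotomy i j with h | h | h
  · rw [if_neg h.ne, if_pos h, if_neg h.not_gt, zero_add, add_zero]
  · rw [if_pos h, if_neg (h ▸ lt_irrefl i), if_neg (h ▸ lt_irrefl i), add_zero, add_zero]
  · rw [if_neg h.ne', if_neg h.not_gt, if_pos h, zero_add, zero_add]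

/-- The second compound matrix. -/
def compound (h : Matrix (Fin n) (Fin n) ℂ) :
    Matrix {p : Fin n × Fin n // p.1 < p.2} {p : Fin n × Fin n // p.1 < p.2} ℂ :=
  Matrix.of fun p q => h p.1.1 q.1.1 * h p.1.2 q.1.2 - h p.1.2 q.1.1 * h p.1.1 q.1.2

theorem compound_mul (h k : Matrix (Fin n) (Fin n) ℂ) :
    compound (h * k) = compound h * compound k := by
  ext p q
  have h1 : compound (h * k) p q = ∑ i, ∑ j, h p.1.1 i * h p.1.2 j *
      (k i q.1.1 * k j q.1.2 - k j q.1.1 * k i q.1.2) := by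
    simp only [compound, Matrix.of_apply, Matrix.mul_apply]
    rw [Finset.sum_mul_sum, mul_comm, Finset.sum_mul_sum, ← Finset.sum_sub_distrib]
    refine Finset.sum_congr rfl fun i _ => ?_
    rw [← Finset.sum_sub_distrib]
    refine Finset.sum_congr rfl fun j _ => ?_
    ring
  rw [h1, sum_prod_eq_sum_lt, Matrix.mul_apply, Finset.sum_eq_zero, zero_add]
  · refine Finset.sum_congr rfl fun r _ => ?_
    simp only [compound, Matrix.of_apply]
    ring
  · intro i _
    ring

theorem compound_diagonal (t : Fin n → ℂ) :
    compound (Matrix.diagonal t) = Matrix.diagonal fun p => t p.1.1 * t p.1.2 := by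
  ext p q
  simp only [compound, Matrix.of_apply, Matrix.diagonal_apply]
  have h1 : ¬(p.1.2 = q.1.1 ∧ p.1.1 = q.1.2) := fun h => by
    have := p.2
    have := q.2
    omega
  have h2 : p = q ↔ p.1.1 = q.1.1 ∧ p.1.2 = q.1.2 := by
    rw [Subtype.ext_iff, Prod.ext_iff]
  by_cases ha : p.1.2 = q.1.1
  · rw [if_pos ha, if_neg (c := p.1.1 = q.1.2) fun h => h1 ⟨ha, h⟩, mul_zero, sub_zero]
    split_ifs with h3 h4 h5 h5 <;> simp_all
  · rw [if_neg ha, zero_mul, sub_zero]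
    split_ifs <;> simp_all

/-- The right action on pairs of a square matrix and an alternating matrix. -/
def rightPair (n : ℕ) : PolyAct n (PairIdx n) where
  A :=
    { toFun := fun h => fromBlocks ((1 : Matrix (Fin n) (Fin n) ℂ) ⊗ₖ h) 0 0 (compound h)
      map_one' := by
        rw [one_kronecker_one, ← Matrix.diagonal_one, ← Matrix.diagonal_one,
          ← fromBlocks_one, ← Matrix.diagonal_one, compound_diagonal]
        simp
      map_mul' := fun g h => by
        rw [fromBlocks_multiply, ← mul_kronecker_mul, one_mul, compound_mul]
        simp }
  w := colWt n
  conjT g := by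
    show fromBlocks _ _ _ _ = (fromBlocks _ _ _ _)ᴴ
    rw [fromBlocks_conjTranspose, conjTranspose_kronecker, conjTranspose_one,
      conjTranspose_zero, conjTranspose_zero]
    congr 1
    ext p q
    simp only [compound, Matrix.of_apply, conjTranspose_apply, star_sub, star_mul']
    ring
  diag t := by
    show fromBlocks (1 ⊗ₖ Matrix.diagonal t) 0 0 (compound (Matrix.diagonal t)) = _
    rw [compound_diagonal, ← Matrix.diagonal_one, diagonal_kronecker_diagonal,
      fromBlocks_diagonal]
    congr 1
    funext s
    rcases s with s | p
    · rw [Sum.elim_inl, colWt, Sum.elim_inl, Finset.prod_eq_single s.2, Pi.single_eq_same, pow_one,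
        one_mul]
      · intro i _ hi
        rw [Pi.single_eq_of_ne hi, pow_zero]
      · simp
    · simp only [Sum.elim_inr, colWt, Pi.add_apply, pow_add, Finset.prod_mul_distrib]
      congr 1
      · rw [Finset.prod_eq_single p.1.1, Pi.single_eq_same, pow_one]
        · intro i _ hi
          rw [Pi.single_eq_of_ne hi, pow_zero]
        · simp
      · rw [Finset.prod_eq_single p.1.2, Pi.single_eq_same, pow_one]
        · intro i _ hi
          rw [Pi.single_eq_of_ne hi, pow_zero]
        · simp
  cont := by
    show Continuous fun h : Matrix (Fin n) (Fin n) ℂ =>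
      fromBlocks ((1 : Matrix (Fin n) (Fin n) ℂ) ⊗ₖ h) 0 0 (compound h)
    refine Continuous.matrix_fromBlocks (continuous_matrix fun i j => ?_) continuous_const
      continuous_const (continuous_matrix fun i j => ?_)
    · show Continuous fun g : Matrix (Fin n) (Fin n) ℂ =>
        (1 : Matrix (Fin n) (Fin n) ℂ) i.1 j.1 * g i.2 j.2
      fun_prop
    · simp only [compound, Matrix.of_apply]
      fun_prop

/-- The left action on pairs of a square matrix and an alternating matrix. -/
def leftPair (n : ℕ) : PolyAct n (PairIdx n) where
  A :=
    { toFun := fun g => fromBlocks (g ⊗ₖ (1 : Matrix (Fin n) (Fin n) ℂ)) 0 0 1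
      map_one' := by rw [one_kronecker_one, fromBlocks_one]
      map_mul' := fun g h => by
        rw [fromBlocks_multiply, ← mul_kronecker_mul, one_mul]
        simp }
  w := Sum.elim (fun s => Pi.single s.1 1) fun _ => 0
  conjT g := by
    show fromBlocks _ _ _ _ = (fromBlocks _ _ _ _)ᴴ
    rw [fromBlocks_conjTranspose, conjTranspose_kronecker, conjTranspose_one,
      conjTranspose_zero, conjTranspose_zero, conjTranspose_one]
  diag t := by
    show fromBlocks (Matrix.diagonal t ⊗ₖ 1) 0 0 1 = _
    rw [← Matrix.diagonal_one, diagonal_kronecker_diagonal, ← Matrix.diagonal_one,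
      fromBlocks_diagonal]
    congr 1
    funext s
    rcases s with s | p
    · rw [Sum.elim_inl, Sum.elim_inl, Finset.prod_eq_single s.1, Pi.single_eq_same, pow_one,
        mul_one]
      · intro i _ hi
        rw [Pi.single_eq_of_ne hi, pow_zero]
      · simp
    · simp
  cont := by
    show Continuous fun g : Matrix (Fin n) (Fin n) ℂ =>
      fromBlocks (g ⊗ₖ (1 : Matrix (Fin n) (Fin n) ℂ)) 0 0 1
    refine Continuous.matrix_fromBlocks (continuous_matrix fun i j => ?_) continuous_const
      continuous_const continuous_const
    show Continuous fun g : Matrix (Fin n) (Fin n) ℂ =>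
      g i.1 j.1 * (1 : Matrix (Fin n) (Fin n) ℂ) i.2 j.2
    fun_prop

theorem commutes_leftPair_rightPair : Commutes (leftPair n) (rightPair n) := by
  intro g h
  show fromBlocks (g ⊗ₖ 1) 0 0 1 * fromBlocks (1 ⊗ₖ h) 0 0 (compound h) =
    fromBlocks (1 ⊗ₖ h) 0 0 (compound h) * fromBlocks (g ⊗ₖ 1) 0 0 1
  rw [fromBlocks_multiply, fromBlocks_multiply, ← mul_kronecker_mul, ← mul_kronecker_mul]
  simp

theorem rightPair_w_ne_zero (s : PairIdx n) : (rightPair n).w s ≠ 0 := by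
  rcases s with s | p
  · exact fun h => by simpa using congrFun (show Pi.single s.2 1 = (0 : Fin n → ℕ) from h) s.2
  · intro h
    have := congrFun (show Pi.single p.1.1 1 + Pi.single p.1.2 1 = (0 : Fin n → ℕ) from h) p.1.1
    simp at this

theorem sum_wt_leftPair (a : PairIdx n →₀ ℕ) (r : Fin n) :
    (leftPair n).wt a r = ∑ c, a (Sum.inl (r, c)) := by
  have h : ∀ s : Fin n × Fin n, a (Sum.inl s) * (Pi.single s.1 1 : Fin n → ℕ) r =
      if s.1 = r then a (Sum.inl s) else 0 := fun s => by
    rw [Pi.single_apply]; split_ifs <;> simp_all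
  show ∑ s, a s * (Sum.elim (fun s : Fin n × Fin n => Pi.single s.1 1) (fun _ => 0) s : Fin n → ℕ) r
    = _
  rw [Fintype.sum_sum_type]
  simp only [Sum.elim_inl, Sum.elim_inr, Pi.zero_apply, mul_zero,
    Finset.sum_const_zero, add_zero, h]
  rw [Fintype.sum_prod_type, Finset.sum_eq_single r]
  · simp
  · intro i _ hi
    simp [hi]
  · simp

end PairActions

section PairCount

open MvPolynomial PolyAct

namespace PolyAct

variable {n : ℕ} {σ : Type*} [Fintype σ] [DecidableEq σ] (P : PolyAct n σ)

/-- The space of polynomials of a given total weight. -/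
def degSub (d : ℕ) : Submodule ℂ (MvPolynomial σ ℂ) :=
  restrictSupport ℂ {a : σ →₀ ℕ | ∑ i, P.wt a i = d}

variable {P}

theorem mem_degSub {d : ℕ} {p : MvPolynomial σ ℂ} :
    p ∈ P.degSub d ↔ ∀ a, coeff a p ≠ 0 → ∑ i, P.wt a i = d :=
  mem_restrictSupport_iff_coeff

theorem mem_degSub_iff {d : ℕ} {p : MvPolynomial σ ℂ} :
    p ∈ P.degSub d ↔ linSub (P.A (Matrix.diagonal fun _ => 2)) p = (2 : ℂ) ^ d • p := by
  rw [mem_degSub, MvPolynomial.ext_iff]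
  refine forall_congr' fun a => ?_
  rw [coeff_torus, coeff_smul, smul_eq_mul, Finset.prod_pow_eq_pow_sum]
  refine ⟨fun h => ?_, fun h ha => ?_⟩
  · by_cases ha : coeff a p = 0
    · rw [ha, mul_zero, mul_zero]
    · rw [h ha]
  · have h1 := mul_right_cancel₀ ha h
    exact Nat.pow_right_injective le_rfl (by exact_mod_cast h1)

theorem degSub_stable (d : ℕ) : P.Stable (P.degSub d) := by
  intro g p hp
  rw [mem_degSub_iff] at hp ⊢
  have h : Matrix.diagonal (fun _ => 2) * (matOf (N := n) ⟨g, Subgroup.mem_top g⟩) =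
      (matOf ⟨g, Subgroup.mem_top g⟩) * Matrix.diagonal (fun _ => (2 : ℂ)) := by
    ext i j
    rw [Matrix.diagonal_mul, Matrix.mul_diagonal, mul_comm]
  rw [← linSub_mul, ← map_mul, h, map_mul, linSub_mul, hp, map_smul]

theorem wtSub_le_degSub (β : Fin n → ℕ) : P.wtSub β ≤ P.degSub (∑ i, β i) := by
  intro p hp
  rw [mem_degSub]
  intro a ha
  rw [hp a ha]

theorem finiteDimensional_degSub (hw : ∀ s, P.w s ≠ 0) (d : ℕ) :
    FiniteDimensional ℂ (P.degSub d) := by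
  refine finiteDimensional_restrictSupport ?_
  have h : {a : σ →₀ ℕ | ∑ i, P.wt a i = d} ⊆
      ⋃ β ∈ {β : Fin n → ℕ | ∀ i, β i ≤ d}, {a : σ →₀ ℕ | P.wt a = β} := by
    intro a ha
    simp only [Set.mem_iUnion]
    refine ⟨P.wt a, fun i => ?_, rfl⟩
    rw [← show _ = d from ha]
    exact Finset.single_le_sum (f := P.wt a) (fun _ _ => Nat.zero_le _) (Finset.mem_univ i)
  refine Set.Finite.subset (Set.Finite.biUnion ?_ fun β _ => finite_setOf_wt_eq hw β) h
  exact Set.finite_Iic fun _ => d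

end PolyAct

variable {n : ℕ}

/-- The multiplicities of pairs of highest weights in the polynomials on pairs of a square matrix
and an alternating matrix. -/
def pairMult (m l : Fin n → ℕ) : ℕ :=
  Module.finrank ℂ ↥((rightPair n).hwSub l ⊓ (leftPair n).hwSub m)

instance finiteDimensional_rightPair_hwSub (l : Fin n → ℕ) :
    FiniteDimensional ℂ ((rightPair n).hwSub l) := by
  have := finiteDimensional_wtSub (P := rightPair n) rightPair_w_ne_zero l
  exact Submodule.finiteDimensional_of_le (hwSub_le l)

theorem sum_leftPair_wt_le (a : PairIdx n →₀ ℕ) :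
    ∑ i, (leftPair n).wt a i ≤ ∑ i, (rightPair n).wt a i := by
  rw [show ∑ i, (leftPair n).wt a i = ∑ i, ∑ s, a s * (leftPair n).w s i from rfl,
    show ∑ i, (rightPair n).wt a i = ∑ i, ∑ s, a s * (rightPair n).w s i from rfl,
    Finset.sum_comm, Finset.sum_comm (f := fun i s => a s * (rightPair n).w s i)]
  refine Finset.sum_le_sum fun s _ => ?_
  rw [← Finset.mul_sum, ← Finset.mul_sum]
  refine Nat.mul_le_mul_left _ ?_
  rcases s with s | s
  · show ∑ i, (Pi.single s.1 1 : Fin n → ℕ) i ≤ ∑ i, (Pi.single s.2 1 : Fin n → ℕ) i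
    rw [Finset.sum_pi_single', Finset.sum_pi_single']
    simp
  · show ∑ i : Fin n, 0 ≤ _
    simp

theorem pairMult_eq_zero {m l : Fin n → ℕ} (h : ∑ i, l i < ∑ i, m i) : pairMult m l = 0 := by
  suffices h : (rightPair n).hwSub l ⊓ (leftPair n).hwSub m = ⊥ by rw [pairMult, h, finrank_bot]
  rw [eq_bot_iff]
  rintro p ⟨h1, h2⟩
  rw [Submodule.mem_bot, MvPolynomial.ext_iff]
  intro a
  rw [coeff_zero]
  by_contra ha
  have h3 := sum_leftPair_wt_le a
  rw [h1.1 a ha, h2.1 a ha] at h3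
  omega

theorem ncard_pair_weights (a b : Fin n → ℕ) {d e : ℕ} (ha : ∑ i, a i = d) (hb : ∑ i, b i = d + e) :
    Set.ncard {f : PairIdx n → ℕ | (∀ r, ∑ c, f (Sum.inl (r, c)) = a r) ∧
        ∀ c, ∑ v, f v * colWt n v c = b c} =
      ∑ l ∈ partsLE n (d + e), (∑ m ∈ partsLE n d, pairMult (fun i : Fin n => m i) (fun i => l i) *
        kost n (extZ a) m) * kost n (extZ b) l := by
  have hst : (rightPair n).Stable ((leftPair n).wtSub a ⊓ (rightPair n).degSub (d + e)) :=
    (commutes_leftPair_rightPair.symm.wtSub_stable a).inf (degSub_stable _)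
  have hfd := finiteDimensional_degSub (P := rightPair n) rightPair_w_ne_zero (d + e)
  have : FiniteDimensional ℂ ↥((leftPair n).wtSub a ⊓ (rightPair n).degSub (d + e)) :=
    Submodule.finiteDimensional_of_le inf_le_right
  have hle : ∀ (K : Submodule ℂ (MvPolynomial (PairIdx n) ℂ)) (c : Fin n → ℕ),
      ∑ i, c i = d + e → K ≤ (rightPair n).wtSub c →
      ((leftPair n).wtSub a ⊓ (rightPair n).degSub (d + e)) ⊓ K = (leftPair n).wtSub a ⊓ K := by
    intro K c hc hK
    rw [inf_assoc, inf_eq_right.2 (hK.trans (hc ▸ wtSub_le_degSub c))]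
  have h1 := finrank_inf_wtSub hst b hb
  have h2 := hle _ b hb le_rfl
  rw [h2, finrank_wtSub_inf, sum_partsLE (n := n) _ fun l hl h => by
    rw [weightMult_eq_zero_of_ne hl h hb, mul_zero]] at h1
  have h3 : Set.ncard {f : PairIdx n → ℕ | (∀ r, ∑ c, f (Sum.inl (r, c)) = a r) ∧
      ∀ c, ∑ v, f v * colWt n v c = b c} =
      Set.ncard {f : PairIdx n →₀ ℕ | (leftPair n).wt f = a ∧ (rightPair n).wt f = b} := by
    rw [← ncard_finsupp_eq]
    congr 1
    ext f
    simp only [Set.mem_ofPred_eq, _root_.funext_iff, sum_wt_leftPair]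
    rfl
  rw [h3, h1]
  refine Finset.sum_congr rfl fun l hl => ?_
  rw [weightMult_eq_kost hl hb]
  congr 1
  have h4 := hle _ _ (sum_fin_partsLE hl) (hwSub_le (P := rightPair n) fun i => l i)
  rw [h4, inf_comm, finrank_inf_wtSub (commutes_leftPair_rightPair.hwSub_stable _) a ha,
    sum_partsLE (n := n) _ fun l hl h => by rw [weightMult_eq_zero_of_ne hl h ha, mul_zero]]
  refine Finset.sum_congr rfl fun m hm => ?_
  rw [weightMult_eq_kost hm ha]
  rfl

theorem pairMult_eq_branchLR {d e : ℕ} {m l : ℕ → ℕ} (hm : m ∈ partsLE n d)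
    (hl : l ∈ partsLE n (d + e)) :
    pairMult (fun i : Fin n => m i) (fun i => l i) = branchLR e l m := by
  have h1 : ∀ a ∈ {a : Fin n → ℕ | ∑ i, a i = d}, ∀ b ∈ {b : Fin n → ℕ | ∑ i, b i = d + e},
      ∑ l ∈ partsLE n (d + e), (∑ m ∈ partsLE n d, pairMult (fun i : Fin n => m i) (fun i => l i) *
        kost n (extZ a) m) * kost n (extZ b) l =
      ∑ l ∈ partsLE n (d + e), (∑ m ∈ partsLE n d, branchLR e l m * kost n (extZ a) m) *
        kost n (extZ b) l := by
    intro a ha b hb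
    rw [Set.mem_ofPred_eq] at ha hb
    rw [← ncard_pair_weights a b ha hb, card_pairs a b e (by rw [ha, hb]), ha, hb,
      sum_partsLE (n := n) _ fun m hm h => Finset.sum_eq_zero fun l _ => by
        rw [kost_eq_zero_of_ne (mem_partsOf.1 hm).1 h, zero_mul, zero_mul], Finset.sum_comm,
      sum_partsLE (n := n) _ fun l hl h => Finset.sum_eq_zero fun m _ => by
        rw [kost_eq_zero_of_ne (mem_partsOf.1 hl).1 h, mul_zero]]
    refine Finset.sum_congr rfl fun l _ => ?_
    rw [Finset.sum_mul]
    refine Finset.sum_congr rfl fun m _ => ?_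
    ring
  exact (unitriangular_kost n d).eq_of_sum_mul_eq (fun a ha =>
    (unitriangular_kost n (d + e)).eq_of_sum_mul_eq (h1 a ha) l hl) m hm

end PairCount

section GenericDet

open MvPolynomial

variable {n : ℕ}

theorem prime_rename_of_injective {σ τ : Type*} {f : σ → τ} (hf : Function.Injective f)
    {p : MvPolynomial σ ℂ} (hp : Prime p) : Prime (rename f p) := by
  have h : rename f p = rename ((↑) : Set.range f → τ)
        (renameEquiv ℂ (Equiv.ofInjective f hf) p) := by
    rw [renameEquiv_apply, rename_rename]
    rfl
  rw [h, prime_rename_iff]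
  exact (MulEquiv.prime_iff (renameEquiv ℂ (Equiv.ofInjective f hf)).toMulEquiv).2 hp

/-- The determinant of the generic matrix. -/
def genericDet (n : ℕ) : MvPolynomial (Fin n × Fin n) ℂ := (mvPolynomialX (Fin n) (Fin n) ℂ).det

theorem eval_genericDet (Y : Matrix (Fin n) (Fin n) ℂ) : evalMat Y (genericDet n) = Y.det := by
  rw [genericDet, RingHom.map_det, RingHom.mapMatrix_apply, map_evalMat_mvPolynomialX]

theorem det_submatrix_mvPolynomialX (r c : Fin n → Fin (n + 1)) :
    ((mvPolynomialX (Fin (n + 1)) (Fin (n + 1)) ℂ).submatrix r c).det =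
      rename (Prod.map r c) (genericDet n) := by
  rw [genericDet, AlgHom.map_det]
  congr 1
  ext i j : 2
  simp [mvPolynomialX_apply]

theorem irreducible_genericDet (n : ℕ) : Irreducible (genericDet (n + 1)) := by
  induction n with
  | zero =>
    have h : genericDet 1 = X (0, 0) := by
      rw [genericDet, Matrix.det_fin_one, mvPolynomialX_apply]
    rw [h]
    exact (X_prime (R := ℂ) (i := ((0, 0) : Fin 1 × Fin 1))).irreducible
  | succ n ih =>
    set f : MvPolynomial (Fin (n + 2) × Fin (n + 2)) ℂ :=
      rename (Prod.map Fin.succ Fin.succ) (genericDet (n + 1)) with hf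
    set g : MvPolynomial (Fin (n + 2) × Fin (n + 2)) ℂ :=
      ∑ j : Fin (n + 1), (-1) ^ (j.succ : ℕ) * X (0, j.succ) *
        rename (Prod.map Fin.succ j.succ.succAbove) (genericDet (n + 1)) with hg
    have hfg : genericDet (n + 2) = f * X (0, 0) + g := by
      rw [genericDet, Matrix.det_succ_row_zero, Fin.sum_univ_succ, Fin.succAbove_zero]
      simp only [det_submatrix_mvPolynomialX, mvPolynomialX_apply]
      rw [hf, hg]
      simp [mul_comm]
    have hvar : ∀ c : Fin (n + 1) → Fin (n + 2),
        ((0, 0) : Fin (n + 2) × Fin (n + 2)) ∉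
          (rename (Prod.map Fin.succ c) (genericDet (n + 1))).vars := by
      intro c h
      obtain ⟨s, _, hs⟩ := Finset.mem_image.1 (vars_rename _ _ h)
      exact Fin.succ_ne_zero _ (congrArg Prod.fst hs)
    have hfp : Prime f :=
      prime_rename_of_injective (Prod.map_injective.2 ⟨Fin.succ_injective _, Fin.succ_injective _⟩)
        ih.prime
    rw [hfg]
    refine irreducible_mul_X_add f g (0, 0) hfp.ne_zero (hvar _) ?_ ?_
    · intro h
      obtain ⟨j, _, hj⟩ := Finset.mem_biUnion.1 (vars_sum_subset _ _ h)
      rcases Finset.mem_union.1 (vars_mul _ _ hj) with h1 | h1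
      · rcases Finset.mem_union.1 (vars_mul _ _ h1) with h2 | h2
        · have h3 : ((-1) ^ (j.succ : ℕ) : MvPolynomial (Fin (n + 2) × Fin (n + 2)) ℂ) =
              C ((-1) ^ (j.succ : ℕ)) := by simp
          rw [h3, vars_C] at h2
          simp at h2
        · rw [vars_X, Finset.mem_singleton, Prod.ext_iff] at h2
          exact Fin.succ_ne_zero _ h2.2.symm
      · exact hvar _ h1
    · rw [hfp.irreducible.isRelPrime_iff_not_dvd]
      intro h
      let Y : Matrix (Fin (n + 2)) (Fin (n + 2)) ℂ := (Equiv.swap 0 1).permMatrix ℂ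
      have h1 : f ∣ genericDet (n + 2) := hfg ▸ dvd_add (dvd_mul_right _ _) h
      have h2 := map_dvd (evalMat Y) h1
      rw [eval_genericDet, Matrix.det_permutation] at h2
      have h3 : evalMat Y f = 0 := by
        rw [hf, ← det_submatrix_mvPolynomialX, RingHom.map_det]
        refine Matrix.det_eq_zero_of_row_eq_zero 0 fun j => ?_
        simp [Y, mvPolynomialX_apply, Equiv.Perm.permMatrix, PEquiv.toMatrix_apply,
          (Fin.succ_ne_zero j).symm]
      rw [h3, zero_dvd_iff] at h2
      simp at h2

end GenericDet

section PairEvaluation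

open MvPolynomial PolyAct
open scoped Kronecker

variable {n : ℕ}

/-- Evaluation at a square matrix and the upper entries of an alternating matrix. -/
abbrev evalPair (Y A : Matrix (Fin n) (Fin n) ℂ) : MvPolynomial (PairIdx n) ℂ →+* ℂ :=
  eval (Sum.elim (fun s => Y s.1 s.2) fun q => A q.1.1 q.1.2)

/-- The alternating matrix with given entries above the diagonal. -/
def altOf (y : {p : Fin n × Fin n // p.1 < p.2} → ℂ) : Matrix (Fin n) (Fin n) ℂ :=
  Matrix.of fun i j => if h : i < j then y ⟨(i, j), h⟩ else if h : j < i then -y ⟨(j, i), h⟩ else 0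

theorem altOf_transpose (y : {p : Fin n × Fin n // p.1 < p.2} → ℂ) : (altOf y)ᵀ = -altOf y := by
  ext i j
  simp only [altOf, Matrix.transpose_apply, Matrix.neg_apply, Matrix.of_apply]
  rcases lt_trichotomy i j with h | h | h
  · rw [dif_neg h.not_gt, dif_pos h, dif_pos h]
  · subst h
    simp
  · rw [dif_pos h, dif_neg h.not_gt, dif_pos h, neg_neg]

theorem exists_evalPair_eq (x : PairIdx n → ℂ) : ∃ Y A : Matrix (Fin n) (Fin n) ℂ,
    Aᵀ = -A ∧ eval x = evalPair Y A := by
  refine ⟨Matrix.of fun i j => x (Sum.inl (i, j)), altOf fun p => x (Sum.inr p),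
    altOf_transpose _, ?_⟩
  congr 1
  funext s
  rcases s with s | p
  · rfl
  · simp only [Sum.elim_inr, altOf, Matrix.of_apply]
    rw [dif_pos p.2]

theorem apply_self_of_transpose_eq_neg {A : Matrix (Fin n) (Fin n) ℂ} (hA : Aᵀ = -A) (i : Fin n) :
    A i i = 0 :=
  self_eq_neg.1 (congrFun (congrFun hA i) i)

theorem evalPair_linSub_rightPair {A : Matrix (Fin n) (Fin n) ℂ} (hA : Aᵀ = -A)
    (Y h : Matrix (Fin n) (Fin n) ℂ) (q : MvPolynomial (PairIdx n) ℂ) :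
    evalPair Y A (linSub ((rightPair n).A h) q) = evalPair (Y * h) (hᵀ * A * h) q := by
  rw [evalPair, eval_linSub, evalPair]
  congr 2
  show _ ᵥ* fromBlocks (1 ⊗ₖ h) 0 0 (compound h) = _
  rw [vecMul_fromBlocks]
  congr 1
  · funext s
    simp only [Matrix.vecMul_zero, add_zero, Matrix.vecMul, dotProduct, Function.comp_apply,
      Sum.elim_inl, Fintype.sum_prod_type, kroneckerMap_apply, Matrix.one_apply, Matrix.mul_apply]
    rw [Finset.sum_eq_single s.1]
    · simp
    · intro i _ hi
      simp [hi]
    · simp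
  · funext p
    simp only [Matrix.vecMul_zero, zero_add, Matrix.vecMul, dotProduct, Function.comp_apply,
      Sum.elim_inr, compound, Matrix.of_apply]
    have h1 : (hᵀ * A * h) p.1.1 p.1.2 = ∑ i, ∑ j, A i j * (h i p.1.1 * h j p.1.2) := by
      simp only [Matrix.mul_apply, Matrix.transpose_apply, Finset.sum_mul]
      rw [Finset.sum_comm]
      exact Finset.sum_congr rfl fun i _ => Finset.sum_congr rfl fun j _ => by ring
    have h3 : ∑ i, A i i * (h i p.1.1 * h i p.1.2) = 0 := Finset.sum_eq_zero fun i _ => by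
      rw [apply_self_of_transpose_eq_neg hA, zero_mul]
    rw [h1, sum_prod_eq_sum_lt, h3, zero_add]
    · refine Finset.sum_congr rfl fun r _ => ?_
      have h2 : A r.1.2 r.1.1 = -A r.1.1 r.1.2 := congrFun (congrFun hA r.1.1) r.1.2
      rw [h2]
      ring

theorem evalPair_linSub_leftPair (Y A g : Matrix (Fin n) (Fin n) ℂ)
    (q : MvPolynomial (PairIdx n) ℂ) :
    evalPair Y A (linSub ((leftPair n).A g) q) = evalPair (gᵀ * Y) A q := by
  rw [evalPair, eval_linSub, evalPair]
  congr 2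
  show _ ᵥ* fromBlocks (g ⊗ₖ 1) 0 0 1 = _
  rw [vecMul_fromBlocks]
  congr 1
  · funext s
    simp only [Matrix.vecMul_zero, add_zero, Matrix.vecMul, dotProduct, Function.comp_apply,
      Sum.elim_inl, Fintype.sum_prod_type, kroneckerMap_apply, Matrix.one_apply, Matrix.mul_apply,
      Matrix.transpose_apply]
    refine Finset.sum_congr rfl fun i _ => ?_
    rw [Finset.sum_eq_single s.2]
    · simp [mul_comm]
    · intro j _ hj
      simp [hj]
    · simp
  · rw [Matrix.vecMul_zero, zero_add, Matrix.vecMul_one]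
    rfl

theorem evalPair_rename_inl (Y A : Matrix (Fin n) (Fin n) ℂ) (p : MvPolynomial (Fin n × Fin n) ℂ) :
    evalPair Y A (rename Sum.inl p) = evalMat Y p := by
  rw [evalPair, eval_rename]
  rfl

theorem genericDet_dvd_of_evalPair (r : MvPolynomial (PairIdx (n + 1)) ℂ)
    (h : ∀ Y A : Matrix (Fin (n + 1)) (Fin (n + 1)) ℂ, Aᵀ = -A → Y.det = 0 →
      (Y + Matrix.single 0 0 1).det ≠ 0 → evalPair Y A r = 0) :
    rename Sum.inl (genericDet (n + 1)) ∣ r := by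
  set dp : MvPolynomial (PairIdx (n + 1)) ℂ := rename Sum.inl (genericDet (n + 1)) with hdp
  have hp : Prime dp := prime_rename_of_injective Sum.inl_injective
    (irreducible_genericDet n).prime
  set m : MvPolynomial (PairIdx (n + 1)) ℂ := rename Sum.inl
    (mvPolynomialX (Fin (n + 1)) (Fin (n + 1)) ℂ +
      (Matrix.single 0 0 1 : Matrix (Fin (n + 1)) (Fin (n + 1)) ℂ).map C).det with hm
  have hme : ∀ Y A : Matrix (Fin (n + 1)) (Fin (n + 1)) ℂ,
      evalPair Y A m = (Y + Matrix.single 0 0 1).det := by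
    intro Y A
    rw [hm, evalPair_rename_inl, RingHom.map_det]
    congr 1
    ext i j
    simp only [RingHom.mapMatrix_apply, Matrix.map_apply, Matrix.add_apply, map_add, eval_C,
      mvPolynomialX_apply, eval_X]
  have h1 : m * r ∈ (Ideal.span {dp}).radical := by
    rw [← vanishingIdeal_zeroLocus_eq_radical (K := ℂ), mem_vanishingIdeal_iff]
    intro x hx
    obtain ⟨Y, A, hA, hYA⟩ := exists_evalPair_eq x
    have hx' : evalPair Y A dp = 0 := by
      rw [← hYA, ← coe_aeval_eq_eval]
      exact hx dp (Ideal.mem_span_singleton_self dp)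
    rw [hdp, evalPair_rename_inl, eval_genericDet] at hx'
    show aeval x (m * r) = 0
    have hx2 : aeval x (m * r) = evalPair Y A (m * r) := by
      rw [← hYA, ← coe_aeval_eq_eval]
      rfl
    rw [hx2, map_mul, hme]
    by_cases h2 : (Y + Matrix.single 0 0 1).det = 0
    · rw [h2, zero_mul]
    · rw [h Y A hA hx' h2, mul_zero]
  obtain ⟨k, hk⟩ := h1
  have h2 := hp.dvd_of_dvd_pow (Ideal.mem_span_singleton.1 hk)
  refine (hp.dvd_or_dvd h2).resolve_left fun h3 => ?_
  have h4 := map_dvd (evalPair (1 - Matrix.single 0 0 1) 0) h3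
  rw [hme, hdp, evalPair_rename_inl, eval_genericDet, sub_add_cancel, Matrix.det_one,
    Matrix.det_eq_zero_of_row_eq_zero (i := 0), zero_dvd_iff] at h4
  · exact one_ne_zero h4
  · intro j
    rcases eq_or_ne j 0 with rfl | hj
    · simp
    · simp [Matrix.one_apply_ne hj.symm, hj.symm]

end PairEvaluation

section SiegelSlice

open MvPolynomial PolyAct

variable {n : ℕ}

/-- The first `n` indices in order, followed by the last `n` indices in reverse order. -/
def splitEquiv (n : ℕ) : Fin n ⊕ Fin n ≃ Fin (2 * n) :=
  ((Equiv.sumCongr (Equiv.refl _) Fin.revPerm).trans finSumFinEquiv).trans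
    (finCongr (two_mul n).symm)

theorem val_splitEquiv_inl (i : Fin n) : (splitEquiv n (Sum.inl i) : ℕ) = i := by
  simp [splitEquiv]

theorem val_splitEquiv_inr (i : Fin n) : (splitEquiv n (Sum.inr i) : ℕ) = 2 * n - 1 - i := by
  simp [splitEquiv]
  omega

theorem sympForm_eq_submatrix : sympForm n =
    (fromBlocks (0 : Matrix (Fin n) (Fin n) ℂ) 1 (-1) 0).submatrix
      (splitEquiv n).symm (splitEquiv n).symm := by
  have h : (sympForm n).submatrix (splitEquiv n) (splitEquiv n) =
      fromBlocks (0 : Matrix (Fin n) (Fin n) ℂ) 1 (-1) 0 := by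
    ext i j
    rcases i with i | i <;> rcases j with j | j <;>
      simp only [sympForm, Matrix.submatrix_apply, Matrix.of_apply, val_splitEquiv_inl,
        val_splitEquiv_inr, fromBlocks_apply₁₁, fromBlocks_apply₁₂, fromBlocks_apply₂₁,
        fromBlocks_apply₂₂, Matrix.zero_apply, Matrix.one_apply, Matrix.neg_apply, Fin.ext_iff]
    · rw [if_neg (by omega)]
    · split_ifs <;> first | rfl | omega
    · split_ifs <;> first | rfl | omega | simp
    · rw [if_neg (by omega)]
  rw [← h, Matrix.submatrix_submatrix]
  simp

/-- The first `n` rows. -/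
def topRows (X : Matrix (Fin (2 * n)) (Fin n) ℂ) : Matrix (Fin n) (Fin n) ℂ :=
  X.submatrix (splitEquiv n ∘ Sum.inl) id

/-- The last `n` rows, in reverse order. -/
def botRows (X : Matrix (Fin (2 * n)) (Fin n) ℂ) : Matrix (Fin n) (Fin n) ℂ :=
  X.submatrix (splitEquiv n ∘ Sum.inr) id

/-- The matrix with given top and bottom rows. -/
def stackRows (Y Z : Matrix (Fin n) (Fin n) ℂ) : Matrix (Fin (2 * n)) (Fin n) ℂ :=
  (fromRows Y Z).submatrix (splitEquiv n).symm id

theorem topRows_stackRows (Y Z : Matrix (Fin n) (Fin n) ℂ) : topRows (stackRows Y Z) = Y := by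
  ext i j
  simp [topRows, stackRows]

theorem stackRows_topRows_botRows (X : Matrix (Fin (2 * n)) (Fin n) ℂ) :
    stackRows (topRows X) (botRows X) = X := by
  ext i j
  obtain ⟨i, rfl⟩ := (splitEquiv n).surjective i
  rcases i with i | i <;> simp [topRows, botRows, stackRows]

theorem blocks_mul_stackRows (B : Matrix (Fin n ⊕ Fin n) (Fin n ⊕ Fin n) ℂ)
    (Y Z : Matrix (Fin n) (Fin n) ℂ) :
    B.submatrix (splitEquiv n).symm (splitEquiv n).symm * stackRows Y Z =
      stackRows (B.toBlocks₁₁ * Y + B.toBlocks₁₂ * Z) (B.toBlocks₂₁ * Y + B.toBlocks₂₂ * Z) := by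
  rw [stackRows, Matrix.submatrix_mul_equiv, stackRows]
  conv_lhs => rw [← fromBlocks_toBlocks B, fromBlocks_mul_fromRows]

/-- The alternating Gram matrix of the columns. -/
def sympGram (X : Matrix (Fin (2 * n)) (Fin n) ℂ) : Matrix (Fin n) (Fin n) ℂ := Xᵀ * sympForm n * X

theorem sympGram_stackRows (Y Z : Matrix (Fin n) (Fin n) ℂ) :
    sympGram (stackRows Y Z) = Yᵀ * Z - Zᵀ * Y := by
  rw [sympGram, Matrix.mul_assoc, sympForm_eq_submatrix, blocks_mul_stackRows, stackRows, stackRows,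
    Matrix.transpose_submatrix, Matrix.submatrix_mul_equiv, transpose_fromRows,
    fromCols_mul_fromRows]
  simp [sub_eq_add_neg]

theorem sympGram_transpose (X : Matrix (Fin (2 * n)) (Fin n) ℂ) : (sympGram X)ᵀ = -sympGram X := by
  rw [sympGram, Matrix.transpose_mul, Matrix.transpose_mul, sympForm_transpose]
  simp [Matrix.mul_assoc]

theorem sympGram_mul_right (X : Matrix (Fin (2 * n)) (Fin n) ℂ) (h : Matrix (Fin n) (Fin n) ℂ) :
    sympGram (X * h) = hᵀ * sympGram X * h := by
  simp only [sympGram, Matrix.transpose_mul, Matrix.mul_assoc]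

theorem topRows_mul (X : Matrix (Fin (2 * n)) (Fin n) ℂ) (h : Matrix (Fin n) (Fin n) ℂ) :
    topRows (X * h) = topRows X * h := rfl

/-- Pullback of polynomials along `X ↦ (topRows X, sympGram X)`. -/
def slicePull (n : ℕ) : MvPolynomial (PairIdx n) ℂ →ₐ[ℂ] MvPolynomial (Fin (2 * n) × Fin n) ℂ :=
  aeval (Sum.elim (fun s => X (splitEquiv n (Sum.inl s.1), s.2)) fun q =>
    ∑ i, (X (splitEquiv n (Sum.inl i), q.1.1) * X (splitEquiv n (Sum.inr i), q.1.2) -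
      X (splitEquiv n (Sum.inr i), q.1.1) * X (splitEquiv n (Sum.inl i), q.1.2)))

theorem evalMat_slicePull (X : Matrix (Fin (2 * n)) (Fin n) ℂ) (q : MvPolynomial (PairIdx n) ℂ) :
    evalMat X (slicePull n q) = evalPair (topRows X) (sympGram X) q := by
  have h : (evalMat X).comp (slicePull n : MvPolynomial (PairIdx n) ℂ →+* _) =
      evalPair (topRows X) (sympGram X) := by
    refine MvPolynomial.ringHom_ext (fun c => ?_) fun s => ?_
    · rw [RingHom.comp_apply, RingHom.coe_coe, slicePull, ← algebraMap_eq, AlgHom.commutes,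
        algebraMap_eq, algebraMap_eq, eval_C, eval_C]
    · rw [RingHom.comp_apply, RingHom.coe_coe, slicePull, aeval_X, eval_X]
      rcases s with s | p
      · simp [topRows]
      · conv_rhs => rw [← stackRows_topRows_botRows X, sympGram_stackRows]
        simp [topRows, botRows, Matrix.mul_apply, Finset.sum_sub_distrib]
  exact congrArg (fun f : MvPolynomial (PairIdx n) ℂ →+* ℂ => f q) h

theorem transpose_inv_mul {Y : Matrix (Fin n) (Fin n) ℂ} (hY : Y.det ≠ 0) :
    Yᵀ * (Y⁻¹)ᵀ = 1 := by
  rw [← Matrix.transpose_mul, Matrix.nonsing_inv_mul _ hY.isUnit, Matrix.transpose_one]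

theorem inv_transpose_mul {Y : Matrix (Fin n) (Fin n) ℂ} (hY : Y.det ≠ 0) :
    (Y⁻¹)ᵀ * Yᵀ = 1 := by
  rw [← Matrix.transpose_mul, Matrix.mul_nonsing_inv _ hY.isUnit, Matrix.transpose_one]

/-- A matrix with invertible top rows `Y` and Gram matrix `A`. -/
def sliceBot (Y A : Matrix (Fin n) (Fin n) ℂ) : Matrix (Fin n) (Fin n) ℂ :=
  (2⁻¹ : ℂ) • ((Y⁻¹)ᵀ * A)

theorem sympGram_sliceBot {Y A : Matrix (Fin n) (Fin n) ℂ} (hY : Y.det ≠ 0) (hA : Aᵀ = -A) :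
    sympGram (stackRows Y (sliceBot Y A)) = A := by
  rw [sympGram_stackRows, sliceBot, Matrix.mul_smul, ← Matrix.mul_assoc, transpose_inv_mul hY,
    Matrix.one_mul, Matrix.transpose_smul, Matrix.transpose_mul, Matrix.transpose_transpose,
    Matrix.smul_mul, Matrix.mul_assoc, Matrix.nonsing_inv_mul _ hY.isUnit, Matrix.mul_one, hA,
    smul_neg, sub_neg_eq_add, ← two_smul ℂ ((2⁻¹ : ℂ) • A), smul_smul]
  simp

theorem exists_symm_sliceBot {Y : Matrix (Fin n) (Fin n) ℂ} (hY : Y.det ≠ 0)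
    (Z : Matrix (Fin n) (Fin n) ℂ) :
    ∃ K : Matrix (Fin n) (Fin n) ℂ, Kᵀ = K ∧ Z + K * Y = sliceBot Y (sympGram (stackRows Y Z)) := by
  refine ⟨-(2⁻¹ : ℂ) • (Z * Y⁻¹ + (Z * Y⁻¹)ᵀ), ?_, ?_⟩
  · rw [Matrix.transpose_smul, Matrix.transpose_add, Matrix.transpose_transpose, add_comm]
  · rw [sympGram_stackRows, sliceBot, Matrix.mul_sub, ← Matrix.mul_assoc, inv_transpose_mul hY,
      Matrix.one_mul, Matrix.smul_mul, Matrix.add_mul, Matrix.mul_assoc Z,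
      Matrix.nonsing_inv_mul _ hY.isUnit, Matrix.mul_one, Matrix.transpose_mul,
      ← Matrix.mul_assoc]
    module

theorem exists_sympGram_eq {Y A : Matrix (Fin (n + 1)) (Fin (n + 1)) ℂ} (hA : Aᵀ = -A)
    (hY : (Y + Matrix.single 0 0 1).det ≠ 0) : ∃ Z, sympGram (stackRows Y Z) = A := by
  set E : Matrix (Fin (n + 1)) (Fin (n + 1)) ℂ := Matrix.single 0 0 1 with hE
  set P := (Y + E)⁻¹ with hP
  have h1 : P * Y = 1 - P * E := by
    rw [eq_sub_iff_add_eq, ← Matrix.mul_add, hP, Matrix.nonsing_inv_mul _ hY.isUnit]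
  have hEt : Eᵀ = E := by rw [hE, Matrix.transpose_single]
  have h2 : Yᵀ * Pᵀ = 1 - E * Pᵀ := by
    rw [← Matrix.transpose_mul, h1, Matrix.transpose_sub, Matrix.transpose_one,
      Matrix.transpose_mul, hEt]
  have h3 : E * Pᵀ * A * (P * E) = 0 := by
    have h4 : (Pᵀ * A * P) 0 0 = 0 := by
      refine apply_self_of_transpose_eq_neg ?_ 0
      simp [Matrix.transpose_mul, hA, Matrix.mul_assoc]
    have h5 : E * Pᵀ * A * (P * E) = E * (Pᵀ * A * P) * E := by simp only [Matrix.mul_assoc]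
    rw [h5, hE, Matrix.single_mul_mul_single, h4]
    simp
  refine ⟨(2⁻¹ : ℂ) • (Pᵀ * A * (1 + P * E)), ?_⟩
  have h6 : Yᵀ * ((2⁻¹ : ℂ) • (Pᵀ * A * (1 + P * E))) =
      (2⁻¹ : ℂ) • (A + A * (P * E) - E * Pᵀ * A) := by
    rw [Matrix.mul_smul, ← Matrix.mul_assoc, ← Matrix.mul_assoc, h2]
    congr 1
    rw [Matrix.sub_mul, Matrix.one_mul, Matrix.mul_add, Matrix.mul_one, Matrix.sub_mul, h3]
    abel
  have h7 : ((2⁻¹ : ℂ) • (Pᵀ * A * (1 + P * E)))ᵀ * Y =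
      (Yᵀ * ((2⁻¹ : ℂ) • (Pᵀ * A * (1 + P * E))))ᵀ := by
    rw [Matrix.transpose_mul, Matrix.transpose_transpose]
  rw [sympGram_stackRows, h7, h6, Matrix.transpose_smul, Matrix.transpose_sub, Matrix.transpose_add,
    Matrix.transpose_mul, Matrix.transpose_mul, Matrix.transpose_mul, Matrix.transpose_mul,
    Matrix.transpose_transpose, hA, hEt]
  simp only [Matrix.mul_neg, Matrix.neg_mul, Matrix.mul_assoc]
  module

end SiegelSlice

section SliceImage

open MvPolynomial PolyAct

variable {n : ℕ}

/-- The determinant as a polynomial on pairs. -/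
def pairDet (n : ℕ) : MvPolynomial (PairIdx n) ℂ := rename Sum.inl (genericDet n)

theorem evalPair_pairDet (Y A : Matrix (Fin n) (Fin n) ℂ) : evalPair Y A (pairDet n) = Y.det := by
  rw [pairDet, evalPair_rename_inl, eval_genericDet]

theorem pairDet_ne_zero : pairDet n ≠ 0 := fun h => by
  have h1 := evalPair_pairDet (1 : Matrix (Fin n) (Fin n) ℂ) 0
  rw [h, map_zero, Matrix.det_one] at h1
  exact zero_ne_one h1

theorem slicePull_injective : Function.Injective (slicePull n) := by
  rw [injective_iff_map_eq_zero]
  intro q hq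
  refine (mul_eq_zero.1 (?_ : pairDet n * q = 0)).resolve_left pairDet_ne_zero
  refine MvPolynomial.funext fun x => ?_
  obtain ⟨Y, A, hA, hx⟩ := exists_evalPair_eq x
  rw [hx, map_mul, evalPair_pairDet, map_zero]
  by_cases hY : Y.det = 0
  · rw [hY, zero_mul]
  · have h1 := evalMat_slicePull (stackRows Y (sliceBot Y A)) q
    rw [hq, map_zero, topRows_stackRows, sympGram_sliceBot hY hA] at h1
    rw [← h1, mul_zero]

/-- The generic alternating matrix. -/
def genericAlt (n : ℕ) : Matrix (Fin n) (Fin n) (MvPolynomial (PairIdx n) ℂ) :=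
  Matrix.of fun i j => if h : i < j then X (Sum.inr ⟨(i, j), h⟩) else
    if h : j < i then -X (Sum.inr ⟨(j, i), h⟩) else 0

theorem evalPair_genericAlt {Y A : Matrix (Fin n) (Fin n) ℂ} (hA : Aᵀ = -A) (i j : Fin n) :
    evalPair Y A (genericAlt n i j) = A i j := by
  rw [genericAlt, Matrix.of_apply]
  rcases lt_trichotomy i j with h | h | h
  · rw [dif_pos h, eval_X, Sum.elim_inr]
  · subst h
    rw [dif_neg (lt_irrefl i), dif_neg (lt_irrefl i), map_zero,
      apply_self_of_transpose_eq_neg hA]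
  · rw [dif_neg h.not_gt, dif_pos h, map_neg, eval_X, Sum.elim_inr]
    exact (congrFun (congrFun hA j) i).symm

theorem exists_clear_denominators (p : MvPolynomial (Fin (2 * n) × Fin n) ℂ) :
    ∃ (r : MvPolynomial (PairIdx n) ℂ) (k : ℕ), ∀ Y A : Matrix (Fin n) (Fin n) ℂ, Aᵀ = -A →
      Y.det ≠ 0 → evalPair Y A r = Y.det ^ k * evalMat (stackRows Y (sliceBot Y A)) p := by
  induction p using MvPolynomial.induction_on with
  | C a => exact ⟨C a, 0, fun Y A _ _ => by rw [eval_C, eval_C, pow_zero, one_mul]⟩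
  | add p q hp hq =>
    obtain ⟨r, k, hr⟩ := hp
    obtain ⟨s, l, hs⟩ := hq
    refine ⟨pairDet n ^ l * r + pairDet n ^ k * s, k + l, fun Y A hA hY => ?_⟩
    rw [map_add, map_mul, map_mul, map_pow, map_pow, evalPair_pairDet, hr Y A hA hY, hs Y A hA hY,
      map_add]
    ring
  | mul_X p s hp =>
    obtain ⟨r, k, hr⟩ := hp
    obtain ⟨i, j⟩ := s
    obtain ⟨i, rfl⟩ := (splitEquiv n).surjective i
    rcases i with i | i
    · refine ⟨r * X (Sum.inl (i, j)), k, fun Y A hA hY => ?_⟩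
      rw [map_mul, map_mul, hr Y A hA hY, eval_X, eval_X, mul_assoc]
      simp [stackRows]
    · refine ⟨r * (C 2⁻¹ * ∑ l, (((mvPolynomialX (Fin n) (Fin n) ℂ).adjugate l i).rename Sum.inl) *
        genericAlt n l j), k + 1, fun Y A hA hY => ?_⟩
      have h1 : evalMat (stackRows Y (sliceBot Y A)) (X (splitEquiv n (Sum.inr i), j)) =
          sliceBot Y A i j := by
        simp [stackRows]
      have h2 : ∀ l, evalMat Y ((mvPolynomialX (Fin n) (Fin n) ℂ).adjugate l i) =
          Y.det * Y⁻¹ l i := by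
        intro l
        have h3 := RingHom.map_adjugate (evalMat Y) (mvPolynomialX (Fin n) (Fin n) ℂ)
        rw [RingHom.mapMatrix_apply, RingHom.mapMatrix_apply, map_evalMat_mvPolynomialX] at h3
        have h4 := congrFun (congrFun h3 l) i
        rw [Matrix.map_apply] at h4
        rw [h4, Matrix.inv_def, Ring.inverse_eq_inv', Matrix.smul_apply, smul_eq_mul,
          mul_inv_cancel_left₀ hY]
      rw [map_mul, map_mul, hr Y A hA hY, map_mul, h1, eval_C, map_sum]
      have h5 : ∑ l, evalPair Y A (rename Sum.inl
          ((mvPolynomialX (Fin n) (Fin n) ℂ).adjugate l i) * genericAlt n l j) =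
          Y.det * ((Y⁻¹)ᵀ * A) i j := by
        rw [Matrix.mul_apply, Finset.mul_sum]
        refine Finset.sum_congr rfl fun l _ => ?_
        rw [map_mul, evalPair_rename_inl, h2, evalPair_genericAlt hA, Matrix.transpose_apply,
          mul_assoc]
      rw [h5, sliceBot, Matrix.smul_apply, smul_eq_mul]
      ring

theorem evalMat_slicePull_pairDet (X : Matrix (Fin (2 * n)) (Fin n) ℂ) :
    evalMat X (slicePull n (pairDet n)) = (topRows X).det := by
  rw [evalMat_slicePull, evalPair_pairDet]

theorem exists_slicePull_eq_of_pow_mul (k : ℕ) (p : MvPolynomial (Fin (2 * n) × Fin n) ℂ)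
    (r : MvPolynomial (PairIdx n) ℂ) (h : slicePull n (pairDet n) ^ k * p = slicePull n r) :
    ∃ q, slicePull n q = p := by
  induction k generalizing r with
  | zero => exact ⟨r, by rw [← h, pow_zero, one_mul]⟩
  | succ k ih =>
    have hd : pairDet n ∣ r := by
      cases n with
      | zero =>
        have h1 : pairDet 0 = 1 := by
          rw [pairDet, genericDet, Matrix.det_fin_zero, map_one]
        rw [h1]
        exact one_dvd r
      | succ m =>
        refine genericDet_dvd_of_evalPair r fun Y A hA hY hE => ?_
        obtain ⟨Z, hZ⟩ := exists_sympGram_eq hA hE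
        have h1 := evalMat_slicePull (stackRows Y Z) r
        rw [← h, map_mul, map_pow, evalMat_slicePull_pairDet, topRows_stackRows, hY, hZ,
          zero_pow (Nat.succ_ne_zero k), zero_mul] at h1
        exact h1.symm
    obtain ⟨r', rfl⟩ := hd
    refine ih r' ?_
    rw [map_mul, pow_succ', mul_assoc] at h
    exact mul_left_cancel₀ ((map_ne_zero_iff _ slicePull_injective).2 pairDet_ne_zero) h

theorem exists_slicePull_eq (p : MvPolynomial (Fin (2 * n) × Fin n) ℂ)
    (hp : ∀ K Y Z : Matrix (Fin n) (Fin n) ℂ, Kᵀ = K →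
      evalMat (stackRows Y (Z + K * Y)) p = evalMat (stackRows Y Z) p) :
    ∃ q, slicePull n q = p := by
  obtain ⟨r, k, hr⟩ := exists_clear_denominators p
  refine exists_slicePull_eq_of_pow_mul (k + 1) p (pairDet n * r) (evalMat_ext fun X => ?_)
  rw [map_mul, map_pow, map_mul, map_mul, evalMat_slicePull_pairDet, evalMat_slicePull]
  by_cases hY : (topRows X).det = 0
  · rw [hY, zero_pow (Nat.succ_ne_zero k), zero_mul, zero_mul]
  · obtain ⟨K, hK, hKZ⟩ := exists_symm_sliceBot hY (botRows X)
    have h1 := hp K (topRows X) (botRows X) hK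
    rw [hKZ, stackRows_topRows_botRows] at h1
    rw [hr _ _ (sympGram_transpose X) hY, h1]
    ring

end SliceImage

section SliceEquivariance

open MvPolynomial PolyAct

variable {n : ℕ}

theorem det_eq_one_of_isUpperUni {A : Matrix (Fin n) (Fin n) ℂ} (hA : IsUpperUni A) :
    A.det = 1 := by
  rw [← Matrix.det_transpose]
  exact (IsLowerUni.det_eq_one (isUpperUni_transpose.1 (by rwa [Matrix.transpose_transpose])))

/-- The symplectic group element with a given matrix. -/
def spOf (A : Matrix (Fin (2 * n)) (Fin (2 * n)) ℂ) (hA : Aᵀ * sympForm n * A = sympForm n) :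
    SpGL n :=
  have h : -(sympForm n * Aᵀ * sympForm n) * A = 1 := by
    rw [Matrix.neg_mul, Matrix.mul_assoc, Matrix.mul_assoc, ← Matrix.mul_assoc Aᵀ, hA,
      sympForm_mul_self, neg_neg]
  ⟨⟨A, -(sympForm n * Aᵀ * sympForm n), mul_eq_one_comm.1 h, h⟩, hA⟩

theorem matOf_spOf (A : Matrix (Fin (2 * n)) (Fin (2 * n)) ℂ)
    (hA : Aᵀ * sympForm n * A = sympForm n) : matOf (spOf A hA) = A := rfl

/-- The matrix in the given ordering of coordinates attached to a block matrix. -/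
abbrev ofBlocks (B : Matrix (Fin n ⊕ Fin n) (Fin n ⊕ Fin n) ℂ) :
    Matrix (Fin (2 * n)) (Fin (2 * n)) ℂ :=
  B.submatrix (splitEquiv n).symm (splitEquiv n).symm

theorem ofBlocks_symplectic {B : Matrix (Fin n ⊕ Fin n) (Fin n ⊕ Fin n) ℂ}
    (hB : Bᵀ * fromBlocks 0 1 (-1) 0 * B = fromBlocks 0 1 (-1) 0) :
    (ofBlocks B)ᵀ * sympForm n * ofBlocks B = sympForm n := by
  rw [sympForm_eq_submatrix, Matrix.transpose_submatrix, Matrix.submatrix_mul_equiv,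
    Matrix.submatrix_mul_equiv, hB]

/-- The symplectic transvection attached to a symmetric matrix. -/
def siegel (K : Matrix (Fin n) (Fin n) ℂ) (hK : Kᵀ = K) : SpGL n :=
  spOf (ofBlocks (fromBlocks 1 K 0 1)) <| ofBlocks_symplectic <| by
    simp [fromBlocks_transpose, fromBlocks_multiply, hK]

/-- The embedding of the general linear group in the symplectic group. -/
def levi (g : GL (Fin n) ℂ) : SpGL n :=
  spOf (ofBlocks (fromBlocks (g : Matrix (Fin n) (Fin n) ℂ) 0 0
    ((g⁻¹ : GL (Fin n) ℂ) : Matrix (Fin n) (Fin n) ℂ)ᵀ)) <| ofBlocks_symplectic <| by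
    have h1 : (g : Matrix (Fin n) (Fin n) ℂ) *
        ((g⁻¹ : GL (Fin n) ℂ) : Matrix (Fin n) (Fin n) ℂ) = 1 := by
      rw [← Units.val_mul, mul_inv_cancel, Units.val_one]
    have h2 : ((g⁻¹ : GL (Fin n) ℂ) : Matrix (Fin n) (Fin n) ℂ) *
        (g : Matrix (Fin n) (Fin n) ℂ) = 1 := by
      rw [← Units.val_mul, inv_mul_cancel, Units.val_one]
    rw [fromBlocks_transpose, fromBlocks_multiply, fromBlocks_multiply]
    simp only [Matrix.transpose_zero, Matrix.mul_zero, Matrix.zero_mul, add_zero, zero_add,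
      Matrix.mul_one, Matrix.mul_neg, Matrix.neg_mul, Matrix.transpose_transpose, h2,
      ← Matrix.transpose_mul, Matrix.transpose_one, neg_zero]

theorem isUpperUni_ofBlocks {B : Matrix (Fin n ⊕ Fin n) (Fin n ⊕ Fin n) ℂ} :
    IsUpperUni (ofBlocks B) ↔
      IsUpperUni B.toBlocks₁₁ ∧ B.toBlocks₂₁ = 0 ∧ IsLowerUni B.toBlocks₂₂ := by
  refine ⟨fun h => ?_, fun ⟨h1, h2, h3⟩ => ?_⟩
  · have hd : ∀ s, B s s = 1 := fun s => by simpa using h.1 (splitEquiv n s)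
    have ho : ∀ s t, (splitEquiv n t : ℕ) < splitEquiv n s → B s t = 0 := fun s t hst => by
      simpa using h.2 _ _ hst
    refine ⟨⟨fun i => hd _, fun i j hij => ho _ _ ?_⟩, ?_,
      ⟨fun i => hd _, fun i j hij => ho _ _ ?_⟩⟩
    · rwa [val_splitEquiv_inl, val_splitEquiv_inl]
    · ext i j
      refine ho _ _ ?_
      rw [val_splitEquiv_inl, val_splitEquiv_inr]
      omega
    · rw [val_splitEquiv_inr, val_splitEquiv_inr]
      omega
  · refine ⟨fun i => ?_, fun i j hij => ?_⟩
    · obtain ⟨s, rfl⟩ := (splitEquiv n).surjective i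
      rw [ofBlocks, Matrix.submatrix_apply, Equiv.symm_apply_apply]
      rcases s with s | s
      · exact h1.1 s
      · exact h3.1 s
    · obtain ⟨s, rfl⟩ := (splitEquiv n).surjective i
      obtain ⟨t, rfl⟩ := (splitEquiv n).surjective j
      rw [ofBlocks, Matrix.submatrix_apply, Equiv.symm_apply_apply, Equiv.symm_apply_apply]
      rcases s with s | s <;> rcases t with t | t <;>
        simp only [val_splitEquiv_inl, val_splitEquiv_inr] at hij
      · exact h1.2 s t hij
      · omega
      · exact congrFun (congrFun h2 s) t
      · exact h3.2 s t (by omega)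

theorem isUpperUni_one : IsUpperUni (1 : Matrix (Fin n) (Fin n) ℂ) :=
  ⟨fun i => Matrix.one_apply_eq i, fun i j h => Matrix.one_apply_ne fun e => h.ne' (by rw [e])⟩

theorem isUpperUni_siegel (K : Matrix (Fin n) (Fin n) ℂ) (hK : Kᵀ = K) :
    IsUpperUni (matOf (siegel K hK)) := by
  rw [siegel, matOf_spOf, isUpperUni_ofBlocks]
  refine ⟨isUpperUni_one, rfl, ?_⟩
  rw [toBlocks_fromBlocks₂₂, ← isUpperUni_transpose, Matrix.transpose_one]
  exact isUpperUni_one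

theorem isUpperUni_levi {g : GL (Fin n) ℂ} (hg : IsUpperUni (g : Matrix (Fin n) (Fin n) ℂ)) :
    IsUpperUni (matOf (levi g)) := by
  rw [levi, matOf_spOf, isUpperUni_ofBlocks]
  refine ⟨hg, rfl, ?_⟩
  rw [toBlocks_fromBlocks₂₂, ← isUpperUni_transpose, Matrix.transpose_transpose]
  exact hg.inv

theorem slicePull_rightPair (h : Matrix (Fin n) (Fin n) ℂ) (q : MvPolynomial (PairIdx n) ℂ) :
    slicePull n (linSub ((rightPair n).A h) q) =
      linSub ((rightAct (2 * n) n).A h) (slicePull n q) := by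
  refine evalMat_ext fun X => ?_
  rw [evalMat_rightAct, evalMat_slicePull, evalMat_slicePull,
    evalPair_linSub_rightPair (sympGram_transpose X), sympGram_mul_right, topRows_mul]

theorem slicePull_leftPair (g : SpGL n) {B : Matrix (Fin n ⊕ Fin n) (Fin n ⊕ Fin n) ℂ}
    (hB : matOf g = ofBlocks B) (h21 : B.toBlocks₂₁ = 0) (q : MvPolynomial (PairIdx n) ℂ) :
    slicePull n (linSub ((leftPair n).A B.toBlocks₁₁) q) =
      linSub ((leftAct (2 * n) n).A (matOf g)) (slicePull n q) := by
  refine evalMat_ext fun X => ?_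
  rw [evalMat_leftAct, evalMat_slicePull, evalMat_slicePull, evalPair_linSub_leftPair]
  have h1 : sympGram ((matOf g)ᵀ * X) = sympGram X := by
    simp only [sympGram, Matrix.transpose_mul, Matrix.transpose_transpose]
    conv_rhs => rw [← mem_SpGL_iff'.1 g.2]
    simp only [Matrix.mul_assoc]
  have h2 : topRows ((matOf g)ᵀ * X) = B.toBlocks₁₁ᵀ * topRows X := by
    conv_lhs => rw [← stackRows_topRows_botRows X, hB, Matrix.transpose_submatrix,
      blocks_mul_stackRows, topRows_stackRows]
    have h3 : Bᵀ.toBlocks₁₂ = 0 := by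
      ext i j
      exact congrFun (congrFun h21 j) i
    rw [h3, Matrix.zero_mul, add_zero]
    rfl
  rw [h1, h2]

theorem slicePull_mem_hwSub_rightAct {l : Fin n → ℕ} {q : MvPolynomial (PairIdx n) ℂ} :
    slicePull n q ∈ (rightAct (2 * n) n).hwSub l ↔ q ∈ (rightPair n).hwSub l := by
  rw [mem_hwSub, mem_hwSub, mem_wtSub_iff, mem_wtSub_iff, ← slicePull_rightPair, ← map_smul,
    slicePull_injective.eq_iff]
  refine and_congr Iff.rfl (forall₂_congr fun u hu => ?_)
  rw [← slicePull_rightPair, slicePull_injective.eq_iff]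

theorem eq_ofBlocks (A : Matrix (Fin (2 * n)) (Fin (2 * n)) ℂ) :
    A = ofBlocks (A.submatrix (splitEquiv n) (splitEquiv n)) := by
  simp [ofBlocks]

theorem prod_splitEquiv (f : Fin (2 * n) → ℂ) :
    ∏ i, f i = (∏ i, f (splitEquiv n (Sum.inl i))) * ∏ i, f (splitEquiv n (Sum.inr i)) := by
  rw [← (splitEquiv n).prod_comp, Fintype.prod_sum_type]

end SliceEquivariance

section SliceMultiplicity

open MvPolynomial PolyAct

variable {n : ℕ}

theorem mem_spHwSpace {lam : Fin n → ℕ} {mu : Fin (2 * n) → ℕ}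
    {x : (rightAct (2 * n) n).hwSub lam} :
    x ∈ (spCell n).hwSpace (rep (hwStable (2 * n) lam) (SpGL n)) (torusChar mu) ↔
      (∀ u : SpGL n, IsUpperUni (matOf u) → linSub ((leftAct (2 * n) n).A (matOf u)) x.1 = x.1) ∧
      ∀ (t : SpGL n) (d : Fin (2 * n) → ℂ), matOf t = Matrix.diagonal d →
        linSub ((leftAct (2 * n) n).A (matOf t)) x.1 = (∏ i, d i ^ mu i) • x.1 := by
  rw [CellData.mem_hwSpace]
  refine and_congr (forall₂_congr fun u hu => ?_) ⟨fun h t d ht => ?_, fun h t ⟨d, ht⟩ => ?_⟩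
  · rw [Subtype.ext_iff, coe_rep]
  · have h1 := congrArg Subtype.val (h t ⟨d, ht⟩)
    rw [coe_rep] at h1
    rw [h1, torusChar, ht]
    simp
  · refine Subtype.ext ?_
    rw [coe_rep, h t d ht, torusChar, ht]
    simp

theorem map_slicePull_eq (lam : Fin n → ℕ) {mu : ℕ → ℕ} (hmu : ∀ i, n ≤ i → mu i = 0) :
    ((rightPair n).hwSub lam ⊓ (leftPair n).hwSub fun i : Fin n => mu i).map
        (slicePull n).toLinearMap =
      ((spCell n).hwSpace (rep (hwStable (2 * n) lam) (SpGL n))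
        (torusChar fun i : Fin (2 * n) => mu i)).map ((rightAct (2 * n) n).hwSub lam).subtype := by
  have hchar : ∀ d : Fin (2 * n) → ℂ, ∏ i : Fin (2 * n), d i ^ mu i =
      ∏ i : Fin n, d (splitEquiv n (Sum.inl i)) ^ mu i := fun d => by
    rw [prod_splitEquiv, Finset.prod_eq_one (f := fun i : Fin n =>
      d (splitEquiv n (Sum.inr i)) ^ mu (splitEquiv n (Sum.inr i))), mul_one]
    · simp only [val_splitEquiv_inl]
    · intro i _
      rw [val_splitEquiv_inr, hmu _ (by omega), pow_zero]
  ext p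
  rw [Submodule.mem_map, Submodule.mem_map]
  refine ⟨?_, ?_⟩
  · rintro ⟨q, ⟨hr, hl⟩, rfl⟩
    refine ⟨⟨slicePull n q, slicePull_mem_hwSub_rightAct.2 hr⟩, ?_, rfl⟩
    rw [mem_spHwSpace]
    refine ⟨fun u hu => ?_, fun t d ht => ?_⟩
    · have h1 := eq_ofBlocks (matOf u)
      rw [h1, isUpperUni_ofBlocks] at hu
      rw [← slicePull_leftPair u h1 hu.2.1]
      congr 1
      have h2 := det_eq_one_of_isUpperUni hu.1
      exact (mem_hwSub.1 hl).2 (Matrix.GeneralLinearGroup.mkOfDetNeZero _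
        (h2.trans_ne one_ne_zero)) hu.1
    · have h1 := eq_ofBlocks (matOf t)
      rw [← slicePull_leftPair t h1, hchar, ← map_smul]
      · congr 1
        have h2 : ((matOf t).submatrix (splitEquiv n) (splitEquiv n)).toBlocks₁₁ =
            Matrix.diagonal fun i => d (splitEquiv n (Sum.inl i)) := by
          ext i j
          simp [ht, Matrix.toBlocks₁₁, Matrix.diagonal_apply]
        rw [h2]
        exact torus_of_mem (mem_hwSub.1 hl).1 _
      · ext i j
        simp [ht, Matrix.toBlocks₂₁]
  · rintro ⟨⟨p, hp⟩, hx, rfl⟩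
    rw [mem_spHwSpace] at hx
    obtain ⟨hU, hT⟩ := hx
    obtain ⟨q, rfl⟩ := exists_slicePull_eq p fun K Y Z hK => by
      have h1 := congrArg (evalMat (stackRows Y Z)) (hU (siegel K hK) (isUpperUni_siegel K hK))
      rw [evalMat_leftAct, siegel, matOf_spOf, Matrix.transpose_submatrix, blocks_mul_stackRows,
        fromBlocks_transpose] at h1
      simpa [hK, add_comm] using h1
    refine ⟨q, ⟨slicePull_mem_hwSub_rightAct.1 hp,
      mem_hwSub.2 ⟨mem_wtSub_iff.2 ?_, fun u hu => ?_⟩⟩,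
      rfl⟩
    · have hd : matOf (levi (genTorus n)) = Matrix.diagonal
          ((Sum.elim (fun i : Fin n => ((Nat.nth Nat.Prime i : ℕ) : ℂ))
            fun i : Fin n => ((Nat.nth Nat.Prime i : ℕ) : ℂ)⁻¹) ∘ (splitEquiv n).symm) := by
        have h3 : (((genTorus n)⁻¹ : GL (Fin n) ℂ) : Matrix (Fin n) (Fin n) ℂ) =
            Matrix.diagonal fun i : Fin n => ((Nat.nth Nat.Prime i : ℕ) : ℂ)⁻¹ :=
          (diagonal_inv_eq coe_genTorus).2
        rw [levi, matOf_spOf, h3, coe_genTorus, Matrix.diagonal_transpose, fromBlocks_diagonal,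
          ofBlocks, Matrix.submatrix_diagonal_equiv]
      have h1 := hT (levi (genTorus n)) _ hd
      rw [hchar, ← slicePull_leftPair (levi (genTorus n)) rfl rfl, ← map_smul,
        slicePull_injective.eq_iff] at h1
      simpa using h1
    · have h1 := hU (levi u) (isUpperUni_levi hu)
      rw [← slicePull_leftPair (levi u) rfl rfl] at h1
      exact slicePull_injective h1

theorem finrank_spHwSpace (lam : Fin n → ℕ) {mu : ℕ → ℕ} (hmu : ∀ i, n ≤ i → mu i = 0) :
    Module.finrank ℂ ((spCell n).hwSpace (rep (hwStable (2 * n) lam) (SpGL n))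
        (torusChar fun i : Fin (2 * n) => mu i)) =
      pairMult (fun i : Fin n => mu i) lam := by
  rw [pairMult, ((Submodule.equivMapOfInjective _ slicePull_injective _).finrank_eq :
    _ = Module.finrank ℂ (((rightPair n).hwSub lam ⊓ (leftPair n).hwSub fun i : Fin n => mu i).map
      (slicePull n).toLinearMap)), map_slicePull_eq lam hmu]
  exact (Submodule.equivMapOfInjective _ Subtype.val_injective _).finrank_eq

end SliceMultiplicity

section Assembly

open PolyAct

theorem exists_lower_fixed_functional {N : ℕ} {V : Type*} [AddCommGroup V] [Module ℂ V]
    [FiniteDimensional ℂ V] [Nontrivial V] {H : Subgroup (GL (Fin N) ℂ)}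
    (hH : HasPrincipalTorus H) (hT : ∀ g ∈ H, glT g ∈ H) (ρ : Representation ℂ H V) :
    ∃ ξ : V →ₗ[ℂ] ℂ, ξ ≠ 0 ∧ ∀ l ∈ lowerSub H, ∀ x, ξ (ρ l x) = ξ x := by
  let tr : H → H := fun g => ⟨glT g, hT g g.2⟩
  have htr_mul : ∀ g h, tr (g * h) = tr h * tr g := fun g h =>
    Subtype.ext <| Units.ext <| Matrix.transpose_mul _ _
  have htr_one : tr 1 = 1 := Subtype.ext <| Units.ext Matrix.transpose_one
  have htr_tr : ∀ g, tr (tr g) = g := fun g => Subtype.ext <| Units.ext rfl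
  let τ : Representation ℂ H (V →ₗ[ℂ] ℂ) :=
    { toFun := fun g => LinearMap.lcomp ℂ ℂ (ρ (tr g))
      map_one' := by
        ext ξ x
        rw [htr_one, map_one]
        rfl
      map_mul' := fun g h => by
        ext ξ x
        rw [htr_mul, map_mul]
        rfl }
  have : Nontrivial (V →ₗ[ℂ] ℂ) := inferInstanceAs (Nontrivial (Module.Dual ℂ V))
  obtain ⟨ξ, hξ0, hξ⟩ := exists_fixed_of_hasPrincipalTorus hH τ
  refine ⟨ξ, hξ0, fun l hl x => ?_⟩
  have h1 := LinearMap.congr_fun (hξ (tr l) (isUpperUni_transpose.2 hl)) x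
  have h2 : τ (tr l) ξ x = ξ (ρ (tr (tr l)) x) := rfl
  rwa [h2, htr_tr] at h1

theorem finrank_equivariantMaps_congr {G V V' W : Type*} [Group G] [AddCommGroup V] [Module ℂ V]
    [AddCommGroup V'] [Module ℂ V'] [AddCommGroup W] [Module ℂ W] {ρ : Representation ℂ G V}
    {ρ' : Representation ℂ G V'} (π : Representation ℂ G W) (E : V ≃ₗ[ℂ] V')
    (hE : ∀ g x, E (ρ g x) = ρ' g (E x)) :
    Module.finrank ℂ (equivariantMaps π ρ) = Module.finrank ℂ (equivariantMaps π ρ') := by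
  have h : (equivariantMaps π ρ).map (E.congrRight : (W →ₗ[ℂ] V) ≃ₗ[ℂ] (W →ₗ[ℂ] V')).toLinearMap =
      equivariantMaps π ρ' := by
    ext f
    rw [Submodule.mem_map]
    constructor
    · rintro ⟨f, hf, rfl⟩ g
      refine LinearMap.ext fun x => ?_
      have h1 := LinearMap.congr_fun (hf g) x
      show E (f (π g x)) = ρ' g (E (f x))
      rw [← hE]
      exact congrArg E h1
    · intro hf
      refine ⟨E.symm.toLinearMap ∘ₗ f, fun g => LinearMap.ext fun x => E.injective ?_, ?_⟩
      · have h1 := LinearMap.congr_fun (hf g) x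
        show E (E.symm (f (π g x))) = E (ρ g (E.symm (f x)))
        rw [hE, E.apply_symm_apply, E.apply_symm_apply]
        exact h1
      · refine LinearMap.ext fun x => ?_
        exact E.apply_symm_apply _
  rw [← h]
  exact (LinearEquiv.submoduleMap (E.congrRight : (W →ₗ[ℂ] V) ≃ₗ[ℂ] (W →ₗ[ℂ] V')) _).finrank_eq

theorem bijective_of_mem_equivariantMaps {G V W : Type*} [Group G] [AddCommGroup V] [Module ℂ V]
    [AddCommGroup W] [Module ℂ W] {ρ : Representation ℂ G V} {π : Representation ℂ G W}
    (hπ : IsIrreducibleRep π) (hρ : IsIrreducibleRep ρ) {f : W →ₗ[ℂ] V}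
    (hf : f ∈ equivariantMaps π ρ) (hf0 : f ≠ 0) : Function.Bijective f := by
  have hfg : ∀ g x, f (π g x) = ρ g (f x) := fun g x => LinearMap.congr_fun (hf g) x
  constructor
  · refine LinearMap.ker_eq_bot.1 ((hπ.2 (LinearMap.ker f) fun g y hy => ?_).resolve_right
      fun h => hf0 (LinearMap.ker_eq_top.1 h))
    rw [LinearMap.mem_ker] at hy ⊢
    rw [hfg, hy, map_zero]
  · refine LinearMap.range_eq_top.1 ((hρ.2 (LinearMap.range f) ?_).resolve_left
      fun h => hf0 (LinearMap.range_eq_bot.1 h))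
    rintro g _ ⟨y, rfl⟩
    exact ⟨π g y, hfg g y⟩

theorem exists_equiv_hwSub {N m : ℕ} (hmN : m ≤ N) {lam : Fin m → ℕ} (hl : Antitone lam)
    {V : Type*} [AddCommGroup V] [Module ℂ V] {ρ : Representation ℂ (GL (Fin N) ℂ) V}
    (hρ : IsGLHW N (polyWeight N (extZ lam)) ρ) :
    ∃ E : V ≃ₗ[ℂ] (rightAct N m).hwSub lam, ∀ (H : Subgroup (GL (Fin N) ℂ)) (g : H) (x : V),
      E (ρ g x) = rep (hwStable N lam) H g (E x) := by
  obtain ⟨hirr, hfd, v, hv0, hvU, hvT⟩ := hρ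
  have := hirr.1
  let ρ' : Representation ℂ (⊤ : Subgroup (GL (Fin N) ℂ)) V :=
    ρ.comp (⊤ : Subgroup (GL (Fin N) ℂ)).subtype
  have hirr' : IsIrreducibleRep ρ' := ⟨hirr.1, fun U hU => hirr.2 U fun g => hU ⟨g, trivial⟩⟩
  obtain ⟨ξ, hξ0, hξ⟩ := exists_lower_fixed_functional (hasPrincipalTorus_top N)
    (fun _ _ => trivial) ρ'
  have hv : v ∈ (glCell N).hwSpace ρ' (torusChar fun i : Fin N => extZ lam i) := by
    rw [CellData.mem_hwSpace]
    refine ⟨fun u hu => hvU u hu, fun t ⟨d, ht⟩ => ?_⟩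
    refine (hvT t d ht).trans ?_
    congr 1
    refine Finset.prod_congr rfl fun i _ => ?_
    rw [polyWeight, zpow_natCast, ht, Matrix.diagonal_apply_eq]
  obtain ⟨f, hf, hfx⟩ := exists_equivariant (glCell N) (topDag N) topDag_topDag
    (fun l hl => IsLowerUni.conjTranspose hl) hirr' hv hv0 hξ0 hξ
    (form (hwStable N lam) (dag := topDag N) fun _ => rfl)
    (x := ⟨leadPoly N lam, leadPoly_mem_hwSub hl⟩)
    ((mem_hwSpace_iff (hwStable N lam)).2 (leadPoly_mem_left hmN hl))
  have hf0 : f ≠ 0 := fun h => by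
    rw [h, LinearMap.zero_apply] at hfx
    exact leadPoly_ne_zero hmN (congrArg Subtype.val hfx).symm
  refine ⟨LinearEquiv.ofBijective f (bijective_of_mem_equivariantMaps hirr'
    (isIrreducibleRep_hwSub hmN hl) hf hf0), fun H g x => ?_⟩
  exact Subtype.ext (congrArg Subtype.val (LinearMap.congr_fun (hf ⟨g, trivial⟩) x))

theorem repMult_eq_pairMult {n : ℕ} {lam : Fin n → ℕ} (hl : Antitone lam) {mu : ℕ → ℕ}
    (hmu : ∀ i, n ≤ i → mu i = 0) {V W : Type*} [AddCommGroup V] [Module ℂ V] [AddCommGroup W]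
    [Module ℂ W] {ρ : Representation ℂ (GL (Fin (2 * n)) ℂ) V} {π : Representation ℂ (SpGL n) W}
    (hρ : IsGLHW (2 * n) (polyWeight (2 * n) (extZ lam)) ρ) (hπ : IsSpHW n mu π) :
    repMult (ρ.comp (SpGL n).subtype) π = pairMult (fun i : Fin n => mu i) lam := by
  obtain ⟨E, hE⟩ := exists_equiv_hwSub (by omega) hl hρ
  obtain ⟨hirr, hfd, w, hw0, hwU, hwT⟩ := hπ
  have := hirr.1
  rw [repMult, finrank_equivariantMaps_congr (ρ' := rep (hwStable (2 * n) lam) (SpGL n)) π E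
    (hE (SpGL n)), ← finrank_spHwSpace lam hmu]
  obtain ⟨ξ, hξ0, hξ⟩ := exists_lower_fixed_functional (hasPrincipalTorus_SpGL n)
    (fun _ => glT_mem_SpGL) π
  have hw : w ∈ (spCell n).hwSpace π (torusChar fun i : Fin (2 * n) => mu i) := by
    rw [CellData.mem_hwSpace]
    refine ⟨fun u hu => hwU u hu, fun t ⟨d, ht⟩ => ?_⟩
    refine (hwT t d ht).trans ?_
    congr 1
    refine Finset.prod_congr rfl fun i _ => ?_
    rw [ht, Matrix.diagonal_apply_eq]
  exact finrank_equivariantMaps (spCell n) (fun g => ⟨glH g, glH_mem_SpGL g.2⟩)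
    (fun g => matOf_injective (Matrix.conjTranspose_conjTranspose _))
    (fun l hl => IsLowerUni.conjTranspose hl) hirr hw hw0 hξ0 hξ
    (form (hwStable (2 * n) lam) fun _ => rfl)

theorem apply_eq_zero_of_plen_le {f : ℕ → ℕ} (hf : IsPartition f) {n i : ℕ} (h : plen f ≤ n)
    (hi : n ≤ i) : f i = 0 := by
  have h1 : f (plen f) = 0 := Nat.sInf_mem (s := {k | f k = 0}) hf.2
  exact Nat.eq_zero_of_le_zero (h1 ▸ hf.1 (h.trans hi))

theorem mem_partsLE_of_isPartition {f : ℕ → ℕ} (hf : IsPartition f) {n : ℕ} (h : plen f ≤ n) :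
    f ∈ partsLE n (∑ i ∈ Finset.range n, f i) :=
  Finset.mem_filter.2 ⟨(mem_partsOf_iff fun _ => apply_eq_zero_of_plen_le hf h).2
    ⟨fun _ _ hij => hf.1 hij, rfl⟩, apply_eq_zero_of_plen_le hf h le_rfl⟩

end Assembly

/-- Littlewood restriction rule for `Sp_{2n} ⊆ GL_{2n}`.  Let `lam`
and `mu` be partitions with at most `n` parts.  Then the multiplicity of `V^mu_(2n)` in
the restriction of `F^lam_(2n)` to `Sp_{2n}(ℂ)` is `∑_{2δ} c^lam_{mu, (2δ)'}`, the sum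
over all transposes `(2δ)'` of even partitions. -/
theorem littlewood_restriction_Sp2n_sub_GL2n
    (n : ℕ) (lam mu : ℕ → ℕ) (hlam : IsPartition lam) (hmu : IsPartition mu)
    (hlamlen : plen lam ≤ n) (hmulen : plen mu ≤ n)
    {V W : Type*} [AddCommGroup V] [Module ℂ V] [AddCommGroup W] [Module ℂ W]
    (ρ : Representation ℂ (GL (Fin (2 * n)) ℂ) V) (π : Representation ℂ (SpGL n) W)
    (hρ : IsGLHW (2 * n) (polyWeight (2 * n) lam) ρ) (hπ : IsSpHW n mu π) :
    repMult (ρ.comp (SpGL n).subtype) π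
      = ∑ᶠ δ : Ptn, lrCoeff lam mu (conj (double δ.1)) := by
  have hl := mem_partsLE_of_isPartition hlam hlamlen
  have hm := mem_partsLE_of_isPartition hmu hmulen
  have hl' := (Finset.mem_filter.1 hl).1
  have hm' := (Finset.mem_filter.1 hm).1
  rw [← extZ_restrict hl] at hρ
  rw [repMult_eq_pairMult (fun i j hij => hlam.1 hij)
    (fun i => apply_eq_zero_of_plen_le hmu hmulen) hρ hπ]
  rcases lt_or_ge (∑ i ∈ Finset.range n, lam i) (∑ i ∈ Finset.range n, mu i) with h | h
  · rw [finsum_lrCoeff_eq_zero hm' hl' h]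
    refine pairMult_eq_zero ?_
    rwa [sum_fin_partsLE hl, sum_fin_partsLE hm]
  · obtain ⟨e, he⟩ := Nat.exists_eq_add_of_le h
    rw [he] at hl hl'
    rw [pairMult_eq_branchLR hm hl, finsum_lrCoeff_eq hm' hl', branchLR]

end
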